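/- Let k be a nonzero integer. For every ε > 0 there exists a constant C (depending on k and ε) such that for all positive integers N, R_3(k, N) ≤ C · N^{11/6 + ε}, where R_3(k, N) denotes the number of quadruples (n₁, n₂, n₃, n₄) of integers with 1 ≤ n₁, n₂, n₃, n₄ ≤ N and n₁³ + n₂³ − n₃³ − n₄³ = k. -/

import Mathlib

section

open Polynomial

/-- A valuation by pole orders at a rational place on an algebra of functions regular elsewhere,
with every order from `c` on attained. -/
structure PoleOrder (F : Type*) {S : Type*} [Field F] [CommRing S] [Algebra F S]
    (v : S → WithBot ℕ) (c : ℕ) : Prop where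
  eq_bot_iff : ∀ f, v f = ⊥ ↔ f = 0
  map_mul : ∀ f g, v (f * g) = v f + v g
  map_add_le : ∀ f g, v (f + g) ≤ max (v f) (v g)
  map_algebraMap_le : ∀ a : F, v (algebraMap F S a) ≤ 0
  exists_lt : ∀ f g, v f = v g → f ≠ 0 → ∃ a : F, v (f - a • g) < v f
  exists_eq : ∀ n : ℕ, c ≤ n → ∃ f, v f = n

namespace PoleOrder

variable {F S : Type*} [Field F] [CommRing S] [Algebra F S] {v : S → WithBot ℕ} {c : ℕ}

lemma map_zero (h : PoleOrder F v c) : v 0 = ⊥ := (h.eq_bot_iff 0).2 rfl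

lemma map_smul_le (h : PoleOrder F v c) (a : F) (f : S) : v (a • f) ≤ v f := by
  rw [Algebra.smul_def, h.map_mul]
  calc _ ≤ 0 + v f := by gcongr; exact h.map_algebraMap_le a
    _ = _ := zero_add _

lemma map_neg (h : PoleOrder F v c) (f : S) : v (-f) = v f := by
  have key : ∀ f, v (-f) ≤ v f := fun f => by
    have := h.map_smul_le (-1) f
    simpa using this
  exact le_antisymm (key f) (by simpa using key (-f))

lemma map_sub_le (h : PoleOrder F v c) (f g : S) : v (f - g) ≤ max (v f) (v g) := by
  rw [sub_eq_add_neg, ← h.map_neg g]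
  exact h.map_add_le _ _

lemma map_add_eq_left (h : PoleOrder F v c) {f g : S} (hfg : v g < v f) : v (f + g) = v f := by
  refine le_antisymm ((h.map_add_le f g).trans (max_le le_rfl hfg.le)) ?_
  by_contra! hlt
  have := h.map_sub_le (f + g) g
  rw [add_sub_cancel_right] at this
  exact absurd (this.trans_lt (max_lt hlt hfg)) (lt_irrefl _)

lemma map_sum_lt (h : PoleOrder F v c) {ι : Type*} (s : Finset ι) (f : ι → S) {b : WithBot ℕ}
    (hb0 : ⊥ < b) (hb : ∀ i ∈ s, v (f i) < b) : v (∑ i ∈ s, f i) < b := by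
  classical
  induction s using Finset.induction_on with
  | empty => simpa [h.map_zero] using hb0
  | insert i s hi ih =>
    rw [Finset.sum_insert hi]
    exact (h.map_add_le _ _).trans_lt (max_lt (hb i (by simp)) (ih fun j hj => hb j (by simp [hj])))

lemma map_pow (h : PoleOrder F v c) {f : S} {n : ℕ} (hf : v f = n) (k : ℕ) :
    f ≠ 0 → v (f ^ (k + 1)) = ((k + 1) * n : ℕ) := by
  intro hf0
  induction k with
  | zero => simpa using hf
  | succ k ih => rw [pow_succ, h.map_mul, ih, hf]; norm_cast; ring_nf

/-- The space of functions of pole order at most `n`. -/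
def space (h : PoleOrder F v c) (n : ℕ) : Submodule F S where
  carrier := {f | v f ≤ n}
  add_mem' ha hb := (h.map_add_le _ _).trans (max_le ha hb)
  zero_mem' := by simp [h.map_zero]
  smul_mem' a f hf := (h.map_smul_le a f).trans hf

lemma mem_space (h : PoleOrder F v c) {n : ℕ} {f : S} : f ∈ h.space n ↔ v f ≤ n := Iff.rfl

lemma space_mono (h : PoleOrder F v c) {m n : ℕ} (hmn : m ≤ n) : h.space m ≤ h.space n :=
  fun f hf => le_trans (α := WithBot ℕ) hf (by exact_mod_cast hmn)

lemma space_zero_le (h : PoleOrder F v c) {V : Submodule F S} (hV : ∀ f, v f < (n : ℕ) → f ∈ V)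
    {e : S} (he : v e = n) : h.space n ≤ V ⊔ Submodule.span F {e} := by
  intro f hf
  rcases (h.mem_space.1 hf).lt_or_eq with hlt | heq
  · exact Submodule.mem_sup_left (hV f hlt)
  · have hf0 : f ≠ 0 := by
      rintro rfl
      rw [h.map_zero] at heq
      exact absurd heq WithBot.bot_ne_coe
    obtain ⟨a, ha⟩ := h.exists_lt f e (heq.trans he.symm) hf0
    rw [heq] at ha
    have : f = (f - a • e) + a • e := by abel
    rw [this]
    exact Submodule.add_mem_sup (hV _ ha) (Submodule.smul_mem _ _ (Submodule.mem_span_singleton_self e))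

lemma exists_space_le (h : PoleOrder F v c) {V : Submodule F S} {n : ℕ}
    (hV : ∀ f, v f < (n : ℕ) → f ∈ V) : ∃ e, h.space n ≤ V ⊔ Submodule.span F {e} := by
  by_cases hn : ∃ e, v e = n
  · obtain ⟨e, he⟩ := hn
    exact ⟨e, h.space_zero_le hV he⟩
  · push Not at hn
    exact ⟨0, fun f hf => Submodule.mem_sup_left (hV f (lt_of_le_of_ne hf (hn f)))⟩

lemma finite_and_finrank_space_le (h : PoleOrder F v c) (n : ℕ) :
    Module.Finite F (h.space n) ∧ Module.finrank F (h.space n) ≤ n + 1 := by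
  have aux : ∀ (V W : Submodule F S) (e : S), Module.Finite F V → W ≤ V ⊔ Submodule.span F {e} →
      Module.Finite F W ∧ Module.finrank F W ≤ Module.finrank F V + 1 := by
    intro V W e hV hW
    have hfin : Module.Finite F (V ⊔ Submodule.span F {e} : Submodule F S) := inferInstance
    refine ⟨Submodule.finiteDimensional_of_le hW, (Submodule.finrank_mono hW).trans ?_⟩
    refine (Submodule.finrank_add_le_finrank_add_finrank _ _).trans ?_
    gcongr
    simpa using finrank_span_le_card (R := F) ({e} : Set S)
  induction n with
  | zero =>
    obtain ⟨e, he⟩ := h.exists_space_le (V := ⊥) (n := 0) (fun f hf => by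
      have : v f = ⊥ := by
        rcases hvf : v f with _ | m
        · rfl
        · rw [hvf] at hf
          change ((m : ℕ) : WithBot ℕ) < ((0 : ℕ) : WithBot ℕ) at hf
          norm_cast at hf
      simpa using (h.eq_bot_iff f).1 this)
    have := aux ⊥ _ e inferInstance he
    simpa using this
  | succ n ih =>
    obtain ⟨e, he⟩ := h.exists_space_le (V := h.space n) (n := n + 1) (fun f hf => by
      rw [h.mem_space]
      rcases hvf : v f with _ | m
      · exact bot_le
      · rw [hvf] at hf
        change ((m : ℕ) : WithBot ℕ) < ((n + 1 : ℕ) : WithBot ℕ) at hf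
        change ((m : ℕ) : WithBot ℕ) ≤ _
        norm_cast at hf ⊢
        omega)
    have := aux _ _ e ih.1 he
    exact ⟨this.1, this.2.trans (by omega)⟩

instance (h : PoleOrder F v c) (n : ℕ) : Module.Finite F (h.space n) :=
  (h.finite_and_finrank_space_le n).1

/-- A sum of elements of distinct orders is nonzero. -/
lemma sum_ne_zero (h : PoleOrder F v c) {ι : Type*} (s : Finset ι) (f : ι → S)
    (hinj : ∀ i ∈ s, ∀ j ∈ s, f i ≠ 0 → f j ≠ 0 → v (f i) = v (f j) → i = j)
    (hne : ∃ i ∈ s, f i ≠ 0) : ∑ i ∈ s, f i ≠ 0 := by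
  classical
  obtain ⟨i0, hi0, hfi0⟩ := hne
  obtain ⟨i, hi, hmax⟩ := Finset.exists_max_image s (fun i => v (f i)) ⟨i0, hi0⟩
  have hpos : ⊥ < v (f i) := lt_of_lt_of_le
    (bot_lt_iff_ne_bot.2 fun hb => hfi0 ((h.eq_bot_iff _).1 hb)) (hmax i0 hi0)
  have hfi : f i ≠ 0 := fun h0 => by simp [h0, h.map_zero] at hpos
  rw [← Finset.add_sum_erase s f hi]
  intro h0
  have hlt : v (∑ x ∈ s.erase i, f x) < v (f i) := by
    refine h.map_sum_lt _ _ hpos fun j hj => lt_of_le_of_ne (hmax j (Finset.mem_of_mem_erase hj)) ?_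
    intro heq
    by_cases hfj : f j = 0
    · rw [hfj, h.map_zero] at heq
      exact absurd heq.symm hpos.ne'
    · exact (Finset.ne_of_mem_erase hj) (hinj j (Finset.mem_of_mem_erase hj) i hi hfj hfi heq)
  have := h.map_add_eq_left hlt
  rw [h0, h.map_zero] at this
  exact absurd this hpos.ne

lemma le_finrank_space (h : PoleOrder F v c) (n : ℕ) :
    n + 1 - c ≤ Module.finrank F (h.space n) := by
  choose! e he using h.exists_eq
  have hmem : ∀ i : Fin (n + 1 - c), e (c + i) ∈ h.space n := fun i => by
    rw [h.mem_space, he _ (by omega)]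
    have := i.2
    norm_cast
    omega
  have hli : LinearIndependent F (fun i : Fin (n + 1 - c) => (⟨e (c + i), hmem i⟩ : h.space n)) := by
    rw [Fintype.linearIndependent_iff]
    intro g hg
    by_contra! hne
    obtain ⟨i, hi⟩ := hne
    have hg' := congrArg (Submodule.subtype _) hg
    simp only [map_sum, map_smul, Submodule.subtype_apply, _root_.map_zero] at hg'
    have hv : ∀ i : Fin (n + 1 - c), g i ≠ 0 → v (g i • e (c + i)) = (c + i : ℕ) := by
      intro i hgi
      refine le_antisymm ((h.map_smul_le _ _).trans (he _ (by omega)).le) ?_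
      have := h.map_smul_le (g i)⁻¹ (g i • e (c + i))
      rwa [smul_smul, inv_mul_cancel₀ hgi, one_smul, he _ (by omega)] at this
    refine h.sum_ne_zero Finset.univ (fun i => g i • e (c + i)) ?_ ⟨i, Finset.mem_univ _, ?_⟩ hg'
    · intro i _ j _ h1 h2 h12
      have h1' : g i ≠ 0 := fun h0 => h1 (by simp [h0])
      have h2' : g j ≠ 0 := fun h0 => h2 (by simp [h0])
      rw [hv i h1', hv j h2'] at h12
      norm_cast at h12
      ext; omega
    · intro h0
      have := hv i hi
      rw [h0, h.map_zero] at this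
      exact WithBot.bot_ne_coe this
  simpa using hli.fintype_card_le_finrank

lemma exists_mem_space (h : PoleOrder F v c) (f : S) : ∃ n, f ∈ h.space n := by
  rcases hvf : v f with _ | m
  · exact ⟨0, by rw [h.mem_space, hvf]; exact bot_le⟩
  · exact ⟨m, by rw [h.mem_space, hvf]; rfl⟩

lemma mul_mem_space (h : PoleOrder F v c) {m n : ℕ} {f g : S} (hf : f ∈ h.space m)
    (hg : g ∈ h.space n) : f * g ∈ h.space (m + n) := by
  rw [h.mem_space] at *
  rw [h.map_mul]
  push_cast
  gcongr

lemma pow_mem_space (h : PoleOrder F v c) {m : ℕ} {f : S} (hf : f ∈ h.space m) (k : ℕ) :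
    f ^ k ∈ h.space (k * m) := by
  induction k with
  | zero =>
    rw [h.mem_space]
    simpa using h.map_algebraMap_le 1
  | succ k ih =>
    rw [pow_succ, add_mul, one_mul]
    exact h.mul_mem_space ih hf

/-- A nonzero function vanishes at no more points than its pole order plus the conductor. -/
lemma card_zeros_le (h : PoleOrder F v c) {f : S} (hf : f ≠ 0) {m : ℕ} (hm : f ∈ h.space m)
    (Z : Finset (S →ₐ[F] F)) (hZ : ∀ φ ∈ Z, φ f = 0) : Z.card ≤ m + c := by
  classical
  have hinj : Function.Injective (fun φ : Z => ((φ : S →ₐ[F] F) : S →* F)) := by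
    intro φ ψ hφ
    ext x
    exact DFunLike.congr_fun hφ x
  have hind : LinearIndependent F (fun φ : Z => (φ : S →ₐ[F] F).toLinearMap) := by
    have h1 := (linearIndependent_monoidHom S F).comp _ hinj
    rw [Fintype.linearIndependent_iff] at h1 ⊢
    intro g hg
    refine h1 g ?_
    funext x
    have := DFunLike.congr_fun hg x
    simpa using this
  have hsurj : Function.Surjective
      (LinearMap.pi (fun φ : Z => (φ : S →ₐ[F] F).toLinearMap) : S →ₗ[F] (Z → F)) := by
    rw [← LinearMap.range_eq_top]
    by_contra hne
    obtain ⟨g, hg0, hg⟩ := Submodule.exists_le_ker_of_lt_top _ (lt_top_iff_ne_top.2 hne)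
    apply hg0
    rw [Fintype.linearIndependent_iff] at hind
    have hz := hind (fun φ => g (Pi.single φ 1)) (by
      ext x
      have hx : g (fun φ : Z => (φ : S →ₐ[F] F) x) = 0 :=
        LinearMap.mem_ker.1 (hg ⟨x, by ext; rfl⟩)
      rw [LinearMap.pi_apply_eq_sum_univ] at hx
      simp only [LinearMap.coe_sum, Finset.sum_apply, LinearMap.smul_apply, AlgHom.toLinearMap_apply,
        LinearMap.zero_apply]
      rw [← hx]
      refine Finset.sum_congr rfl fun φ _ => ?_
      rw [smul_eq_mul, smul_eq_mul, mul_comm]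
      congr 2
      funext ψ
      simp [Pi.single_apply, eq_comm])
    ext φ
    simpa using hz φ
  obtain ⟨s, hs⟩ := hsurj.hasRightInverse
  choose d hd using h.exists_mem_space
  let N := m + c + ∑ φ : Z, d (s (Pi.single φ 1))
  let T : h.space N →ₗ[F] (Z → F) :=
    (LinearMap.pi (fun φ : Z => (φ : S →ₐ[F] F).toLinearMap)).comp (h.space N).subtype
  have hT : Function.Surjective T := by
    rw [← LinearMap.range_eq_top, eq_top_iff, ← (Pi.basisFun F Z).span_eq, Submodule.span_le]
    rintro _ ⟨φ, rfl⟩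
    refine ⟨⟨s (Pi.single φ 1), h.space_mono ?_ (hd _)⟩, ?_⟩
    · have := Finset.single_le_sum (f := fun φ : Z => d (s (Pi.single φ 1)))
        (fun _ _ => Nat.zero_le _) (Finset.mem_univ φ)
      simp only [N]
      omega
    · simpa [T] using hs (Pi.single φ 1)
  have hker : Module.finrank F (h.space (N - m)) ≤ Module.finrank F (LinearMap.ker T) := by
    have hNm : m + (N - m) = N := by simp only [N]; omega
    let M : h.space (N - m) →ₗ[F] LinearMap.ker T :=
      { toFun := fun g => ⟨⟨f * g, by
            have := h.mul_mem_space hm g.2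
            rwa [hNm] at this⟩, by
          rw [LinearMap.mem_ker]
          funext φ
          simp [T, hZ φ φ.2]⟩
        map_add' := fun a b => by ext; simp [mul_add]
        map_smul' := fun a b => by ext; simp }
    refine LinearMap.finrank_le_finrank_of_injective (f := M) ?_
    refine (injective_iff_map_eq_zero M).2 fun g hg => ?_
    have hg' : f * (g : S) = 0 := congrArg (fun x : LinearMap.ker T => ((x : h.space N) : S)) hg
    have hv := h.map_mul f g
    rw [hg', h.map_zero] at hv
    rcases WithBot.add_eq_bot.1 hv.symm with h1 | h1
    · exact absurd ((h.eq_bot_iff _).1 h1) hf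
    · exact Subtype.ext ((h.eq_bot_iff _).1 h1)
  have hrank := LinearMap.finrank_range_add_finrank_ker T
  rw [LinearMap.range_eq_top.2 hT, finrank_top, Module.finrank_fintype_fun_eq_card,
    Fintype.card_coe] at hrank
  have h1 := (h.finite_and_finrank_space_le N).2
  have h2 := h.le_finrank_space (N - m)
  simp only [N] at *
  omega

end PoleOrder

end

namespace PoleOrder

variable {F S : Type*} [Field F] [CommRing S] [Algebra F S] {v : S → WithBot ℕ} {c : ℕ}

lemma natCard_space [Finite F] (h : PoleOrder F v c) (n : ℕ) :
    Nat.card (h.space n) = Nat.card F ^ Module.finrank F (h.space n) :=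
  Module.natCard_eq_pow_finrank

/-- Stepanov's bound: the number of rational points of a curve with a pole valuation. -/
theorem card_algHom_le [Fintype F] (h : PoleOrder F v c) {p μ : ℕ} [Fact p.Prime] [CharP F p]
    (hq : Fintype.card F = (p ^ μ) ^ 2) (hbig : (c + 2) * (c + 1) + c < 2 * p ^ μ)
    (Z : Finset (S →ₐ[F] F)) : Z.card ≤ (p ^ μ) ^ 2 + (2 * c + 2) * p ^ μ + c := by
  classical
  have : CharP S p := by
    have : Nontrivial S := by
      obtain ⟨f, hf⟩ := h.exists_eq c le_rfl
      refine ⟨f, 0, fun h0 => ?_⟩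
      rw [h0, h.map_zero] at hf
      exact WithBot.bot_ne_coe hf
    exact charP_of_injective_algebraMap (algebraMap F S).injective p
  have hfrob : ∀ x y : S, (x + y) ^ p ^ μ = x ^ p ^ μ + y ^ p ^ μ := fun x y => add_pow_char_pow x y p μ
  have hfrobSum : ∀ (n : ℕ) (x : Fin n → F), (∑ i, x i) ^ p ^ μ = ∑ i, x i ^ p ^ μ := fun n x =>
    sum_pow_char_pow p μ _ _
  have hQpos : 1 ≤ p ^ μ := Nat.one_le_pow _ _ (Fact.out : p.Prime).pos
  generalize p ^ μ = Q at *
  have hcQ : c + 1 < Q := by nlinarith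
  set K := Q + c + 2 with hK
  choose! e he using h.exists_eq
  have he0 : ∀ i, c ≤ i → e i ≠ 0 := fun i hi h0 => by
    have := he i hi
    rw [h0, h.map_zero] at this
    exact WithBot.bot_ne_coe this
  set M := Q * (Q - 1) + (c + K - 1) with hM
  let T : (Fin K → h.space (Q - 1)) →+ h.space M :=
    { toFun := fun s => ⟨∑ i, ((s i : S)) ^ Q * e (c + i), Submodule.sum_mem _ fun i _ => by
        refine h.mul_mem_space (h.pow_mem_space (s i).2 Q) ?_
        rw [h.mem_space, he _ (by omega)]
        have := i.2
        norm_cast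
        omega⟩
      map_zero' := by
        ext
        simp [zero_pow (by omega : Q ≠ 0)]
      map_add' := fun s t => by
        ext
        simp only [Pi.add_apply, Submodule.coe_add]
        rw [← Finset.sum_add_distrib]
        refine Finset.sum_congr rfl fun i _ => ?_
        rw [hfrob, add_mul] }
  have hFin : ∀ n, Finite (h.space n) := fun n => Module.finite_of_finite F
  have hnot : ¬ Function.Injective T := by
    intro hinj
    have h1 := Nat.card_le_card_of_injective _ hinj
    rw [Nat.card_pi, Finset.prod_const, Finset.card_univ, Fintype.card_fin, h.natCard_space,
      h.natCard_space, ← pow_mul] at h1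
    have h2 := (Nat.pow_le_pow_iff_right (Finite.one_lt_card)).1 h1
    have h3 := h.le_finrank_space (Q - 1)
    have h4 := (h.finite_and_finrank_space_le M).2
    have h5 : (Q - c) * K ≤ M + 1 := by
      refine le_trans ?_ (h2.trans h4)
      gcongr
      omega
    obtain ⟨r, hr⟩ : ∃ r, Q = c + 2 + r := ⟨Q - (c + 2), by omega⟩
    have e1 : Q - c = r + 2 := by omega
    have e2 : Q - 1 = c + 1 + r := by omega
    have e3 : c + K - 1 = c + (Q + c + 1) := by omega
    rw [hM, e1, e2, e3, hK] at h5
    rw [hr] at h5 hbig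
    nlinarith
  rw [injective_iff_map_eq_zero] at hnot
  push Not at hnot
  obtain ⟨s, hs, hs0⟩ := hnot
  have hs' : ∑ i, ((s i : S)) ^ Q * e (c + i) = 0 := congrArg Subtype.val hs
  obtain ⟨i0, hi0⟩ : ∃ i, s i ≠ 0 := by
    by_contra! hall
    exact hs0 (funext hall)
  have hvterm : ∀ i : Fin K, ∀ n : ℕ, v (s i) = n →
      v ((s i : S) * e (c + i) ^ Q) = (n + Q * (c + i) : ℕ) := by
    intro i n hn
    have := h.map_pow (he (c + i) (by omega)) (Q - 1) (he0 _ (by omega))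
    rw [Nat.sub_add_cancel hQpos] at this
    rw [h.map_mul, hn, this]
    norm_cast
  have hvs : ∀ i : Fin K, (s i : S) ≠ 0 → ∃ n : ℕ, v (s i) = n ∧ n ≤ Q - 1 := by
    intro i hi
    have hmem := (s i).2
    rw [h.mem_space] at hmem
    rcases hvf : v (s i) with _ | m
    · exact absurd ((h.eq_bot_iff _).1 hvf) hi
    · refine ⟨m, rfl, ?_⟩
      rw [hvf] at hmem
      change ((m : ℕ) : WithBot ℕ) ≤ _ at hmem
      exact_mod_cast hmem
  have hterm0 : ∀ i : Fin K, (s i : S) * e (c + i) ^ Q ≠ 0 → (s i : S) ≠ 0 :=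
    fun i hi h0 => hi (by rw [h0, zero_mul])
  have hΨ : ∑ i : Fin K, (s i : S) * e (c + i) ^ Q ≠ 0 := by
    refine h.sum_ne_zero _ _ ?_ ⟨i0, Finset.mem_univ _, ?_⟩
    · intro i _ j _ hi hj hij
      obtain ⟨n, hn, hn'⟩ := hvs i (hterm0 i hi)
      obtain ⟨m, hm, hm'⟩ := hvs j (hterm0 j hj)
      rw [hvterm i n hn, hvterm j m hm] at hij
      norm_cast at hij
      have h1 : (n + Q * (c + i)) / Q = c + i := by
        rw [Nat.add_mul_div_left _ _ (by omega), Nat.div_eq_of_lt (by omega), zero_add]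
      have h2 : (m + Q * (c + j)) / Q = c + j := by
        rw [Nat.add_mul_div_left _ _ (by omega), Nat.div_eq_of_lt (by omega), zero_add]
      rw [hij, h2] at h1
      ext; omega
    · intro h0
      obtain ⟨n, hn, -⟩ := hvs i0 (fun hh => hi0 (Subtype.ext hh))
      have := hvterm i0 n hn
      rw [h0, h.map_zero] at this
      exact WithBot.bot_ne_coe this
  have hmem : ∑ i : Fin K, (s i : S) * e (c + i) ^ Q ∈ h.space (Q - 1 + Q * (c + K - 1)) := by
    refine Submodule.sum_mem _ fun i _ => h.mul_mem_space (s i).2 (h.pow_mem_space ?_ Q)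
    rw [h.mem_space, he _ (by omega)]
    have := i.2
    norm_cast
    omega
  have hzero : ∀ φ ∈ Z, φ (∑ i : Fin K, (s i : S) * e (c + i) ^ Q) = 0 := by
    intro φ _
    have hcard : ∀ x : F, (x ^ Q) ^ Q = x := fun x => by
      rw [← pow_mul, ← sq, ← hq, FiniteField.pow_card]
    have h1 : (φ (∑ i : Fin K, (s i : S) * e (c + i) ^ Q)) ^ Q = 0 := by
      rw [map_sum, hfrobSum]
      have h2 := congrArg φ hs'
      rw [map_sum, _root_.map_zero] at h2
      rw [← h2]
      refine Finset.sum_congr rfl fun i _ => ?_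
      rw [_root_.map_mul, _root_.map_mul, _root_.map_pow, _root_.map_pow, mul_pow, hcard]
    exact pow_eq_zero_iff (by omega) |>.1 h1
  have hfinal := h.card_zeros_le hΨ hmem Z hzero
  refine hfinal.trans ?_
  obtain ⟨r, hr⟩ : ∃ r, Q = r + 1 := ⟨Q - 1, by omega⟩
  have e3 : c + K - 1 = c + (Q + c + 1) := by omega
  rw [e3, hr, Nat.add_sub_cancel]
  nlinarith

end PoleOrder

namespace PoleOrder

/-- The order of `x * W ^ l` in a totally ramified extension of degree `n`, where `W` has order
`w`. -/
def lift (n w l : ℕ) : WithBot ℕ → WithBot ℕ := WithBot.map fun i => n * i + l * w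

@[simp] lemma lift_bot (n w l : ℕ) : lift n w l ⊥ = ⊥ := rfl

@[simp] lemma lift_coe (n w l i : ℕ) : lift n w l (i : WithBot ℕ) = (n * i + l * w : ℕ) := rfl

lemma lift_mono (n w l : ℕ) : Monotone (lift n w l) :=
  WithBot.monotone_map_iff.2 fun i j hij => by gcongr

lemma lift_strictMono {n : ℕ} (hn : 0 < n) (w l : ℕ) : StrictMono (lift n w l) :=
  WithBot.strictMono_map_iff.2 fun i j hij => by gcongr

lemma lift_add (n w l l' : ℕ) (x y : WithBot ℕ) :
    lift n w l x + lift n w l' y = lift n w (l + l') (x + y) := by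
  rcases x with _ | x
  · exact WithBot.bot_add _
  rcases y with _ | y
  · exact WithBot.add_bot _
  change ((n * x + l * w : ℕ) : WithBot ℕ) + ((n * y + l' * w : ℕ) : WithBot ℕ) =
    ((n * (x + y) + (l + l') * w : ℕ) : WithBot ℕ)
  norm_cast
  ring

lemma lift_eq_bot {n w l : ℕ} {x : WithBot ℕ} : lift n w l x = ⊥ ↔ x = ⊥ := by
  unfold lift
  exact WithBot.map_eq_bot_iff

lemma lift_add_self (n w l : ℕ) (x : WithBot ℕ) :
    lift n w (l + n) x = lift n w l (x + (w : WithBot ℕ)) := by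
  rcases x with _ | x
  · rfl
  change ((n * x + (l + n) * w : ℕ) : WithBot ℕ) = ((n * (x + w) + l * w : ℕ) : WithBot ℕ)
  norm_cast
  ring

/-- Orders on distinct powers are incongruent. -/
lemma lift_inj {n w : ℕ} (hnw : n.Coprime w) {l l' : ℕ} (hl : l < n) (hl' : l' < n)
    {x y : WithBot ℕ} (hx : x ≠ ⊥) (h : lift n w l x = lift n w l' y) : l = l' ∧ x = y := by
  have hy : y ≠ ⊥ := by
    rintro rfl
    rw [lift_bot, lift_eq_bot] at h
    exact hx h
  lift x to ℕ using hx
  lift y to ℕ using hy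
  have h' : n * x + l * w = n * y + l' * w := WithBot.coe_injective h
  have hmod : l * w ≡ l' * w [MOD n] := by
    have h1 : n * x + l * w ≡ n * y + l' * w [MOD n] := by rw [h']
    have h2 : ∀ a b : ℕ, n * a + b ≡ b [MOD n] := fun a b => by simp [Nat.ModEq]
    exact (h2 x _).symm.trans (h1.trans (h2 y _))
  have hll : l = l' :=
    (Nat.ModEq.cancel_right_of_coprime hnw hmod).eq_of_lt_of_lt hl hl'
  subst hll
  refine ⟨rfl, ?_⟩
  have : n * x = n * y := by omega
  rw [Nat.eq_of_mul_eq_mul_left (by omega) this]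

section Extension

variable {F A B : Type*} [Field F] [CommRing A] [CommRing B] [Algebra F A] [Algebra F B]
  [Algebra A B] [IsScalarTower F A B] {v : A → WithBot ℕ} {c n : ℕ}

/-- The extension of a pole order to an algebra with basis `1, W, …, W ^ (n - 1)`. -/
noncomputable def ext (v : A → WithBot ℕ) (w : ℕ) (bas : Module.Basis (Fin n) A B) (f : B) : WithBot ℕ :=
  Finset.univ.sup fun l : Fin n => lift n w l (v (bas.repr f l))

lemma ext_le {w : ℕ} {bas : Module.Basis (Fin n) A B} {f : B} {x : WithBot ℕ} :
    ext v w bas f ≤ x ↔ ∀ l : Fin n, lift n w l (v (bas.repr f l)) ≤ x := by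
  simp [ext, Finset.sup_le_iff]

lemma ext_lt {w : ℕ} {bas : Module.Basis (Fin n) A B} {f : B} {x : WithBot ℕ} (hx : ⊥ < x) :
    ext v w bas f < x ↔ ∀ l : Fin n, lift n w l (v (bas.repr f l)) < x := by
  simp [ext, Finset.sup_lt_iff hx]

lemma le_ext (w : ℕ) (bas : Module.Basis (Fin n) A B) (f : B) (l : Fin n) :
    lift n w l (v (bas.repr f l)) ≤ ext v w bas f := ext_le.1 le_rfl l

lemma exists_ext_eq (hn : 0 < n) (w : ℕ) (bas : Module.Basis (Fin n) A B) (f : B) :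
    ∃ l : Fin n, ext v w bas f = lift n w l (v (bas.repr f l)) := by
  obtain ⟨l, -, hl⟩ := Finset.exists_mem_eq_sup (Finset.univ : Finset (Fin n))
    ⟨⟨0, hn⟩, Finset.mem_univ _⟩ (fun l : Fin n => lift n w l (v (bas.repr f l)))
  exact ⟨l, hl⟩

/-- Totally ramified extensions `W ^ n = a * W + b` of an algebra with a pole order. -/
theorem extension (h : PoleOrder F v c) (hn : 0 < n) {w : ℕ} (hnw : n.Coprime w)
    (bas : Module.Basis (Fin n) A B) (W : B) (hbas : ∀ l : Fin n, bas l = W ^ (l : ℕ)) {a b : A}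
    (hW : W ^ n = algebraMap A B a * W + algebraMap A B b) (hb : v b = w)
    (ha : lift n w 1 (v a) < lift n w n (0 : ℕ)) :
    PoleOrder F (ext v w bas) (n * c + n * w) ∧
      ∀ l < n, ∀ x : A, ext v w bas (x • W ^ l) = lift n w l (v x) := by
  set V := ext v w bas with hV
  have hadd : ∀ f g, V (f + g) ≤ max (V f) (V g) := by
    intro f g
    refine ext_le.2 fun l => ?_
    rw [map_add, Finsupp.add_apply]
    refine (lift_mono n w l (h.map_add_le _ _)).trans ?_
    rw [(lift_mono n w l).map_max]
    exact max_le_max (le_ext w bas f l) (le_ext w bas g l)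
  have hzero : V 0 = ⊥ := by
    rw [← le_bot_iff]
    refine ext_le.2 fun l => ?_
    simp [h.map_zero]
  have hbot : ∀ f, V f = ⊥ ↔ f = 0 := by
    refine fun f => ⟨fun hf => ?_, fun hf => hf ▸ hzero⟩
    rw [← bas.repr.map_eq_zero_iff]
    ext l
    have := le_ext (v := v) w bas f l
    rw [← hV, hf, le_bot_iff, lift_eq_bot, h.eq_bot_iff] at this
    simpa using this
  have hsmulF : ∀ (x : F) (f : B), V (x • f) ≤ V f := by
    intro x f
    refine ext_le.2 fun l => ?_
    have e1 : bas.repr (x • f) l = x • bas.repr f l := by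
      rw [← algebraMap_smul A x f, map_smul, Finsupp.smul_apply, smul_eq_mul, Algebra.smul_def]
    rw [e1]
    exact (lift_mono n w l (h.map_smul_le _ _)).trans (le_ext w bas f l)
  have hneg : ∀ f, V (-f) = V f := by
    have key : ∀ f, V (-f) ≤ V f := fun f => by simpa using hsmulF (-1) f
    exact fun f => le_antisymm (key f) (by simpa using key (-f))
  have hsub : ∀ f g, V (f - g) ≤ max (V f) (V g) := by
    intro f g
    rw [sub_eq_add_neg, ← hneg g]
    exact hadd _ _
  have haddlt : ∀ f g, V g < V f → V (f + g) = V f := by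
    intro f g hfg
    refine le_antisymm ((hadd f g).trans (max_le le_rfl hfg.le)) ?_
    by_contra! hlt
    have := hsub (f + g) g
    rw [add_sub_cancel_right] at this
    exact absurd (this.trans_lt (max_lt hlt hfg)) (lt_irrefl _)
  have hsum : ∀ (s : Finset (Fin n)) (f : Fin n → B) (x : WithBot ℕ), (∀ i ∈ s, V (f i) ≤ x) →
      V (∑ i ∈ s, f i) ≤ x := by
    classical
    intro s f x hx
    induction s using Finset.induction_on with
    | empty => simp [hzero]
    | insert i s hi ih =>
      rw [Finset.sum_insert hi]
      exact (hadd _ _).trans (max_le (hx i (by simp)) (ih fun j hj => hx j (by simp [hj])))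
  have hmono : ∀ (l : ℕ), l < n → ∀ x : A, V (x • W ^ l) = lift n w l (v x) := by
    intro l hl x
    have hrepr : ∀ k : Fin n, bas.repr (x • W ^ l) k = if k = ⟨l, hl⟩ then x else 0 := by
      intro k
      have := hbas ⟨l, hl⟩
      simp only at this
      rw [← this, map_smul, Finsupp.smul_apply, Module.Basis.repr_self, Finsupp.single_apply]
      simp only [eq_comm (a := k)]
      split_ifs <;> simp
    refine le_antisymm (ext_le.2 fun k => ?_) ?_
    · rw [hrepr]
      split_ifs with hk
      · rw [hk]
      · simp [h.map_zero]
    · have := le_ext (v := v) w bas (x • W ^ l) ⟨l, hl⟩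
      rwa [hrepr, if_pos rfl] at this
  -- products of monomials
  have hmm : ∀ (l : ℕ), l ≤ 2 * n - 2 → ∀ x : A, V (x • W ^ l) = lift n w l (v x) := by
    intro l hl x
    by_cases hln : l < n
    · exact hmono l hln x
    obtain ⟨k, rfl⟩ : ∃ k, l = k + n := ⟨l - n, by omega⟩
    have e1 : x • W ^ (k + n) = (x * b) • W ^ k + (x * a) • W ^ (k + 1) := by
      rw [pow_add, hW, Algebra.smul_def, Algebra.smul_def, Algebra.smul_def, _root_.map_mul, _root_.map_mul,
        pow_succ]
      ring
    by_cases hx0 : x = 0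
    · simp [hx0, hzero, h.map_zero]
    have hxv : v x ≠ ⊥ := fun hh => hx0 ((h.eq_bot_iff x).1 hh)
    have e2 : V ((x * b) • W ^ k) = lift n w (k + n) (v x) := by
      rw [hmono k (by omega), h.map_mul, hb, lift_add_self]
    rw [e1, haddlt _ _, e2]
    rw [e2, hmono (k + 1) (by omega), h.map_mul, add_comm k 1, add_comm k n, add_comm (v x),
      ← lift_add, ← zero_add (v x), ← Nat.cast_zero, ← lift_add]
    have hne : lift n w k ((0 : ℕ) + v x) ≠ ⊥ := by
      rw [Ne, lift_eq_bot]
      simpa using hxv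
    rw [Nat.cast_zero, zero_add]  at *
    exact WithBot.add_lt_add_right hne ha
  have hexp : ∀ f : B, f = ∑ l : Fin n, bas.repr f l • W ^ (l : ℕ) := fun f => by
    conv_lhs => rw [← bas.sum_repr f]
    simp only [hbas]
  have hmulle : ∀ f g, V (f * g) ≤ V f + V g := by
    intro f g
    rw [hexp f, hexp g, Finset.sum_mul_sum, ← hexp f, ← hexp g]
    refine hsum _ _ _ fun i _ => hsum _ _ _ fun j _ => ?_
    rw [smul_mul_smul_comm, ← pow_add, hmm _ (by omega), h.map_mul, ← lift_add]
    exact add_le_add (le_ext w bas f i) (le_ext w bas g j)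
  have hlead : ∀ f, f ≠ 0 → ∃ (l : Fin n) (x : A) (g : B), f = x • W ^ (l : ℕ) + g ∧
      V (x • W ^ (l : ℕ)) = V f ∧ V g < V f := by
    intro f hf
    obtain ⟨l, hl⟩ := exists_ext_eq (v := v) hn w bas f
    have hVf : ⊥ < V f := bot_lt_iff_ne_bot.2 fun hh => hf ((hbot f).1 hh)
    refine ⟨l, bas.repr f l, f - bas.repr f l • W ^ (l : ℕ), by abel, ?_, ?_⟩
    · rw [hmono l l.2, hV, hl]
    · refine (ext_lt hVf).2 fun k => ?_
      rw [map_sub, ← hbas, map_smul, Module.Basis.repr_self, Finsupp.sub_apply, Finsupp.smul_apply,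
        Finsupp.single_apply]
      by_cases hk : l = k
      · subst hk
        simpa [h.map_zero] using hVf
      · simp only [if_neg hk, smul_zero, sub_zero]
        refine lt_of_le_of_ne (le_ext w bas f k) fun heq => hk ?_
        have h1 : v (bas.repr f l) ≠ ⊥ := by
          rw [hV, hl, bot_lt_iff_ne_bot, Ne, lift_eq_bot] at hVf
          exact hVf
        rw [hV, hl] at heq
        exact Fin.ext (lift_inj hnw l.2 k.2 h1 heq.symm).1
  have hmul : ∀ f g, V (f * g) = V f + V g := by
    intro f g
    by_cases hf : f = 0
    · simp [hf, hzero]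
    by_cases hg : g = 0
    · simp [hg, hzero]
    obtain ⟨l, x, f', hf1, hf2, hf3⟩ := hlead f hf
    obtain ⟨k, y, g', hg1, hg2, hg3⟩ := hlead g hg
    have hVf : V f ≠ ⊥ := fun hh => hf ((hbot f).1 hh)
    have hVg : V g ≠ ⊥ := fun hh => hg ((hbot g).1 hh)
    have e1 : f * g = x • W ^ (l : ℕ) * (y • W ^ (k : ℕ)) + (f' * g + x • W ^ (l : ℕ) * g') := by
      conv_lhs => rw [hf1, add_mul]
      conv_lhs => enter [1]; rw [hg1]
      rw [mul_add]
      ring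
    have e2 : V (x • W ^ (l : ℕ) * (y • W ^ (k : ℕ))) = V f + V g := by
      rw [smul_mul_smul_comm, ← pow_add, hmm _ (by omega), h.map_mul, ← lift_add,
        ← hmono l l.2, ← hmono k k.2, hf2, hg2]
    rw [e1, haddlt, e2]
    rw [e2]
    refine (hadd _ _).trans_lt (max_lt ?_ ?_)
    · exact (hmulle _ _).trans_lt (WithBot.add_lt_add_right hVg hf3)
    · refine (hmulle _ _).trans_lt ?_
      rw [hf2]
      exact WithBot.add_lt_add_left hVf hg3
  refine ⟨⟨hbot, hmul, hadd, ?_, ?_, ?_⟩, hmono⟩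
  · intro x
    have h1 := hmono 0 hn (algebraMap F A x)
    rw [pow_zero, ← Algebra.algebraMap_eq_smul_one, ← IsScalarTower.algebraMap_apply] at h1
    rw [h1]
    refine (lift_mono n w 0 (h.map_algebraMap_le x)).trans ?_
    change ((n * 0 + 0 * w : ℕ) : WithBot ℕ) ≤ _
    simp
  · intro f g hfg hf
    obtain ⟨l, x, f', hf1, hf2, hf3⟩ := hlead f hf
    have hg : g ≠ 0 := fun hg => hf ((hbot f).1 (by rw [hfg, hg, hzero]))
    obtain ⟨k, y, g', hg1, hg2, hg3⟩ := hlead g hg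
    have hVf : V f ≠ ⊥ := fun hh => hf ((hbot f).1 hh)
    have h1 := hf2.trans (hfg.trans hg2.symm)
    rw [hmono l l.2, hmono k k.2] at h1
    have hx : v x ≠ ⊥ := by
      rw [← hf2, hmono l l.2, Ne, lift_eq_bot] at hVf
      exact hVf
    obtain ⟨hlk, hxy⟩ := lift_inj hnw l.2 k.2 hx h1
    obtain ⟨z, hz⟩ := h.exists_lt x y hxy (fun h0 => hx ((h.eq_bot_iff x).2 h0))
    refine ⟨z, ?_⟩
    have e1 : f - z • g = (x - z • y) • W ^ (l : ℕ) + (f' - z • g') := by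
      conv_lhs => rw [hf1, hg1, ← hlk]
      rw [sub_smul, smul_add, smul_assoc]
      abel
    rw [e1]
    refine (hadd _ _).trans_lt (max_lt ?_ ?_)
    · rw [hmono l l.2, ← hf2, hmono l l.2]
      exact lift_strictMono hn w l hz
    · refine (hsub _ _).trans_lt (max_lt hf3 ?_)
      rw [hfg]
      exact (hsmulF _ _).trans_lt hg3
  · intro N hN
    obtain ⟨l, hl, hlw⟩ : ∃ l < n, l * w ≡ N [MOD n] := by
      obtain ⟨m, hm, hm'⟩ := Nat.exists_mul_mod_eq_of_coprime N hnw.symm hn.ne'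
      exact ⟨m, hm, by rw [mul_comm]; exact hm'⟩
    have h1 : l * w ≤ N := by nlinarith
    obtain ⟨i, hi⟩ := (Nat.modEq_iff_dvd' h1).1 hlw
    have h2 : c ≤ i := by
      by_contra! hlt
      have : l * w ≤ n * w := by gcongr
      nlinarith [Nat.sub_add_cancel h1]
    obtain ⟨x, hx⟩ := h.exists_eq i h2
    refine ⟨x • W ^ l, ?_⟩
    rw [hmono l hl, hx, lift_coe]
    congr 1
    omega

end Extension

end PoleOrder

section

open Polynomial

namespace PoleOrder

lemma nontrivial' {F S : Type*} [Field F] [CommRing S] [Algebra F S] {v : S → WithBot ℕ} {c : ℕ}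
    (h : PoleOrder F v c) : Nontrivial S := by
  obtain ⟨f, hf⟩ := h.exists_eq c le_rfl
  refine ⟨f, 0, fun h0 => ?_⟩
  rw [h0, h.map_zero] at hf
  exact WithBot.bot_ne_coe hf

lemma polynomial (F : Type*) [Field F] : PoleOrder F (degree : F[X] → WithBot ℕ) 0 where
  eq_bot_iff _ := degree_eq_bot
  map_mul _ _ := degree_mul
  map_add_le := degree_add_le
  map_algebraMap_le _ := degree_C_le
  exists_lt f g hfg hf := by
    have hg : g ≠ 0 := by
      rintro rfl
      rw [degree_zero, degree_eq_bot] at hfg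
      exact hf hfg
    refine ⟨f.leadingCoeff / g.leadingCoeff, ?_⟩
    have hne : f.leadingCoeff / g.leadingCoeff ≠ 0 :=
      div_ne_zero (leadingCoeff_ne_zero.2 hf) (leadingCoeff_ne_zero.2 hg)
    refine degree_sub_lt_left ?_ hf ?_
    · rw [hfg, smul_eq_C_mul, degree_mul, degree_C hne, zero_add]
    · rw [smul_eq_C_mul, leadingCoeff_mul, leadingCoeff_C,
        div_mul_cancel₀ _ (leadingCoeff_ne_zero.2 hg)]
  exists_eq n _ := ⟨X ^ n, degree_X_pow n⟩

section Adjoin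

variable {F A : Type*} [Field F] [CommRing A] [Algebra F A] {v : A → WithBot ℕ} {c n : ℕ}

/-- The defining polynomial of the extension `W ^ n = a * W + b`. -/
noncomputable abbrev trinomial (n : ℕ) (a b : A) : A[X] := X ^ n - (C a * X + C b)

lemma degree_linear_lt (hn : 2 ≤ n) (a b : A) : degree (C a * X + C b) < (n : ℕ) :=
  degree_linear_le.trans_lt (by norm_cast)

lemma monic_trinomial (hn : 2 ≤ n) (a b : A) : (trinomial n a b).Monic :=
  monic_X_pow_sub (degree_linear_lt hn a b)

lemma natDegree_trinomial [Nontrivial A] (hn : 2 ≤ n) (a b : A) :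
    (trinomial n a b).natDegree = n := by
  refine natDegree_eq_of_degree_eq_some ?_
  rw [degree_sub_eq_left_of_degree_lt, degree_X_pow]
  rw [degree_X_pow]
  exact degree_linear_lt hn a b

theorem adjoin (h : PoleOrder F v c) (hn : 2 ≤ n) {w : ℕ} (hnw : n.Coprime w) {a b : A}
    (hb : v b = w) (ha : lift n w 1 (v a) < lift n w n (0 : ℕ)) :
    ∃ v' : AdjoinRoot (trinomial n a b) → WithBot ℕ, PoleOrder F v' (n * c + n * w) ∧
      ∀ l < n, ∀ x : A, v' (x • AdjoinRoot.root _ ^ l) = lift n w l (v x) := by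
  have := h.nontrivial'
  let bas := (AdjoinRoot.powerBasisAux' (monic_trinomial hn a b)).reindex
    (finCongr (natDegree_trinomial hn a b))
  refine ⟨_, h.extension (by omega) hnw bas (AdjoinRoot.root _) (fun l => ?_) ?_ hb ha⟩
  · have := (AdjoinRoot.powerBasis' (monic_trinomial hn a b)).basis_eq_pow
      ((finCongr (natDegree_trinomial hn a b)).symm l)
    rw [AdjoinRoot.powerBasis'_gen] at this
    simp only [bas, Module.Basis.reindex_apply]
    exact this
  · have := AdjoinRoot.eval₂_root (trinomial n a b)
    simp only [trinomial, eval₂_sub, eval₂_add, eval₂_mul, eval₂_pow, eval₂_X, eval₂_C] at this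
    exact sub_eq_zero.1 this

/-- Points on the extension lying over a given point. -/
noncomputable def adjoinHom (φ : A →ₐ[F] F) (a b : A) (s : F) (hs : s ^ n = φ a * s + φ b) :
    AdjoinRoot (trinomial n a b) →ₐ[F] F :=
  AdjoinRoot.liftAlgHom _ φ s (by
    simp only [trinomial, eval₂_sub, eval₂_add, eval₂_mul, eval₂_pow, eval₂_X, eval₂_C]
    exact sub_eq_zero.2 hs)

lemma adjoinHom_root (φ : A →ₐ[F] F) (a b : A) (s : F) (hs : s ^ n = φ a * s + φ b) :
    adjoinHom φ a b s hs (AdjoinRoot.root _) = s := AdjoinRoot.liftAlgHom_root _ _ _ _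

lemma adjoinHom_of (φ : A →ₐ[F] F) (a b : A) (s : F) (hs : s ^ n = φ a * s + φ b) (x : A) :
    adjoinHom φ a b s hs (AdjoinRoot.of _ x) = φ x := AdjoinRoot.liftAlgHom_of _ _ _ _ _

end Adjoin

section Cubic

variable {F : Type*} [Field F] {f : F[X]}

/-- The coordinate ring of `V ^ 2 = f(U)`. -/
abbrev Hyper (f : F[X]) : Type _ := AdjoinRoot (trinomial 2 0 f)

theorem hyper (hf : f.degree = 3) :
    ∃ v : Hyper f → WithBot ℕ, PoleOrder F v 6 ∧
      v (AdjoinRoot.of _ X) = (2 : ℕ) ∧ v (AdjoinRoot.root _) = (3 : ℕ) := by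
  obtain ⟨v, hv, hv'⟩ := (polynomial F).adjoin (n := 2) le_rfl (w := 3) (by norm_num) (a := 0)
    (b := f) (by exact_mod_cast hf) (by
      rw [degree_zero]
      exact WithBot.bot_lt_coe _)
  refine ⟨v, hv, ?_, ?_⟩
  · have := hv' 0 (by norm_num) X
    rw [pow_zero, ← Algebra.algebraMap_eq_smul_one, degree_X] at this
    exact this
  · have := hv' 1 (by norm_num) 1
    rw [pow_one, one_smul, degree_one] at this
    exact this

/-- The point `(u, w)` of `V ^ 2 = f(U)`. -/
noncomputable def hyperHom (u w : F) (h : w ^ 2 = f.eval u) : Hyper f →ₐ[F] F :=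
  adjoinHom (aeval u) 0 f w (by simp [h, aeval_def])

lemma hyperHom_root (u w : F) (h : w ^ 2 = f.eval u) :
    hyperHom u w h (AdjoinRoot.root _) = w := adjoinHom_root _ _ _ _ _

lemma hyperHom_of (u w : F) (h : w ^ 2 = f.eval u) (x : F[X]) :
    hyperHom u w h (AdjoinRoot.of _ x) = x.eval u := by
  rw [hyperHom, adjoinHom_of, aeval_def, eval₂_eq_eval_map]
  simp

variable [Fintype F] [DecidableEq F] {p μ : ℕ} [Fact p.Prime] [CharP F p]

lemma card_hyper_le (hf : f.degree = 3) (hq : Fintype.card F = (p ^ μ) ^ 2)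
    (hbig : 62 < 2 * p ^ μ) :
    (Finset.univ.filter fun P : F × F => P.2 ^ 2 = f.eval P.1).card ≤
      (p ^ μ) ^ 2 + 14 * p ^ μ + 6 := by
  classical
  obtain ⟨v, hv, -, -⟩ := hyper hf
  set S := Finset.univ.filter fun P : F × F => P.2 ^ 2 = f.eval P.1 with hS
  have hpt : ∀ P : S, P.1.2 ^ 2 = f.eval P.1.1 := fun P => (Finset.mem_filter.1 P.2).2
  let Z := S.attach.image fun P => hyperHom P.1.1 P.1.2 (hpt P)
  have hZ : Z.card = S.card := by
    rw [Finset.card_image_of_injective, Finset.card_attach]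
    intro P P' hPP
    have h1 := DFunLike.congr_fun hPP (AdjoinRoot.of _ X)
    have h2 := DFunLike.congr_fun hPP (AdjoinRoot.root _)
    simp only [hyperHom_root, hyperHom_of, eval_X] at h1 h2
    exact Subtype.ext (Prod.ext h1 h2)
  rw [← hZ]
  have := hv.card_algHom_le hq (by omega) Z
  omega

/-- Points of an Artin–Schreier cover of `V ^ 2 = f(U)`. -/
lemma card_artinSchreier_le (hp2 : 2 < p) (hf : f.degree = 3) (α γ : F) {β : F} (hβ : β ≠ 0)
    (hq : Fintype.card F = (p ^ μ) ^ 2)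
    (hbig : (p * 6 + p * (2 * p + 1) + 2) * (p * 6 + p * (2 * p + 1) + 1) +
      (p * 6 + p * (2 * p + 1)) < 2 * p ^ μ) :
    (Finset.univ.filter fun P : F × F × F => P.1 ≠ 0 ∧ P.2.1 ^ 2 = f.eval P.1 ∧
      P.2.2 ^ p - P.2.2 = (α + β * P.2.1) / P.1 - γ).card ≤
      (p ^ μ) ^ 2 + (2 * (p * 6 + p * (2 * p + 1)) + 2) * p ^ μ + (p * 6 + p * (2 * p + 1)) := by
  classical
  obtain ⟨v, hv, hvU, hvV⟩ := hyper hf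
  set U : Hyper f := AdjoinRoot.of _ X with hU
  set V : Hyper f := AdjoinRoot.root _ with hV
  have hU0 : U ≠ 0 := fun h0 => by
    rw [h0, hv.map_zero] at hvU
    exact WithBot.bot_ne_coe hvU
  obtain ⟨k, rfl⟩ : ∃ k, p = k + 2 := ⟨p - 2, by omega⟩
  have hvU' : v (U ^ (k + 1)) = ((k + 1) * 2 : ℕ) := hv.map_pow hvU k hU0
  have hvz : v (β • V + (algebraMap F _ α - γ • U)) = (3 : ℕ) := by
    have h3 : v (β • V) = (3 : ℕ) := by
      refine le_antisymm ((hv.map_smul_le _ _).trans hvV.le) ?_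
      have := hv.map_smul_le β⁻¹ (β • V)
      rwa [smul_smul, inv_mul_cancel₀ hβ, one_smul, hvV] at this
    rw [hv.map_add_eq_left, h3]
    rw [h3]
    refine (hv.map_sub_le _ _).trans_lt (max_lt ?_ ?_)
    · exact (hv.map_algebraMap_le α).trans_lt (by norm_cast)
    · refine (hv.map_smul_le _ _).trans_lt ?_
      rw [hvU]
      norm_cast
  have hb : v (U ^ (k + 1) * (β • V + (algebraMap F _ α - γ • U))) =
      ((2 * (k + 2) + 1 : ℕ) : WithBot ℕ) := by
    rw [hv.map_mul, hvU', hvz]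
    norm_cast
    ring
  obtain ⟨v', hv', -⟩ := hv.adjoin (n := k + 2) (by omega) (w := 2 * (k + 2) + 1)
    (by simp) (a := U ^ (k + 1)) hb (by
      rw [hvU', lift_coe, lift_coe]
      norm_cast
      nlinarith)
  set S := Finset.univ.filter fun P : F × F × F => P.1 ≠ 0 ∧ P.2.1 ^ 2 = f.eval P.1 ∧
      P.2.2 ^ (k + 2) - P.2.2 = (α + β * P.2.1) / P.1 - γ with hS
  have hpt : ∀ P : S, (P.1.2.2 * P.1.1) ^ (k + 2) =
      hyperHom P.1.1 P.1.2.1 (Finset.mem_filter.1 P.2).2.2.1 (U ^ (k + 1)) * (P.1.2.2 * P.1.1) +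
      hyperHom P.1.1 P.1.2.1 (Finset.mem_filter.1 P.2).2.2.1
        (U ^ (k + 1) * (β • V + (algebraMap F _ α - γ • U))) := by
    rintro ⟨⟨u, w, t⟩, hP⟩
    obtain ⟨-, hu, huw, ht⟩ := Finset.mem_filter.1 hP
    simp only [_root_.map_mul, _root_.map_pow, _root_.map_add, _root_.map_sub, map_smul,
      hU, hV, hyperHom_root, hyperHom_of, eval_X, AlgHom.commutes, smul_eq_mul,
      Algebra.algebraMap_self, RingHom.id_apply] at *
    have e1 : (t ^ (k + 2) - t) * u = α + β * w - γ * u := by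
      rw [ht]; field_simp
    rw [mul_pow]
    linear_combination u ^ (k + 1) * e1
  let Z := S.attach.image fun P => adjoinHom (n := k + 2)
    (hyperHom P.1.1 P.1.2.1 (Finset.mem_filter.1 P.2).2.2.1) _ _ (P.1.2.2 * P.1.1) (hpt P)
  have hZ : Z.card = S.card := by
    rw [Finset.card_image_of_injective, Finset.card_attach]
    intro P P' hPP
    have h1 := DFunLike.congr_fun hPP (AdjoinRoot.of _ U)
    have h2 := DFunLike.congr_fun hPP (AdjoinRoot.of _ V)
    have h3 := DFunLike.congr_fun hPP (AdjoinRoot.root _)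
    have hu0 := (Finset.mem_filter.1 P.2).2.1
    simp only [adjoinHom_of, adjoinHom_root, hU, hV, hyperHom_root, hyperHom_of, eval_X]
      at h1 h2 h3
    rw [← h1] at h3
    exact Subtype.ext (Prod.ext h1 (Prod.ext h2 (mul_right_cancel₀ hu0 h3)))
  rw [← hZ]
  exact hv'.card_algHom_le hq hbig Z

end Cubic

end PoleOrder

end

section

open Polynomial

/-- The additive form of Hilbert's theorem 90 over finite fields. -/
lemma exists_pow_sub_eq_of_trace_eq_zero {p : ℕ} [Fact p.Prime] {F : Type*} [Field F] [Finite F]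
    [Algebra (ZMod p) F] {x : F} (hx : Algebra.trace (ZMod p) F x = 0) : ∃ t : F, t ^ p - t = x := by
  have hp := (Fact.out : p.Prime)
  have hfd : FiniteDimensional (ZMod p) F := Module.Finite.of_finite
  let fr : F →ₐ[ZMod p] F := FiniteField.frobeniusAlgHom (ZMod p) F
  have hfr : ∀ t, fr t = t ^ p := fun t => by
    simp [fr]
  let T : F →ₗ[ZMod p] F := fr.toLinearMap - LinearMap.id
  have hT : ∀ t, T t = t ^ p - t := fun t => by simp [T, hfr]
  have hker : Module.finrank (ZMod p) (LinearMap.ker T) ≤ 1 := by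
    have h1 : Nat.card (LinearMap.ker T) ≤ p := by
      classical
      have hne := FiniteField.X_pow_card_sub_X_ne_zero F hp.one_lt
      have hsub : ((LinearMap.ker T : Submodule (ZMod p) F) : Set F) ⊆
          ((X ^ p - X : F[X]).roots.toFinset : Set F) := by
        intro t ht
        have ht' : T t = 0 := ht
        rw [hT] at ht'
        simp [mem_roots hne, ht']
      calc Nat.card (LinearMap.ker T) = Set.ncard ((LinearMap.ker T : Submodule (ZMod p) F) : Set F) := rfl
        _ ≤ _ := Set.ncard_le_ncard hsub (Finset.finite_toSet _)
        _ = _ := Set.ncard_coe_finset _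
        _ ≤ _ := (Multiset.toFinset_card_le _).trans ((card_roots' _).trans
          (FiniteField.X_pow_card_sub_X_natDegree_eq F hp.one_lt).le)
    rw [Module.natCard_eq_pow_finrank (K := ZMod p), Nat.card_zmod] at h1
    exact (Nat.pow_le_pow_iff_right hp.one_lt).1 (by simpa using h1)
  have hle : LinearMap.range T ≤ LinearMap.ker (Algebra.trace (ZMod p) F) := by
    rintro _ ⟨t, rfl⟩
    rw [LinearMap.mem_ker, hT, map_sub, sub_eq_zero, ← hfr]
    exact Algebra.trace_eq_of_algEquiv (AlgEquiv.ofBijective fr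
      ⟨fr.injective, Finite.surjective_of_injective fr.injective⟩) t
  have hr1 := LinearMap.finrank_range_add_finrank_ker T
  have hr2 := LinearMap.finrank_range_add_finrank_ker (Algebra.trace (ZMod p) F)
  rw [LinearMap.range_eq_top.2 (Algebra.trace_surjective (ZMod p) F), finrank_top,
    Module.finrank_self] at hr2
  have heq := Submodule.eq_of_le_of_finrank_le hle (by omega)
  have : x ∈ LinearMap.range T := by rw [heq]; exact hx
  obtain ⟨t, ht⟩ := this
  exact ⟨t, by rw [← hT, ht]⟩

namespace PoleOrder

variable {F : Type*} [Field F] {f : F[X]} [Fintype F] [DecidableEq F] {p μ : ℕ} [Fact p.Prime]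

/-- The conductor of the Artin–Schreier covers. -/
def asConductor (p : ℕ) : ℕ := p * 6 + p * (2 * p + 1)

lemma le_card_hyper [CharP F p] (hp2 : 2 < p) (hf : f.degree = 3) (hq : Fintype.card F = (p ^ μ) ^ 2)
    (hbig : 62 < 2 * p ^ μ) :
    (p ^ μ) ^ 2 ≤ (Finset.univ.filter fun P : F × F => P.1 ≠ 0 ∧ P.2 ^ 2 = f.eval P.1).card +
      (14 * p ^ μ + 8) := by
  classical
  have hchar : ringChar F ≠ 2 := by
    rw [ringChar.eq F p]; omega
  obtain ⟨θ, hθ⟩ := FiniteField.exists_nonsquare hchar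
  have hθ0 : θ ≠ 0 := by rintro rfl; exact hθ (IsSquare.zero)
  have h1 := card_hyper_le (f := C θ * f) (p := p) (μ := μ)
    (by rw [degree_mul, degree_C hθ0, zero_add, hf]) hq hbig
  have hfib : ∀ g : F[X], ((Finset.univ.filter fun P : F × F => P.2 ^ 2 = g.eval P.1).card : ℤ) =
      ∑ u : F, (quadraticChar F (g.eval u) + 1) := by
    intro g
    rw [Finset.card_eq_sum_card_fiberwise (f := Prod.fst) (t := Finset.univ) (fun _ _ => by simp)]
    push_cast
    refine Finset.sum_congr rfl fun u _ => ?_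
    rw [← quadraticChar_card_sqrts hchar]
    norm_cast
    refine Finset.card_bij (fun P _ => P.2) ?_ ?_ ?_
    · rintro ⟨a, b⟩ h
      simp only [Finset.mem_filter, Finset.mem_univ, true_and] at h
      simp [h.1, h.2]
    · rintro ⟨a, b⟩ h ⟨a', b'⟩ h' hb
      simp only [Finset.mem_filter, Finset.mem_univ, true_and] at h h'
      exact Prod.ext (h.2.trans h'.2.symm) hb
    · intro w hw
      exact ⟨(u, w), by simpa using hw, rfl⟩
  have hsum : ((Finset.univ.filter fun P : F × F => P.2 ^ 2 = f.eval P.1).card : ℤ) +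
      (Finset.univ.filter fun P : F × F => P.2 ^ 2 = (C θ * f).eval P.1).card =
      2 * ((p ^ μ) ^ 2 : ℕ) := by
    rw [hfib, hfib, ← Finset.sum_add_distrib, ← hq]
    rw [Finset.sum_congr rfl (g := fun _ => (2 : ℤ))]
    · simp [Finset.card_univ, mul_comm]
    · intro u _
      rw [eval_mul, eval_C, _root_.map_mul, quadraticChar_neg_one_iff_not_isSquare.2 hθ]
      ring
  have h0 : (Finset.univ.filter fun P : F × F => P.2 ^ 2 = f.eval P.1).card ≤
      (Finset.univ.filter fun P : F × F => P.1 ≠ 0 ∧ P.2 ^ 2 = f.eval P.1).card + 2 := by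
    have hsplit := Finset.card_filter_add_card_filter_not (s := Finset.univ.filter
      fun P : F × F => P.2 ^ 2 = f.eval P.1) (fun P => P.1 ≠ 0)
    rw [Finset.filter_filter, Finset.filter_filter] at hsplit
    have hle : (Finset.univ.filter fun P : F × F => P.2 ^ 2 = f.eval P.1 ∧ ¬ P.1 ≠ 0).card ≤ 2 := by
      have h2 : ((Finset.univ.filter fun w : F => w ^ 2 = f.eval 0).card) ≤ 2 := by
        have := quadraticChar_card_sqrts hchar (f.eval 0)
        have h3 : quadraticChar F (f.eval 0) ≤ 1 := by
          by_cases h0 : f.eval 0 = 0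
          · simp [h0]
          · rcases quadraticChar_dichotomy h0 with h | h <;> simp [h]
        have h4 : (({x : F | x ^ 2 = f.eval 0}.toFinset.card : ℕ) : ℤ) ≤ 2 := by rw [this]; omega
        have h5 : {x : F | x ^ 2 = f.eval 0}.toFinset =
          Finset.univ.filter fun w : F => w ^ 2 = f.eval 0 := by ext; simp
        rw [h5] at h4
        exact_mod_cast h4
      refine (Finset.card_le_card_of_injOn Prod.snd ?_ ?_).trans h2
      · rintro ⟨a, b⟩ h
        simp only [Finset.coe_filter, Finset.mem_univ, true_and, not_not, Set.mem_ofPred_eq] at h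
        simpa [h.2] using h.1
      · rintro ⟨a, b⟩ h ⟨a', b'⟩ h' hb
        simp only [Finset.coe_filter, Finset.mem_univ, true_and, not_not, Set.mem_ofPred_eq] at h h'
        simp only at hb
        rw [h.2, h'.2, hb]
    simp only [and_comm (a := (_ : F) ^ 2 = _)] at hsplit hle
    omega
  zify at h1 h0 ⊢
  push_cast at hsum
  linarith

lemma card_trace_eq_le [Algebra (ZMod p) F] (hp2 : 2 < p) (hf : f.degree = 3) (α : F) {β : F}
    (hβ : β ≠ 0) (hq : Fintype.card F = (p ^ μ) ^ 2)
    (hbig : (asConductor p + 2) * (asConductor p + 1) + asConductor p < 2 * p ^ μ) (j : ZMod p) :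
    p * (Finset.univ.filter fun P : F × F => (P.1 ≠ 0 ∧ P.2 ^ 2 = f.eval P.1) ∧
      Algebra.trace (ZMod p) F ((α + β * P.2) / P.1) = j).card ≤
      (p ^ μ) ^ 2 + (2 * asConductor p + 2) * p ^ μ + asConductor p := by
  classical
  have hchar : CharP F p := charP_of_injective_algebraMap (algebraMap (ZMod p) F).injective p
  obtain ⟨γ, hγ⟩ := Algebra.trace_surjective (ZMod p) F j
  refine le_trans ?_ (card_artinSchreier_le hp2 hf α γ hβ hq hbig)
  set M := Finset.univ.filter fun P : F × F => (P.1 ≠ 0 ∧ P.2 ^ 2 = f.eval P.1) ∧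
      Algebra.trace (ZMod p) F ((α + β * P.2) / P.1) = j with hM
  have hex : ∀ P ∈ M, ∃ t : F, t ^ p - t = (α + β * P.2) / P.1 - γ := by
    intro P hP
    refine exists_pow_sub_eq_of_trace_eq_zero ?_
    rw [map_sub, (Finset.mem_filter.1 hP).2.2, hγ, sub_self]
  choose! t ht using hex
  have hcard : p * M.card = (M ×ˢ (Finset.univ : Finset (ZMod p))).card := by
    rw [Finset.card_product, Finset.card_univ, ZMod.card, mul_comm]
  rw [hcard]
  refine Finset.card_le_card_of_injOn
    (fun x => (x.1.1, x.1.2, t x.1 + algebraMap (ZMod p) F x.2)) ?_ ?_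
  · rintro ⟨P, i⟩ h
    have hP : P ∈ M := by simpa using h
    have hP' := (Finset.mem_filter.1 hP).2.1
    simp only [Finset.coe_filter, Finset.mem_univ, true_and, Set.mem_ofPred_eq]
    refine ⟨hP'.1, hP'.2, ?_⟩
    rw [← ht P hP, add_pow_char, ← _root_.map_pow, ZMod.pow_card]
    ring
  · rintro ⟨⟨a, b⟩, i⟩ _ ⟨⟨a', b'⟩, i'⟩ _ h
    simp only [Prod.mk.injEq] at h
    obtain ⟨rfl, rfl, h⟩ := h
    rw [(algebraMap (ZMod p) F).injective (add_left_cancel h)]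

/-- A bound of square-root strength for exponential sums on `w ^ 2 = f(u)` over all large fields of
square cardinality, with a constant depending on the characteristic. -/
theorem norm_sum_le [Algebra (ZMod p) F] (hp2 : 2 < p) (hf : f.degree = 3) (α : F) {β : F}
    (hβ : β ≠ 0) (hq : Fintype.card F = (p ^ μ) ^ 2)
    (hbig : (asConductor p + 2) * (asConductor p + 1) + asConductor p < 2 * p ^ μ)
    {ψ : AddChar (ZMod p) ℂ} (hψ : ψ ≠ 1) :
    ‖∑ P ∈ Finset.univ.filter fun P : F × F => P.1 ≠ 0 ∧ P.2 ^ 2 = f.eval P.1,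
      ψ (Algebra.trace (ZMod p) F ((α + β * P.2) / P.1))‖ ≤ (3 * asConductor p + 24) * p ^ μ := by
  classical
  have hchar : CharP F p := charP_of_injective_algebraMap (algebraMap (ZMod p) F).injective p
  have hp := (Fact.out : p.Prime)
  have hQ1 : 1 ≤ p ^ μ := Nat.one_le_pow _ _ hp.pos
  have hc : 6 ≤ asConductor p := by unfold asConductor; nlinarith
  have hlow := le_card_hyper (f := f) (μ := μ) hp2 hf hq (by nlinarith)
  have hup := card_trace_eq_le (f := f) (μ := μ) hp2 hf α hβ hq hbig
  set E := Finset.univ.filter fun P : F × F => P.1 ≠ 0 ∧ P.2 ^ 2 = f.eval P.1 with hE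
  set τ : F × F → ZMod p := fun P => Algebra.trace (ZMod p) F ((α + β * P.2) / P.1) with hτ
  set M : ZMod p → ℕ := fun j => (E.filter fun P => τ P = j).card with hMdef
  have hM : ∀ j, p * M j ≤ (p ^ μ) ^ 2 + (2 * asConductor p + 2) * p ^ μ + asConductor p := by
    intro j
    have := hup j
    rwa [← Finset.filter_filter] at this
  set B : ℝ := (p ^ μ) ^ 2 + (2 * asConductor p + 2) * p ^ μ + asConductor p with hB
  have hM' : ∀ j, (M j : ℝ) ≤ B / p := by
    intro j
    rw [le_div_iff₀ (by exact_mod_cast hp.pos), mul_comm, hB]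
    exact_mod_cast hM j
  have hcardE : (E.card : ℝ) = ∑ j, (M j : ℝ) := by
    rw [Finset.card_eq_sum_card_fiberwise (f := τ) (t := Finset.univ) (fun _ _ => by simp)]
    push_cast
    rfl
  have hsum : ∑ P ∈ E, ψ (τ P) = ∑ j, ((M j : ℝ) - B / p : ℝ) * ψ j := by
    have h1 : ∑ P ∈ E, ψ (τ P) = ∑ j, (M j : ℂ) * ψ j := by
      rw [← Finset.sum_fiberwise E τ]
      refine Finset.sum_congr rfl fun j _ => ?_
      rw [Finset.sum_congr rfl (g := fun _ => ψ j)]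
      · rw [Finset.sum_const, nsmul_eq_mul]
      · intro P hP
        rw [(Finset.mem_filter.1 hP).2]
    rw [h1]
    push_cast
    simp only [sub_mul, Finset.sum_sub_distrib]
    rw [← Finset.mul_sum, AddChar.sum_eq_zero_of_ne_one hψ, mul_zero, sub_zero]
  rw [hsum]
  calc _ ≤ ∑ j, ‖(((M j : ℝ) - B / p : ℝ) : ℂ) * ψ j‖ := _root_.norm_sum_le _ _
    _ = ∑ j, (B / p - M j) := by
      refine Finset.sum_congr rfl fun j _ => ?_
      rw [norm_mul, AddChar.norm_apply, mul_one, Complex.norm_real, Real.norm_eq_abs, abs_sub_comm,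
        abs_of_nonneg (by linarith [hM' j])]
    _ = B - E.card := by
      rw [Finset.sum_sub_distrib, ← hcardE, Finset.sum_const, Finset.card_univ, ZMod.card,
        nsmul_eq_mul, mul_div_cancel₀]
      exact_mod_cast hp.ne_zero
    _ ≤ _ := by
      have hlow' : ((p : ℝ) ^ μ) ^ 2 ≤ E.card + (14 * p ^ μ + 8) := by exact_mod_cast hlow
      have hQ1' : (1 : ℝ) ≤ (p : ℝ) ^ μ := by exact_mod_cast hQ1
      have hc' : (0 : ℝ) ≤ asConductor p := Nat.cast_nonneg _
      rw [hB]
      nlinarith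

end PoleOrder

end

section

open Polynomial

/-- A ring with basis `1, ξ, ξ ^ 2` over `F[z]`, where `ξ` satisfies a monic cubic equation of
total degree three in `ξ` and `z`. -/
structure CubicRing (F R : Type*) [Field F] [CommRing R] [Algebra F R] [Algebra F[X] R] where
  ξ : R
  b : Fin 3 → F[X]
  bas : Module.Basis (Fin 3) F[X] R
  bas_eq : ∀ i, bas i = ξ ^ (i : ℕ)
  rel : ξ ^ 3 = ∑ i : Fin 3, b i • ξ ^ (i : ℕ)
  degree_lt : ∀ i, (b i).degree < ((4 - i : ℕ) : WithBot ℕ)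

namespace CubicRing

variable {F R : Type*} [Field F] [CommRing R] [Algebra F R] [Algebra F[X] R]
  [IsScalarTower F F[X] R] (H : CubicRing F R)

set_option linter.unusedSectionVars false

lemma expand (α : R) : α = ∑ i : Fin 3, H.bas.repr α i • H.ξ ^ (i : ℕ) := by
  conv_lhs => rw [← H.bas.sum_repr α]
  simp only [H.bas_eq]

lemma repr_smul' (x : F) (α : R) (i : Fin 3) : H.bas.repr (x • α) i = x • H.bas.repr α i := by
  rw [← algebraMap_smul F[X] x α, map_smul, Finsupp.smul_apply, algebraMap_smul]

lemma repr_smul (a : F[X]) (α : R) (i : Fin 3) : H.bas.repr (a • α) i = a * H.bas.repr α i := by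
  rw [map_smul, Finsupp.smul_apply, smul_eq_mul]

lemma repr_smul_pow (a : F[X]) (k i : Fin 3) :
    H.bas.repr (a • H.ξ ^ (k : ℕ)) i = if k = i then a else 0 := by
  rw [← H.bas_eq, map_smul, Module.Basis.repr_self, Finsupp.smul_apply, Finsupp.single_apply]
  split_ifs <;> simp

/-- Elements of filtration degree less than `n`. -/
def Fil (n : ℕ) : Submodule F R where
  carrier := {α | ∀ i : Fin 3, (H.bas.repr α i).degree < ((n - i : ℕ) : WithBot ℕ)}
  add_mem' := fun {x y} ha hb i => by
    rw [map_add, Finsupp.add_apply]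
    exact (degree_add_le _ _).trans_lt (max_lt (ha i) (hb i))
  zero_mem' := fun i => by simpa using WithBot.bot_lt_coe _
  smul_mem' := fun x α hα i => by
    rw [H.repr_smul']
    exact (degree_smul_le _ _).trans_lt (hα i)

lemma mem_Fil {n : ℕ} {α : R} :
    α ∈ H.Fil n ↔ ∀ i : Fin 3, (H.bas.repr α i).degree < ((n - i : ℕ) : WithBot ℕ) := Iff.rfl

lemma Fil_mono {m n : ℕ} (h : m ≤ n) : H.Fil m ≤ H.Fil n := fun α hα i =>
  (hα i).trans_le (by norm_cast; omega)

lemma mem_Fil_zero {α : R} : α ∈ H.Fil 0 ↔ α = 0 := by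
  refine ⟨fun h => ?_, fun h => h ▸ zero_mem _⟩
  rw [← H.bas.repr.map_eq_zero_iff]
  ext1 i
  have := h i
  rw [Nat.zero_sub, Nat.cast_zero, ← Nat.cast_zero, Nat.cast_zero] at this
  simpa using this

lemma exists_mem_Fil (α : R) : ∃ n, α ∈ H.Fil n := by
  refine ⟨(∑ i : Fin 3, (H.bas.repr α i).natDegree) + 3, fun i => ?_⟩
  refine degree_le_natDegree.trans_lt ?_
  have := Finset.single_le_sum (f := fun i : Fin 3 => (H.bas.repr α i).natDegree)
    (fun _ _ => Nat.zero_le _) (Finset.mem_univ i)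
  have hi := i.2
  norm_cast
  omega

lemma smul_pow_mem_Fil {n : ℕ} (k : ℕ) (a : F[X]) (ha : a.degree < ((n - k : ℕ) : WithBot ℕ)) :
    a • H.ξ ^ k ∈ H.Fil n := by
  induction k using Nat.strong_induction_on generalizing a with
  | _ k ih =>
  by_cases hk : k < 3
  · intro i
    have := H.repr_smul_pow a ⟨k, hk⟩ i
    simp only at this
    rw [this]
    split_ifs with h
    · rw [← h]; exact ha
    · simpa using WithBot.bot_lt_coe _
  · obtain ⟨l, rfl⟩ : ∃ l, k = l + 3 := ⟨k - 3, by omega⟩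
    by_cases ha0 : a = 0
    · simp [ha0]
    rw [pow_add, H.rel, Finset.mul_sum, Finset.smul_sum]
    refine Submodule.sum_mem _ fun i _ => ?_
    rw [mul_smul_comm, ← pow_add, smul_smul]
    have hi := i.2
    refine ih (l + i) (by omega) _ ?_
    by_cases hb : H.b i = 0
    · rw [hb, mul_zero]; exact WithBot.bot_lt_coe _
    have h1 := H.degree_lt i
    rw [degree_eq_natDegree ha0] at ha
    rw [degree_eq_natDegree hb] at h1
    rw [degree_mul, degree_eq_natDegree ha0, degree_eq_natDegree hb]
    norm_cast at ha h1 ⊢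
    omega

lemma mul_mem_Fil {m n : ℕ} {α β : R} (hα : α ∈ H.Fil m) (hβ : β ∈ H.Fil n) :
    α * β ∈ H.Fil (m + n - 1) := by
  rw [H.expand α, H.expand β, Finset.sum_mul_sum]
  refine Submodule.sum_mem _ fun i _ => Submodule.sum_mem _ fun k _ => ?_
  rw [smul_mul_smul_comm, ← pow_add]
  refine H.smul_pow_mem_Fil _ _ ?_
  have h1 := hα i
  have h2 := hβ k
  by_cases ha : H.bas.repr α i = 0
  · rw [ha, zero_mul]; exact WithBot.bot_lt_coe _
  by_cases hb : H.bas.repr β k = 0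
  · rw [hb, mul_zero]; exact WithBot.bot_lt_coe _
  rw [degree_eq_natDegree ha] at h1
  rw [degree_eq_natDegree hb] at h2
  rw [degree_mul, degree_eq_natDegree ha, degree_eq_natDegree hb]
  norm_cast at h1 h2 ⊢
  omega

/-- The coefficient of `X ^ j * ξ ^ i`. -/
noncomputable def coord (i : Fin 3) (j : ℕ) : R →ₗ[F] F where
  toFun α := (H.bas.repr α i).coeff j
  map_add' x y := by simp
  map_smul' x α := by rw [H.repr_smul']; simp

lemma coord_apply (i : Fin 3) (j : ℕ) (α : R) : H.coord i j α = (H.bas.repr α i).coeff j := rfl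

lemma mem_Fil_iff_coord {n : ℕ} {α : R} :
    α ∈ H.Fil n ↔ ∀ (i : Fin 3) (j : ℕ), n ≤ i + j → H.coord i j α = 0 := by
  simp only [mem_Fil, degree_lt_iff_coeff_zero, coord_apply]
  refine forall_congr' fun i => forall_congr' fun j => ?_
  have : n - i ≤ j ↔ n ≤ i + j := by omega
  rw [this]

lemma coord_X_pow_smul (i : Fin 3) (j k : ℕ) (α : R) :
    H.coord i (j + k) ((X ^ k : F[X]) • α) = H.coord i j α := by
  rw [coord_apply, repr_smul, coeff_X_pow_mul, coord_apply]

lemma exists_coord_ne_zero {n : ℕ} {α : R} (h : α ∉ H.Fil n) :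
    ∃ i : Fin 3, ∃ j : ℕ, n ≤ i + j ∧ α ∈ H.Fil (i + j + 1) ∧ H.coord i j α ≠ 0 := by
  classical
  have hex := H.exists_mem_Fil α
  have hm := Nat.find_spec hex
  have hmin := fun m => Nat.find_min hex (m := m)
  generalize Nat.find hex = m at hm hmin
  have hnm : n < m := by
    by_contra! hc
    exact h (H.Fil_mono hc hm)
  obtain ⟨l, rfl⟩ : ∃ l, m = l + 1 := ⟨m - 1, by omega⟩
  have hl := hmin l (Nat.lt_succ_self l)
  rw [mem_Fil_iff_coord] at hl
  push Not at hl
  obtain ⟨i, j, hij, hne⟩ := hl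
  have : (i : ℕ) + j = l := by
    by_contra hc
    exact hne (H.mem_Fil_iff_coord.1 hm i j (by omega))
  exact ⟨i, j, by omega, by rwa [this], hne⟩

/-- Elements with leading term `X ^ D`. -/
def IsMonic (D : ℕ) (α : R) : Prop := α - algebraMap F[X] R (X ^ D) ∈ H.Fil D

lemma coord_isMonic_mul {D : ℕ} {α β : R} (hα : H.IsMonic D α) {i : Fin 3} {j : ℕ}
    (hβ : β ∈ H.Fil (i + j + 1)) : H.coord i (j + D) (α * β) = H.coord i j β := by
  have h : α * β = (X ^ D : F[X]) • β + (α - algebraMap F[X] R (X ^ D)) * β := by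
    rw [Algebra.smul_def]; ring
  rw [h, map_add, coord_X_pow_smul,
    H.mem_Fil_iff_coord.1 (H.mul_mem_Fil hα hβ) i (j + D) (by omega), add_zero]

lemma mem_Fil_of_isMonic_mul {D n : ℕ} {α β : R} (hα : H.IsMonic D α)
    (h : α * β ∈ H.Fil (n + D)) : β ∈ H.Fil n := by
  by_contra hβ
  obtain ⟨i, j, hij, hm, hne⟩ := H.exists_coord_ne_zero hβ
  apply hne
  rw [← H.coord_isMonic_mul hα hm]
  exact H.mem_Fil_iff_coord.1 h i (j + D) (by omega)

lemma IsMonic.ne_zero {D : ℕ} {α : R} (hα : H.IsMonic D α) [Nontrivial R] : α ≠ 0 := by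
  rintro rfl
  have := H.mem_Fil_of_isMonic_mul (n := 0) hα (β := 1) (by simp)
  rw [mem_Fil_zero] at this
  exact one_ne_zero this

lemma repr_algebraMap (a : F[X]) (i : Fin 3) :
    H.bas.repr (algebraMap F[X] R a) i = if i = 0 then a else 0 := by
  have := H.repr_smul_pow a 0 i
  simp only [Fin.val_zero, pow_zero, ← Algebra.algebraMap_eq_smul_one, eq_comm (a := (0 : Fin 3))]
    at this
  exact this

lemma algebraMap_mem_Fil {a : F[X]} {n : ℕ} (h : a.degree < n) : algebraMap F[X] R a ∈ H.Fil n := by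
  intro i
  rw [H.repr_algebraMap]
  split_ifs with hi
  · subst hi; simpa using h
  · simpa using WithBot.bot_lt_coe _

lemma pow_mem_Fil (i : ℕ) : H.ξ ^ i ∈ H.Fil (i + 1) := by
  have := H.smul_pow_mem_Fil (n := i + 1) i 1 (by simp)
  simpa using this

lemma X_pow_smul_mem_Fil {n k : ℕ} {α : R} (h : α ∈ H.Fil n) :
    (X ^ k : F[X]) • α ∈ H.Fil (n + k) := by
  rw [Algebra.smul_def]
  have := H.mul_mem_Fil (H.algebraMap_mem_Fil (a := (X : F[X]) ^ k) (n := k + 1)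
    ((degree_X_pow_le k).trans_lt (by norm_cast; omega))) h
  exact H.Fil_mono (by omega) this

/-- The coordinates identify a filtration step with a product of spaces of polynomials. -/
noncomputable def filEquiv (n : ℕ) : H.Fil n ≃ₗ[F] (i : Fin 3) → degreeLT F (n - i) where
  toFun α i := ⟨H.bas.repr α i, mem_degreeLT.2 (α.2 i)⟩
  map_add' x y := by ext1 i; apply Subtype.ext; simp
  map_smul' x y := by ext1 i; apply Subtype.ext; simp [H.repr_smul']
  invFun p := ⟨H.bas.equivFun.symm fun i => p i, fun i => by
    rw [← H.bas.equivFun_apply, LinearEquiv.apply_symm_apply]; exact mem_degreeLT.1 (p i).2⟩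
  left_inv α := by
    apply Subtype.ext
    exact H.bas.equivFun.symm_apply_apply α
  right_inv p := by
    ext1 i; apply Subtype.ext
    simp only
    rw [← H.bas.equivFun_apply, LinearEquiv.apply_symm_apply]

lemma finrank_degreeLT (n : ℕ) : Module.finrank F (degreeLT F n) = n := by
  rw [(degreeLTEquiv F n).finrank_eq, Module.finrank_fin_fun]

instance finite_degreeLT (n : ℕ) : Module.Finite F (degreeLT F n) :=
  Module.Finite.equiv (degreeLTEquiv F n).symm

instance (n : ℕ) : Module.Finite F (H.Fil n) := Module.Finite.equiv (H.filEquiv n).symm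

lemma finrank_Fil {n : ℕ} (hn : 2 ≤ n) : Module.finrank F (H.Fil n) + 3 = 3 * n := by
  rw [(H.filEquiv n).finrank_eq, Module.finrank_pi_fintype]
  simp only [finrank_degreeLT, Fin.sum_univ_three, Fin.val_zero, Fin.val_one, Fin.val_two]
  omega

end CubicRing

end

section

open Polynomial

namespace CubicRing

variable {F R : Type*} [Field F] [CommRing R] [Algebra F R] [Algebra F[X] R]
  [IsScalarTower F F[X] R] (H : CubicRing F R)

set_option linter.unusedSectionVars false

/-- The combination of the monomials `X ^ j * ξ ^ i` with `j < D`. -/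
noncomputable def box (D : ℕ) : (Fin 3 × Fin D → F) →ₗ[F] R :=
  ∑ t : Fin 3 × Fin D, (LinearMap.proj t).smulRight ((X ^ (t.2 : ℕ) : F[X]) • H.ξ ^ (t.1 : ℕ))

lemma box_apply (D : ℕ) (c : Fin 3 × Fin D → F) :
    H.box D c = ∑ t : Fin 3 × Fin D, c t • (X ^ (t.2 : ℕ) : F[X]) • H.ξ ^ (t.1 : ℕ) := by
  simp [box]

lemma coord_monomial (i k : Fin 3) (j l : ℕ) :
    H.coord i j ((X ^ l : F[X]) • H.ξ ^ (k : ℕ)) = if k = i ∧ j = l then 1 else 0 := by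
  rw [coord_apply, repr_smul_pow]
  split_ifs with h1 h2 h2
  · rw [coeff_X_pow, if_pos h2.2]
  · rw [coeff_X_pow, if_neg (fun h => h2 ⟨h1, h⟩)]
  · exact absurd h2.1 h1
  · simp

lemma coord_box {D : ℕ} (c : Fin 3 × Fin D → F) (i : Fin 3) (j : ℕ) :
    H.coord i j (H.box D c) = if h : j < D then c (i, ⟨j, h⟩) else 0 := by
  classical
  rw [box_apply, map_sum]
  simp only [map_smul, coord_monomial, smul_eq_mul]
  split_ifs with h
  · rw [Finset.sum_eq_single (i, ⟨j, h⟩)]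
    · simp
    · rintro ⟨k, l⟩ - hne
      rw [if_neg, mul_zero]
      rintro ⟨rfl, rfl⟩
      exact hne rfl
    · simp
  · refine Finset.sum_eq_zero fun t _ => ?_
    rw [if_neg, mul_zero]
    rintro ⟨-, rfl⟩
    exact h t.2.2

lemma box_mem_Fil {D : ℕ} (c : Fin 3 × Fin D → F) : H.box D c ∈ H.Fil (D + 2) := by
  rw [mem_Fil_iff_coord]
  intro i j h
  rw [coord_box, dif_neg (by omega)]

lemma ext_coord {α β : R} (h : ∀ i j, H.coord i j α = H.coord i j β) : α = β := by
  apply H.bas.repr.injective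
  ext i j
  exact h i j

/-- Division with remainder by `X ^ D`. -/
lemma exists_eq_box_add {D n : ℕ} {α : R} (hα : α ∈ H.Fil n) :
    ∃ c : Fin 3 × Fin D → F, ∃ β ∈ H.Fil (n - D), α = H.box D c + (X ^ D : F[X]) • β ∧
      ∀ i j, (h : j < D) → c (i, ⟨j, h⟩) = H.coord i j α := by
  refine ⟨fun t => H.coord t.1 t.2 α,
    H.bas.equivFun.symm fun i => divX^[D] (H.bas.repr α i), ?_, ?_, fun i j h => rfl⟩
  all_goals
    have hc : ∀ i j, H.coord i j (H.bas.equivFun.symm fun i => divX^[D] (H.bas.repr α i)) =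
        H.coord i (j + D) α := by
      intro i j
      rw [coord_apply, ← H.bas.equivFun_apply, LinearEquiv.apply_symm_apply, coord_apply]
      generalize H.bas.repr α i = p
      induction D generalizing j p with
      | zero => simp
      | succ D ih => rw [Function.iterate_succ_apply, ih, coeff_divX, add_assoc]
  · rw [mem_Fil_iff_coord]
    intro i j hij
    rw [hc]
    exact H.mem_Fil_iff_coord.1 hα _ _ (by omega)
  · refine H.ext_coord fun i j => ?_
    rw [map_add, coord_box]
    split_ifs with h
    · rw [coord_apply _ _ _ (_ • _), repr_smul, coeff_X_pow_mul', if_neg (by omega), add_zero]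
    · obtain ⟨l, rfl⟩ : ∃ l, j = l + D := ⟨j - D, by omega⟩
      rw [coord_X_pow_smul, hc, zero_add]

lemma isMonic_algebraMap {a : F[X]} (ha : a.Monic) : H.IsMonic a.natDegree (algebraMap F[X] R a) := by
  rw [IsMonic, ← map_sub]
  refine H.algebraMap_mem_Fil ?_
  have h := degree_sub_lt_left (p := a) (q := X ^ a.natDegree) ?_ ha.ne_zero ?_
  · rwa [degree_eq_natDegree ha.ne_zero] at h
  · rw [degree_X_pow, degree_eq_natDegree ha.ne_zero]
  · rw [ha.leadingCoeff, leadingCoeff_X_pow]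

lemma exists_box_sub_mem {D : ℕ} {α : R} (hα : H.IsMonic D α) (β : R) :
    ∃ c : Fin 3 × Fin D → F, H.box D c - β ∈ Ideal.span {α} := by
  obtain ⟨n, hn⟩ := H.exists_mem_Fil β
  induction n using Nat.strong_induction_on generalizing β with
  | _ n ih =>
  obtain ⟨c, γ, hγ, h, -⟩ := H.exists_eq_box_add (D := D) hn
  by_cases hnD : n ≤ D
  · rw [Nat.sub_eq_zero_of_le hnD, mem_Fil_zero] at hγ
    exact ⟨c, by rw [h, hγ]; simp⟩
  · obtain ⟨c', hc'⟩ := ih (n - 1) (by omega) (-((α - algebraMap F[X] R (X ^ D)) * γ))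
      (neg_mem (H.Fil_mono (by omega) (H.mul_mem_Fil hα hγ)))
    refine ⟨c + c', ?_⟩
    have : H.box D (c + c') - β = (H.box D c' - -((α - algebraMap F[X] R (X ^ D)) * γ)) +
        α * (-γ) := by
      rw [map_add, h, Algebra.smul_def]; ring
    rw [this]
    exact add_mem hc' (Ideal.mul_mem_right _ _ (Ideal.mem_span_singleton_self α))

lemma box_eq_zero {D : ℕ} {α : R} (hα : H.IsMonic D α) {c : Fin 3 × Fin D → F}
    (h : H.box D c ∈ Ideal.span {α}) : c = 0 := by
  obtain ⟨β, hβ⟩ := Ideal.mem_span_singleton'.1 h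
  have h0 : β = 0 := by
    by_contra hne
    rw [← H.mem_Fil_zero] at hne
    obtain ⟨i, j, -, hm, hc⟩ := H.exists_coord_ne_zero hne
    apply hc
    rw [← H.coord_isMonic_mul hα hm, mul_comm, hβ, coord_box, dif_neg (by omega)]
  rw [h0, zero_mul] at hβ
  ext ⟨i, j⟩
  have := H.coord_box c i j
  rw [← hβ, dif_pos j.2, map_zero] at this
  exact this.symm

/-- Coordinates on the quotient by an element with leading term `X ^ D`. -/
noncomputable def boxEquiv {D : ℕ} {α : R} (hα : H.IsMonic D α) :
    (Fin 3 × Fin D → F) ≃ₗ[F] R ⧸ Ideal.span {α} :=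
  LinearEquiv.ofBijective ((Ideal.Quotient.mkₐ F (Ideal.span {α})).toLinearMap ∘ₗ H.box D) <| by
    constructor
    · rw [← LinearMap.ker_eq_bot, LinearMap.ker_eq_bot']
      intro c hc
      exact H.box_eq_zero hα (Ideal.Quotient.eq_zero_iff_mem.1 hc)
    · intro y
      obtain ⟨β, rfl⟩ := Ideal.Quotient.mk_surjective y
      obtain ⟨c, hc⟩ := H.exists_box_sub_mem hα β
      exact ⟨c, (Ideal.Quotient.eq.2 hc)⟩

lemma boxEquiv_apply {D : ℕ} {α : R} (hα : H.IsMonic D α) (c : Fin 3 × Fin D → F) :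
    H.boxEquiv hα c = Ideal.Quotient.mk (Ideal.span {α}) (H.box D c) := rfl

lemma finrank_quotient {D : ℕ} {α : R} (hα : H.IsMonic D α) :
    Module.finrank F (R ⧸ Ideal.span {α}) = 3 * D := by
  rw [← (H.boxEquiv hα).finrank_eq]; simp

lemma boxEquiv_symm_mk {D n : ℕ} {α : R} (hα : H.IsMonic (D + 1) α) (i : Fin 3) {β : R}
    (hn : n ≤ D + 1 + i) (hβ : β ∈ H.Fil n) :
    (H.boxEquiv hα).symm (Ideal.Quotient.mk _ β) (i, Fin.last D) = H.coord i D β := by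
  induction n using Nat.strong_induction_on generalizing β with
  | _ n ih =>
  obtain ⟨c, γ, hγ, h, hcoord⟩ := H.exists_eq_box_add (D := D + 1) hβ
  have h1 : Ideal.Quotient.mk (Ideal.span {α}) β = H.boxEquiv hα c -
      Ideal.Quotient.mk (Ideal.span {α}) ((α - algebraMap F[X] R (X ^ (D + 1))) * γ) := by
    rw [boxEquiv_apply, ← map_sub, Ideal.Quotient.eq]
    have : β - (H.box (D + 1) c - (α - algebraMap F[X] R (X ^ (D + 1))) * γ) = α * γ := by
      rw [h, Algebra.smul_def]; ring
    rw [this]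
    exact Ideal.mul_mem_right _ _ (Ideal.mem_span_singleton_self α)
  rw [h1, map_sub, LinearEquiv.symm_apply_apply, Pi.sub_apply, ← hcoord i D (Nat.lt_succ_self D),
    sub_eq_self.2]
  · rfl
  by_cases hnD : n ≤ D + 1
  · rw [Nat.sub_eq_zero_of_le hnD, mem_Fil_zero] at hγ
    simp [hγ]
  · have h2 : (α - algebraMap F[X] R (X ^ (D + 1))) * γ ∈ H.Fil (n - 1) :=
      H.Fil_mono (by omega) (H.mul_mem_Fil hα hγ)
    rw [ih (n - 1) (by omega) (by omega) h2]
    exact H.mem_Fil_iff_coord.1 h2 _ _ (by omega)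

lemma trace_eq (β : R) :
    Algebra.trace F[X] R β = ∑ i : Fin 3, H.bas.repr (β * H.ξ ^ (i : ℕ)) i := by
  classical
  rw [Algebra.trace_eq_matrix_trace H.bas, Matrix.trace]
  simp only [Matrix.diag_apply, Algebra.leftMulMatrix_eq_repr_mul, H.bas_eq]

lemma coeff_trace (β : R) (j : ℕ) :
    (Algebra.trace F[X] R β).coeff j = ∑ i : Fin 3, H.coord i j (β * H.ξ ^ (i : ℕ)) := by
  rw [H.trace_eq, finset_sum_coeff]; rfl

lemma coeff_trace_eq_zero {n j : ℕ} {β : R} (hβ : β ∈ H.Fil n) (h : n ≤ j) :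
    (Algebra.trace F[X] R β).coeff j = 0 := by
  rw [H.coeff_trace]
  refine Finset.sum_eq_zero fun i _ => ?_
  exact H.mem_Fil_iff_coord.1 (H.mul_mem_Fil hβ (H.pow_mem_Fil i)) _ _ (by omega)

lemma trace_quotient {D : ℕ} {α : R} (hα : H.IsMonic (D + 1) α) :
    Algebra.trace F (R ⧸ Ideal.span {α}) (Ideal.Quotient.mk _ (algebraMap F[X] R X)) =
      - (Algebra.trace F[X] R (α - algebraMap F[X] R (X ^ (D + 1)))).coeff D := by
  classical
  have hx : ∀ (i : Fin 3) (k : ℕ), Ideal.Quotient.mk (Ideal.span {α}) (algebraMap F[X] R X) *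
      Ideal.Quotient.mk (Ideal.span {α}) ((X ^ k : F[X]) • H.ξ ^ (i : ℕ)) =
      Ideal.Quotient.mk (Ideal.span {α}) ((X ^ (k + 1) : F[X]) • H.ξ ^ (i : ℕ)) := by
    intro i k
    rw [← map_mul, ← Algebra.smul_def, smul_smul, pow_succ']
  have hs : ∀ t : Fin 3 × Fin (D + 1), H.box (D + 1) (Pi.single t 1) =
      (X ^ (t.2 : ℕ) : F[X]) • H.ξ ^ (t.1 : ℕ) := by
    intro t
    rw [box_apply, Finset.sum_eq_single t]
    · simp
    · intro b _ hb; simp [Pi.single_apply, hb]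
    · simp
  have hmk : ∀ t : Fin 3 × Fin (D + 1), (H.boxEquiv hα).symm (Ideal.Quotient.mk (Ideal.span {α})
      ((X ^ (t.2 : ℕ) : F[X]) • H.ξ ^ (t.1 : ℕ))) = Pi.single t 1 := by
    intro t
    rw [LinearEquiv.symm_apply_eq, boxEquiv_apply, hs]
  rw [Algebra.trace_apply, LinearMap.trace_eq_matrix_trace F (Module.Basis.ofEquivFun (H.boxEquiv hα).symm),
    Matrix.trace, Fintype.sum_prod_type, H.coeff_trace, ← Finset.sum_neg_distrib]
  refine Finset.sum_congr rfl fun i _ => ?_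
  have hd : ∀ j : Fin (D + 1), (LinearMap.toMatrix (Module.Basis.ofEquivFun (H.boxEquiv hα).symm)
      (Module.Basis.ofEquivFun (H.boxEquiv hα).symm) (LinearMap.mul F _ (Ideal.Quotient.mk
        (Ideal.span {α}) (algebraMap F[X] R X)))).diag (i, j) =
      (H.boxEquiv hα).symm (Ideal.Quotient.mk (Ideal.span {α})
        ((X ^ (j + 1 : ℕ) : F[X]) • H.ξ ^ (i : ℕ))) (i, j) := by
    intro j
    rw [Matrix.diag_apply, LinearMap.toMatrix_apply, Module.Basis.ofEquivFun_repr_apply,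
      Module.Basis.coe_ofEquivFun, LinearEquiv.symm_symm]
    beta_reduce
    rw [boxEquiv_apply, hs, LinearMap.mul_apply', hx]
  rw [Fin.sum_univ_castSucc, Finset.sum_eq_zero, zero_add]
  · refine (hd _).trans ?_
    have h1 : Ideal.Quotient.mk (Ideal.span {α}) ((X ^ ((Fin.last D : ℕ) + 1) : F[X]) • H.ξ ^ (i : ℕ)) =
        - Ideal.Quotient.mk (Ideal.span {α})
          ((α - algebraMap F[X] R (X ^ (D + 1))) * H.ξ ^ (i : ℕ)) := by
      rw [← map_neg, Ideal.Quotient.eq, Fin.val_last, Algebra.smul_def]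
      have : algebraMap F[X] R (X ^ (D + 1)) * H.ξ ^ (i : ℕ) -
        -((α - algebraMap F[X] R (X ^ (D + 1))) * H.ξ ^ (i : ℕ)) = α * H.ξ ^ (i : ℕ) := by ring
      rw [this]
      exact Ideal.mul_mem_right _ _ (Ideal.mem_span_singleton_self α)
    rw [h1, map_neg, Pi.neg_apply, H.boxEquiv_symm_mk hα i le_rfl]
    exact H.Fil_mono (by omega) (H.mul_mem_Fil hα (H.pow_mem_Fil i))
  · intro j _
    refine (hd _).trans ?_
    have := hmk (i, j.succ)
    simp only [Fin.val_succ, Fin.val_castSucc] at this ⊢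
    rw [this, Pi.single_apply, if_neg]
    intro h
    have := congrArg (fun t => (t.2 : ℕ)) h
    simp at this

end CubicRing

end

section

open Polynomial

lemma LinearMap.trace_eq_add_of_exact {F U V W : Type*} [Field F] [AddCommGroup U] [Module F U]
    [AddCommGroup V] [Module F V] [AddCommGroup W] [Module F W] [Module.Finite F U]
    [Module.Finite F V] [Module.Finite F W] {f : U →ₗ[F] V} {g : V →ₗ[F] W}
    (hf : Function.Injective f) (hg : Function.Surjective g)
    (hfg : LinearMap.range f = LinearMap.ker g) {TU : Module.End F U} {TV : Module.End F V}
    {TW : Module.End F W} (h1 : ∀ u, TV (f u) = f (TU u)) (h2 : ∀ v, g (TV v) = TW (g v)) :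
    LinearMap.trace F V TV = LinearMap.trace F U TU + LinearMap.trace F W TW := by
  obtain ⟨s, hs⟩ := g.exists_rightInverse_of_surjective (LinearMap.range_eq_top.2 hg)
  have hmem : ∀ v, (LinearMap.id - s ∘ₗ g : V →ₗ[F] V) v ∈ LinearMap.range f := by
    intro v
    rw [hfg, LinearMap.mem_ker, LinearMap.sub_apply, map_sub, LinearMap.comp_apply,
      ← LinearMap.comp_apply g s, hs]
    simp
  set r : V →ₗ[F] U := (LinearEquiv.ofInjective f hf).symm.toLinearMap ∘ₗ
    LinearMap.codRestrict _ _ hmem with hr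
  have hfr : ∀ v, f (r v) = v - s (g v) := by
    intro v
    have := congrArg Subtype.val ((LinearEquiv.ofInjective f hf).apply_symm_apply
      (LinearMap.codRestrict _ _ hmem v))
    rw [LinearEquiv.ofInjective_apply] at this
    exact this
  have hrf : ∀ u, r (f u) = u := by
    intro u
    apply hf
    rw [hfr]
    have : g (f u) = 0 := by
      rw [← LinearMap.mem_ker, ← hfg]; exact LinearMap.mem_range_self f u
    rw [this, map_zero, sub_zero]
  have e : TV = (TV ∘ₗ f) ∘ₗ r + (TV ∘ₗ s) ∘ₗ g := by
    ext v
    simp only [LinearMap.add_apply, LinearMap.comp_apply, hfr, map_sub]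
    abel
  rw [e, map_add, LinearMap.trace_comp_comm', LinearMap.trace_comp_comm' g (TV ∘ₗ s)]
  congr 2
  · ext u
    simp [h1, hrf]
  · ext w
    have : g (s w) = w := LinearMap.congr_fun hs w
    simp [h2, this]

section Quotients

set_option linter.unusedSectionVars false

variable {F R : Type*} [Field F] [CommRing R] [Algebra F R]

/-- The degree of an ideal. -/
noncomputable def Ideal.degree (F : Type*) {R : Type*} [Field F] [CommRing R] [Algebra F R]
    (I : Ideal R) : ℕ := Module.finrank F (R ⧸ I)

/-- The trace of an element on the quotient by an ideal. -/
noncomputable def Ideal.traceMod (F : Type*) {R : Type*} [Field F] [CommRing R] [Algebra F R]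
    (z : R) (I : Ideal R) : F := Algebra.trace F (R ⧸ I) (Ideal.Quotient.mk I z)

variable [IsDedekindDomain R]

lemma Ideal.exists_mem_sub_mul_mem {I P : Ideal R} (hI : I ≠ ⊥) (hP : P ≠ ⊥) [P.IsPrime] :
    ∃ a ∈ I, (∀ x, a * x ∈ I * P ↔ x ∈ P) ∧ ∀ y ∈ I, ∃ x, y - a * x ∈ I * P := by
  have hPm : P.IsMaximal := Ring.DimensionLEOne.maximalOfPrime hP ‹_›
  have hlt : I * P < I := by
    refine lt_of_le_of_ne Ideal.mul_le_left fun h => ?_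
    have : I * P = I * 1 := by rw [h, mul_one]
    exact hPm.ne_top ((mul_left_cancel₀ hI this).trans Ideal.one_eq_top)
  obtain ⟨a, ha, haP⟩ := SetLike.exists_of_lt hlt
  refine ⟨a, ha, fun x => ⟨fun hx => ?_, fun hx => Ideal.mul_mem_mul ha hx⟩, fun y hy => ?_⟩
  · by_contra hxP
    obtain ⟨y, hy⟩ := hPm.exists_inv hxP
    apply haP
    obtain ⟨p, hp, h1⟩ := hy
    have : a = a * x * y + a * p := by rw [mul_assoc, ← mul_add, mul_comm x y, h1, mul_one]
    rw [this]
    exact add_mem (Ideal.mul_mem_right _ _ hx) (Ideal.mul_mem_mul ha hp)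
  · have hle : Ideal.span {a} ⊔ I * P ≤ I :=
      sup_le ((Ideal.span_singleton_le_iff_mem _).2 ha) Ideal.mul_le_left
    obtain ⟨K, hK⟩ := Ideal.dvd_iff_le.2 hle
    have hPK : P ≤ K := by
      have : I * P ≤ I * K := hK ▸ le_sup_right
      rw [← Ideal.dvd_iff_le] at this ⊢
      exact (mul_dvd_mul_iff_left hI).1 this
    by_cases h : K = ⊤
    · rw [h, Ideal.mul_top] at hK
      rw [← hK] at hy
      obtain ⟨x, z, hz, rfl⟩ := Ideal.mem_span_singleton_sup.1 hy
      exact ⟨x, by rw [mul_comm a x, add_sub_cancel_left]; exact hz⟩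
    · exfalso
      rw [← hPm.eq_of_le h hPK] at hK
      apply haP
      rw [← hK]
      exact Ideal.mem_sup_left (Ideal.mem_span_singleton_self a)

lemma Ideal.degree_traceMod_mul_prime {I P : Ideal R} (hI : I ≠ ⊥) (hP : P ≠ ⊥) [P.IsPrime]
    (hfin : ∀ J : Ideal R, J ≠ ⊥ → Module.Finite F (R ⧸ J)) (z : R) :
    (I * P).degree F = I.degree F + P.degree F ∧
      (I * P).traceMod F z = I.traceMod F z + P.traceMod F z := by
  have hIP : I * P ≠ ⊥ := mul_ne_zero hI hP
  have := hfin I hI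
  have := hfin P hP
  have := hfin _ hIP
  obtain ⟨a, ha, h1, h2⟩ := Ideal.exists_mem_sub_mul_mem hI hP
  have hle : I * P ≤ I := Ideal.mul_le_left
  set g : (R ⧸ I * P) →ₗ[F] (R ⧸ I) := (Ideal.Quotient.factorₐ F hle).toLinearMap with hg
  have hgm : ∀ x, g (Ideal.Quotient.mk _ x) = Ideal.Quotient.mk _ x := fun x => rfl
  set f' : R →ₗ[F] (R ⧸ I * P) :=
    (Ideal.Quotient.mkₐ F (I * P)).toLinearMap ∘ₗ LinearMap.mulLeft F a with hf'
  have hf'm : ∀ x, f' x = Ideal.Quotient.mk _ (a * x) := fun x => rfl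
  set f : (R ⧸ P) →ₗ[F] (R ⧸ I * P) := (P.restrictScalars F).liftQ f' (by
    intro x hx
    rw [LinearMap.mem_ker, hf'm, Ideal.Quotient.eq_zero_iff_mem]
    exact (h1 x).2 hx) with hf
  have hfm : ∀ x, f (Ideal.Quotient.mk _ x) = Ideal.Quotient.mk _ (a * x) := fun x => rfl
  have finj : Function.Injective f := by
    rw [← LinearMap.ker_eq_bot, LinearMap.ker_eq_bot']
    intro m hm
    obtain ⟨x, rfl⟩ := Ideal.Quotient.mk_surjective m
    rw [hfm, Ideal.Quotient.eq_zero_iff_mem, h1] at hm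
    rwa [Ideal.Quotient.eq_zero_iff_mem]
  have gsurj : Function.Surjective g := by
    intro m
    obtain ⟨x, rfl⟩ := Ideal.Quotient.mk_surjective m
    exact ⟨Ideal.Quotient.mk _ x, rfl⟩
  have hex : LinearMap.range f = LinearMap.ker g := by
    ext m
    constructor
    · rintro ⟨n, rfl⟩
      obtain ⟨x, rfl⟩ := Ideal.Quotient.mk_surjective n
      rw [LinearMap.mem_ker, hfm, hgm, Ideal.Quotient.eq_zero_iff_mem]
      exact Ideal.mul_mem_right _ _ ha
    · intro hm
      obtain ⟨y, rfl⟩ := Ideal.Quotient.mk_surjective m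
      rw [LinearMap.mem_ker, hgm, Ideal.Quotient.eq_zero_iff_mem] at hm
      obtain ⟨x, hx⟩ := h2 y hm
      exact ⟨Ideal.Quotient.mk _ x, by rw [hfm]; exact (Ideal.Quotient.eq.2 hx).symm⟩
  constructor
  · have := LinearMap.finrank_range_add_finrank_ker g
    rw [LinearMap.range_eq_top.2 gsurj, finrank_top, ← hex, LinearMap.finrank_range_of_inj finj]
      at this
    exact this.symm
  · rw [add_comm]
    refine LinearMap.trace_eq_add_of_exact finj gsurj hex ?_ ?_
    · intro u
      obtain ⟨x, rfl⟩ := Ideal.Quotient.mk_surjective u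
      change Ideal.Quotient.mk (I * P) (z * (a * x)) = Ideal.Quotient.mk (I * P) (a * (z * x))
      congr 1; ring
    · intro v
      obtain ⟨x, rfl⟩ := Ideal.Quotient.mk_surjective v
      rfl

lemma Ideal.degree_traceMod_one (z : R) :
    (1 : Ideal R).degree F = 0 ∧ (1 : Ideal R).traceMod F z = 0 := by
  have : Subsingleton (R ⧸ (1 : Ideal R)) := Ideal.Quotient.subsingleton_iff.2 Ideal.one_eq_top
  refine ⟨Module.finrank_zero_of_subsingleton, ?_⟩
  rw [Ideal.traceMod, Subsingleton.elim (Ideal.Quotient.mk 1 z) 0, map_zero]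

lemma Ideal.degree_traceMod_mul {I J : Ideal R} (hI : I ≠ ⊥) (hJ : J ≠ ⊥)
    (hfin : ∀ J : Ideal R, J ≠ ⊥ → Module.Finite F (R ⧸ J)) (z : R) :
    (I * J).degree F = I.degree F + J.degree F ∧
      (I * J).traceMod F z = I.traceMod F z + J.traceMod F z := by
  induction J using UniqueFactorizationMonoid.induction_on_prime generalizing I with
  | h₁ => exact absurd rfl hJ
  | h₂ J h =>
    rw [Ideal.isUnit_iff.1 h, ← Ideal.one_eq_top, mul_one, (degree_traceMod_one z).1,
      (degree_traceMod_one z).2]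
    exact ⟨rfl, (add_zero _).symm⟩
  | h₃ J P hJ0 hP ih =>
    have hJ0' : P ≠ ⊥ := hP.ne_zero
    have hPp : J ≠ ⊥ := hJ0
    have : P.IsPrime := Ideal.isPrime_of_prime hP
    have h1 := Ideal.degree_traceMod_mul_prime (F := F) hPp hJ0' hfin z
    have h2 := Ideal.degree_traceMod_mul_prime (F := F) hI hJ0' hfin z
    have h3 := ih (I := I * P) (mul_ne_zero hI hJ0') hPp
    rw [← mul_assoc, h3.1, h3.2, h2.1, h2.2, mul_comm P J, h1.1, h1.2]
    exact ⟨by ring, by ring⟩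

end Quotients

namespace CubicRing

variable {F R : Type*} [Field F] [CommRing R] [Algebra F R] [Algebra F[X] R]
  [IsScalarTower F F[X] R] (H : CubicRing F R)

set_option linter.unusedSectionVars false

include H in
lemma finite_quotient [IsDomain R] (I : Ideal R) (hI : I ≠ ⊥) : Module.Finite F (R ⧸ I) := by
  obtain ⟨α, hα, hα0⟩ := Submodule.exists_mem_ne_zero_of_ne_bot hI
  have : Module.Finite F[X] R := Module.Finite.of_basis H.bas
  have hne := Ideal.comap_ne_bot_of_integral_mem (R := F[X]) hα0 hα (Algebra.IsIntegral.isIntegral α)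
  obtain ⟨a, ha, ha0⟩ := Submodule.exists_mem_ne_zero_of_ne_bot hne
  rw [Ideal.mem_comap] at ha
  have hm := H.isMonic_algebraMap (monic_mul_leadingCoeff_inv ha0)
  have := Module.Finite.equiv (H.boxEquiv hm)
  have hle : Ideal.span {algebraMap F[X] R (a * C a.leadingCoeff⁻¹)} ≤ I := by
    rw [Ideal.span_singleton_le_iff_mem, map_mul]
    exact Ideal.mul_mem_right _ _ ha
  exact Module.Finite.of_surjective (Ideal.Quotient.factorₐ F hle).toLinearMap
    (Ideal.Quotient.factor_surjective hle)

include H in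
lemma exists_monic_mem [IsDomain R] {I : Ideal R} (hI : I ≠ ⊥) :
    ∃ a : F[X], a.Monic ∧ a.natDegree = I.degree F ∧ algebraMap F[X] R a ∈ I := by
  have := H.finite_quotient I hI
  set T := Algebra.lmul F (R ⧸ I) (Ideal.Quotient.mk I (algebraMap F[X] R X)) with hT
  refine ⟨T.charpoly, LinearMap.charpoly_monic _, LinearMap.charpoly_natDegree _, ?_⟩
  have h := LinearMap.aeval_self_charpoly T
  rw [hT, aeval_algHom_apply] at h
  have h2 := LinearMap.congr_fun h 1
  rw [Algebra.coe_lmul_eq_mul, LinearMap.mul_apply', mul_one, LinearMap.zero_apply,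
    ← Ideal.Quotient.mkₐ_eq_mk F, aeval_algHom_apply] at h2
  rw [← Ideal.Quotient.eq_zero_iff_mem]
  have h3 : ∀ b : F[X], aeval (algebraMap F[X] R X) b = algebraMap F[X] R b := by
    intro b
    rw [aeval_algebraMap_apply, aeval_X_left_apply]
  rw [h3] at h2
  exact h2

include H in
lemma exists_mem_Fil_sub_mem [IsDomain R] {I : Ideal R} (hI : I ≠ ⊥) (β : R) :
    ∃ γ ∈ H.Fil (I.degree F + 2), γ - β ∈ I := by
  obtain ⟨a, ha, hd, haI⟩ := H.exists_monic_mem hI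
  obtain ⟨c, hc⟩ := H.exists_box_sub_mem (H.isMonic_algebraMap ha) β
  refine ⟨_, by rw [← hd]; exact H.box_mem_Fil c, ?_⟩
  exact (Ideal.span_singleton_le_iff_mem I).2 haI hc

include H in
lemma finite_ideals [IsDomain R] [Finite F] (d : ℕ) :
    {I : Ideal R | I ≠ ⊥ ∧ I.degree F = d}.Finite := by
  have hfin : (H.Fil (d + 2) : Set R).Finite := by
    have : Finite (H.Fil (d + 2)) := Module.finite_of_finite F
    exact Set.toFinite _
  refine (hfin.finite_subsets.image Ideal.span).subset ?_
  rintro I ⟨hI, rfl⟩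
  refine ⟨(I : Set R) ∩ H.Fil (I.degree F + 2), Set.inter_subset_right, ?_⟩
  apply le_antisymm
  · exact Ideal.span_le.2 Set.inter_subset_left
  · intro β hβ
    obtain ⟨a, ha, hd, haI⟩ := H.exists_monic_mem hI
    have ha' : algebraMap F[X] R a ∈ Ideal.span ((I : Set R) ∩ H.Fil (I.degree F + 2)) := by
      refine Ideal.subset_span ⟨haI, H.algebraMap_mem_Fil ?_⟩
      rw [degree_eq_natDegree ha.ne_zero, hd]
      norm_cast; omega
    obtain ⟨c, hc⟩ := H.exists_box_sub_mem (H.isMonic_algebraMap ha) β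
    have h1 : H.box _ c - β ∈ I := (Ideal.span_singleton_le_iff_mem I).2 haI hc
    have h2 := (Ideal.span_singleton_le_iff_mem _).2 ha' hc
    have h3 : H.box _ c ∈ Ideal.span ((I : Set R) ∩ H.Fil (I.degree F + 2)) := by
      refine Ideal.subset_span ⟨?_, by rw [← hd]; exact H.box_mem_Fil c⟩
      have := add_mem h1 hβ
      rwa [sub_add_cancel] at this
    have := sub_mem h3 h2
    rwa [sub_sub_cancel] at this

end CubicRing

end

section

open Polynomial

namespace CubicRing

variable {F R : Type*} [Field F] [CommRing R] [Algebra F R] [Algebra F[X] R]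
  [IsScalarTower F F[X] R] (H : CubicRing F R)

set_option linter.unusedSectionVars false

/-- Reduction modulo an ideal on a filtration step. -/
noncomputable def filMk (n : ℕ) (I : Ideal R) : H.Fil n →ₗ[F] (R ⧸ I) :=
  (Ideal.Quotient.mkₐ F I).toLinearMap ∘ₗ (H.Fil n).subtype

lemma filMk_apply (n : ℕ) (I : Ideal R) (x : H.Fil n) :
    H.filMk n I x = Ideal.Quotient.mk I (x : R) := rfl

lemma finrank_ker_filMk [IsDomain R] {n : ℕ} {I : Ideal R} (hI : I ≠ ⊥)
    (hn : I.degree F + 2 ≤ n) :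
    Module.finrank F (LinearMap.ker (H.filMk n I)) + I.degree F + 3 = 3 * n := by
  have hs : LinearMap.range (H.filMk n I) = ⊤ := by
    rw [LinearMap.range_eq_top]
    intro m
    obtain ⟨β, rfl⟩ := Ideal.Quotient.mk_surjective m
    obtain ⟨γ, hγ, h⟩ := H.exists_mem_Fil_sub_mem hI β
    exact ⟨⟨γ, H.Fil_mono hn hγ⟩, Ideal.Quotient.eq.2 h⟩
  have h := LinearMap.finrank_range_add_finrank_ker (H.filMk n I)
  rw [hs, finrank_top] at h
  have := H.finrank_Fil (n := n) (by omega)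
  rw [← this, ← h, Ideal.degree]; ring

lemma degree_le_of_mem [IsDomain R] {m : ℕ} {J : Ideal R} {η : R} (h0 : η ≠ 0) (hη : η ∈ J)
    (hm : η ∈ H.Fil (m + 1)) : J.degree F ≤ 3 * m := by
  have hJ : J ≠ ⊥ := fun h => h0 (by rwa [h, Ideal.mem_bot] at hη)
  set n := J.degree F + 2 with hn
  have h1 := H.finrank_ker_filMk (n := n + m) hJ (by omega)
  have h2 := H.finrank_Fil (n := n) (by omega)
  set f : H.Fil n →ₗ[F] LinearMap.ker (H.filMk (n + m) J) :=
    LinearMap.codRestrict _ (((LinearMap.mulLeft F η).domRestrict (H.Fil n)).codRestrict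
      (H.Fil (n + m)) fun x => H.Fil_mono (by omega) (H.mul_mem_Fil hm x.2)) fun x => by
        rw [LinearMap.mem_ker, filMk_apply, Ideal.Quotient.eq_zero_iff_mem]
        exact Ideal.mul_mem_right _ _ hη with hf
  have hinj : Function.Injective f := by
    intro x y hxy
    have h : η * (x : R) = η * (y : R) := congrArg (fun t : LinearMap.ker (H.filMk (n + m) J) => ((t : H.Fil (n + m)) : R)) hxy
    exact Subtype.ext (mul_left_cancel₀ h0 h)
  have h3 := LinearMap.finrank_le_finrank_of_injective hinj
  omega

lemma coeff_trace_smul (x : F) (η : R) (j : ℕ) :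
    (Algebra.trace F[X] R (x • η)).coeff j = x * (Algebra.trace F[X] R η).coeff j := by
  rw [← algebraMap_smul F[X] x η, map_smul, smul_eq_mul, algebraMap_eq, coeff_C_mul]

lemma exists_coeff_trace_ne_zero [IsDomain R] (h3 : (3 : F) ≠ 0) {J : Ideal R} {d e : ℕ}
    (hJ : J ≠ ⊥) (hd : 10 ≤ d) (hde : d ≤ e) (hJd : J.degree F + d = 3 * (e + 1)) :
    ∃ η ∈ J, η ∈ H.Fil (e + 1) ∧ (Algebra.trace F[X] R η).coeff e ≠ 0 := by
  by_contra! hcon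
  have := H.finite_quotient J hJ
  obtain ⟨m, hm⟩ : ∃ m, m + 1 = e + 1 - d / 3 := ⟨e - d / 3, by omega⟩
  set f : H.Fil (m + 1) × degreeLT F (e - m) →ₗ[F] (R ⧸ J) :=
    LinearMap.coprod (H.filMk (m + 1) J) ((Ideal.Quotient.mkₐ F J).toLinearMap ∘ₗ
      ((Algebra.linearMap F[X] R).restrictScalars F) ∘ₗ (LinearMap.mulLeft F (X ^ (m + 1))) ∘ₗ
        (degreeLT F (e - m)).subtype) with hf
  have hfm : ∀ t, f t = Ideal.Quotient.mk J ((t.1 : R) + algebraMap F[X] R (X ^ (m + 1) * (t.2 : F[X]))) := by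
    intro t
    rw [map_add]; rfl
  have hinj : Function.Injective f := by
    rw [← LinearMap.ker_eq_bot, LinearMap.ker_eq_bot']
    rintro ⟨⟨α, hα⟩, ⟨p, hp⟩⟩ h
    rw [hfm, Ideal.Quotient.eq_zero_iff_mem] at h
    simp only at h
    have hp0 : p = 0 := by
      by_contra hp0
      rw [mem_degreeLT, degree_eq_natDegree hp0] at hp
      norm_cast at hp
      have hF : α + algebraMap F[X] R (X ^ (m + 1) * p) ∈ H.Fil (m + 1 + p.natDegree + 1) := by
        refine add_mem (H.Fil_mono (by omega) hα) (H.algebraMap_mem_Fil ?_)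
        rw [degree_mul, degree_X_pow, degree_eq_natDegree hp0]
        norm_cast; omega
      have h1 := hcon _ (Ideal.mul_mem_left J (algebraMap F[X] R (X ^ (e - (m + 1 + p.natDegree)))) h)
      rw [← Algebra.smul_def] at h1
      have hF' := H.X_pow_smul_mem_Fil (k := e - (m + 1 + p.natDegree)) hF
      rw [show m + 1 + p.natDegree + 1 + (e - (m + 1 + p.natDegree)) = e + 1 by omega] at hF'
      have h2 := h1 hF'
      rw [map_smul, smul_eq_mul, coeff_X_pow_mul', if_pos (by omega), map_add, coeff_add,
        H.coeff_trace_eq_zero hα (by omega), zero_add, Algebra.trace_algebraMap_of_basis H.bas,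
        Fintype.card_fin, nsmul_eq_mul,
        show e - (e - (m + 1 + p.natDegree)) = p.natDegree + (m + 1) by omega,
        mul_left_comm, mul_comm, coeff_mul_X_pow, ← C_eq_natCast, coeff_C_mul] at h2
      exact mul_ne_zero (by exact_mod_cast h3) (by simpa using hp0) h2
    subst hp0
    rw [mul_zero, map_zero, add_zero] at h
    have hα0 : α = 0 := by
      by_contra hα0
      have := H.degree_le_of_mem hα0 h hα
      omega
    subst hα0
    rfl
  have h1 := LinearMap.finrank_le_finrank_of_injective hinj
  rw [Module.finrank_prod, finrank_degreeLT] at h1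
  have h2 := H.finrank_Fil (n := m + 1) (by omega)
  have h3 : Module.finrank F (R ⧸ J) = J.degree F := rfl
  omega

/-- The value of the character attached to `ψ` on an ideal. -/
noncomputable def chi (ψ : AddChar F ℂ) (I : Ideal R) : ℂ :=
  ψ (I.traceMod F (algebraMap F[X] R X))

lemma chi_ne_zero (ψ : AddChar F ℂ) (I : Ideal R) : chi ψ I ≠ 0 := fun h => by
  have := AddChar.map_add_eq_mul ψ (I.traceMod F (algebraMap F[X] R X))
    (-I.traceMod F (algebraMap F[X] R X))
  rw [add_neg_cancel, AddChar.map_zero_eq_one] at this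
  rw [chi] at h
  rw [h, zero_mul] at this
  exact one_ne_zero this

variable [IsDedekindDomain R]

include H in
lemma chi_mul (ψ : AddChar F ℂ) {I J : Ideal R} (hI : I ≠ ⊥) (hJ : J ≠ ⊥) :
    chi ψ (I * J) = chi ψ I * chi ψ J := by
  rw [chi, (Ideal.degree_traceMod_mul hI hJ H.finite_quotient _).2, AddChar.map_add_eq_mul]; rfl

include H in
lemma degree_mul (I J : Ideal R) (hI : I ≠ ⊥) (hJ : J ≠ ⊥) :
    (I * J).degree F = I.degree F + J.degree F :=
  (Ideal.degree_traceMod_mul hI hJ H.finite_quotient 0).1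

variable [Finite F]

/-- The ideals of a given degree. -/
noncomputable def ideals (d : ℕ) : Finset (Ideal R) := (H.finite_ideals d).toFinset

lemma mem_ideals {d : ℕ} {I : Ideal R} : I ∈ H.ideals d ↔ I ≠ ⊥ ∧ I.degree F = d := by
  simp [ideals]

lemma finite_isMonic (e : ℕ) : {α | H.IsMonic e α}.Finite := by
  have hfin : (H.Fil (e + 1) : Set R).Finite := by
    have : Finite (H.Fil (e + 1)) := Module.finite_of_finite F
    exact Set.toFinite _
  refine hfin.subset fun α hα => ?_
  have h1 : algebraMap F[X] R (X ^ e) ∈ H.Fil (e + 1) :=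
    H.algebraMap_mem_Fil (by rw [degree_X_pow]; norm_cast; omega)
  have := add_mem (H.Fil_mono (Nat.le_succ e) hα) h1
  rwa [sub_add_cancel] at this

/-- The elements with leading term `X ^ e`. -/
noncomputable def monics (e : ℕ) : Finset R := (H.finite_isMonic e).toFinset

lemma mem_monics {e : ℕ} {α : R} : α ∈ H.monics e ↔ H.IsMonic e α := by simp [monics]

open Classical in
lemma card_monics {d e : ℕ} (hde : d + 2 ≤ e) {I : Ideal R} (hI : I ∈ H.ideals d) :
    ((H.monics e).filter (· ∈ I)).card = Nat.card F ^ (3 * e - 3 - d) := by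
  obtain ⟨hI0, hId⟩ := H.mem_ideals.1 hI
  have h1 := H.finrank_ker_filMk (n := e) hI0 (by omega)
  obtain ⟨a, ha, had, haI⟩ := H.exists_monic_mem hI0
  set a' : F[X] := X ^ (e - d) * a with ha'
  have hm : a'.Monic := (monic_X_pow _).mul ha
  have hdeg : a'.natDegree = e := by
    rw [ha', (monic_X_pow _).natDegree_mul ha, natDegree_X_pow]; omega
  have haI' : algebraMap F[X] R a' ∈ I := by
    rw [ha', map_mul]; exact Ideal.mul_mem_left _ _ haI
  have hM := H.isMonic_algebraMap hm
  rw [hdeg] at hM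
  have : Finite (LinearMap.ker (H.filMk e I)) := Module.finite_of_finite F
  have h2 := Module.natCard_eq_pow_finrank (K := F) (V := LinearMap.ker (H.filMk e I))
  rw [show 3 * e - 3 - d = Module.finrank F (LinearMap.ker (H.filMk e I)) by omega, ← h2,
    ← Nat.card_eq_finsetCard]
  refine Nat.card_congr ⟨fun α => ⟨⟨α - algebraMap F[X] R a', ?_⟩, ?_⟩,
    fun κ => ⟨(κ : H.Fil e) + algebraMap F[X] R a', ?_⟩, fun α => ?_, fun κ => ?_⟩
  · have := α.2
    simp only [Finset.mem_filter, mem_monics] at this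
    have h := sub_mem this.1 hM
    rwa [sub_sub_sub_cancel_right] at h
  · have := α.2
    simp only [Finset.mem_filter, mem_monics] at this
    rw [LinearMap.mem_ker, filMk_apply, Ideal.Quotient.eq_zero_iff_mem]
    exact sub_mem this.2 haI'
  · have h := κ.2
    rw [LinearMap.mem_ker, filMk_apply, Ideal.Quotient.eq_zero_iff_mem] at h
    simp only [Finset.mem_filter, mem_monics]
    refine ⟨?_, add_mem h haI'⟩
    rw [IsMonic, add_sub_assoc]
    exact add_mem (κ : H.Fil e).2 hM
  · simp
  · simp

open Classical in
lemma sum_chi_monics (h3 : (3 : F) ≠ 0) {ψ : AddChar F ℂ} (hψ : ψ ≠ 1) {d e : ℕ} (hd : 10 ≤ d)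
    (hde : d ≤ e) {J : Ideal R} (hJ : J ≠ ⊥) (hJd : J.degree F + d = 3 * (e + 1)) :
    ∑ α ∈ (H.monics (e + 1)).filter (· ∈ J), chi ψ (Ideal.span {α}) = 0 := by
  obtain ⟨η, hη, hF, hne⟩ := H.exists_coeff_trace_ne_zero h3 hJ hd hde hJd
  obtain ⟨a, ha⟩ := (AddChar.ne_one_iff).1 hψ
  set c := (Algebra.trace F[X] R η).coeff e with hc
  set κ := (-a / c) • η with hκ
  have hκJ : κ ∈ J := by
    rw [hκ, Algebra.smul_def]; exact Ideal.mul_mem_left _ _ hη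
  have hκF : κ ∈ H.Fil (e + 1) := Submodule.smul_mem _ _ hF
  have hκc : (Algebra.trace F[X] R κ).coeff e = -a := by
    rw [hκ, coeff_trace_smul, ← hc, div_mul_cancel₀ _ hne]
  have hch : ∀ α, H.IsMonic (e + 1) α →
      chi ψ (Ideal.span {α + κ}) = ψ a * chi ψ (Ideal.span {α}) := by
    intro α hα
    have hα' : H.IsMonic (e + 1) (α + κ) := by
      rw [IsMonic, add_sub_right_comm]; exact add_mem hα hκF
    rw [chi, chi, Ideal.traceMod, Ideal.traceMod, H.trace_quotient hα, H.trace_quotient hα',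
      add_sub_right_comm, map_add, coeff_add, hκc, neg_add, neg_neg, AddChar.map_add_eq_mul,
      mul_comm]
  have key : ∑ α ∈ (H.monics (e + 1)).filter (· ∈ J), chi ψ (Ideal.span {α}) =
      ψ a * ∑ α ∈ (H.monics (e + 1)).filter (· ∈ J), chi ψ (Ideal.span {α}) := by
    rw [Finset.mul_sum]
    symm
    refine Finset.sum_nbij' (· + κ) (· - κ) ?_ ?_ ?_ ?_ ?_
    · intro α hα
      rw [Finset.mem_filter, mem_monics] at hα ⊢
      refine ⟨?_, add_mem hα.2 hκJ⟩
      rw [IsMonic, add_sub_right_comm]; exact add_mem hα.1 hκF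
    · intro α hα
      rw [Finset.mem_filter, mem_monics] at hα ⊢
      refine ⟨?_, sub_mem hα.2 hκJ⟩
      rw [IsMonic, sub_right_comm]; exact sub_mem hα.1 hκF
    · intro α _; simp
    · intro α _; simp
    · intro α hα
      rw [Finset.mem_filter, mem_monics] at hα
      exact (hch α hα.1).symm
  have h0 := sub_eq_zero.2 key
  rw [← one_sub_mul] at h0
  exact (mul_eq_zero.1 h0).resolve_left (sub_ne_zero.2 (Ne.symm ha))

open Classical in
/-- The complementary ideal of `I` with respect to an element. -/
noncomputable def compl (t : Ideal R × R) : Ideal R × R :=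
  (if h : t.1 ∣ Ideal.span {t.2} then h.choose else ⊥, t.2)

lemma mul_compl {t : Ideal R × R} (h : t.2 ∈ t.1) : t.1 * (compl t).1 = Ideal.span {t.2} := by
  have h' : t.1 ∣ Ideal.span {t.2} := by rwa [Ideal.dvd_iff_le, Ideal.span_singleton_le_iff_mem]
  rw [compl, dif_pos h']
  exact h'.choose_spec.symm

lemma compl_ne_bot {t : Ideal R × R} (h : t.2 ∈ t.1) (h2 : t.2 ≠ 0) : (compl t).1 ≠ ⊥ := by
  intro h0
  have := mul_compl h
  rw [h0, Ideal.mul_bot, eq_comm, Ideal.span_singleton_eq_bot] at this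
  exact h2 this

lemma mem_compl {t : Ideal R × R} (h : t.2 ∈ t.1) : (compl t).2 ∈ (compl t).1 := by
  have h1 : (compl t).2 = t.2 := rfl
  rw [h1, ← Ideal.span_singleton_le_iff_mem, ← mul_compl h]
  exact Ideal.mul_le_right

lemma compl_compl {t : Ideal R × R} (h : t.2 ∈ t.1) (h2 : t.2 ≠ 0) : compl (compl t) = t := by
  have h3 := mul_compl (mem_compl h)
  have h1 : (compl t).2 = t.2 := rfl
  rw [h1, ← mul_compl h, mul_comm] at h3
  exact Prod.ext (mul_right_cancel₀ (compl_ne_bot h h2) h3) rfl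

open Classical in
theorem sum_chi_eq_zero (h3 : (3 : F) ≠ 0) {ψ : AddChar F ℂ} (hψ : ψ ≠ 1) {d : ℕ} (hd : 10 ≤ d) :
    ∑ I ∈ H.ideals d, chi ψ I = 0 := by
  set e := d + 2 with he
  set d' := 3 * (e + 1) - d with hd'
  have hdeg : ∀ {t : Ideal R × R}, t.1 ≠ ⊥ → H.IsMonic (e + 1) t.2 → t.2 ∈ t.1 →
      t.1.degree F + (compl t).1.degree F = 3 * (e + 1) := by
    intro t ht hm hmem
    rw [← H.degree_mul _ _ ht (compl_ne_bot hmem (hm.ne_zero H)), mul_compl hmem, Ideal.degree,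
      H.finrank_quotient hm]
  have h1 : ∑ I ∈ H.ideals d, ∑ α ∈ (H.monics (e + 1)).filter (· ∈ I), chi ψ I =
      ∑ J ∈ H.ideals d', ∑ α ∈ (H.monics (e + 1)).filter (· ∈ J),
        (chi ψ J)⁻¹ * chi ψ (Ideal.span {α}) := by
    simp only [Finset.sum_filter]
    rw [← Finset.sum_product', ← Finset.sum_product', ← Finset.sum_filter, ← Finset.sum_filter]
    refine Finset.sum_nbij' compl compl ?_ ?_ ?_ ?_ ?_
    all_goals
      intro t ht
      simp only [Finset.mem_filter, Finset.mem_product, mem_ideals, mem_monics] at ht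
      have hdt := hdeg ht.1.1.1 ht.1.2 ht.2
      have hn := ht.1.2.ne_zero H
    · simp only [Finset.mem_filter, Finset.mem_product, mem_ideals, mem_monics]
      exact ⟨⟨⟨compl_ne_bot ht.2 hn, by omega⟩, ht.1.2⟩, mem_compl ht.2⟩
    · simp only [Finset.mem_filter, Finset.mem_product, mem_ideals, mem_monics]
      exact ⟨⟨⟨compl_ne_bot ht.2 hn, by omega⟩, ht.1.2⟩, mem_compl ht.2⟩
    · exact compl_compl ht.2 hn
    · exact compl_compl ht.2 hn
    · have h2 : (compl t).2 = t.2 := rfl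
      rw [h2, ← mul_compl ht.2, H.chi_mul ψ ht.1.1.1 (compl_ne_bot ht.2 hn), mul_comm, mul_assoc,
        mul_inv_cancel₀ (chi_ne_zero _ _), mul_one]
  have h2 : ∑ I ∈ H.ideals d, ∑ α ∈ (H.monics (e + 1)).filter (· ∈ I), chi ψ I =
      (Nat.card F ^ (3 * (e + 1) - 3 - d) : ℂ) * ∑ I ∈ H.ideals d, chi ψ I := by
    rw [Finset.mul_sum]
    refine Finset.sum_congr rfl fun I hI => ?_
    rw [Finset.sum_const, H.card_monics (e := e + 1) (by omega) hI, nsmul_eq_mul, Nat.cast_pow]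
  have h4 : ∑ J ∈ H.ideals d', ∑ α ∈ (H.monics (e + 1)).filter (· ∈ J),
        (chi ψ J)⁻¹ * chi ψ (Ideal.span {α}) = 0 := by
    refine Finset.sum_eq_zero fun J hJ => ?_
    rw [mem_ideals] at hJ
    rw [← Finset.mul_sum, H.sum_chi_monics h3 hψ hd (by omega) hJ.1 (by omega), mul_zero]
  rw [h2, h4] at h1
  have h5 : (Nat.card F : ℂ) ≠ 0 := by exact_mod_cast Nat.card_pos.ne'
  exact (mul_eq_zero.1 h1).resolve_left (pow_ne_zero _ h5)

end CubicRing

end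

section

open Polynomial UniqueFactorizationMonoid

namespace CubicRing

variable {F R : Type*} [Field F] [CommRing R] [Algebra F R] [Algebra F[X] R]
  [IsScalarTower F F[X] R] (H : CubicRing F R) [IsDedekindDomain R] [Finite F]

set_option linter.unusedSectionVars false

open Classical in
/-- The nonzero primes of degree at most `n`. -/
noncomputable def primes (n : ℕ) : Finset (Ideal R) :=
  ((Finset.range (n + 1)).biUnion H.ideals).filter Ideal.IsPrime

lemma mem_primes {n : ℕ} {P : Ideal R} :
    P ∈ H.primes n ↔ P ≠ ⊥ ∧ P.degree F ≤ n ∧ P.IsPrime := by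
  simp only [primes, Finset.mem_filter, Finset.mem_biUnion, Finset.mem_range, mem_ideals]
  constructor
  · rintro ⟨⟨d, hd, h0, rfl⟩, hp⟩
    exact ⟨h0, by omega, hp⟩
  · rintro ⟨h0, hd, hp⟩
    exact ⟨⟨_, by omega, h0, rfl⟩, hp⟩

include H in
lemma degree_pos {P : Ideal R} (h0 : P ≠ ⊥) (hP : P.IsPrime) : 0 < P.degree F := by
  have := H.finite_quotient P h0
  have := Ideal.Quotient.nontrivial_iff.2 hP.ne_top
  exact Module.finrank_pos

include H in
lemma degree_pow {P : Ideal R} (h0 : P ≠ ⊥) (j : ℕ) : (P ^ j).degree F = j * P.degree F := by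
  induction j with
  | zero => rw [pow_zero, (Ideal.degree_traceMod_one (F := F) (0 : R)).1, zero_mul]
  | succ j ih => rw [pow_succ, H.degree_mul _ _ (pow_ne_zero j h0) h0, ih]; ring

include H in
lemma chi_pow (ψ : AddChar F ℂ) {P : Ideal R} (h0 : P ≠ ⊥) (j : ℕ) :
    chi ψ (P ^ j) = chi ψ P ^ j := by
  induction j with
  | zero => rw [pow_zero, pow_zero, chi, (Ideal.degree_traceMod_one (F := F) _).2,
      AddChar.map_zero_eq_one]
  | succ j ih => rw [pow_succ, H.chi_mul ψ (pow_ne_zero j h0) h0, ih, pow_succ]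

include H in
lemma degree_multiset_prod (s : Multiset (Ideal R)) (hs : ∀ P ∈ s, P ≠ ⊥) :
    s.prod.degree F = (s.map fun P => P.degree F).sum := by
  induction s using Multiset.induction_on with
  | empty => simpa using (Ideal.degree_traceMod_one (F := F) (0 : R)).1
  | cons P s ih =>
    rw [Multiset.prod_cons, Multiset.map_cons, Multiset.sum_cons, H.degree_mul,
      ih fun Q hQ => hs Q (Multiset.mem_cons_of_mem hQ)]
    · exact hs P (Multiset.mem_cons_self P s)
    · rw [← Ideal.zero_eq_bot, Ne, Multiset.prod_eq_zero_iff]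
      exact fun h => hs 0 (Multiset.mem_cons_of_mem h) rfl

open Classical in
lemma degree_eq_sum {I : Ideal R} {d : ℕ} (hI : I ∈ H.ideals d) :
    d = ∑ P ∈ H.primes d, ∑ j ∈ (Finset.Icc 1 d).filter (P ^ · ∣ I), P.degree F := by
  obtain ⟨h0, rfl⟩ := H.mem_ideals.1 hI
  have hprime : ∀ P ∈ normalizedFactors I, Prime P := fun P hP => prime_of_normalized_factor P hP
  have hle : ∀ {P : Ideal R} {j : ℕ}, P ≠ ⊥ → P ^ j ∣ I → j * P.degree F ≤ I.degree F := by
    rintro P j hP ⟨J, hJ⟩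
    have hJ0 : J ≠ ⊥ := by
      rintro rfl
      exact h0 (by rw [hJ, Ideal.mul_bot])
    rw [hJ, H.degree_mul _ _ (pow_ne_zero j hP) hJ0, H.degree_pow hP]
    omega
  conv_lhs => rw [← associated_iff_eq.1 (prod_normalizedFactors h0)]
  rw [H.degree_multiset_prod _ fun P hP => (hprime P hP).ne_zero,
    Finset.sum_multiset_map_count]
  have hsub : (normalizedFactors I).toFinset ⊆ H.primes (I.degree F) := by
    intro P hP
    rw [Multiset.mem_toFinset] at hP
    have hp := hprime P hP
    refine H.mem_primes.2 ⟨hp.ne_zero, ?_, Ideal.isPrime_of_prime hp⟩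
    have := hle (j := 1) hp.ne_zero (by rw [pow_one]; exact dvd_of_mem_normalizedFactors hP)
    omega
  rw [Finset.sum_subset hsub]
  · refine Finset.sum_congr rfl fun P hP => ?_
    obtain ⟨hP0, -, hPp⟩ := H.mem_primes.1 hP
    have hirr : Irreducible P := (Ideal.prime_of_isPrime hP0 hPp).irreducible
    rw [Finset.sum_const]
    congr 1
    have hiff : ∀ j, P ^ j ∣ I ↔ j ≤ (normalizedFactors I).count P := by
      intro j
      rw [dvd_iff_normalizedFactors_le_normalizedFactors (pow_ne_zero j hP0) h0,
        normalizedFactors_pow, normalizedFactors_irreducible hirr, normalize_eq,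
        Multiset.nsmul_singleton, Multiset.le_count_iff_replicate_le]
    have hc : (normalizedFactors I).count P ≤ I.degree F := by
      have h1 := hle hP0 ((hiff _).2 le_rfl)
      have h2 := H.degree_pos hP0 hPp
      nlinarith
    have : (Finset.Icc 1 (I.degree F)).filter (P ^ · ∣ I) =
        Finset.Icc 1 ((normalizedFactors I).count P) := by
      ext j
      rw [Finset.mem_filter, Finset.mem_Icc, Finset.mem_Icc, hiff]
      omega
    rw [this, Nat.card_Icc]
    omega
  · intro P _ hP
    rw [Multiset.mem_toFinset] at hP
    rw [Multiset.count_eq_zero_of_notMem hP, zero_smul]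

open Classical in
lemma sum_chi_of_dvd (ψ : AddChar F ℂ) {P : Ideal R} (h0 : P ≠ ⊥) (d j : ℕ) :
    ∑ I ∈ (H.ideals d).filter (P ^ j ∣ ·), chi ψ I = if j * P.degree F ≤ d then
      chi ψ P ^ j * ∑ I ∈ H.ideals (d - j * P.degree F), chi ψ I else 0 := by
  have hpj : P ^ j ≠ ⊥ := pow_ne_zero j h0
  have hdeg : ∀ {J : Ideal R}, P ^ j * J ≠ ⊥ →
      J ≠ ⊥ ∧ (P ^ j * J).degree F = j * P.degree F + J.degree F := by
    intro J h
    have : J ≠ ⊥ := by rintro rfl; exact h (Ideal.mul_bot _)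
    exact ⟨this, by rw [H.degree_mul _ _ hpj this, H.degree_pow h0]⟩
  split_ifs with hjd
  · rw [Finset.mul_sum]
    symm
    refine Finset.sum_nbij (P ^ j * ·) ?_ ?_ ?_ ?_
    · intro J hJ
      rw [mem_ideals] at hJ
      have hne : P ^ j * J ≠ ⊥ := mul_ne_zero hpj hJ.1
      rw [Finset.mem_filter, mem_ideals]
      refine ⟨⟨hne, ?_⟩, dvd_mul_right _ _⟩
      rw [(hdeg hne).2, hJ.2]; omega
    · intro J _ J' _ h
      exact mul_left_cancel₀ hpj h
    · intro I hI
      rw [Finset.mem_coe, Finset.mem_filter, mem_ideals] at hI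
      obtain ⟨⟨hI0, hId⟩, J, rfl⟩ := hI
      have := hdeg hI0
      refine ⟨J, ?_, rfl⟩
      rw [Finset.mem_coe, mem_ideals]
      exact ⟨this.1, by omega⟩
    · intro J hJ
      rw [mem_ideals] at hJ
      rw [H.chi_mul ψ hpj hJ.1, H.chi_pow ψ h0]
  · refine Finset.sum_eq_zero fun I hI => ?_
    exfalso
    rw [Finset.mem_filter, mem_ideals] at hI
    obtain ⟨⟨hI0, hId⟩, J, rfl⟩ := hI
    have := hdeg hI0
    omega

/-- The logarithmic derivative coefficients of the Euler product. -/
noncomputable def powerSum (ψ : AddChar F ℂ) (r : ℕ) : ℂ :=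
  ∑ P ∈ (H.primes r).filter (·.degree F ∣ r), (P.degree F : ℂ) * chi ψ P ^ (r / P.degree F)

open Classical in
theorem mul_sum_chi (ψ : AddChar F ℂ) (d : ℕ) :
    (d : ℂ) * ∑ I ∈ H.ideals d, chi ψ I =
      ∑ r ∈ Finset.Icc 1 d, H.powerSum ψ r * ∑ I ∈ H.ideals (d - r), chi ψ I := by
  have h1 : (d : ℂ) * ∑ I ∈ H.ideals d, chi ψ I = ∑ P ∈ H.primes d, ∑ j ∈ Finset.Icc 1 d,
      (P.degree F : ℂ) * ∑ I ∈ (H.ideals d).filter (P ^ j ∣ ·), chi ψ I := by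
    rw [Finset.mul_sum]
    have : ∀ I ∈ H.ideals d, (d : ℂ) * chi ψ I = ∑ P ∈ H.primes d, ∑ j ∈ Finset.Icc 1 d,
        if P ^ j ∣ I then (P.degree F : ℂ) * chi ψ I else 0 := by
      intro I hI
      conv_lhs => rw [H.degree_eq_sum hI]
      rw [Nat.cast_sum, Finset.sum_mul]
      refine Finset.sum_congr rfl fun P _ => ?_
      rw [Nat.cast_sum, Finset.sum_mul, Finset.sum_filter]
    rw [Finset.sum_congr rfl this, Finset.sum_comm]
    refine Finset.sum_congr rfl fun P _ => ?_
    rw [Finset.sum_comm]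
    refine Finset.sum_congr rfl fun j _ => ?_
    rw [Finset.mul_sum, Finset.sum_filter]
  have h2 : ∀ P ∈ H.primes d, ∑ j ∈ Finset.Icc 1 d,
      (P.degree F : ℂ) * ∑ I ∈ (H.ideals d).filter (P ^ j ∣ ·), chi ψ I =
      ∑ r ∈ (Finset.Icc 1 d).filter (P.degree F ∣ ·), (P.degree F : ℂ) *
        chi ψ P ^ (r / P.degree F) * ∑ I ∈ H.ideals (d - r), chi ψ I := by
    intro P hP
    obtain ⟨hP0, -, hPp⟩ := H.mem_primes.1 hP
    have hpos := H.degree_pos hP0 hPp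
    simp only [H.sum_chi_of_dvd ψ hP0, mul_ite, mul_zero, ← mul_assoc]
    rw [← Finset.sum_filter]
    refine Finset.sum_bij (fun j _ => j * P.degree F) ?_ ?_ ?_ ?_
    · intro j hj
      simp only [Finset.mem_filter, Finset.mem_Icc] at hj ⊢
      exact ⟨⟨Nat.mul_pos (by omega) hpos, hj.2⟩, dvd_mul_left _ _⟩
    · intro j _ j' _ h
      exact Nat.eq_of_mul_eq_mul_right hpos h
    · intro r hr
      simp only [Finset.mem_filter, Finset.mem_Icc] at hr
      obtain ⟨⟨hr1, hr2⟩, j, rfl⟩ := hr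
      have hj : 1 ≤ j := by
        rcases Nat.eq_zero_or_pos j with rfl | h
        · omega
        · exact h
      refine ⟨j, ?_, mul_comm _ _⟩
      simp only [Finset.mem_filter, Finset.mem_Icc]
      refine ⟨⟨hj, ?_⟩, by rwa [mul_comm]⟩
      nlinarith
    · intro j _
      rw [Nat.mul_div_cancel _ hpos]
  rw [h1, Finset.sum_congr rfl h2]
  simp only [Finset.sum_filter]
  rw [Finset.sum_comm]
  refine Finset.sum_congr rfl fun r hr => ?_
  rw [Finset.mem_Icc] at hr
  rw [powerSum, Finset.sum_mul, ← Finset.sum_filter]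
  refine Finset.sum_congr ?_ fun P _ => rfl
  ext P
  rw [Finset.mem_filter, Finset.mem_filter, mem_primes, mem_primes]
  constructor
  · rintro ⟨⟨h0, -, hp⟩, hd⟩
    exact ⟨⟨h0, Nat.le_of_dvd (by omega) hd, hp⟩, hd⟩
  · rintro ⟨⟨h0, hl, hp⟩, hd⟩
    exact ⟨⟨h0, by omega, hp⟩, hd⟩

variable {K : Type*} [Field K] [Algebra F K] [Finite K]

include H in
lemma finite_algHom : Finite (R →ₐ[F] K) := by
  refine Finite.of_injective
    (fun φ : R →ₐ[F] K => (φ (algebraMap F[X] R X), φ H.ξ)) fun φ φ' h => ?_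
  simp only [Prod.mk.injEq] at h
  have hz : φ.comp ((Algebra.ofId F[X] R).restrictScalars F) =
      φ'.comp ((Algebra.ofId F[X] R).restrictScalars F) := by
    apply Polynomial.algHom_ext
    exact h.1
  have hz' : ∀ a, φ (algebraMap F[X] R a) = φ' (algebraMap F[X] R a) := fun a =>
    DFunLike.congr_fun hz a
  ext α
  rw [H.expand α, map_sum, map_sum]
  refine Finset.sum_congr rfl fun i _ => ?_
  rw [Algebra.smul_def, map_mul, map_mul, map_pow, map_pow, hz', h.2]

include H in
lemma ker_ne_bot (φ : R →ₐ[F] K) : RingHom.ker φ ≠ ⊥ := by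
  intro h
  have hinj : Function.Injective φ := (RingHom.injective_iff_ker_eq_bot φ).2 h
  have : Module.Finite F K := inferInstance
  have h1 := LinearMap.finrank_le_finrank_of_injective
    (f := φ.toLinearMap ∘ₗ (H.Fil (Module.finrank F K + 4)).subtype)
    (hinj.comp Subtype.val_injective)
  have h2 := H.finrank_Fil (n := Module.finrank F K + 4) (by omega)
  omega

open Classical in
theorem sum_algHom [Fintype (R →ₐ[F] K)] (ψ : AddChar F ℂ) :
    ∑ φ : R →ₐ[F] K, ψ (Algebra.trace F K (φ (algebraMap F[X] R X))) =
      H.powerSum ψ (Module.finrank F K) := by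
  have hmaps : ∀ φ ∈ (Finset.univ : Finset (R →ₐ[F] K)), RingHom.ker φ ∈
      (H.primes (Module.finrank F K)).filter (·.degree F ∣ Module.finrank F K) := by
    intro φ _
    have hp : (RingHom.ker φ).IsPrime := RingHom.ker_isPrime φ
    have h0 := H.ker_ne_bot φ
    have := Ring.DimensionLEOne.maximalOfPrime h0 hp
    letI := Ideal.Quotient.field (RingHom.ker φ)
    have hdvd : (RingHom.ker φ).degree F ∣ Module.finrank F K :=
      FiniteField.nonempty_algHom_iff_finrank_dvd.1
        ⟨Ideal.Quotient.liftₐ (RingHom.ker φ) φ fun a ha => ha⟩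
    rw [Finset.mem_filter, mem_primes]
    exact ⟨⟨h0, Nat.le_of_dvd Module.finrank_pos hdvd, hp⟩, hdvd⟩
  rw [← Finset.sum_fiberwise_of_maps_to hmaps, powerSum]
  refine Finset.sum_congr rfl fun P hP => ?_
  rw [Finset.mem_filter, mem_primes] at hP
  obtain ⟨⟨h0, -, hp⟩, hdvd⟩ := hP
  have hmax := Ring.DimensionLEOne.maximalOfPrime h0 hp
  letI := Ideal.Quotient.field P
  have hfinP := H.finite_quotient P h0
  have : Finite (R ⧸ P) := Module.finite_of_finite F
  have hcard := FiniteField.natCard_algHom_of_finrank_dvd (F := F) (K := R ⧸ P) (L := K) hdvd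
  have hval : ∀ φ ∈ (Finset.univ : Finset (R →ₐ[F] K)).filter (fun φ => RingHom.ker φ = P),
      ψ (Algebra.trace F K (φ (algebraMap F[X] R X))) =
        chi ψ P ^ (Module.finrank F K / P.degree F) := by
    intro φ hφ
    have hk : RingHom.ker φ = P := (Finset.mem_filter.1 hφ).2
    let g : (R ⧸ P) →ₐ[F] K := Ideal.Quotient.liftₐ P φ fun a ha => by rwa [← hk] at ha
    letI := g.toRingHom.toAlgebra
    have : IsScalarTower F (R ⧸ P) K := IsScalarTower.of_algebraMap_eq fun x => (g.commutes x).symm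
    have h1 : φ (algebraMap F[X] R X) =
      algebraMap (R ⧸ P) K (Ideal.Quotient.mk P (algebraMap F[X] R X)) := rfl
    have : Module.Finite (R ⧸ P) K := Module.Finite.of_restrictScalars_finite F _ _
    have h2 : Module.finrank F K / P.degree F = Module.finrank (R ⧸ P) K := by
      rw [← Module.finrank_mul_finrank F (R ⧸ P) K]
      exact Nat.mul_div_cancel_left _ (H.degree_pos h0 hp)
    rw [h1, ← Algebra.trace_trace (S := R ⧸ P), Algebra.trace_algebraMap, h2, map_nsmul,
      AddChar.map_nsmul_eq_pow]
    rfl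
  rw [Finset.sum_congr rfl hval, Finset.sum_const, nsmul_eq_mul]
  congr 2
  refine Eq.trans ?_ hcard
  rw [← Nat.card_eq_finsetCard]
  refine Nat.card_congr ⟨fun φ => Ideal.Quotient.liftₐ P (φ : R →ₐ[F] K) fun a ha => ?_,
    fun g => ⟨g.comp (Ideal.Quotient.mkₐ F P), ?_⟩, fun φ => ?_, fun g => ?_⟩
  · have hk := (Finset.mem_filter.1 φ.2).2
    rwa [← hk] at ha
  · rw [Finset.mem_filter]
    refine ⟨Finset.mem_univ _, ?_⟩
    ext a
    rw [RingHom.mem_ker, AlgHom.comp_apply, Ideal.Quotient.mkₐ_eq_mk,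
      map_eq_zero_iff g g.toRingHom.injective, Ideal.Quotient.eq_zero_iff_mem]
  · apply Subtype.ext; ext a; rfl
  · apply Ideal.Quotient.algHom_ext; rfl

end CubicRing

end

section

open Polynomial

theorem Multiset.exists_fin_map_eq {α : Type*} {s : Multiset α} {n : ℕ} (h : s.card = n) :
    ∃ ω : Fin n → α, (Finset.univ : Finset (Fin n)).val.map ω = s := by
  subst h
  induction s using Quotient.inductionOn with
  | _ l =>
    refine ⟨l.get, ?_⟩
    rw [Fin.univ_def]
    change ((List.finRange l.length : Multiset _).map l.get) = (l : Multiset α)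
    rw [Multiset.map_coe, List.map_get_finRange]

theorem exists_eq_neg_sum_pow {n : ℕ} {A S : ℕ → ℂ} (hA0 : A 0 = 1) (hA : ∀ d, n < d → A d = 0)
    (hrec : ∀ d : ℕ, (d : ℂ) * A d = ∑ r ∈ Finset.Icc 1 d, S r * A (d - r)) :
    ∃ ω : Fin n → ℂ, ∀ r, 0 < r → S r = -∑ i, ω i ^ r := by
  classical
  set f : ℂ[X] := ∑ j ∈ Finset.range (n + 1), C (A j) * X ^ (n - j) with hf
  have hcoeff : ∀ j ≤ n, f.coeff (n - j) = A j := by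
    intro j hj
    rw [hf, finsetSum_coeff, Finset.sum_eq_single j]
    · simp
    · intro i hi hij
      rw [coeff_C_mul_X_pow, if_neg]
      have := Finset.mem_range.1 hi
      omega
    · intro h; exact absurd (Finset.mem_range.2 (by omega)) h
  have hdeg : f.natDegree ≤ n := by
    refine natDegree_sum_le_of_forall_le _ _ fun j _ => ?_
    exact (natDegree_C_mul_X_pow_le _ _).trans (by omega)
  have hlead : f.coeff n = 1 := by simpa [hA0] using hcoeff 0 (Nat.zero_le _)
  have hnat : f.natDegree = n := le_antisymm hdeg (le_natDegree_of_ne_zero (by rw [hlead]; simp))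
  have hmon : f.Monic := by rw [Monic, leadingCoeff, hnat, hlead]
  have hcard : f.roots.card = n := by rw [← hnat]; exact (IsAlgClosed.card_roots_eq_natDegree (p := f))
  obtain ⟨ω, hω⟩ := Multiset.exists_fin_map_eq hcard
  have hes : ∀ k, A k = (-1) ^ k * MvPolynomial.aeval ω (MvPolynomial.esymm (Fin n) ℂ k) := by
    intro k
    rw [MvPolynomial.aeval_esymm_eq_multiset_esymm, hω]
    by_cases hk : k ≤ n
    · rw [← hcoeff k hk, coeff_eq_esymm_roots_of_card (hcard.trans hnat.symm) (by omega),
        hmon.leadingCoeff, one_mul, hnat, Nat.sub_sub_self hk]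
    · rw [hA k (by omega), Multiset.esymm, Multiset.powersetCard_eq_empty _ (by omega)]
      simp
  refine ⟨ω, fun r => ?_⟩
  induction r using Nat.strong_induction_on with
  | _ k ih =>
    intro hk
    have hN := congrArg (MvPolynomial.aeval ω) (MvPolynomial.mul_esymm_eq_sum (Fin n) ℂ k)
    simp only [_root_.map_mul, map_sum, map_natCast, _root_.map_pow, _root_.map_neg, _root_.map_one] at hN
    have h2 : (k : ℂ) * A k = ∑ r ∈ Finset.Icc 1 k, (-∑ i, ω i ^ r) * A (k - r) := by
      rw [hes k, mul_left_comm, hN, ← mul_assoc, ← pow_add, Finset.mul_sum]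
      have : (-1 : ℂ) ^ (k + (k + 1)) = -1 := Odd.neg_one_pow ⟨k, by ring⟩
      rw [this]
      refine Finset.sum_bij' (fun a _ => a.2) (fun r _ => (k - r, r)) ?_ ?_ ?_ ?_ ?_
      · intro a ha
        simp only [Finset.mem_filter, Finset.HasAntidiagonal.mem_antidiagonal] at ha
        rw [Finset.mem_Icc]; omega
      · intro a ha
        simp only [Finset.mem_filter, Finset.HasAntidiagonal.mem_antidiagonal]
        rw [Finset.mem_Icc] at ha; omega
      · intro a ha
        simp only [Finset.mem_filter, Finset.HasAntidiagonal.mem_antidiagonal] at ha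
        ext <;> simp; omega
      · intro a ha; rfl
      · intro a ha
        simp only [Finset.mem_filter, Finset.HasAntidiagonal.mem_antidiagonal] at ha
        rw [hes, MvPolynomial.psum, map_sum]
        have : k - a.2 = a.1 := by omega
        rw [this]
        simp only [_root_.map_pow, MvPolynomial.aeval_X]
        ring
    obtain ⟨k, rfl⟩ : ∃ j, k = j + 1 := ⟨k - 1, by omega⟩
    rw [hrec, Finset.sum_Icc_succ_top (by omega), Finset.sum_Icc_succ_top (by omega), Nat.sub_self,
      hA0, mul_one, mul_one, Finset.sum_congr rfl fun r hr => by
        rw [ih r (by have := Finset.mem_Icc.1 hr; omega) (by have := Finset.mem_Icc.1 hr; omega)]]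
      at h2
    exact add_left_cancel h2

theorem norm_sq_le_of_sum_pow {ι : Type*} [Fintype ι] (z : ι → ℂ) {B q : ℝ} {μ₀ : ℕ} (hq : 0 < q)
    (h : ∀ μ, μ₀ ≤ μ → ‖∑ i, z i ^ μ‖ ≤ B * q ^ μ) (i : ι) : ‖z i‖ ≤ q := by
  classical
  by_contra! hlt
  set g : ℂ[X] := ∏ γ ∈ (Finset.univ.image z).erase (z i), (X - C γ) with hg
  have hg0 : g.eval (z i) ≠ 0 := by
    rw [hg, eval_prod, Finset.prod_ne_zero_iff]
    intro γ hγ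
    simpa [sub_eq_zero] using (Finset.ne_of_mem_erase hγ).symm
  have hg1 : ∀ j, z j ≠ z i → g.eval (z j) = 0 := by
    intro j hj
    rw [hg, eval_prod, Finset.prod_eq_zero_iff]
    exact ⟨z j, by simp [hj], by simp⟩
  set m := (Finset.univ.filter fun j => z j = z i).card with hm
  have hm0 : m ≠ 0 := by
    rw [hm, Finset.card_ne_zero]; exact ⟨i, by simp⟩
  have key : ∀ μ, ∑ j ∈ Finset.range (g.natDegree + 1), g.coeff j * ∑ l, z l ^ (μ + j) =
      m * g.eval (z i) * z i ^ μ := by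
    intro μ
    calc _ = ∑ l, z l ^ μ * g.eval (z l) := by
          simp_rw [Finset.mul_sum]
          rw [Finset.sum_comm]
          refine Finset.sum_congr rfl fun l _ => ?_
          rw [eval_eq_sum_range, Finset.mul_sum]
          exact Finset.sum_congr rfl fun j _ => by ring
      _ = ∑ l ∈ Finset.univ.filter (fun j => z j = z i), z l ^ μ * g.eval (z l) := by
          rw [Finset.sum_filter_of_ne]
          intro l _ hl
          by_contra hne
          exact hl (by rw [hg1 l hne, mul_zero])
      _ = ∑ l ∈ Finset.univ.filter (fun j => z j = z i), z i ^ μ * g.eval (z i) :=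
          Finset.sum_congr rfl fun l hl => by rw [(Finset.mem_filter.1 hl).2]
      _ = _ := by rw [Finset.sum_const, nsmul_eq_mul]; ring
  set D := ∑ j ∈ Finset.range (g.natDegree + 1), ‖g.coeff j‖ * (B * q ^ j) with hD
  have hbd : ∀ μ, μ₀ ≤ μ → (m * ‖g.eval (z i)‖) * (‖z i‖ / q) ^ μ ≤ D := by
    intro μ hμ
    have h1 : ‖m * g.eval (z i) * z i ^ μ‖ ≤ D * q ^ μ := by
      rw [← key, hD, Finset.sum_mul]
      refine norm_sum_le_of_le _ fun j _ => ?_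
      rw [norm_mul]
      calc _ ≤ ‖g.coeff j‖ * (B * q ^ (μ + j)) := by gcongr; exact h _ (by omega)
        _ = _ := by ring
    rw [norm_mul, norm_mul, norm_pow, Complex.norm_natCast] at h1
    rw [div_pow, ← mul_div_assoc, div_le_iff₀ (by positivity)]
    exact h1
  have hpos : 0 < m * ‖g.eval (z i)‖ := by
    have := norm_pos_iff.2 hg0
    positivity
  obtain ⟨μ, hμ⟩ := pow_unbounded_of_one_lt (D / (m * ‖g.eval (z i)‖)) ((one_lt_div hq).2 hlt)
  have h3 : (‖z i‖ / q) ^ μ ≤ (‖z i‖ / q) ^ (μ + μ₀) :=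
    pow_le_pow_right₀ ((one_lt_div hq).2 hlt).le (by omega)
  have := hbd (μ + μ₀) (by omega)
  rw [div_lt_iff₀ hpos] at hμ
  nlinarith

end

section

open Polynomial

theorem IsDedekindDomain.of_ringEquiv {A B : Type*} [CommRing A] [CommRing B]
    (_ : IsDedekindDomain B)
    (e : A ≃+* B) : IsDedekindDomain A := by
  have : IsDomain A := e.toMulEquiv.isDomain B
  have : IsNoetherianRing A := isNoetherianRing_of_ringEquiv B e.symm
  have := Ring.DimensionLEOne.of_ringEquiv e
  have : IsIntegrallyClosed A := IsIntegrallyClosed.of_equiv e.symm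
  exact { }

section

set_option linter.unusedSectionVars false

variable {A : Type*} [CommRing A] [IsDomain A] [IsPrincipalIdealRing A] {h : A}

lemma isEisensteinAt_X_pow_sub_C (hsq : Squarefree h) {p : A} (hp : Prime p) (hd : p ∣ h) :
    (X ^ 3 - C h : A[X]).IsEisensteinAt (Ideal.span {p}) where
  leading := by
    rw [(monic_X_pow_sub_C h (by norm_num)).leadingCoeff, Ideal.mem_span_singleton]
    exact fun h1 => hp.not_isUnit (isUnit_of_dvd_one h1)
  mem := by
    intro n hn
    rw [natDegree_X_pow_sub_C] at hn
    rw [Ideal.mem_span_singleton, coeff_sub, coeff_X_pow, if_neg (by omega), coeff_C, zero_sub,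
      dvd_neg]
    split_ifs
    · exact hd
    · exact dvd_zero _
  notMem := by
    rw [Ideal.span_singleton_pow, Ideal.mem_span_singleton, coeff_sub, coeff_X_pow,
      if_neg (by omega), coeff_C_zero, zero_sub, dvd_neg, pow_two]
    exact fun h1 => hp.not_isUnit (hsq p h1)

theorem isDedekindDomain_adjoinRoot_X_pow_sub_C (hsq : Squarefree h) (hu : ¬ IsUnit h)
    (h0 : h ≠ 0) (h3 : IsUnit (3 : A)) :
    IsDedekindDomain (AdjoinRoot (X ^ 3 - C h : A[X])) := by
  set g : A[X] := X ^ 3 - C h with hg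
  have hmon : g.Monic := monic_X_pow_sub_C h (by norm_num)
  obtain ⟨p₀, hp₀, hp₀d⟩ := WfDvdMonoid.exists_irreducible_factor hu h0
  have hirr : Irreducible g :=
    (isEisensteinAt_X_pow_sub_C hsq hp₀.prime hp₀d).irreducible
      ((Ideal.span_singleton_prime hp₀.ne_zero).2 hp₀.prime) hmon.isPrimitive
      (by rw [natDegree_X_pow_sub_C]; norm_num)
  let K := FractionRing A
  set gK : K[X] := g.map (algebraMap A K) with hgK
  have hirrK : Irreducible gK := (Monic.irreducible_iff_irreducible_map_fraction_map hmon).1 hirr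
  have hmonK : gK.Monic := hmon.map _
  have : Fact (Irreducible gK) := ⟨hirrK⟩
  let L := AdjoinRoot gK
  let B : PowerBasis K L := AdjoinRoot.powerBasis hirrK.ne_zero
  have hgen : B.gen = AdjoinRoot.root gK := AdjoinRoot.powerBasis_gen _
  have hminK : minpoly K B.gen = gK := AdjoinRoot.minpoly_powerBasis_gen_of_monic hmonK
  have hfin : Module.Finite K L := B.finite
  have hgenInt : IsIntegral A B.gen := by
    refine ⟨g, hmon, ?_⟩
    rw [hgen, IsScalarTower.algebraMap_eq A K L, ← eval₂_map]
    exact AdjoinRoot.eval₂_root gK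
  have hmin : minpoly A B.gen = g := by
    apply map_injective _ (IsFractionRing.injective A K)
    exact (minpoly.isIntegrallyClosed_eq_field_fractions' K hgenInt).symm.trans hminK
  have hgKe : gK = X ^ 3 - C (algebraMap A K h) := by
    rw [hgK, hg]; simp
  have hK0 : algebraMap A K h ≠ 0 := by
    rwa [Ne, IsFractionRing.to_map_eq_zero_iff]
  have hK3 : (3 : K) ≠ 0 := by
    have := h3.map (algebraMap A K)
    rw [map_ofNat] at this
    exact this.ne_zero
  have hsep : gK.Separable := by
    rw [hgKe]
    exact separable_X_pow_sub_C _ (by exact_mod_cast hK3) hK0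
  have hadj : IntermediateField.adjoin K {B.gen} = ⊤ := by
    rw [eq_top_iff]
    intro x _
    have hx : x ∈ Algebra.adjoin K {B.gen} := by rw [B.adjoin_gen_eq_top]; trivial
    exact IntermediateField.algebra_adjoin_le_adjoin K _ hx
  have hLsep : Algebra.IsSeparable K L := by
    rw [← separableClosure.eq_top_iff, eq_top_iff, ← hadj, IntermediateField.adjoin_simple_le_iff,
      mem_separableClosure_iff, IsSeparable, hminK]
    exact hsep
  have hdisc : ∃ u : A, IsUnit u ∧ Algebra.discr K B.basis = algebraMap A K (u * h ^ 2) := by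
    refine ⟨(-1) ^ (Module.finrank K L * (Module.finrank K L - 1) / 2) * 3 ^ Module.finrank K L,
      ((isUnit_one.neg).pow _).mul (h3.pow _), ?_⟩
    have h1 : aeval B.gen (derivative (minpoly K B.gen)) = algebraMap K L 3 * B.gen ^ 2 := by
      have hder : derivative gK = C 3 * X ^ 2 := by
        rw [hgKe, derivative_sub, derivative_C, sub_zero, derivative_X_pow]
        norm_num
      rw [hminK, hder, _root_.map_mul, aeval_C, _root_.map_pow, aeval_X]
    rw [Algebra.discr_powerBasis_eq_norm, h1, _root_.map_mul, _root_.map_pow,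
      Algebra.norm_algebraMap, Algebra.PowerBasis.norm_gen_eq_coeff_zero_minpoly, hminK]
    have h2 : gK.coeff 0 = - algebraMap A K h := by rw [hgKe]; simp
    rw [h2, mul_pow _ (-_) 2, ← pow_mul, mul_comm _ 2, pow_mul, neg_one_sq, one_pow]
    simp only [_root_.map_mul, _root_.map_pow, _root_.map_neg, _root_.map_one, map_ofNat]
    ring
  have hstrip : ∀ a : A, a ∣ h → ∀ z : L, IsIntegral A z → a • z ∈ Algebra.adjoin A {B.gen} →
      z ∈ Algebra.adjoin A {B.gen} := by
    intro a
    induction a using UniqueFactorizationMonoid.induction_on_prime with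
    | h₁ => intro h1; exact absurd (zero_dvd_iff.1 h1) h0
    | h₂ x hx =>
      intro _ z _ hz
      obtain ⟨u, rfl⟩ := hx
      have := Subalgebra.smul_mem _ hz (↑u⁻¹ : A)
      rwa [smul_smul, Units.inv_mul, one_smul] at this
    | h₃ a p ha hp ih =>
      intro hd z hz hz'
      refine ih (dvd_of_mul_left_dvd hd) z hz ?_
      rw [mul_smul] at hz'
      refine mem_adjoin_of_smul_prime_smul_of_minpoly_isEisensteinAt (K := K) hp hgenInt (hz.smul a)
        hz' ?_
      rw [hmin]
      exact isEisensteinAt_X_pow_sub_C hsq hp (dvd_of_mul_right_dvd hd)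
  have hcl : integralClosure A L = Algebra.adjoin A {B.gen} := by
    apply le_antisymm
    · intro z hz
      have hz' : IsIntegral A z := hz
      have h1 := Algebra.discr_mul_isIntegral_mem_adjoin K hgenInt hz'
      obtain ⟨u, ⟨u, rfl⟩, hu⟩ := hdisc
      rw [hu, algebraMap_smul] at h1
      have h2 := Subalgebra.smul_mem _ h1 (↑u⁻¹ : A)
      rw [smul_smul, Units.inv_mul_cancel_left, pow_two, mul_smul] at h2
      exact hstrip h dvd_rfl z hz' (hstrip h dvd_rfl _ (hz'.smul h) h2)
    · exact adjoin_le_integralClosure hgenInt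
  have hD : IsDedekindDomain (Algebra.adjoin A {B.gen}) :=
    (integralClosure.isDedekindDomain A K L).of_ringEquiv
      (Subalgebra.equivOfEq _ _ hcl.symm).toRingEquiv
  have : Module.IsTorsionFree A L := by
    rw [Module.isTorsionFree_iff_algebraMap_injective, IsScalarTower.algebraMap_eq A K L]
    exact (algebraMap K L).injective.comp (IsFractionRing.injective A K)
  have e := (minpoly.equivAdjoin hgenInt).toRingEquiv
  rw [hmin] at e
  exact hD.of_ringEquiv e

end

end

section

open Polynomial

section

variable {F : Type*} [Field F] (c m n : F)

/-- The coefficients of the cubic equation satisfied by `x` over `F[z]`, where `z = m x + n y` and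
`x ^ 3 + y ^ 3 = c`. -/
noncomputable def fermatCoeff : Fin 3 → F[X] :=
  ![C (n ^ 3 - m ^ 3)⁻¹ * (C (n ^ 3 * c) - X ^ 3), C ((n ^ 3 - m ^ 3)⁻¹ * (3 * m)) * X ^ 2,
    C (-(n ^ 3 - m ^ 3)⁻¹ * (3 * m ^ 2)) * X]

/-- The cubic equation satisfied by `x` over `F[z]`, where `z = m x + n y` and
`x ^ 3 + y ^ 3 = c`. -/
noncomputable def fermatPoly : F[X][X] :=
  X ^ 3 - ∑ i : Fin 3, C (fermatCoeff c m n i) * X ^ (i : ℕ)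

lemma fermatPoly_monic : (fermatPoly c m n).Monic := by
  apply monic_X_pow_sub
  refine (degree_sum_le _ _).trans_lt ((Finset.sup_lt_iff (by decide)).2 fun i _ => ?_)
  exact (degree_C_mul_X_pow_le _ _).trans_lt (by exact_mod_cast i.2)

lemma natDegree_fermatPoly : (fermatPoly c m n).natDegree = 3 := by
  apply natDegree_eq_of_degree_eq_some
  rw [fermatPoly, degree_sub_eq_left_of_degree_lt, degree_X_pow]
  rw [degree_X_pow]
  refine (degree_sum_le _ _).trans_lt ((Finset.sup_lt_iff (by decide)).2 fun i _ => ?_)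
  exact (degree_C_mul_X_pow_le _ _).trans_lt (by exact_mod_cast i.2)

/-- The coordinate ring of `x ^ 3 + y ^ 3 = c`, as an algebra over `F[z]` with `z = m x + n y`. -/
abbrev FermatRing := AdjoinRoot (fermatPoly c m n)

lemma eval₂_fermatPoly {S : Type*} [CommRing S] (i : F[X] →+* S) (x : S) :
    eval₂ i x (fermatPoly c m n) = x ^ 3 - i (C (n ^ 3 - m ^ 3)⁻¹) *
      ((i (C n) ^ 3 * i (C c) - i X ^ 3) + 3 * i (C m) * i X ^ 2 * x
        - 3 * i (C m) ^ 2 * i X * x ^ 2) := by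
  simp [fermatPoly, fermatCoeff, Fin.sum_univ_three, -map_inv₀, eval₂_pow,
    show (C (3 : F) : F[X]) = 3 from map_ofNat C 3]
  rw [map_ofNat]
  ring

lemma eval₂_fermatPoly_eq_zero {S : Type*} [CommRing S] (i : F[X] →+* S) {x y : S}
    (h : n ^ 3 - m ^ 3 ≠ 0) (hxy : x ^ 3 + y ^ 3 = i (C c))
    (hz : i X = i (C m) * x + i (C n) * y) : eval₂ i x (fermatPoly c m n) = 0 := by
  have h1 : i (C (n ^ 3 - m ^ 3)⁻¹) * (i (C n) ^ 3 - i (C m) ^ 3) = 1 := by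
    have := congrArg (fun a => i (C a)) (inv_mul_cancel₀ h)
    simpa [-map_inv₀, -inv_mul_cancel₀] using this
  rw [eval₂_fermatPoly, hz, ← hxy]
  linear_combination (-x ^ 3) * h1

lemma eq_of_eval₂_fermatPoly_eq_zero {S : Type*} [CommRing S] (i : F[X] →+* S) {x : S}
    (hn : n ≠ 0) (h : n ^ 3 - m ^ 3 ≠ 0) (hx : eval₂ i x (fermatPoly c m n) = 0) :
    x ^ 3 + (i (C n⁻¹) * (i X - i (C m) * x)) ^ 3 = i (C c) := by
  have h1 : i (C (n ^ 3 - m ^ 3)⁻¹) * (i (C n) ^ 3 - i (C m) ^ 3) = 1 := by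
    have := congrArg (fun a => i (C a)) (inv_mul_cancel₀ h)
    simpa [-map_inv₀, -inv_mul_cancel₀] using this
  have h2 : i (C n⁻¹) * i (C n) = 1 := by
    rw [← _root_.map_mul, ← _root_.map_mul, inv_mul_cancel₀ hn, _root_.map_one, _root_.map_one]
  rw [eval₂_fermatPoly] at hx
  have h3 : (i (C n⁻¹) * i (C n)) ^ 3 = 1 := by rw [h2, one_pow]
  linear_combination (i (C n⁻¹)) ^ 3 * (i (C n) ^ 3 - i (C m) ^ 3) * hx +
    (i (C n⁻¹)) ^ 3 * ((i (C n) ^ 3 * i (C c) - i X ^ 3) + 3 * i (C m) * i X ^ 2 * x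
        - 3 * i (C m) ^ 2 * i X * x ^ 2) * h1 + (i (C c) - x ^ 3) * h3

/-- The coordinate ring of `x ^ 3 + y ^ 3 = c` is a cubic ring. -/
noncomputable def FermatRing.cubicRing : CubicRing F (FermatRing c m n) where
  ξ := AdjoinRoot.root _
  b := fermatCoeff c m n
  bas := (AdjoinRoot.powerBasis' (fermatPoly_monic c m n)).basis.reindex
    (finCongr (natDegree_fermatPoly c m n))
  bas_eq i := by
    rw [Module.Basis.reindex_apply, PowerBasis.basis_eq_pow]
    rfl
  rel := by
    have := AdjoinRoot.eval₂_root (fermatPoly c m n)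
    conv_lhs at this => enter [3]; rw [fermatPoly]
    rw [eval₂_sub, eval₂_X_pow, sub_eq_zero, eval₂_finsetSum] at this
    rw [this]
    refine Finset.sum_congr rfl fun i _ => ?_
    rw [eval₂_mul, eval₂_C, eval₂_X_pow, Algebra.smul_def]
    rfl
  degree_lt i := by
    fin_cases i
    · refine lt_of_le_of_lt (b := ((3 : ℕ) : WithBot ℕ)) ?_ (by norm_num)
      simp only [fermatCoeff]
      dsimp
      compute_degree!
    · refine lt_of_le_of_lt (b := ((2 : ℕ) : WithBot ℕ)) ?_ (by norm_num)
      simp only [fermatCoeff]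
      dsimp
      compute_degree!
    · refine lt_of_le_of_lt (b := ((1 : ℕ) : WithBot ℕ)) ?_ (by norm_num)
      simp only [fermatCoeff]
      dsimp
      compute_degree!

variable {c m n}

theorem FermatRing.isDedekindDomain (h3 : (3 : F) ≠ 0) (hc : c ≠ 0) (hn : n ≠ 0)
    (h : n ^ 3 - m ^ 3 ≠ 0) : IsDedekindDomain (FermatRing c m n) := by
  have hsq : Squarefree (C c - X ^ 3 : F[X]) := by
    have : (X ^ 3 - C c : F[X]).Separable := separable_X_pow_sub_C _ (by exact_mod_cast h3) hc
    have := this.squarefree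
    exact fun x hx => this x (by rwa [← dvd_neg, neg_sub])
  have hdeg : (C c - X ^ 3 : F[X]).degree = 3 := by
    rw [← neg_sub, degree_neg, degree_X_pow_sub_C (by norm_num)]; norm_num
  have h0 : (C c - X ^ 3 : F[X]) ≠ 0 := by
    intro h0; rw [h0] at hdeg; simp at hdeg
  have hu : ¬ IsUnit (C c - X ^ 3 : F[X]) := by
    intro h1; rw [degree_eq_zero_of_isUnit h1] at hdeg; norm_num at hdeg
  have h3' : IsUnit (3 : F[X]) := by
    have := (isUnit_iff_ne_zero.2 h3).map (C : F →+* F[X])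
    rwa [map_ofNat] at this
  refine (isDedekindDomain_adjoinRoot_X_pow_sub_C hsq hu h0 h3').of_ringEquiv ?_
  set g : F[X][X] := X ^ 3 - C (C c - X ^ 3) with hg
  let x₀ : AdjoinRoot g := AdjoinRoot.of g X
  let y₀ : AdjoinRoot g := AdjoinRoot.root g
  have hxy₀ : x₀ ^ 3 + y₀ ^ 3 = algebraMap F _ c := by
    have h1 := AdjoinRoot.eval₂_root g
    have h2 : eval₂ (AdjoinRoot.of g) (AdjoinRoot.root g) g = y₀ ^ 3 - AdjoinRoot.of g (C c - X ^ 3)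
      := by
      conv_lhs => enter [3]; rw [hg]
      simp [y₀, eval₂_pow]
    rw [h2, _root_.map_sub, _root_.map_pow] at h1
    have h4 : algebraMap F (AdjoinRoot g) c = AdjoinRoot.of g (C c) := rfl
    rw [h4]
    linear_combination h1
  let i : F[X] →ₐ[F] AdjoinRoot g := aeval (algebraMap F _ m * x₀ + algebraMap F _ n * y₀)
  let x₁ : FermatRing c m n := AdjoinRoot.root _
  let z₁ : FermatRing c m n := AdjoinRoot.of _ X
  let y₁ : FermatRing c m n := algebraMap F _ n⁻¹ * (z₁ - algebraMap F _ m * x₁)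
  have hxy₁ : x₁ ^ 3 + y₁ ^ 3 = algebraMap F _ c :=
    eq_of_eval₂_fermatPoly_eq_zero c m n (AdjoinRoot.of _) hn h (AdjoinRoot.eval₂_root _)
  have hzn : ∀ {S : Type _} [CommRing S] [Algebra F S] (s : S),
      algebraMap F S n * (algebraMap F S n⁻¹ * s) = s := by
    intro S _ _ s
    rw [← mul_assoc, ← _root_.map_mul, mul_inv_cancel₀ hn, _root_.map_one, one_mul]
  have hzn' : ∀ {S : Type _} [CommRing S] [Algebra F S] (s : S),
      algebraMap F S n⁻¹ * (algebraMap F S n * s) = s := by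
    intro S _ _ s
    rw [← mul_assoc, ← _root_.map_mul, inv_mul_cancel₀ hn, _root_.map_one, one_mul]
  let Φ : FermatRing c m n →ₐ[F] AdjoinRoot g := AdjoinRoot.liftAlgHom _ i x₀ (by
    refine eval₂_fermatPoly_eq_zero (y := y₀) c m n _ h ?_ ?_
    · rw [hxy₀]; exact (i.commutes c).symm
    · have : (i : F[X] →+* AdjoinRoot g) X = algebraMap F _ m * x₀ + algebraMap F _ n * y₀ :=
        aeval_X _
      rw [this]
      congr 2
      · exact (i.commutes m).symm
      · exact (i.commutes n).symm)
  let j : F[X] →ₐ[F] FermatRing c m n := aeval x₁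
  let Ψ : AdjoinRoot g →ₐ[F] FermatRing c m n := AdjoinRoot.liftAlgHom _ j y₁ (by
    have : eval₂ (j : F[X] →+* FermatRing c m n) y₁ g = x₁ ^ 3 + y₁ ^ 3 - algebraMap F _ c := by
      rw [hg]
      simp [j, eval₂_pow]
      ring
    rw [this, hxy₁, sub_self])
  have hΦx : Φ x₁ = x₀ := AdjoinRoot.liftAlgHom_root ..
  have hΦz : Φ z₁ = algebraMap F _ m * x₀ + algebraMap F _ n * y₀ :=
    (AdjoinRoot.liftAlgHom_of ..).trans (aeval_X _)
  have hΨx : Ψ x₀ = x₁ := (AdjoinRoot.liftAlgHom_of ..).trans (aeval_X _)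
  have hΨy : Ψ y₀ = y₁ := AdjoinRoot.liftAlgHom_root ..
  have e : FermatRing c m n ≃ₐ[F] AdjoinRoot g := AlgEquiv.ofAlgHom Φ Ψ
    (by
      apply AdjoinRoot.algHom_ext'
      · apply Polynomial.algHom_ext
        change Φ (Ψ x₀) = x₀
        rw [hΨx, hΦx]
      · change Φ (Ψ y₀) = y₀
        rw [hΨy, _root_.map_mul, _root_.map_sub, _root_.map_mul, hΦx, hΦz, AlgHom.commutes,
          AlgHom.commutes, add_sub_cancel_left, hzn'])
    (by
      apply AdjoinRoot.algHom_ext'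
      · apply Polynomial.algHom_ext
        change Ψ (Φ z₁) = z₁
        rw [hΦz, _root_.map_add, _root_.map_mul, _root_.map_mul, hΨx, hΨy, AlgHom.commutes,
          AlgHom.commutes, hzn]
        ring
      · change Ψ (Φ x₁) = x₁
        rw [hΦx, hΨx])
  exact e.toRingEquiv

/-- Points of `x ^ 3 + y ^ 3 = c` are homomorphisms from the coordinate ring. -/
theorem FermatRing.sum_algHom_eq_sum_points {K : Type*} [Field K] [Algebra F K] [Fintype K]
    [DecidableEq K] [Fintype (FermatRing c m n →ₐ[F] K)] (hn : n ≠ 0) (h : n ^ 3 - m ^ 3 ≠ 0)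
    {M : Type*} [AddCommMonoid M] (f : K → M) :
    ∑ φ : FermatRing c m n →ₐ[F] K, f (φ (algebraMap F[X] _ X)) =
      ∑ P ∈ Finset.univ.filter fun P : K × K => P.1 ^ 3 + P.2 ^ 3 = algebraMap F K c,
        f (algebraMap F K m * P.1 + algebraMap F K n * P.2) := by
  have hn' : algebraMap F K n ≠ 0 := by simpa using hn
  have hex : ∀ P : K × K, P.1 ^ 3 + P.2 ^ 3 = algebraMap F K c →
      eval₂ ((aeval (algebraMap F K m * P.1 + algebraMap F K n * P.2) : F[X] →ₐ[F] K) : F[X] →+* K)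
        P.1 (fermatPoly c m n) = 0 := by
    intro P hP
    refine eval₂_fermatPoly_eq_zero (y := P.2) c m n _ h ?_ ?_
    · rw [hP]; simp
    · simp
  have hcurve : ∀ φ : FermatRing c m n →ₐ[F] K, φ (AdjoinRoot.root _) ^ 3 +
      ((algebraMap F K n)⁻¹ * (φ (algebraMap F[X] _ X) - algebraMap F K m *
        φ (AdjoinRoot.root _))) ^ 3 = algebraMap F K c := by
    intro φ
    have h1 := eq_of_eval₂_fermatPoly_eq_zero c m n (AdjoinRoot.of _) hn h
      (AdjoinRoot.eval₂_root (fermatPoly c m n))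
    have h2 := congrArg φ h1
    have hcomm : ∀ a : F, φ (AdjoinRoot.of _ (C a)) = algebraMap F K a := fun a => φ.commutes a
    rw [_root_.map_add, _root_.map_pow, _root_.map_pow, _root_.map_mul, _root_.map_sub,
      _root_.map_mul, hcomm, hcomm, hcomm, map_inv₀] at h2
    exact h2
  have hX : ∀ P : K × K, ∀ hh, AdjoinRoot.liftAlgHom (fermatPoly c m n)
      (aeval (algebraMap F K m * P.1 + algebraMap F K n * P.2) : F[X] →ₐ[F] K)
      P.1 hh (algebraMap F[X] _ X) = algebraMap F K m * P.1 + algebraMap F K n * P.2 := fun P hh =>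
    (AdjoinRoot.liftAlgHom_of ..).trans (aeval_X _)
  refine Finset.sum_bij' (fun φ _ => (φ (AdjoinRoot.root _),
      (algebraMap F K n)⁻¹ * (φ (algebraMap F[X] _ X) - algebraMap F K m * φ (AdjoinRoot.root _))))
    (fun P hP => AdjoinRoot.liftAlgHom _ (aeval (algebraMap F K m * P.1 + algebraMap F K n * P.2))
      P.1 (hex P (Finset.mem_filter.1 hP).2)) ?_ ?_ ?_ ?_ ?_
  · intro φ _
    rw [Finset.mem_filter]
    exact ⟨Finset.mem_univ _, hcurve φ⟩
  · intro P hP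
    exact Finset.mem_univ _
  · intro φ _
    apply AdjoinRoot.algHom_ext'
    · apply Polynomial.algHom_ext
      refine (hX _ (hex _ (hcurve φ))).trans ?_
      change _ = φ (algebraMap F[X] _ X)
      rw [mul_inv_cancel_left₀ hn']
      ring
    · rw [AdjoinRoot.liftAlgHom_root]
  · intro P hP
    simp only [hX, AdjoinRoot.liftAlgHom_root]
    ext
    · rfl
    · simp only
      field_simp
      ring
  · intro φ _
    rw [mul_inv_cancel_left₀ hn']
    congr 1
    ring

end

end

section

open Polynomial

section

variable {F R : Type*} [Field F] [CommRing R] [Algebra F R] [Algebra F[X] R]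
  [IsScalarTower F F[X] R] (H : CubicRing F R) [IsDedekindDomain R] [Finite F]

lemma CubicRing.sum_ideals_zero (ψ : AddChar F ℂ) : ∑ I ∈ H.ideals 0, chi ψ I = 1 := by
  have : H.ideals 0 = {1} := by
    ext I
    rw [H.mem_ideals, Finset.mem_singleton]
    constructor
    · rintro ⟨h0, hd⟩
      by_contra h1
      rw [Ideal.one_eq_top] at h1
      replace h1 : I ≠ ⊤ := h1
      have := H.finite_quotient I h0
      have := Ideal.Quotient.nontrivial_iff.2 h1
      have := Module.finrank_pos (R := F) (M := R ⧸ I)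
      exact this.ne' hd
    · rintro rfl
      exact ⟨one_ne_zero, (Ideal.degree_traceMod_one (F := F) (0 : R)).1⟩
  rw [this, Finset.sum_singleton, chi, (Ideal.degree_traceMod_one (F := F) _).2,
    AddChar.map_zero_eq_one]

theorem CubicRing.norm_powerSum_one_le (h3 : (3 : F) ≠ 0) {ψ : AddChar F ℂ} (hψ : ψ ≠ 1)
    {B q : ℝ} {μ₀ : ℕ} (hq : 0 < q) (h : ∀ μ, μ₀ ≤ μ → ‖H.powerSum ψ (2 * μ)‖ ≤ B * q ^ μ) :
    ‖H.powerSum ψ 1‖ ≤ 9 * √q := by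
  obtain ⟨ω, hω⟩ := exists_eq_neg_sum_pow (n := 9) (A := fun d => ∑ I ∈ H.ideals d, chi ψ I)
    (S := H.powerSum ψ) (H.sum_ideals_zero ψ) (fun d hd => H.sum_chi_eq_zero h3 hψ hd)
    (H.mul_sum_chi ψ)
  have h1 : ∀ i, ‖ω i ^ 2‖ ≤ q := by
    refine norm_sq_le_of_sum_pow (fun i => ω i ^ 2) (B := B) (μ₀ := μ₀ + 1) hq fun μ hμ => ?_
    have h2 := h μ (by omega)
    rw [hω _ (by omega), norm_neg] at h2
    simpa only [pow_mul] using h2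
  rw [hω 1 one_pos, norm_neg]
  calc _ ≤ ∑ i : Fin 9, √q := norm_sum_le_of_le _ fun i _ => by
        rw [pow_one]
        apply Real.le_sqrt_of_sq_le
        rw [← norm_pow]; exact h1 i
    _ = _ := by simp

end

/-- A rational parametrisation change: points of `x ^ 3 + y ^ 3 = c` in Weierstrass form. -/
lemma sum_fermat_eq_sum_weierstrass {K M : Type*} [Field K] [Fintype K] [DecidableEq K]
    [AddCommMonoid M] (h2 : (2 : K) ≠ 0) (h3 : (3 : K) ≠ 0) {c : K} (hc : c ≠ 0) (m n : K)
    (f : K → M) :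
    ∑ P ∈ Finset.univ.filter (fun P : K × K => P.1 ^ 3 + P.2 ^ 3 = c), f (m * P.1 + n * P.2) =
      ∑ P ∈ Finset.univ.filter (fun P : K × K => P.1 ≠ 0 ∧
        P.2 ^ 2 = (C (4 * c / 3) * X ^ 3 - C (1 / 3) : K[X]).eval P.1),
        f (((m + n) / 2 + (m - n) / 2 * P.2) / P.1) := by
  have hs : ∀ P : K × K, P.1 ^ 3 + P.2 ^ 3 = c → P.1 + P.2 ≠ 0 := by
    intro P hP h0
    apply hc
    rw [← hP, eq_neg_of_add_eq_zero_left h0]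
    ring
  refine Finset.sum_bij' (fun P _ => (1 / (P.1 + P.2), (P.1 - P.2) / (P.1 + P.2)))
    (fun P _ => ((1 + P.2) / (2 * P.1), (1 - P.2) / (2 * P.1))) ?_ ?_ ?_ ?_ ?_
  · intro P hP
    have hP := (Finset.mem_filter.1 hP).2
    have := hs P hP
    rw [Finset.mem_filter]
    refine ⟨Finset.mem_univ _, one_div_ne_zero this, ?_⟩
    simp only [eval_sub, eval_mul, eval_C, eval_pow, eval_X]
    rw [← hP]
    field_simp
    ring
  · intro P hP
    obtain ⟨h0, hP⟩ := (Finset.mem_filter.1 hP).2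
    rw [Finset.mem_filter]
    refine ⟨Finset.mem_univ _, ?_⟩
    simp only [eval_sub, eval_mul, eval_C, eval_pow, eval_X] at hP
    field_simp at hP ⊢
    linear_combination 2 * hP
  · intro P hP
    have := hs P (Finset.mem_filter.1 hP).2
    ext
    · field_simp; ring
    · field_simp; ring
  · intro P hP
    obtain ⟨h0, hP⟩ := (Finset.mem_filter.1 hP).2
    have : (1 + P.2) / (2 * P.1) + (1 - P.2) / (2 * P.1) = 1 / P.1 := by field_simp; ring
    ext
    · simp only [this]; field_simp
    · simp only [this]; field_simp; ring
  · intro P hP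
    have := hs P (Finset.mem_filter.1 hP).2
    congr 1
    field_simp
    ring

theorem norm_sum_fermat_le_aux {p : ℕ} [Fact p.Prime] (hp : 3 < p) {c m n : ZMod p} (hc : c ≠ 0)
    (hn : n ≠ 0) (h : n ^ 3 - m ^ 3 ≠ 0) {ψ : AddChar (ZMod p) ℂ} (hψ : ψ ≠ 1) :
    ‖∑ P ∈ Finset.univ.filter (fun P : ZMod p × ZMod p => P.1 ^ 3 + P.2 ^ 3 = c),
      ψ (m * P.1 + n * P.2)‖ ≤ 9 * √p := by
  have h2 : (2 : ZMod p) ≠ 0 := by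
    have : ((2 : ℕ) : ZMod p) ≠ 0 := by
      rw [Ne, ZMod.natCast_eq_zero_iff]; intro hd; have := Nat.le_of_dvd (by norm_num) hd; omega
    exact_mod_cast this
  have h3 : (3 : ZMod p) ≠ 0 := by
    have : ((3 : ℕ) : ZMod p) ≠ 0 := by
      rw [Ne, ZMod.natCast_eq_zero_iff]; intro hd; have := Nat.le_of_dvd (by norm_num) hd; omega
    exact_mod_cast this
  have hD := FermatRing.isDedekindDomain h3 hc hn h
  set H := FermatRing.cubicRing c m n
  have hps : ∀ (K : Type) [Field K] [Fintype K] [DecidableEq K] [Algebra (ZMod p) K],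
      ∑ P ∈ Finset.univ.filter (fun P : K × K => P.1 ^ 3 + P.2 ^ 3 = algebraMap (ZMod p) K c),
        ψ (Algebra.trace (ZMod p) K (algebraMap _ K m * P.1 + algebraMap _ K n * P.2)) =
      H.powerSum ψ (Module.finrank (ZMod p) K) := by
    intro K _ _ _ _
    have := H.finite_algHom (K := K)
    have := Fintype.ofFinite (FermatRing c m n →ₐ[ZMod p] K)
    rw [← H.sum_algHom ψ]
    exact (FermatRing.sum_algHom_eq_sum_points hn h
      (fun z => ψ (Algebra.trace (ZMod p) K z))).symm
  have h1 : ∑ P ∈ Finset.univ.filter (fun P : ZMod p × ZMod p => P.1 ^ 3 + P.2 ^ 3 = c),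
      ψ (m * P.1 + n * P.2) = H.powerSum ψ 1 := by
    have := hps (ZMod p)
    rw [Module.finrank_self] at this
    rw [← this]
    simp
  rw [h1]
  obtain ⟨μ₀, hμ₀⟩ := pow_unbounded_of_one_lt
    ((PoleOrder.asConductor p + 2) * (PoleOrder.asConductor p + 1) + PoleOrder.asConductor p)
    (show 1 < p by omega)
  refine H.norm_powerSum_one_le h3 hψ (B := 3 * PoleOrder.asConductor p + 24) (μ₀ := μ₀ + 1)
    (by exact_mod_cast (show 0 < p by omega)) fun μ hμ => ?_
  classical
  let K := GaloisField p (2 * μ)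
  have : Fintype K := Fintype.ofFinite K
  have hfr : Module.finrank (ZMod p) K = 2 * μ := GaloisField.finrank p (by omega)
  have hinj := (algebraMap (ZMod p) K).injective
  have h2K : (2 : K) ≠ 0 := by
    rw [← map_ofNat (algebraMap (ZMod p) K) 2]; exact (map_ne_zero_iff _ hinj).2 h2
  have h3K : (3 : K) ≠ 0 := by
    rw [← map_ofNat (algebraMap (ZMod p) K) 3]; exact (map_ne_zero_iff _ hinj).2 h3
  have hcK : algebraMap (ZMod p) K c ≠ 0 := (map_ne_zero_iff _ hinj).2 hc
  have hcard : Fintype.card K = (p ^ μ) ^ 2 := by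
    rw [← Nat.card_eq_fintype_card, GaloisField.card p _ (by omega), ← pow_mul, mul_comm]
  rw [← hfr, ← hps K, sum_fermat_eq_sum_weierstrass h2K h3K hcK _ _
    (fun z => ψ (Algebra.trace (ZMod p) K z))]
  have h4 : (4 : K) ≠ 0 := by
    have : (4 : K) = 2 * 2 := by norm_num
    rw [this]; exact mul_ne_zero h2K h2K
  refine PoleOrder.norm_sum_le (by omega) ?_ _ ?_ hcard ?_ hψ
  · rw [degree_sub_eq_left_of_degree_lt, degree_C_mul_X_pow]
    · rfl
    · positivity
    · rw [degree_C_mul_X_pow _ (by positivity)]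
      exact degree_C_le.trans_lt (by norm_num)
  · refine div_ne_zero ?_ h2K
    rw [sub_ne_zero]
    intro hmn
    exact h (by rw [hinj hmn, sub_self])
  · have : p ^ μ₀ ≤ p ^ μ := Nat.pow_le_pow_right (by omega) (by omega)
    omega

/-- **Weil bound** for exponential sums over the curve `x ^ 3 + y ^ 3 = c`. -/
theorem norm_sum_fermat_le {p : ℕ} [Fact p.Prime] (hp : 3 < p) {c m n : ZMod p} (hc : c ≠ 0)
    (h : m ^ 3 ≠ n ^ 3) {ψ : AddChar (ZMod p) ℂ} (hψ : ψ ≠ 1) :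
    ‖∑ P ∈ Finset.univ.filter (fun P : ZMod p × ZMod p => P.1 ^ 3 + P.2 ^ 3 = c),
      ψ (m * P.1 + n * P.2)‖ ≤ 9 * √p := by
  by_cases hn : n = 0
  · have hm : m ≠ 0 := by rintro rfl; exact h (by rw [hn])
    have hnm : m ^ 3 - n ^ 3 ≠ 0 := sub_ne_zero.2 h
    refine le_of_eq_of_le (congrArg norm ?_) (norm_sum_fermat_le_aux hp hc hm hnm hψ)
    refine Finset.sum_nbij' Prod.swap Prod.swap ?_ ?_ ?_ ?_ ?_ <;> intro P hP
    · simpa [add_comm] using hP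
    · simpa [add_comm] using hP
    · simp
    · simp
    · simp [add_comm]
  · exact norm_sum_fermat_le_aux hp hc hn (sub_ne_zero.2 h.symm) hψ

end

theorem add_one_le_mul_rpow {δ : ℝ} (hδ : 0 < δ) {p : ℕ} (hp : 2 ≤ p) (e : ℕ) :
    ((e : ℝ) + 1) ≤ (1 + 1 / (δ * Real.log 2)) * ((p : ℝ) ^ e) ^ δ := by
  have hl : 0 < Real.log 2 := Real.log_pos (by norm_num)
  have hc : 0 < δ * Real.log 2 := mul_pos hδ hl
  have h1 : 1 + e * (δ * Real.log 2) ≤ ((p : ℝ) ^ e) ^ δ := by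
    calc 1 + e * (δ * Real.log 2) ≤ Real.exp (e * (δ * Real.log 2)) := by
          linarith [Real.add_one_le_exp (e * (δ * Real.log 2))]
      _ = ((2 : ℝ) ^ e) ^ δ := by
          rw [Real.rpow_def_of_pos (by positivity), Real.log_pow]
          ring_nf
      _ ≤ _ := by
          have : (2 : ℝ) ≤ p := by exact_mod_cast hp
          gcongr
  have h2 : (1 + 1 / (δ * Real.log 2)) * (1 + e * (δ * Real.log 2)) =
      e + 1 + e * (δ * Real.log 2) + 1 / (δ * Real.log 2) := by
    field_simp
    ring
  have h3 : 0 < 1 / (δ * Real.log 2) := by positivity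
  have h4 : 0 ≤ (e : ℝ) * (δ * Real.log 2) := by positivity
  calc ((e : ℝ) + 1) ≤ (1 + 1 / (δ * Real.log 2)) * (1 + e * (δ * Real.log 2)) := by
        rw [h2]; linarith
    _ ≤ _ := by gcongr

theorem exists_card_divisors_le_rpow {δ : ℝ} (hδ : 0 < δ) :
    ∃ C : ℝ, 1 ≤ C ∧ ∀ n : ℕ, n ≠ 0 → (n.divisors.card : ℝ) ≤ C * (n : ℝ) ^ δ := by
  have hl : 0 < Real.log 2 := Real.log_pos (by norm_num)
  set K : ℝ := 1 + 1 / (δ * Real.log 2) with hK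
  have hK1 : 1 ≤ K := by
    have : 0 < 1 / (δ * Real.log 2) := by positivity
    linarith
  set B : ℕ := ⌈(2 : ℝ) ^ (1 / δ)⌉₊ with hB
  refine ⟨K ^ B, one_le_pow₀ hK1, fun n hn => ?_⟩
  rw [Nat.card_divisors hn]
  push_cast
  have key : ∀ p ∈ n.primeFactors, ((n.factorization p : ℝ) + 1) ≤
      (if p < B then K else 1) * ((p : ℝ) ^ n.factorization p) ^ δ := by
    intro p hp
    have hp2 := (Nat.prime_of_mem_primeFactors hp).two_le
    split_ifs with h
    · exact add_one_le_mul_rpow hδ hp2 _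
    · push Not at h
      have h1 : (2 : ℝ) ^ (1 / δ) ≤ p := (Nat.le_ceil _).trans (by exact_mod_cast h)
      have h2 : (2 : ℝ) ≤ (p : ℝ) ^ δ := by
        calc (2 : ℝ) = ((2 : ℝ) ^ (1 / δ)) ^ δ := by
              rw [← Real.rpow_mul (by norm_num), one_div_mul_cancel hδ.ne', Real.rpow_one]
          _ ≤ _ := by gcongr
      rw [one_mul, ← Real.rpow_natCast, ← Real.rpow_mul (by positivity), mul_comm,
        Real.rpow_mul (by positivity), Real.rpow_natCast]
      calc ((n.factorization p : ℝ) + 1) ≤ 2 ^ (n.factorization p) := by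
            exact_mod_cast Nat.lt_two_pow_self
        _ ≤ _ := by gcongr
  calc ∏ p ∈ n.primeFactors, ((n.factorization p : ℝ) + 1)
      ≤ ∏ p ∈ n.primeFactors, ((if p < B then K else 1) * ((p : ℝ) ^ n.factorization p) ^ δ) :=
        Finset.prod_le_prod (fun _ _ => by positivity) key
    _ = K ^ (n.primeFactors.filter (· < B)).card * (n : ℝ) ^ δ := by
        rw [Finset.prod_mul_distrib, Finset.prod_ite, Finset.prod_const, Finset.prod_const_one,
          mul_one, Real.finsetProd_rpow _ _ (fun _ _ => by positivity)]
        congr 2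
        conv_rhs => rw [← Nat.prod_factorization_pow_eq_self hn]
        rw [Finsupp.prod]
        push_cast
        rfl
    _ ≤ K ^ B * (n : ℝ) ^ δ := by
        gcongr
        · calc _ ≤ (Finset.range B).card := Finset.card_le_card (fun x hx => by simp at hx ⊢; exact hx.2)
            _ = B := by simp

/-- The exponential sum of a function on `(ZMod m) ^ 2` at the frequency `(u, v)`. -/
noncomputable def pairSum {m : ℕ} [NeZero m] (ψ : AddChar (ZMod m) ℂ) (f : ZMod m → ZMod m → ℂ)
    (u v : ZMod m) : ℂ := ∑ x, ∑ y, f x y * ψ (u * x + v * y)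

theorem exists_primitive_split {m n : ℕ} (h : m.Coprime n) {ψ : AddChar (ZMod (m * n)) ℂ}
    (hψ : ψ.IsPrimitive) : ∃ (ψ₁ : AddChar (ZMod m) ℂ) (ψ₂ : AddChar (ZMod n) ℂ),
      ψ₁.IsPrimitive ∧ ψ₂.IsPrimitive ∧ ∀ z, ψ z =
        ψ₁ (ZMod.chineseRemainder h z).1 * ψ₂ (ZMod.chineseRemainder h z).2 := by
  set e := ZMod.chineseRemainder h with he
  refine ⟨⟨fun x => ψ (e.symm (x, 0)), ?_, ?_⟩, ⟨fun x => ψ (e.symm (0, x)), ?_, ?_⟩, ?_, ?_, ?_⟩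
  · rw [← Prod.zero_eq_mk, map_zero, AddChar.map_zero_eq_one]
  · intro a b
    rw [← AddChar.map_add_eq_mul, ← map_add]
    simp
  · rw [← Prod.zero_eq_mk, map_zero, AddChar.map_zero_eq_one]
  · intro a b
    rw [← AddChar.map_add_eq_mul, ← map_add]
    simp
  · intro a ha h1
    have hne : e.symm (a, 0) ≠ 0 := by
      rw [Ne, map_eq_zero_iff _ e.symm.injective]
      simp [ha]
    apply hψ hne
    ext x
    have := DFunLike.congr_fun h1 (e x).1
    simp only [AddChar.mulShift_apply, AddChar.one_apply, AddChar.coe_mk] at this ⊢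
    rw [← this]
    congr 1
    apply e.injective
    rw [_root_.map_mul]
    ext <;> simp
  · intro a ha h1
    have hne : e.symm (0, a) ≠ 0 := by
      rw [Ne, map_eq_zero_iff _ e.symm.injective]
      simp [ha]
    apply hψ hne
    ext x
    have := DFunLike.congr_fun h1 (e x).2
    simp only [AddChar.mulShift_apply, AddChar.one_apply, AddChar.coe_mk] at this ⊢
    rw [← this]
    congr 1
    apply e.injective
    rw [_root_.map_mul]
    ext <;> simp
  · intro z
    simp only [AddChar.coe_mk]
    rw [← AddChar.map_add_eq_mul, ← map_add]
    simp

theorem pairSum_mul {m n : ℕ} [NeZero m] [NeZero n] (h : m.Coprime n)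
    {ψ : AddChar (ZMod (m * n)) ℂ} {ψ₁ : AddChar (ZMod m) ℂ} {ψ₂ : AddChar (ZMod n) ℂ}
    (hψ : ∀ z, ψ z = ψ₁ (ZMod.chineseRemainder h z).1 * ψ₂ (ZMod.chineseRemainder h z).2)
    (f : ZMod m → ZMod m → ℂ) (g : ZMod n → ZMod n → ℂ) (u v : ZMod (m * n)) :
    pairSum ψ (fun x y => f (ZMod.chineseRemainder h x).1 (ZMod.chineseRemainder h y).1 *
      g (ZMod.chineseRemainder h x).2 (ZMod.chineseRemainder h y).2) u v =
    pairSum ψ₁ f (ZMod.chineseRemainder h u).1 (ZMod.chineseRemainder h v).1 *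
      pairSum ψ₂ g (ZMod.chineseRemainder h u).2 (ZMod.chineseRemainder h v).2 := by
  set e := ZMod.chineseRemainder h with he
  simp only [pairSum]
  have h1 : ∀ F : ZMod m × ZMod n → ZMod m × ZMod n → ℂ,
      ∑ x, ∑ y, F (e x) (e y) = ∑ x₁, ∑ y₁, ∑ x₂, ∑ y₂, F (x₁, x₂) (y₁, y₂) := by
    intro F
    calc ∑ x, ∑ y, F (e x) (e y) = ∑ x, ∑ y, F x y := by
          rw [← Equiv.sum_comp e.toEquiv (fun x => ∑ y, F x y)]
          refine Finset.sum_congr rfl fun x _ => ?_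
          exact Equiv.sum_comp e.toEquiv (fun y => F (e x) y)
      _ = _ := by
          simp only [Fintype.sum_prod_type]
          refine Finset.sum_congr rfl fun x₁ _ => ?_
          rw [Finset.sum_comm]
  have h2 := h1 (fun x y => f x.1 y.1 * g x.2 y.2 *
    (ψ₁ ((e u).1 * x.1 + (e v).1 * y.1) * ψ₂ ((e u).2 * x.2 + (e v).2 * y.2)))
  simp only at h2
  have h3 : ∀ x y, ψ (u * x + v * y) = ψ₁ ((e u).1 * (e x).1 + (e v).1 * (e y).1) *
      ψ₂ ((e u).2 * (e x).2 + (e v).2 * (e y).2) := by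
    intro x y
    rw [hψ]
    simp
  simp only [h3]
  rw [h2, Finset.sum_mul]
  refine Finset.sum_congr rfl fun x₁ _ => ?_
  rw [Finset.sum_mul]
  refine Finset.sum_congr rfl fun y₁ _ => ?_
  rw [Finset.mul_sum]
  refine Finset.sum_congr rfl fun x₂ _ => ?_
  rw [Finset.mul_sum]
  refine Finset.sum_congr rfl fun y₂ _ => ?_
  ring

theorem norm_pairSum_le {m : ℕ} [NeZero m] (ψ : AddChar (ZMod m) ℂ) (f : ZMod m → ZMod m → ℂ)
    (u v : ZMod m) : ‖pairSum ψ f u v‖ ≤ ∑ x, ∑ y, ‖f x y‖ := by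
  refine (norm_sum_le _ _).trans (Finset.sum_le_sum fun x _ => ?_)
  refine (norm_sum_le _ _).trans (Finset.sum_le_sum fun y _ => ?_)
  rw [norm_mul, AddChar.norm_apply, mul_one]

/-- Parseval's identity for exponential sums modulo `m`. -/
theorem sum_norm_sq_sum_mul {m : ℕ} [NeZero m] {ψ : AddChar (ZMod m) ℂ} (hψ : ψ.IsPrimitive)
    (F : ZMod m → ℂ) : ∑ u, ‖∑ x, F x * ψ (u * x)‖ ^ 2 = (m : ℝ) * ∑ x, ‖F x‖ ^ 2 := by
  have hc : ∀ z : ZMod m, (starRingEnd ℂ) (ψ z) = ψ (-z) := fun z => by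
    rw [AddChar.map_neg_eq_conj]
  apply Complex.ofReal_injective
  push_cast
  calc ∑ u, ((‖∑ x, F x * ψ (u * x)‖ : ℂ)) ^ 2
      = ∑ u, ∑ x, ∑ y, F x * (starRingEnd ℂ) (F y) * ψ (u * (x - y)) := by
        refine Finset.sum_congr rfl fun u _ => ?_
        rw [← Complex.mul_conj', map_sum, Finset.sum_mul_sum]
        refine Finset.sum_congr rfl fun x _ => Finset.sum_congr rfl fun y _ => ?_
        rw [RingHom.map_mul, hc, mul_sub, sub_eq_add_neg, AddChar.map_add_eq_mul]
        ring
    _ = ∑ x, ∑ y, F x * (starRingEnd ℂ) (F y) * ∑ u, ψ (u * (x - y)) := by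
        rw [Finset.sum_comm]
        refine Finset.sum_congr rfl fun x _ => ?_
        rw [Finset.sum_comm]
        refine Finset.sum_congr rfl fun y _ => ?_
        rw [Finset.mul_sum]
    _ = ∑ x, F x * (starRingEnd ℂ) (F x) * m := by
        refine Finset.sum_congr rfl fun x _ => ?_
        simp_rw [AddChar.sum_mulShift _ hψ, sub_eq_zero]
        simp [ZMod.card]
    _ = _ := by
        rw [Finset.mul_sum]
        refine Finset.sum_congr rfl fun x _ => ?_
        rw [Complex.mul_conj']
        ring

/-- Parseval's identity for exponential sums in two variables. -/
theorem sum_norm_sq_pairSum {m : ℕ} [NeZero m] {ψ : AddChar (ZMod m) ℂ} (hψ : ψ.IsPrimitive)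
    (f : ZMod m → ZMod m → ℂ) :
    ∑ u, ∑ v, ‖pairSum ψ f u v‖ ^ 2 = (m : ℝ) ^ 2 * ∑ x, ∑ y, ‖f x y‖ ^ 2 := by
  have h2 : ∀ u v, pairSum ψ f u v = ∑ y, (∑ x, f x y * ψ (u * x)) * ψ (v * y) := by
    intro u v
    rw [pairSum, Finset.sum_comm]
    refine Finset.sum_congr rfl fun y _ => ?_
    rw [Finset.sum_mul]
    refine Finset.sum_congr rfl fun x _ => ?_
    rw [AddChar.map_add_eq_mul]
    ring
  calc ∑ u, ∑ v, ‖pairSum ψ f u v‖ ^ 2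
      = ∑ u, (m : ℝ) * ∑ y, ‖∑ x, f x y * ψ (u * x)‖ ^ 2 := by
        refine Finset.sum_congr rfl fun u _ => ?_
        simp_rw [h2]
        rw [sum_norm_sq_sum_mul hψ]
    _ = (m : ℝ) * ∑ y, ∑ u, ‖∑ x, f x y * ψ (u * x)‖ ^ 2 := by
        rw [← Finset.mul_sum, Finset.sum_comm]
    _ = _ := by
        simp_rw [sum_norm_sq_sum_mul hψ]
        rw [← Finset.mul_sum, Finset.sum_comm]
        ring

/-- The indicator function of the affine Fermat cubic `x ^ 3 + y ^ 3 + k = 0` modulo `m`. -/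
noncomputable def fermatInd (m : ℕ) (k : ℤ) (x y : ZMod m) : ℂ :=
  open Classical in if x ^ 3 + y ^ 3 + (k : ZMod m) = 0 then 1 else 0

/-- The number of points on the affine Fermat cubic `x ^ 3 + y ^ 3 + k = 0` modulo `m`. -/
def fermatCard (m : ℕ) [NeZero m] (k : ℤ) : ℕ :=
  (Finset.univ.filter fun P : ZMod m × ZMod m => P.1 ^ 3 + P.2 ^ 3 + (k : ZMod m) = 0).card

theorem fermatInd_mul {m n : ℕ} (h : m.Coprime n) (k : ℤ) (x y : ZMod (m * n)) :
    fermatInd (m * n) k x y =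
      fermatInd m k (ZMod.chineseRemainder h x).1 (ZMod.chineseRemainder h y).1 *
      fermatInd n k (ZMod.chineseRemainder h x).2 (ZMod.chineseRemainder h y).2 := by
  set e := ZMod.chineseRemainder h with he
  have h1 : x ^ 3 + y ^ 3 + (k : ZMod (m * n)) = 0 ↔
      (e x).1 ^ 3 + (e y).1 ^ 3 + (k : ZMod m) = 0 ∧
      (e x).2 ^ 3 + (e y).2 ^ 3 + (k : ZMod n) = 0 := by
    rw [← map_eq_zero_iff e e.injective, map_add, map_add, map_pow, map_pow, map_intCast,
      Prod.ext_iff]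
    simp
  simp only [fermatInd, h1]
  split_ifs <;> simp_all

theorem sum_norm_fermatInd (m : ℕ) [NeZero m] (k : ℤ) :
    ∑ x, ∑ y, ‖fermatInd m k x y‖ = fermatCard m k := by
  classical
  rw [fermatCard, Finset.card_filter, Fintype.sum_prod_type]
  push_cast
  refine Finset.sum_congr rfl fun x _ => Finset.sum_congr rfl fun y _ => ?_
  simp only [fermatInd]
  split_ifs <;> simp

theorem pairSum_one_fermatInd (m : ℕ) [NeZero m] (k : ℤ) :
    pairSum 1 (fermatInd m k) 0 0 = fermatCard m k := by
  classical
  rw [fermatCard, Finset.card_filter, Fintype.sum_prod_type, pairSum]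
  push_cast
  refine Finset.sum_congr rfl fun x _ => Finset.sum_congr rfl fun y _ => ?_
  simp only [fermatInd]
  split_ifs <;> simp

theorem pairSum_fermatInd_mul {m n : ℕ} [NeZero m] [NeZero n] (h : m.Coprime n) (k : ℤ)
    {ψ : AddChar (ZMod (m * n)) ℂ} {ψ₁ : AddChar (ZMod m) ℂ} {ψ₂ : AddChar (ZMod n) ℂ}
    (hψ : ∀ z, ψ z = ψ₁ (ZMod.chineseRemainder h z).1 * ψ₂ (ZMod.chineseRemainder h z).2)
    (u v : ZMod (m * n)) :
    pairSum ψ (fermatInd (m * n) k) u v =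
    pairSum ψ₁ (fermatInd m k) (ZMod.chineseRemainder h u).1 (ZMod.chineseRemainder h v).1 *
    pairSum ψ₂ (fermatInd n k) (ZMod.chineseRemainder h u).2 (ZMod.chineseRemainder h v).2 := by
  rw [← pairSum_mul h hψ]
  congr 1
  ext x y
  exact fermatInd_mul h k x y

theorem fermatCard_mul {m n : ℕ} [NeZero m] [NeZero n] (h : m.Coprime n) (k : ℤ) :
    fermatCard (m * n) k = fermatCard m k * fermatCard n k := by
  have := pairSum_fermatInd_mul h k (ψ := 1) (ψ₁ := 1) (ψ₂ := 1) (by simp) 0 0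
  simp only [map_zero, Prod.fst_zero, Prod.snd_zero, pairSum_one_fermatInd] at this
  exact_mod_cast this

theorem norm_pairSum_fermatInd_le_card (m : ℕ) [NeZero m] (k : ℤ) (ψ : AddChar (ZMod m) ℂ)
    (u v : ZMod m) : ‖pairSum ψ (fermatInd m k) u v‖ ≤ fermatCard m k :=
  (norm_pairSum_le ψ _ u v).trans (sum_norm_fermatInd m k).le

theorem card_unit_cube_eq_le {p : ℕ} (hp : p.Prime) (hp2 : p ≠ 2) (j : ℕ) [NeZero (p ^ j)]
    (c : ZMod (p ^ j)) :
    (Finset.univ.filter fun y : (ZMod (p ^ j))ˣ => (y : ZMod (p ^ j)) ^ 3 = c).card ≤ 3 := by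
  classical
  have := ZMod.isCyclic_units_of_prime_pow p hp hp2 j
  rcases Finset.eq_empty_or_nonempty
    (Finset.univ.filter fun y : (ZMod (p ^ j))ˣ => (y : ZMod (p ^ j)) ^ 3 = c) with h0 | ⟨z, hz⟩
  · simp [h0]
  · refine le_trans ?_ (IsCyclic.card_pow_eq_one_le (α := (ZMod (p ^ j))ˣ) (n := 3) (by norm_num))
    refine Finset.card_le_card_of_injOn (fun y => y * z⁻¹) ?_ ?_
    · intro y hy
      simp only [Finset.coe_filter, Finset.mem_univ, true_and, Set.mem_ofPred_eq,
        Finset.mem_filter] at hy hz ⊢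
      rw [mul_pow, inv_pow, mul_inv_eq_one]
      apply Units.ext
      push_cast
      rw [hy, hz]
    · intro a _ b _ hab
      simpa using hab

theorem fermatCard_prime_pow_le {p : ℕ} (hp : p.Prime) (hp2 : p ≠ 2) (j : ℕ) [NeZero (p ^ j)]
    {k : ℤ} (hk : ¬ (p : ℤ) ∣ k) : fermatCard (p ^ j) k ≤ 6 * p ^ j := by
  classical
  set R := ZMod (p ^ j) with hR
  set U := Finset.univ.filter fun P : R × Rˣ => P.1 ^ 3 + (P.2 : R) ^ 3 + (k : R) = 0 with hU
  have hUc : U.card ≤ 3 * p ^ j := by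
    rw [hU, Finset.card_filter, Fintype.sum_prod_type]
    calc _ = ∑ x : R, (Finset.univ.filter fun y : Rˣ => (y : R) ^ 3 = -(k : R) - x ^ 3).card := by
          refine Finset.sum_congr rfl fun x _ => ?_
          rw [Finset.card_filter]
          refine Finset.sum_congr rfl fun y _ => ?_
          have : x ^ 3 + (y : R) ^ 3 + (k : R) = 0 ↔ (y : R) ^ 3 = -(k : R) - x ^ 3 := by
            constructor <;> intro h <;> linear_combination h
          simp only [this]
      _ ≤ ∑ x : R, 3 := Finset.sum_le_sum fun x _ => card_unit_cube_eq_le hp hp2 j _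
      _ = 3 * p ^ j := by simp [hR, ZMod.card, mul_comm]
  have hsub : (Finset.univ.filter fun P : R × R => P.1 ^ 3 + P.2 ^ 3 + (k : R) = 0) ⊆
      U.image (fun P => (P.1, (P.2 : R))) ∪ U.image (fun P => ((P.2 : R), P.1)) := by
    rintro ⟨x, y⟩ hP
    simp only [Finset.mem_filter, Finset.mem_univ, true_and] at hP
    simp only [Finset.mem_union, Finset.mem_image, hU, Finset.mem_filter, Finset.mem_univ, true_and,
      Prod.exists, Prod.mk.injEq]
    by_cases hy : IsUnit y
    · obtain ⟨y', rfl⟩ := hy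
      exact Or.inl ⟨x, y', hP, rfl, rfl⟩
    by_cases hx : IsUnit x
    · obtain ⟨x', rfl⟩ := hx
      exact Or.inr ⟨y, x', by rw [← hP]; ring, rfl, rfl⟩
    exfalso
    rcases Nat.eq_zero_or_pos j with rfl | hj
    · apply hx
      have : Subsingleton R := by
        rw [hR, pow_zero]; infer_instance
      rw [Subsingleton.elim x 1]
      exact isUnit_one
    have hdvd : ∀ z : R, ¬ IsUnit z → p ∣ z.val := by
      intro z hz
      by_contra hc
      apply hz
      have := (ZMod.isUnit_iff_coprime z.val (p ^ j)).2
        (Nat.Coprime.pow_right j ((Nat.Prime.coprime_iff_not_dvd hp).2 hc).symm)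
      rwa [ZMod.natCast_zmod_val] at this
    have h1 : ((x.val ^ 3 + y.val ^ 3 + k : ℤ) : R) = 0 := by
      push_cast
      rw [ZMod.natCast_zmod_val, ZMod.natCast_zmod_val]
      exact hP
    replace h1 := (ZMod.intCast_zmod_eq_zero_iff_dvd _ _).1 h1
    have h2 : (p : ℤ) ∣ (x.val ^ 3 + y.val ^ 3 + k : ℤ) := by
      refine dvd_trans ?_ h1
      push_cast
      exact dvd_pow_self _ hj.ne'
    have h3 : (p : ℤ) ∣ (x.val : ℤ) ^ 3 := dvd_pow (by exact_mod_cast hdvd x hx) (by norm_num)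
    have h4 : (p : ℤ) ∣ (y.val : ℤ) ^ 3 := dvd_pow (by exact_mod_cast hdvd y hy) (by norm_num)
    exact hk ((dvd_add_right (dvd_add h3 h4)).1 h2)
  calc fermatCard (p ^ j) k ≤ _ := Finset.card_le_card hsub
    _ ≤ _ := Finset.card_union_le _ _
    _ ≤ U.card + U.card := add_le_add Finset.card_image_le Finset.card_image_le
    _ ≤ _ := by omega

theorem card_divisors_mul_of_coprime {m n : ℕ} (h : m.Coprime n) :
    (m * n).divisors.card = m.divisors.card * n.divisors.card :=
  h.card_divisors_mul

theorem fermatCard_le {k : ℤ} (m : ℕ) : ∀ [NeZero m], IsCoprime (m : ℤ) (6 * k) →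
    fermatCard m k ≤ m.divisors.card ^ 3 * m := by
  induction m using Nat.recOnPosPrimePosCoprime with
  | zero => intro h; exact absurd rfl h.out
  | one =>
    intro _ _
    refine (Finset.card_le_univ _).trans ?_
    simp
  | prime_pow p j hp hj =>
    intro _ h
    have h1 : IsCoprime (p : ℤ) (6 * k) := by
      push_cast at h
      exact (IsCoprime.pow_left_iff hj).1 h
    have hp' : Prime (p : ℤ) := Nat.prime_iff_prime_int.1 hp
    have h2 : ¬ (p : ℤ) ∣ 6 * k := fun hd => hp'.not_isUnit (h1.isUnit_of_dvd' dvd_rfl hd)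
    have hp2 : p ≠ 2 := by
      rintro rfl
      exact h2 (Dvd.dvd.mul_right (by norm_num) _)
    refine (fermatCard_prime_pow_le hp hp2 j (fun hd => h2 (hd.mul_left _))).trans ?_
    rw [Nat.divisors_prime_pow hp, Finset.card_map, Finset.card_range]
    have : 2 ^ 3 ≤ (j + 1) ^ 3 := Nat.pow_le_pow_left (by omega) 3
    nlinarith [Nat.zero_le (p ^ j)]
  | coprime a b ha hb hab iha ihb =>
    intro _ h
    have : NeZero a := ⟨by omega⟩
    have : NeZero b := ⟨by omega⟩
    push_cast at h
    rw [fermatCard_mul hab, card_divisors_mul_of_coprime hab]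
    calc _ ≤ (a.divisors.card ^ 3 * a) * (b.divisors.card ^ 3 * b) :=
          Nat.mul_le_mul (iha h.of_mul_left_left) (ihb h.of_mul_left_right)
      _ = _ := by ring

theorem norm_sq_pairSum_fermatInd_prime_le {p : ℕ} [Fact p.Prime] {k : ℤ}
    (h : IsCoprime (p : ℤ) (6 * k)) {ψ : AddChar (ZMod p) ℂ} (hψ : ψ.IsPrimitive) (u v : ℤ) :
    ‖pairSum ψ (fermatInd p k) u v‖ ^ 2 ≤ 81 * p * Nat.gcd p (u ^ 3 - v ^ 3).natAbs := by
  have hp : p.Prime := Fact.out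
  have hp' : Prime (p : ℤ) := Nat.prime_iff_prime_int.1 hp
  have h2 : ¬ (p : ℤ) ∣ 6 * k := fun hd => hp'.not_isUnit (h.isUnit_of_dvd' dvd_rfl hd)
  have hp2 : p ≠ 2 := by
    rintro rfl
    exact h2 (Dvd.dvd.mul_right (by norm_num) _)
  have hp3 : p ≠ 3 := by
    rintro rfl
    exact h2 (Dvd.dvd.mul_right (by norm_num) _)
  have hp4 : 3 < p := by
    have := hp.two_le
    omega
  have hk : ¬ (p : ℤ) ∣ k := fun hd => h2 (hd.mul_left _)
  by_cases hd : (p : ℤ) ∣ u ^ 3 - v ^ 3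
  · have h1 : Nat.gcd p (u ^ 3 - v ^ 3).natAbs = p :=
      Nat.gcd_eq_left (by rwa [← Int.natCast_dvd])
    rw [h1]
    have h3 : ‖pairSum ψ (fermatInd p k) u v‖ ≤ 6 * p := by
      refine (norm_pairSum_fermatInd_le_card p k ψ u v).trans ?_
      have : fermatCard p k ≤ 6 * p := by
        have : NeZero (p ^ 1) := by rw [pow_one]; infer_instance
        have := fermatCard_prime_pow_le hp hp2 1 hk
        simpa only [pow_one] using this
      exact_mod_cast this
    calc _ ≤ (6 * (p : ℝ)) ^ 2 := by gcongr
      _ ≤ _ := by nlinarith [sq_nonneg (p : ℝ)]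
  · have h1 : Nat.gcd p (u ^ 3 - v ^ 3).natAbs = 1 := by
      rw [Int.natCast_dvd] at hd
      exact (Nat.Prime.coprime_iff_not_dvd hp).2 hd
    rw [h1]
    have hc : -(k : ZMod p) ≠ 0 := by
      rw [Ne, neg_eq_zero, ZMod.intCast_zmod_eq_zero_iff_dvd]
      exact hk
    have huv : (u : ZMod p) ^ 3 ≠ (v : ZMod p) ^ 3 := by
      intro he
      apply hd
      rw [← ZMod.intCast_zmod_eq_zero_iff_dvd]
      push_cast
      rw [he, sub_self]
    have hψ1 : ψ ≠ 1 := by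
      have := hψ one_ne_zero
      rwa [AddChar.mulShift_one] at this
    have := norm_sum_fermat_le hp4 hc huv hψ1
    have h3 : pairSum ψ (fermatInd p k) u v =
        ∑ P ∈ Finset.univ.filter (fun P : ZMod p × ZMod p => P.1 ^ 3 + P.2 ^ 3 = -(k : ZMod p)),
          ψ (u * P.1 + v * P.2) := by
      rw [Finset.sum_filter, Fintype.sum_prod_type, pairSum]
      refine Finset.sum_congr rfl fun x _ => Finset.sum_congr rfl fun y _ => ?_
      simp only [fermatInd, ← add_eq_zero_iff_eq_neg]
      split_ifs <;> simp
    rw [h3]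
    calc _ ≤ (9 * √(p : ℝ)) ^ 2 := by gcongr
      _ = _ := by
        rw [mul_pow, Real.sq_sqrt (by positivity)]
        norm_num

theorem norm_sq_pairSum_fermatInd_squarefree_le {k : ℤ} (m : ℕ) : ∀ [NeZero m], Squarefree m →
    IsCoprime (m : ℤ) (6 * k) → ∀ {ψ : AddChar (ZMod m) ℂ}, ψ.IsPrimitive → ∀ u v : ℤ,
    ‖pairSum ψ (fermatInd m k) u v‖ ^ 2 ≤
      (m.divisors.card : ℝ) ^ 7 * m * Nat.gcd m (u ^ 3 - v ^ 3).natAbs := by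
  induction m using Nat.recOnPosPrimePosCoprime with
  | zero => intro h; exact absurd rfl h.out
  | one =>
    intro _ _ hc ψ hψ u v
    have h1 := norm_pairSum_fermatInd_le_card 1 k ψ u v
    have h2 := fermatCard_le 1 hc
    simp only [Nat.divisors_one, Finset.card_singleton] at h2
    have h3 : ‖pairSum ψ (fermatInd 1 k) u v‖ ≤ 1 := h1.trans (by exact_mod_cast h2)
    simp only [Nat.divisors_one, Finset.card_singleton, Nat.gcd_one_left]
    norm_num
    exact h3
  | prime_pow p j hp hj =>
    intro _ hs hc ψ hψ u v
    have hj1 : j = 1 := by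
      by_contra hne
      exact hp.not_isUnit (hs p ((sq p ▸ pow_dvd_pow p (by omega : 2 ≤ j))))
    subst hj1
    have : Fact p.Prime := ⟨hp⟩
    have aux : ∀ n : ℕ, n = p → ∀ [NeZero n], IsCoprime (n : ℤ) (6 * k) →
        ∀ {ψ : AddChar (ZMod n) ℂ}, ψ.IsPrimitive →
        ‖pairSum ψ (fermatInd n k) u v‖ ^ 2 ≤
          (n.divisors.card : ℝ) ^ 7 * n * Nat.gcd n (u ^ 3 - v ^ 3).natAbs := by
      rintro n rfl _ hc ψ hψ
      refine (norm_sq_pairSum_fermatInd_prime_le hc hψ u v).trans ?_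
      rw [Nat.Prime.divisors hp, Finset.card_pair hp.one_lt.ne]
      gcongr
      norm_num
    exact aux _ (pow_one p) hc hψ
  | coprime a b ha hb hab iha ihb =>
    intro _ hs hc ψ hψ u v
    have : NeZero a := ⟨by omega⟩
    have : NeZero b := ⟨by omega⟩
    obtain ⟨ψ₁, ψ₂, h₁, h₂, hm⟩ := exists_primitive_split hab hψ
    push_cast at hc
    have ha' := iha hs.of_mul_left hc.of_mul_left_left h₁ u v
    have hb' := ihb hs.of_mul_right hc.of_mul_left_right h₂ u v
    rw [pairSum_fermatInd_mul hab k hm, card_divisors_mul_of_coprime hab,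
      Nat.gcd_comm (a * b), Nat.Coprime.gcd_mul _ hab, Nat.gcd_comm _ a, Nat.gcd_comm _ b, norm_mul, mul_pow]
    simp only [map_intCast, Prod.fst_intCast, Prod.snd_intCast]
    calc _ ≤ _ := mul_le_mul ha' hb' (by positivity) (by positivity)
      _ = _ := by push_cast; ring

theorem norm_sq_pairSum_fermatInd_le {k : ℤ} {m q : ℕ} [NeZero m] [NeZero q] (h : m.Coprime q)
    (hs : Squarefree m) (hc : IsCoprime ((m * q : ℕ) : ℤ) (6 * k))
    {ψ : AddChar (ZMod (m * q)) ℂ} (hψ : ψ.IsPrimitive) (u v : ℤ) :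
    ‖pairSum ψ (fermatInd (m * q) k) u v‖ ^ 2 ≤
      ((m * q).divisors.card : ℝ) ^ 7 * m * q ^ 2 * Nat.gcd m (u ^ 3 - v ^ 3).natAbs := by
  obtain ⟨ψ₁, ψ₂, h₁, h₂, hm⟩ := exists_primitive_split h hψ
  push_cast at hc
  have h1 := norm_sq_pairSum_fermatInd_squarefree_le m hs hc.of_mul_left_left h₁ u v
  have h2 : ‖pairSum ψ₂ (fermatInd q k) u v‖ ≤ q.divisors.card ^ 3 * q :=
    (norm_pairSum_fermatInd_le_card q k ψ₂ u v).trans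
      (by exact_mod_cast fermatCard_le q hc.of_mul_left_right)
  have h3 : (1 : ℝ) ≤ q.divisors.card := by
    exact_mod_cast Finset.card_pos.2 ⟨1, by simp [NeZero.ne q]⟩
  rw [pairSum_fermatInd_mul h k hm, card_divisors_mul_of_coprime h, norm_mul, mul_pow]
  simp only [map_intCast, Prod.fst_intCast, Prod.snd_intCast]
  calc _ ≤ ((m.divisors.card : ℝ) ^ 7 * m * Nat.gcd m (u ^ 3 - v ^ 3).natAbs) *
        (q.divisors.card ^ 3 * q) ^ 2 := by gcongr
    _ = ((m.divisors.card : ℝ) ^ 7 * m * Nat.gcd m (u ^ 3 - v ^ 3).natAbs * q ^ 2) *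
        (q.divisors.card : ℝ) ^ 6 := by ring
    _ ≤ ((m.divisors.card : ℝ) ^ 7 * m * Nat.gcd m (u ^ 3 - v ^ 3).natAbs * q ^ 2) *
        (q.divisors.card : ℝ) ^ 7 := by
        gcongr
        norm_num
    _ = _ := by push_cast; ring

/-- The number of points on the affine Fermat cubic modulo `m` lying on the line `x + y = b`. -/
def fermatLine (m : ℕ) [NeZero m] (k : ℤ) (b : ZMod m) : ℕ :=
  (Finset.univ.filter fun x : ZMod m => x ^ 3 + (b - x) ^ 3 + (k : ZMod m) = 0).card

theorem fermatLine_mul_le {m n : ℕ} [NeZero m] [NeZero n] (h : m.Coprime n) (k : ℤ)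
    (b : ZMod (m * n)) : fermatLine (m * n) k b ≤
      fermatLine m k (ZMod.chineseRemainder h b).1 *
      fermatLine n k (ZMod.chineseRemainder h b).2 := by
  set e := ZMod.chineseRemainder h with he
  rw [fermatLine, fermatLine, fermatLine, ← Finset.card_product]
  refine Finset.card_le_card_of_injOn e ?_ e.injective.injOn
  intro x hx
  simp only [Finset.coe_filter, Finset.mem_univ, true_and, Set.mem_ofPred_eq] at hx
  rw [← map_eq_zero_iff e e.injective, map_add, map_add, map_pow, map_pow, map_intCast, map_sub,
    Prod.ext_iff] at hx
  simpa using hx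

theorem fermatLine_prime_le {p : ℕ} [Fact p.Prime] {k : ℤ} (h : IsCoprime (p : ℤ) (6 * k))
    (b : ZMod p) : fermatLine p k b ≤ 2 := by
  have hp : p.Prime := Fact.out
  have hp' : Prime (p : ℤ) := Nat.prime_iff_prime_int.1 hp
  have h2 : ¬ (p : ℤ) ∣ 6 * k := fun hd => hp'.not_isUnit (h.isUnit_of_dvd' dvd_rfl hd)
  have h3 : (3 : ZMod p) ≠ 0 := by
    intro h0
    apply h2
    have : ((3 : ℤ) : ZMod p) = 0 := by exact_mod_cast h0
    rw [ZMod.intCast_zmod_eq_zero_iff_dvd] at this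
    exact (this.trans (by norm_num)).mul_right _
  have hk : (k : ZMod p) ≠ 0 := by
    rw [Ne, ZMod.intCast_zmod_eq_zero_iff_dvd]
    exact fun hd => h2 (hd.mul_left _)
  rw [fermatLine]
  rcases Finset.eq_empty_or_nonempty
    (Finset.univ.filter fun x : ZMod p => x ^ 3 + (b - x) ^ 3 + (k : ZMod p) = 0) with h0 | ⟨z, hz⟩
  · rw [h0]; simp
  · refine (Finset.card_le_card (t := {z, b - z}) ?_).trans Finset.card_le_two
    intro x hx
    simp only [Finset.mem_filter, Finset.mem_univ, true_and] at hx hz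
    simp only [Finset.mem_insert, Finset.mem_singleton]
    have hb : b ≠ 0 := by
      rintro rfl
      apply hk
      linear_combination hx
    have : (3 * b) * ((x - z) * (x - (b - z))) = 0 := by
      linear_combination hx - hz
    rcases mul_eq_zero.1 ((mul_eq_zero.1 this).resolve_left (mul_ne_zero h3 hb)) with h | h
    · exact Or.inl (sub_eq_zero.1 h)
    · exact Or.inr (sub_eq_zero.1 h)

theorem fermatLine_le_self (m : ℕ) [NeZero m] (k : ℤ) (b : ZMod m) : fermatLine m k b ≤ m :=
  (Finset.card_le_univ _).trans (by simp [ZMod.card])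

theorem fermatLine_squarefree_le {k : ℤ} (m : ℕ) : ∀ [NeZero m], Squarefree m →
    IsCoprime (m : ℤ) (6 * k) → ∀ b, fermatLine m k b ≤ m.divisors.card := by
  induction m using Nat.recOnPosPrimePosCoprime with
  | zero => intro h; exact absurd rfl h.out
  | one =>
    intro _ _ hc b
    simpa using fermatLine_le_self 1 k b
  | prime_pow p j hp hj =>
    intro _ hs hc b
    have hj1 : j = 1 := by
      by_contra hne
      exact hp.not_isUnit (hs p ((sq p ▸ pow_dvd_pow p (by omega : 2 ≤ j))))
    subst hj1
    have : Fact p.Prime := ⟨hp⟩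
    have aux : ∀ n : ℕ, n = p → ∀ [NeZero n], IsCoprime (n : ℤ) (6 * k) →
        ∀ b, fermatLine n k b ≤ n.divisors.card := by
      rintro n rfl _ hc b
      refine (fermatLine_prime_le hc b).trans ?_
      rw [Nat.Prime.divisors hp, Finset.card_pair hp.one_lt.ne]
    exact aux _ (pow_one p) hc b
  | coprime a b ha hb hab iha ihb =>
    intro _ hs hc c
    have : NeZero a := ⟨by omega⟩
    have : NeZero b := ⟨by omega⟩
    push_cast at hc
    rw [card_divisors_mul_of_coprime hab]
    exact (fermatLine_mul_le hab k c).trans (Nat.mul_le_mul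
      (iha hs.of_mul_left hc.of_mul_left_left _) (ihb hs.of_mul_right hc.of_mul_left_right _))

theorem sum_fermatLine (m : ℕ) [NeZero m] (k : ℤ) : ∑ b, fermatLine m k b = fermatCard m k := by
  simp only [fermatLine, fermatCard, Finset.card_filter]
  rw [Finset.sum_comm, Fintype.sum_prod_type]
  refine Finset.sum_congr rfl fun x _ => ?_
  exact Equiv.sum_comp (Equiv.subRight x)
    (fun y => if x ^ 3 + y ^ 3 + (k : ZMod m) = 0 then 1 else 0)

theorem sum_norm_sq_pairSum_fermatInd_diag {m : ℕ} [NeZero m] (k : ℤ) {ψ : AddChar (ZMod m) ℂ}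
    (hψ : ψ.IsPrimitive) : ∑ w, ‖pairSum ψ (fermatInd m k) w w‖ ^ 2 =
      m * ∑ b, (fermatLine m k b : ℝ) ^ 2 := by
  classical
  have h1 : ∀ w, pairSum ψ (fermatInd m k) w w = ∑ b, (fermatLine m k b : ℂ) * ψ (w * b) := by
    intro w
    have h2 : ∀ x, ∑ y, fermatInd m k x y * ψ (w * x + w * y) =
        ∑ b, fermatInd m k x (b - x) * ψ (w * b) := by
      intro x
      rw [← Equiv.sum_comp (Equiv.subRight x) (fun y => fermatInd m k x y * ψ (w * x + w * y))]
      refine Finset.sum_congr rfl fun b _ => ?_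
      simp only [Equiv.subRight_apply]
      congr 2
      ring
    rw [pairSum]
    simp_rw [h2]
    rw [Finset.sum_comm]
    refine Finset.sum_congr rfl fun b _ => ?_
    rw [← Finset.sum_mul, fermatLine, Finset.card_filter]
    push_cast
    congr 1
  simp_rw [h1]
  rw [sum_norm_sq_sum_mul hψ]
  simp

theorem sum_norm_sq_pairSum_fermatInd_diag_le {k : ℤ} {m q : ℕ} [NeZero m] [NeZero q]
    (h : m.Coprime q) (hs : Squarefree m) (hc : IsCoprime ((m * q : ℕ) : ℤ) (6 * k))
    {ψ : AddChar (ZMod (m * q)) ℂ} (hψ : ψ.IsPrimitive) :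
    ∑ w, ‖pairSum ψ (fermatInd (m * q) k) w w‖ ^ 2 ≤
      ((m * q).divisors.card : ℝ) ^ 4 * (m * q : ℝ) ^ 2 * q := by
  rw [sum_norm_sq_pairSum_fermatInd_diag k hψ]
  have hc' := hc
  push_cast at hc'
  have h1 : ∀ b, fermatLine (m * q) k b ≤ (m * q).divisors.card * q := by
    intro b
    refine (fermatLine_mul_le h k b).trans ?_
    refine Nat.mul_le_mul ((fermatLine_squarefree_le m hs hc'.of_mul_left_left _).trans ?_)
      (fermatLine_le_self q k _)
    exact Finset.card_le_card (Nat.divisors_subset_of_dvd (NeZero.ne _) (dvd_mul_right _ _))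
  have h2 : ∑ b, (fermatLine (m * q) k b : ℝ) ^ 2 ≤
      ((m * q).divisors.card * q : ℝ) * fermatCard (m * q) k := by
    rw [← sum_fermatLine]
    push_cast
    rw [Finset.mul_sum]
    refine Finset.sum_le_sum fun b _ => ?_
    rw [sq]
    have : (fermatLine (m * q) k b : ℝ) ≤ (m * q).divisors.card * q := by exact_mod_cast h1 b
    gcongr
  have h3 : (fermatCard (m * q) k : ℝ) ≤ (m * q).divisors.card ^ 3 * (m * q) := by
    exact_mod_cast fermatCard_le (m * q) hc
  calc ((m * q : ℕ) : ℝ) * ∑ b, (fermatLine (m * q) k b : ℝ) ^ 2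
      ≤ (m * q : ℕ) * (((m * q).divisors.card * q : ℝ) *
          ((m * q).divisors.card ^ 3 * (m * q))) := by
        gcongr
        exact h2.trans (by gcongr)
    _ = _ := by push_cast; ring

theorem sum_quadraticChar_sq_sub {F : Type*} [Field F] [Fintype F] [DecidableEq F]
    (hF : ringChar F ≠ 2) {d : F} (hd : d ≠ 0) : ∑ z, quadraticChar F (z ^ 2 - d) = -1 := by
  set χ := quadraticChar F with hχ
  have h1 : ∑ z, χ (z ^ 2 - d) = ∑ w, (χ w + 1) * χ (w - d) := by
    rw [← Finset.sum_fiberwise (s := Finset.univ) (g := fun z : F => z ^ 2)]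
    refine Finset.sum_congr rfl fun w _ => ?_
    rw [← quadraticChar_card_sqrts hF w, ← nsmul_eq_mul]
    refine (Finset.sum_eq_card_nsmul (b := χ (w - d)) ?_).trans ?_
    · intro z hz
      simp only [Finset.mem_filter, Finset.mem_univ, true_and] at hz
      rw [hz]
    · congr 2
      ext z
      simp
  have h2 : ∑ w, χ (w - d) = 0 := by
    exact (Equiv.sum_comp (Equiv.subRight d) (fun w => χ w)).trans (quadraticChar_sum_zero hF)
  have h3 : ∑ w, χ w * χ (w - d) = -1 := by
    rw [← Equiv.sum_comp (Equiv.mulLeft₀ d hd)]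
    have h4 : ∀ s, χ (Equiv.mulLeft₀ d hd s) * χ (Equiv.mulLeft₀ d hd s - d) =
        χ (-1) * (χ s * χ (1 - s)) := by
      intro s
      simp only [Equiv.mulLeft₀_apply]
      rw [show d * s - d = d * (-1 * (1 - s)) by ring]
      simp only [_root_.map_mul]
      have := quadraticChar_sq_one hd
      rw [← hχ] at this
      linear_combination (χ s * χ (-1) * χ (1 - s)) * this
    simp_rw [h4]
    rw [← Finset.mul_sum]
    have h5 : ∑ s, χ s * χ (1 - s) = jacobiSum χ χ⁻¹ := by
      rw [(quadraticChar_isQuadratic F).inv]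
      rfl
    rw [h5, jacobiSum_nontrivial_inv (quadraticChar_ne_one hF)]
    have := quadraticChar_sq_one (F := F) (a := -1) (by simp)
    rw [← hχ] at this
    linear_combination -this
  rw [h1]
  simp_rw [add_mul, one_mul]
  rw [Finset.sum_add_distrib, h2, h3, add_zero]

theorem abs_sum_quadraticChar_quadratic_le {F : Type*} [Field F] [Fintype F] [DecidableEq F]
    (hF : ringChar F ≠ 2) {a b c : F} (ha : a ≠ 0) (hd : b ^ 2 - 4 * a * c ≠ 0) :
    |∑ x, quadraticChar F (a * x ^ 2 + b * x + c)| ≤ 1 := by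
  have h2 : (2 : F) ≠ 0 := Ring.two_ne_zero hF
  set e : F ≃ F := (Equiv.mulLeft₀ (2 * a) (mul_ne_zero h2 ha)).trans (Equiv.addRight b) with he
  have h4a : (4 * a) ≠ 0 := by
    rw [show 4 * a = 2 * (2 * a) by ring]
    exact mul_ne_zero h2 (mul_ne_zero h2 ha)
  have h1 : ∀ x, quadraticChar F (a * x ^ 2 + b * x + c) =
      quadraticChar F (4 * a) * quadraticChar F ((e x) ^ 2 - (b ^ 2 - 4 * a * c)) := by
    intro x
    have h3 : (e x) ^ 2 - (b ^ 2 - 4 * a * c) = (4 * a) * (a * x ^ 2 + b * x + c) := by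
      simp only [he, Equiv.trans_apply, Equiv.mulLeft₀_apply, Equiv.coe_addRight]
      ring
    rw [h3, _root_.map_mul _ (4 * a), ← mul_assoc, ← sq, quadraticChar_sq_one h4a, one_mul]
  simp_rw [h1]
  rw [← Finset.mul_sum, Equiv.sum_comp e (fun z => quadraticChar F (z ^ 2 - (b ^ 2 - 4 * a * c))),
    sum_quadraticChar_sq_sub hF hd, abs_mul]
  rcases quadraticChar_dichotomy h4a with h | h <;> rw [h] <;> norm_num

/-- The quadratic character modulo `p` of the cubic form `A * (x ^ 3 + y ^ 3) + B`. -/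
noncomputable def cubicChar (p : ℕ) [Fact p.Prime] (A B : ℤ) (x y : ZMod p) : ℂ :=
  ((quadraticChar (ZMod p) (A * (x ^ 3 + y ^ 3) + B) : ℤ) : ℂ)

theorem abs_quadraticChar_le_one {F : Type*} [Field F] [Fintype F] [DecidableEq F] (a : F) :
    |quadraticChar F a| ≤ 1 := by
  by_cases h : a = 0
  · simp [h]
  · rcases quadraticChar_dichotomy h with h | h <;> rw [h] <;> norm_num

theorem norm_cubicChar_le (p : ℕ) [Fact p.Prime] (A B : ℤ) (x y : ZMod p) :
    ‖cubicChar p A B x y‖ ≤ 1 := by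
  rw [cubicChar, Complex.norm_intCast]
  exact_mod_cast abs_quadraticChar_le_one _

theorem norm_pairSum_cubicChar_diag_le {p : ℕ} [Fact p.Prime] (hp : 3 < p) {A B : ℤ}
    (hA : (A : ZMod p) ≠ 0) (ψ : AddChar (ZMod p) ℂ) (u : ZMod p) :
    ‖pairSum ψ (cubicChar p A B) u u‖ ≤ 5 * p := by
  have hF : ringChar (ZMod p) ≠ 2 := by
    rw [ZMod.ringChar_zmod_n]; omega
  have h3 : (3 : ZMod p) ≠ 0 := by
    intro h0
    have : ((3 : ℕ) : ZMod p) = 0 := by exact_mod_cast h0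
    rw [ZMod.natCast_eq_zero_iff] at this
    have := Nat.le_of_dvd (by norm_num) this
    omega
  set I : ZMod p → ℤ := fun t =>
    ∑ x, quadraticChar (ZMod p) (A * (x ^ 3 + (t - x) ^ 3) + B) with hI
  have h1 : pairSum ψ (cubicChar p A B) u u = ∑ t, (I t : ℂ) * ψ (u * t) := by
    have h2 : ∀ x, ∑ y, cubicChar p A B x y * ψ (u * x + u * y) =
        ∑ t, cubicChar p A B x (t - x) * ψ (u * t) := by
      intro x
      rw [← Equiv.sum_comp (Equiv.subRight x)
        (fun y => cubicChar p A B x y * ψ (u * x + u * y))]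
      refine Finset.sum_congr rfl fun b _ => ?_
      simp only [Equiv.subRight_apply]
      congr 2
      ring
    rw [pairSum]
    simp_rw [h2]
    rw [Finset.sum_comm]
    refine Finset.sum_congr rfl fun b _ => ?_
    rw [← Finset.sum_mul, hI]
    push_cast
    rfl
  have hIp : ∀ t, |I t| ≤ p := by
    intro t
    refine (Finset.abs_sum_le_sum_abs _ _).trans ?_
    refine (Finset.sum_le_sum fun x _ => abs_quadraticChar_le_one _).trans ?_
    simp [ZMod.card]
  have hI1 : ∀ t : ZMod p, t ≠ 0 → A * t ^ 3 + 4 * B ≠ 0 → |I t| ≤ 1 := by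
    intro t ht hb
    have h4 : ∀ x : ZMod p, (A * (x ^ 3 + (t - x) ^ 3) + B : ZMod p) =
        (3 * A * t) * x ^ 2 + (-3 * A * t ^ 2) * x + (A * t ^ 3 + B) := fun x => by ring
    simp only [hI, h4]
    refine abs_sum_quadraticChar_quadratic_le hF (mul_ne_zero (mul_ne_zero h3 hA) ht) ?_
    rw [show (-3 * A * t ^ 2 : ZMod p) ^ 2 - 4 * (3 * A * t) * (A * t ^ 3 + B) =
      -(3 * A * t * (A * t ^ 3 + 4 * B)) by ring]
    exact neg_ne_zero.2 (mul_ne_zero (mul_ne_zero (mul_ne_zero h3 hA) ht) hb)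
  set Z := Finset.univ.filter fun t : ZMod p => t = 0 ∨ A * t ^ 3 + 4 * B = 0 with hZ
  have hZc : Z.card ≤ 4 := by
    have hsub : Z ⊆ {0} ∪ (Polynomial.nthRoots 3 (-(4 * B) / A : ZMod p)).toFinset := by
      intro t ht
      simp only [hZ, Finset.mem_filter, Finset.mem_univ, true_and] at ht
      simp only [Finset.mem_union, Finset.mem_singleton, Multiset.mem_toFinset]
      rcases ht with h | h
      · exact Or.inl h
      · right
        rw [Polynomial.mem_nthRoots (by norm_num), eq_div_iff hA]
        linear_combination h
    refine (Finset.card_le_card hsub).trans ((Finset.card_union_le _ _).trans ?_)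
    have := (Multiset.toFinset_card_le _).trans
      (Polynomial.card_nthRoots 3 (-(4 * B) / A : ZMod p))
    rw [Finset.card_singleton]
    omega
  have hsum : ∑ t, |I t| ≤ 5 * p := by
    rw [← Finset.sum_filter_add_sum_filter_not Finset.univ
      (fun t : ZMod p => t = 0 ∨ A * t ^ 3 + 4 * B = 0)]
    have h5 : ∑ t ∈ Z, |I t| ≤ 4 * p := by
      refine (Finset.sum_le_card_nsmul _ _ (p : ℤ) fun t _ => hIp t).trans ?_
      rw [nsmul_eq_mul]
      have : (Z.card : ℤ) ≤ 4 := by exact_mod_cast hZc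
      gcongr
    have h6 : ∑ t ∈ Finset.univ.filter (fun t : ZMod p => ¬(t = 0 ∨ A * t ^ 3 + 4 * B = 0)), |I t| ≤ p := by
      refine (Finset.sum_le_card_nsmul _ _ (1 : ℤ) fun t ht => ?_).trans ?_
      · simp only [Finset.mem_filter, Finset.mem_univ, true_and, not_or] at ht
        exact hI1 t ht.1 ht.2
      · rw [nsmul_eq_mul, mul_one]
        have := Finset.card_le_univ
          (Finset.univ.filter fun t : ZMod p => ¬(t = 0 ∨ A * t ^ 3 + 4 * B = 0))
        rw [ZMod.card] at this
        exact_mod_cast this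
    linarith
  rw [h1]
  calc _ ≤ ∑ t, ‖(I t : ℂ) * ψ (u * t)‖ := norm_sum_le _ _
    _ = ∑ t, ((|I t| : ℤ) : ℝ) := by
        refine Finset.sum_congr rfl fun t _ => ?_
        rw [norm_mul, AddChar.norm_apply, mul_one, Complex.norm_intCast]
        push_cast
        rfl
    _ ≤ 5 * p := by exact_mod_cast hsum

/-- The standard bound for the Fourier coefficient at the frequency `j` modulo `M` of an interval
of length `N`. -/
noncomputable def freqBound (N M : ℕ) (j : ℤ) : ℝ :=
  if j = 0 then N else min N (M / (2 * |(j : ℝ)|))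

theorem freqBound_nonneg (N M : ℕ) (j : ℤ) : 0 ≤ freqBound N M j := by
  rw [freqBound]
  split_ifs <;> positivity

theorem freqBound_le (N M : ℕ) (j : ℤ) : freqBound N M j ≤ N := by
  rw [freqBound]
  split_ifs
  · exact le_rfl
  · exact min_le_left _ _

theorem freqBound_le_div (N M : ℕ) {j : ℤ} (hj : j ≠ 0) :
    freqBound N M j ≤ M / (2 * |(j : ℝ)|) := by
  rw [freqBound, if_neg hj]
  exact min_le_right _ _

theorem norm_sum_Icc_pow_le {z : ℂ} (hz : ‖z‖ = 1) (h1 : z ≠ 1) (N : ℕ) :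
    ‖∑ n ∈ Finset.Icc 1 N, z ^ n‖ ≤ 2 / ‖z - 1‖ := by
  have h2 : 0 < ‖z - 1‖ := norm_pos_iff.2 (sub_ne_zero.2 h1)
  have h3 : (∑ n ∈ Finset.Icc 1 N, z ^ n) * (z - 1) = z * (z ^ N - 1) := by
    rw [← Finset.Ico_add_one_right_eq_Icc, Finset.sum_Ico_eq_sum_range]
    simp only [pow_add, pow_one, ← Finset.mul_sum, Nat.add_sub_cancel]
    rw [mul_assoc, geom_sum_mul]
  rw [le_div_iff₀ h2, ← norm_mul, h3, norm_mul, hz, one_mul]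
  refine (norm_sub_le _ _).trans ?_
  rw [norm_pow, hz, one_pow, norm_one]
  norm_num

theorem norm_stdAddChar_sub_one_ge {M : ℕ} [NeZero M] (u : ZMod M) :
    4 * |(u.valMinAbs : ℝ)| / M ≤ ‖ZMod.stdAddChar u - 1‖ := by
  have hM : (0 : ℝ) < M := by exact_mod_cast NeZero.pos M
  have hu : |(u.valMinAbs : ℝ)| * 2 ≤ M := by
    have := u.valMinAbs_mem_Ioc
    have h1 : |u.valMinAbs| * 2 ≤ M := by
      rw [← abs_two (α := ℤ), ← abs_mul, abs_le]
      exact ⟨this.1.le, this.2⟩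
    exact_mod_cast h1
  have h1 : ZMod.stdAddChar u =
      Complex.exp (Complex.I * ((2 * Real.pi * u.valMinAbs / M : ℝ) : ℂ)) := by
    conv_lhs => rw [← ZMod.coe_valMinAbs u]
    rw [ZMod.stdAddChar_coe]
    congr 1
    push_cast
    ring
  rw [h1, Complex.norm_exp_I_mul_ofReal_sub_one, norm_mul, Real.norm_eq_abs, Real.norm_eq_abs,
    abs_two]
  have h2 : 2 * Real.pi * u.valMinAbs / M / 2 = Real.pi * (u.valMinAbs / M) := by ring
  rw [h2]
  have h3 : |Real.pi * ((u.valMinAbs : ℝ) / M)| = Real.pi * (|(u.valMinAbs : ℝ)| / M) := by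
    rw [abs_mul, abs_div, abs_of_pos Real.pi_pos, abs_of_pos hM]
  have h4 : |Real.pi * ((u.valMinAbs : ℝ) / M)| ≤ Real.pi / 2 := by
    rw [h3, div_eq_mul_inv Real.pi 2]
    gcongr
    rw [div_le_iff₀ hM]
    linarith
  have h5 := Real.mul_abs_le_abs_sin h4
  rw [h3] at h5
  have h6 : 2 / Real.pi * (Real.pi * (|(u.valMinAbs : ℝ)| / M)) = 2 * |(u.valMinAbs : ℝ)| / M := by
    field_simp
  rw [h6] at h5
  calc 4 * |(u.valMinAbs : ℝ)| / M = 2 * (2 * |(u.valMinAbs : ℝ)| / M) := by ring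
    _ ≤ _ := by gcongr

theorem norm_sum_Icc_stdAddChar_le {M : ℕ} [NeZero M] (N : ℕ) (u : ZMod M) :
    ‖∑ n ∈ Finset.Icc 1 N, ZMod.stdAddChar (-(u * n) : ZMod M)‖ ≤ freqBound N M u.valMinAbs := by
  have hM : (0 : ℝ) < M := by exact_mod_cast NeZero.pos M
  have htriv : ‖∑ n ∈ Finset.Icc 1 N, ZMod.stdAddChar (-(u * n) : ZMod M)‖ ≤ N := by
    refine (norm_sum_le _ _).trans ?_
    simp
  rw [freqBound]
  split_ifs with h0
  · exact htriv
  · refine le_min htriv ?_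
    have hu : u ≠ 0 := fun h => h0 ((ZMod.valMinAbs_eq_zero u).2 h)
    set z := ZMod.stdAddChar (N := M) u with hz
    have hzn : ‖z‖ = 1 := AddChar.norm_apply _ _
    have hz1 : z ≠ 1 := by
      intro h
      have h1 := norm_stdAddChar_sub_one_ge u
      rw [← hz, h, sub_self, norm_zero] at h1
      have h2 : 0 < |(u.valMinAbs : ℝ)| := abs_pos.2 (by exact_mod_cast h0)
      have : 0 < 4 * |(u.valMinAbs : ℝ)| / M := by positivity
      linarith
    have h1 : ∑ n ∈ Finset.Icc 1 N, ZMod.stdAddChar (-(u * n) : ZMod M) =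
        (starRingEnd ℂ) (∑ n ∈ Finset.Icc 1 N, z ^ n) := by
      rw [map_sum]
      refine Finset.sum_congr rfl fun n _ => ?_
      rw [AddChar.map_neg_eq_conj, hz, ← AddChar.map_nsmul_eq_pow, nsmul_eq_mul, mul_comm]
    rw [h1, RCLike.norm_conj]
    refine (norm_sum_Icc_pow_le hzn hz1 N).trans ?_
    have h2 : 0 < |(u.valMinAbs : ℝ)| := abs_pos.2 (by exact_mod_cast h0)
    have h3 : (M : ℝ) / (2 * |(u.valMinAbs : ℝ)|) = 2 / (4 * |(u.valMinAbs : ℝ)| / M) := by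
      field_simp
      norm_num
    rw [h3]
    gcongr
    exact norm_stdAddChar_sub_one_ge u

theorem sum_Icc_eq_completion {M : ℕ} [NeZero M] (N : ℕ) (f : ZMod M → ZMod M → ℂ) :
    ((M : ℂ) ^ 2) * ∑ x ∈ Finset.Icc 1 N, ∑ y ∈ Finset.Icc 1 N, f (x : ZMod M) (y : ZMod M) =
      ∑ u, ∑ v, (∑ n ∈ Finset.Icc 1 N, ZMod.stdAddChar (-(u * n) : ZMod M)) *
        (∑ n ∈ Finset.Icc 1 N, ZMod.stdAddChar (-(v * n) : ZMod M)) *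
        pairSum ZMod.stdAddChar f u v := by
  set ψ : AddChar (ZMod M) ℂ := ZMod.stdAddChar with hψ
  set W : ZMod M → ℂ := fun u => ∑ n ∈ Finset.Icc 1 N, ψ (-(u * n)) with hW
  set w : ZMod M → ℂ := fun x => ∑ n ∈ Finset.Icc 1 N, if (n : ZMod M) = x then 1 else 0 with hw
  have h1 : ∀ x, ∑ u, W u * ψ (u * x) = M * w x := by
    intro x
    simp only [hW, hw, Finset.sum_mul, Finset.mul_sum]
    rw [Finset.sum_comm]
    refine Finset.sum_congr rfl fun n _ => ?_
    have h2 : ∀ u, ψ (-(u * n)) * ψ (u * x) = ψ (u * (x - n)) := by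
      intro u
      rw [← AddChar.map_add_eq_mul]
      congr 1
      ring
    simp_rw [h2]
    rw [AddChar.sum_mulShift _ (ZMod.isPrimitive_stdAddChar M), ZMod.card]
    simp only [sub_eq_zero, eq_comm (a := x)]
    split_ifs <;> simp
  have h3 : ∀ g : ZMod M → ℂ, ∑ x, w x * g x = ∑ n ∈ Finset.Icc 1 N, g n := by
    intro g
    simp only [hw, Finset.sum_mul]
    rw [Finset.sum_comm]
    refine Finset.sum_congr rfl fun n _ => ?_
    simp
  calc (M : ℂ) ^ 2 * ∑ x ∈ Finset.Icc 1 N, ∑ y ∈ Finset.Icc 1 N, f (x : ZMod M) (y : ZMod M)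
      = (M : ℂ) ^ 2 * ∑ x, w x * ∑ y, w y * f x y := by
        simp_rw [h3]
    _ = ∑ x, ∑ y, f x y * ((∑ u, W u * ψ (u * x)) * ∑ v, W v * ψ (v * y)) := by
        simp_rw [h1, Finset.mul_sum]
        refine Finset.sum_congr rfl fun x _ => Finset.sum_congr rfl fun y _ => ?_
        ring
    _ = ∑ x, ∑ y, ∑ u, ∑ v, W u * W v * (f x y * ψ (u * x + v * y)) := by
        refine Finset.sum_congr rfl fun x _ => Finset.sum_congr rfl fun y _ => ?_
        rw [Finset.sum_mul_sum, Finset.mul_sum]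
        refine Finset.sum_congr rfl fun u _ => ?_
        rw [Finset.mul_sum]
        refine Finset.sum_congr rfl fun v _ => ?_
        rw [AddChar.map_add_eq_mul]
        ring
    _ = ∑ u, ∑ v, W u * W v * pairSum ψ f u v := by
        simp only [pairSum, Finset.mul_sum]
        simp_rw [← Fintype.sum_prod_type' (f := fun (u v : ZMod M) => _)]
        exact Finset.sum_comm

theorem norm_sum_Icc_le_completion {M : ℕ} [NeZero M] (N : ℕ) (f : ZMod M → ZMod M → ℂ) :
    ‖∑ x ∈ Finset.Icc 1 N, ∑ y ∈ Finset.Icc 1 N, f (x : ZMod M) (y : ZMod M)‖ ≤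
      1 / (M : ℝ) ^ 2 * ∑ u : ZMod M, ∑ v : ZMod M, freqBound N M u.valMinAbs *
        freqBound N M v.valMinAbs * ‖pairSum ZMod.stdAddChar f u v‖ := by
  have hM : (0 : ℝ) < M := by exact_mod_cast NeZero.pos M
  rw [one_div, ← div_eq_inv_mul, le_div_iff₀ (by positivity), mul_comm]
  have h1 : (M : ℝ) ^ 2 = ‖(M : ℂ) ^ 2‖ := by simp
  rw [h1, ← norm_mul, sum_Icc_eq_completion]
  refine (norm_sum_le _ _).trans (Finset.sum_le_sum fun u _ => ?_)
  refine (norm_sum_le _ _).trans (Finset.sum_le_sum fun v _ => ?_)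
  rw [norm_mul, norm_mul]
  have := freqBound_nonneg N M u.valMinAbs
  gcongr <;> exact norm_sum_Icc_stdAddChar_le N _

/-- The sum of the reciprocals of the first `n` positive integers, as a real number. -/
noncomputable def harmonicSum (n : ℕ) : ℝ := ∑ i ∈ Finset.Icc 1 n, 1 / (i : ℝ)

theorem harmonicSum_mono {m n : ℕ} (h : m ≤ n) : harmonicSum m ≤ harmonicSum n :=
  Finset.sum_le_sum_of_subset_of_nonneg (Finset.Icc_subset_Icc_right h)
    fun _ _ _ => by positivity

theorem harmonicSum_nonneg (n : ℕ) : 0 ≤ harmonicSum n :=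
  Finset.sum_nonneg fun _ _ => by positivity

theorem sum_mul_comp_le {α β : Type*} [Fintype α] [Fintype β] [DecidableEq β] (π : α → β)
    {F : α → ℝ} {B : ℝ} (hB : ∀ w, ∑ u ∈ Finset.univ.filter (fun u => π u = w), F u ≤ B)
    {h : β → ℝ} (hh : ∀ w, 0 ≤ h w) : ∑ u, F u * h (π u) ≤ B * ∑ w, h w := by
  rw [← Finset.sum_fiberwise (s := Finset.univ) (g := π), Finset.mul_sum]
  refine Finset.sum_le_sum fun w _ => ?_
  calc ∑ u ∈ Finset.univ.filter (fun u => π u = w), F u * h (π u)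
      = (∑ u ∈ Finset.univ.filter (fun u => π u = w), F u) * h w := by
        rw [Finset.sum_mul]
        refine Finset.sum_congr rfl fun u hu => ?_
        rw [(Finset.mem_filter.1 hu).2]
    _ ≤ B * h w := mul_le_mul_of_nonneg_right (hB w) (hh w)

theorem sum_sum_mul_comp_le {α β : Type*} [Fintype α] [Fintype β] [DecidableEq β] (π : α → β)
    {F : α → ℝ} {B : ℝ} (hF : ∀ u, 0 ≤ F u) (hB0 : 0 ≤ B)
    (hB : ∀ w, ∑ u ∈ Finset.univ.filter (fun u => π u = w), F u ≤ B)
    {h : β → β → ℝ} (hh : ∀ w z, 0 ≤ h w z) :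
    ∑ u, ∑ v, F u * F v * h (π u) (π v) ≤ B ^ 2 * ∑ w, ∑ z, h w z := by
  calc ∑ u, ∑ v, F u * F v * h (π u) (π v) = ∑ u, F u * ∑ v, F v * h (π u) (π v) := by
        simp only [Finset.mul_sum, mul_assoc]
    _ ≤ ∑ u, F u * (B * ∑ z, h (π u) z) := by
        refine Finset.sum_le_sum fun u _ => mul_le_mul_of_nonneg_left ?_ (hF u)
        exact sum_mul_comp_le π hB (h := h (π u)) (hh _)
    _ ≤ B * ∑ w, (B * ∑ z, h w z) :=
        sum_mul_comp_le π hB (h := fun w => B * ∑ z, h w z)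
          fun w => mul_nonneg hB0 (Finset.sum_nonneg fun z _ => hh w z)
    _ = B ^ 2 * ∑ w, ∑ z, h w z := by rw [← Finset.mul_sum]; ring

theorem sum_freqBound_filter_le (N : ℕ) {M d e : ℕ} [NeZero M] (hM : M = d * e) (w : ZMod d) :
    ∑ u ∈ Finset.univ.filter (fun u : ZMod M => ((u.valMinAbs : ℤ) : ZMod d) = w),
      freqBound N M u.valMinAbs ≤ 2 * N + e * harmonicSum e := by
  have hM0 : M ≠ 0 := NeZero.ne M
  have hd : 0 < d := Nat.pos_of_ne_zero fun h => hM0 (by rw [hM, h, zero_mul])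
  have he : 0 < e := Nat.pos_of_ne_zero fun h => hM0 (by rw [hM, h, mul_zero])
  have hdR : (0 : ℝ) < d := by exact_mod_cast hd
  set β : ℤ → ℝ := fun t => if t = 0 ∨ t = -1 then (N : ℝ) else
    if 0 < t then e / (2 * (t : ℝ)) else e / (2 * (-(t : ℝ) - 1)) with hβ
  have hβ0 : ∀ t, 0 ≤ β t := by
    intro t
    simp only [hβ]
    split_ifs with h1 h2
    · positivity
    · have : (0 : ℝ) < t := by exact_mod_cast h2
      positivity
    · have : (t : ℝ) ≤ -1 := by
        have : t ≤ -1 := by omega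
        exact_mod_cast this
      exact div_nonneg (by positivity) (by linarith)
  have hle : ∀ j : ℤ, freqBound N M j ≤ β (j / d) := by
    intro j
    have hj := Int.mul_ediv_add_emod j d
    have hj1 := Int.emod_nonneg j (b := d) (by omega)
    have hj2 := Int.emod_lt_of_pos j (b := d) (by omega)
    set t := j / (d : ℤ) with ht
    simp only [hβ]
    split_ifs with h1 h2
    · exact freqBound_le N M j
    · have h3 : (d : ℤ) * t ≤ j := by omega
      have h3R : (d : ℝ) * t ≤ j := by exact_mod_cast h3
      have h4 : (0 : ℝ) < t := by exact_mod_cast h2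
      have h5 : (0 : ℝ) < d * t := by positivity
      have h6 : j ≠ 0 := by
        rintro rfl
        have : (0 : ℤ) < d * t := by positivity
        omega
      refine (freqBound_le_div N M h6).trans ?_
      have h7 : (0 : ℝ) < j := by linarith
      rw [abs_of_pos h7, div_le_div_iff₀ (by positivity) (by positivity), hM]
      push_cast
      nlinarith [mul_le_mul_of_nonneg_left h3R (by positivity : (0 : ℝ) ≤ 2 * e)]
    · have h3 : (d : ℤ) * (-t - 1) ≤ -j := by
        have : (d : ℤ) * (-t - 1) = -(d * t) - d := by ring
        omega
      have h3R : (d : ℝ) * (-t - 1) ≤ -j := by exact_mod_cast h3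
      have h4 : (0 : ℝ) < -t - 1 := by
        have : (0 : ℤ) < -t - 1 := by omega
        exact_mod_cast this
      have h5 : (0 : ℝ) < d * (-t - 1) := by positivity
      have h7 : (j : ℝ) < 0 := by linarith
      have h6 : j ≠ 0 := by
        rintro rfl
        simp at h7
      refine (freqBound_le_div N M h6).trans ?_
      rw [abs_of_neg h7, div_le_div_iff₀ (by linarith) (by linarith), hM]
      push_cast
      nlinarith [mul_le_mul_of_nonneg_left h3R (by positivity : (0 : ℝ) ≤ 2 * e)]
  set S := Finset.univ.filter (fun u : ZMod M => ((u.valMinAbs : ℤ) : ZMod d) = w) with hS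
  have hinj : Set.InjOn (fun u : ZMod M => (u.valMinAbs : ℤ) / (d : ℤ)) S := by
    intro u hu v hv huv
    simp only [hS, Finset.coe_filter, Finset.mem_univ, true_and] at hu hv
    have h1 : ((u.valMinAbs : ℤ) : ZMod d) = (v.valMinAbs : ℤ) := hu.trans hv.symm
    rw [ZMod.intCast_eq_intCast_iff] at h1
    have h2 : u.valMinAbs = v.valMinAbs := by
      rw [← Int.mul_ediv_add_emod u.valMinAbs d, ← Int.mul_ediv_add_emod v.valMinAbs d]
      dsimp only at huv
      rw [huv, h1]
    exact ZMod.valMinAbs_inj.1 h2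
  have hmem : ∀ u ∈ S, (u.valMinAbs : ℤ) / (d : ℤ) ∈ Finset.Icc (-(e : ℤ) - 1) e := by
    intro u _
    have h1 := u.valMinAbs_mem_Ioc
    have h2 : (M : ℤ) = d * e := by exact_mod_cast hM
    have hj := Int.mul_ediv_add_emod u.valMinAbs d
    have hj1 := Int.emod_nonneg u.valMinAbs (b := d) (by omega)
    have hj2 := Int.emod_lt_of_pos u.valMinAbs (b := d) (by omega)
    set t := u.valMinAbs / (d : ℤ) with ht
    have hd' : (0 : ℤ) < d := by exact_mod_cast hd
    rw [Finset.mem_Icc]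
    have h3 := h1.1
    have h4 := h1.2
    constructor
    · by_contra! h
      nlinarith
    · by_contra! h
      nlinarith
  calc ∑ u ∈ S, freqBound N M u.valMinAbs ≤ ∑ u ∈ S, β (u.valMinAbs / (d : ℤ)) :=
        Finset.sum_le_sum fun u _ => hle _
    _ = ∑ t ∈ S.image (fun u : ZMod M => (u.valMinAbs : ℤ) / (d : ℤ)), β t :=
        (Finset.sum_image hinj).symm
    _ ≤ ∑ t ∈ Finset.Icc (-(e : ℤ) - 1) e, β t :=
        Finset.sum_le_sum_of_subset_of_nonneg (Finset.image_subset_iff.2 hmem)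
          fun t _ _ => hβ0 t
    _ = ∑ t ∈ {0, -1} ∪ (Finset.Icc 1 e).image (fun i : ℕ => (i : ℤ)) ∪
          (Finset.Icc 1 e).image (fun i : ℕ => -(i : ℤ) - 1), β t := by
        congr 1
        ext t
        simp only [Finset.mem_Icc, Finset.mem_union, Finset.mem_insert, Finset.mem_singleton,
          Finset.mem_image]
        constructor
        · rintro ⟨h1, h2⟩
          by_cases h3 : t = 0 ∨ t = -1
          · exact Or.inl (Or.inl h3)
          · by_cases h4 : 0 < t
            · exact Or.inl (Or.inr ⟨t.toNat, by omega, by omega⟩)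
            · exact Or.inr ⟨(-t - 1).toNat, by omega, by omega⟩
        · rintro ((h | ⟨i, hi, rfl⟩) | ⟨i, hi, rfl⟩) <;> omega
    _ = 2 * N + e * harmonicSum e := by
        rw [Finset.sum_union, Finset.sum_union, Finset.sum_image, Finset.sum_image,
          Finset.sum_pair (by norm_num)]
        · have e1 : ∀ i ∈ Finset.Icc 1 e, β (i : ℤ) = e / 2 * (1 / (i : ℝ)) := by
            intro i hi
            rw [Finset.mem_Icc] at hi
            simp only [hβ]
            rw [if_neg (by omega), if_pos (by omega)]
            have : (i : ℝ) ≠ 0 := by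
              have : i ≠ 0 := by omega
              exact_mod_cast this
            push_cast
            field_simp
          have e2 : ∀ i ∈ Finset.Icc 1 e, β (-(i : ℤ) - 1) = e / 2 * (1 / (i : ℝ)) := by
            intro i hi
            rw [Finset.mem_Icc] at hi
            simp only [hβ]
            rw [if_neg (by omega), if_neg (by omega)]
            have : (i : ℝ) ≠ 0 := by
              have : i ≠ 0 := by omega
              exact_mod_cast this
            push_cast
            have h3 : (-(-(i : ℝ) - 1) - 1) = i := by ring
            rw [h3]
            field_simp
          rw [Finset.sum_congr rfl e1, Finset.sum_congr rfl e2, ← Finset.mul_sum]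
          simp only [hβ, harmonicSum]
          simp
          ring
        · intro i _ j _ h
          simpa using h
        · intro i _ j _ h
          simpa using h
        · rw [Finset.disjoint_left]
          simp only [Finset.mem_insert, Finset.mem_singleton, Finset.mem_image, Finset.mem_Icc]
          rintro t h ⟨i, hi, rfl⟩
          omega
        · rw [Finset.disjoint_left]
          simp only [Finset.mem_union, Finset.mem_insert, Finset.mem_singleton, Finset.mem_image,
            Finset.mem_Icc]
          rintro t (h | ⟨i, hi, rfl⟩) ⟨j, hj, h'⟩ <;> omega

theorem sum_freqBound_le (N M : ℕ) [NeZero M] :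
    ∑ u : ZMod M, freqBound N M u.valMinAbs ≤ 2 * N + M * harmonicSum M := by
  refine le_trans (le_of_eq ?_) (sum_freqBound_filter_le N (one_mul M).symm 0)
  rw [Finset.filter_true_of_mem]
  intro u _
  exact Subsingleton.elim _ _

theorem norm_sum_fermatInd_mul_le_completion {a Q : ℕ} [NeZero a] [NeZero Q] (h : a.Coprime Q)
    (N : ℕ) (k : ℤ) (g : ZMod Q → ZMod Q → ℂ) :
    ∃ (ψ₁ : AddChar (ZMod a) ℂ) (ψ₂ : AddChar (ZMod Q) ℂ), ψ₁.IsPrimitive ∧ ψ₂.IsPrimitive ∧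
    ‖∑ x ∈ Finset.Icc 1 N, ∑ y ∈ Finset.Icc 1 N, fermatInd a k (x : ZMod a) (y : ZMod a) *
      g (x : ZMod Q) (y : ZMod Q)‖ ≤ 1 / ((a * Q : ℕ) : ℝ) ^ 2 *
      ∑ u : ZMod (a * Q), ∑ v : ZMod (a * Q),
        freqBound N (a * Q) u.valMinAbs * freqBound N (a * Q) v.valMinAbs *
        (‖pairSum ψ₁ (fermatInd a k) (u.valMinAbs : ℤ) (v.valMinAbs : ℤ)‖ *
         ‖pairSum ψ₂ g (u.valMinAbs : ℤ) (v.valMinAbs : ℤ)‖) := by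
  obtain ⟨ψ₁, ψ₂, h1, h2, h3⟩ := exists_primitive_split h (ZMod.isPrimitive_stdAddChar (a * Q))
  refine ⟨ψ₁, ψ₂, h1, h2, ?_⟩
  have := norm_sum_Icc_le_completion (M := a * Q) N (fun x y =>
    fermatInd a k (ZMod.chineseRemainder h x).1 (ZMod.chineseRemainder h y).1 *
      g (ZMod.chineseRemainder h x).2 (ZMod.chineseRemainder h y).2)
  simp only [map_natCast, Prod.fst_natCast, Prod.snd_natCast] at this
  refine this.trans (le_of_eq ?_)
  congr 1
  refine Finset.sum_congr rfl fun u _ => Finset.sum_congr rfl fun v _ => ?_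
  congr 1
  rw [pairSum_mul h h3, norm_mul]
  have hu : ∀ w : ZMod (a * Q), ZMod.chineseRemainder h w =
      (((w.valMinAbs : ℤ) : ZMod a), ((w.valMinAbs : ℤ) : ZMod Q)) := by
    intro w
    conv_lhs => rw [← ZMod.coe_valMinAbs w]
    rw [map_intCast]
    rfl
  rw [hu u, hu v]

/-- The weight `1 / max 1 |j|`. -/
noncomputable def invWeight (j : ℤ) : ℝ := 1 / max 1 |(j : ℝ)|

theorem invWeight_nonneg (j : ℤ) : 0 ≤ invWeight j := by
  rw [invWeight]; positivity

theorem invWeight_of_ne_zero {j : ℤ} (hj : j ≠ 0) : invWeight j = 1 / |(j : ℝ)| := by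
  rw [invWeight, max_eq_right]
  exact_mod_cast Int.one_le_abs hj

/-- The average of `gcd (m, j ^ 3 - l ^ 3)` over distinct `j`, `l` with logarithmic weights. -/
noncomputable def gcdSum (R m : ℕ) : ℝ :=
  ∑ j ∈ Finset.Icc (-(R : ℤ)) R, ∑ l ∈ Finset.Icc (-(R : ℤ)) R, if j = l then 0 else
    invWeight j * invWeight l * Nat.gcd m (j ^ 3 - l ^ 3).natAbs

theorem freqBound_mul_le {N M : ℕ} {B : ℝ} (h1 : (N : ℝ) * M ≤ 2 * B) (h2 : (M : ℝ) ^ 2 ≤ 4 * B)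
    {j l : ℤ} (h : j ≠ l) :
    freqBound N M j * freqBound N M l ≤ B * (invWeight j * invWeight l) := by
  have key : ∀ j : ℤ, j ≠ 0 → freqBound N M j ≤ M / 2 * invWeight j := by
    intro j hj
    refine (freqBound_le_div N M hj).trans (le_of_eq ?_)
    rw [invWeight_of_ne_zero hj]
    have : (j : ℝ) ≠ 0 := by exact_mod_cast hj
    field_simp
  have h0 : invWeight 0 = 1 := by simp [invWeight]
  have hf := freqBound_nonneg N M
  have hw := invWeight_nonneg
  by_cases hj : j = 0
  · subst hj
    have hl : l ≠ 0 := Ne.symm h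
    calc freqBound N M 0 * freqBound N M l ≤ N * (M / 2 * invWeight l) :=
          mul_le_mul (freqBound_le _ _ _) (key l hl) (hf _) (by positivity)
      _ ≤ _ := by
          rw [h0]
          nlinarith [mul_le_mul_of_nonneg_right h1 (hw l)]
  · by_cases hl : l = 0
    · subst hl
      calc freqBound N M j * freqBound N M 0 ≤ (M / 2 * invWeight j) * N :=
            mul_le_mul (key j hj) (freqBound_le _ _ _) (hf _)
              (mul_nonneg (by positivity) (hw j))
        _ ≤ _ := by
            rw [h0]
            nlinarith [mul_le_mul_of_nonneg_right h1 (hw j)]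
    · calc freqBound N M j * freqBound N M l ≤ (M / 2 * invWeight j) * (M / 2 * invWeight l) :=
            mul_le_mul (key j hj) (key l hl) (hf _) (mul_nonneg (by positivity) (hw j))
        _ ≤ _ := by
            nlinarith [mul_le_mul_of_nonneg_right h2 (mul_nonneg (hw j) (hw l))]

theorem sum_sum_ne_le_gcdSum {M R : ℕ} [NeZero M] (hR : M ≤ 2 * R) (m : ℕ) :
    ∑ u : ZMod M, ∑ v : ZMod M, (if u = v then 0 else
      invWeight u.valMinAbs * invWeight v.valMinAbs *
        (Nat.gcd m (u.valMinAbs ^ 3 - v.valMinAbs ^ 3).natAbs : ℝ)) ≤ gcdSum R m := by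
  have hmem : ∀ u : ZMod M, u.valMinAbs ∈ Finset.Icc (-(R : ℤ)) R := by
    intro u
    have h1 := u.valMinAbs_mem_Ioc
    have h3 := h1.1
    have h4 := h1.2
    rw [Finset.mem_Icc]
    constructor <;> omega
  have hinj : Function.Injective (fun u : ZMod M => u.valMinAbs) := fun u v h =>
    ZMod.valMinAbs_inj.1 h
  have key : ∀ f : ℤ → ℝ, (∀ j, 0 ≤ f j) →
      ∑ u : ZMod M, f u.valMinAbs ≤ ∑ j ∈ Finset.Icc (-(R : ℤ)) R, f j := by
    intro f hf
    rw [← Finset.sum_image (s := Finset.univ) (g := fun u : ZMod M => u.valMinAbs) (f := f)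
      hinj.injOn]
    exact Finset.sum_le_sum_of_subset_of_nonneg (Finset.image_subset_iff.2 fun u _ => hmem u)
      fun j _ _ => hf j
  have hnn : ∀ j l : ℤ, 0 ≤ if j = l then (0 : ℝ) else
      invWeight j * invWeight l * Nat.gcd m (j ^ 3 - l ^ 3).natAbs := by
    intro j l
    split_ifs
    · exact le_rfl
    · exact mul_nonneg (mul_nonneg (invWeight_nonneg _) (invWeight_nonneg _)) (by positivity)
  calc _ = ∑ u : ZMod M, ∑ v : ZMod M, (if u.valMinAbs = v.valMinAbs then (0 : ℝ) else
      invWeight u.valMinAbs * invWeight v.valMinAbs *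
        Nat.gcd m (u.valMinAbs ^ 3 - v.valMinAbs ^ 3).natAbs) := by
        simp only [ZMod.valMinAbs_inj]
    _ ≤ ∑ u : ZMod M, ∑ l ∈ Finset.Icc (-(R : ℤ)) R, (if u.valMinAbs = l then (0 : ℝ) else
      invWeight u.valMinAbs * invWeight l * Nat.gcd m (u.valMinAbs ^ 3 - l ^ 3).natAbs) :=
        Finset.sum_le_sum fun u _ => key (fun l => if u.valMinAbs = l then (0 : ℝ) else
          invWeight u.valMinAbs * invWeight l * Nat.gcd m (u.valMinAbs ^ 3 - l ^ 3).natAbs)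
          (hnn _)
    _ ≤ gcdSum R m := key (fun j => ∑ l ∈ Finset.Icc (-(R : ℤ)) R, (if j = l then (0 : ℝ) else
      invWeight j * invWeight l * Nat.gcd m (j ^ 3 - l ^ 3).natAbs))
          fun j => Finset.sum_nonneg fun l _ => hnn j l

set_option maxHeartbeats 3200000 in
theorem norm_sum_fermatInd_mul_le {m q Q N R : ℕ} [NeZero m] [NeZero q] [NeZero Q] {k : ℤ}
    (h : m.Coprime q) (hs : Squarefree m) (hc : IsCoprime ((m * q : ℕ) : ℤ) (6 * k))
    (hQ : (m * q).Coprime Q) (ha : m * q ≤ 2 * N) (hQN : Q ≤ N) (hR : m * q * Q ≤ 2 * R)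
    {T : ℝ} (hT : 1 ≤ T) (hd : ((m * q).divisors.card : ℝ) ≤ T)
    (hH : harmonicSum (m * q * Q) ≤ T) (g : ZMod Q → ZMod Q → ℂ) (hg1 : ∀ x y, ‖g x y‖ ≤ 1)
    (hg2 : ∀ (ψ : AddChar (ZMod Q) ℂ), ψ.IsPrimitive →
      ∀ u : ZMod Q, ‖pairSum ψ g u u‖ ≤ 25 * Q) :
    ‖∑ x ∈ Finset.Icc 1 N, ∑ y ∈ Finset.Icc 1 N, fermatInd (m * q) k (x : ZMod (m * q)) y *
      g x y‖ ≤ T ^ 7 * (1 / (m * √q)) * (100 * (N ^ 2 / √Q) + 8 * (N * √N * Q) +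
        N * √N * Q * gcdSum R m) := by
  have hm0 : 0 < m := NeZero.pos m
  have hq0 : 0 < q := NeZero.pos q
  have hQ0 : 0 < Q := NeZero.pos Q
  have hN0 : 0 < N := by omega
  set a := m * q with hadef
  have ha0 : 0 < a := Nat.mul_pos hm0 hq0
  have : NeZero a := ⟨ha0.ne'⟩
  obtain ⟨ψ₁, ψ₂, h₁, h₂, hle⟩ := norm_sum_fermatInd_mul_le_completion hQ N k g
  refine hle.trans ?_
  clear hle
  set M := a * Q with hM
  set F : ZMod M → ℝ := fun u => freqBound N M u.valMinAbs with hF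
  have hF0 : ∀ u, 0 ≤ F u := fun u => freqBound_nonneg _ _ _
  have hFN : ∀ u, F u ≤ N := fun u => freqBound_le _ _ _
  set S : ZMod a → ZMod a → ℝ := fun u v => ‖pairSum ψ₁ (fermatInd a k) u v‖ with hS
  set G : ZMod Q → ZMod Q → ℝ := fun u v => ‖pairSum ψ₂ g u v‖ with hG
  set α : ZMod M → ZMod a := fun u => (u.valMinAbs : ℤ) with hα
  set β : ZMod M → ZMod Q := fun u => (u.valMinAbs : ℤ) with hβ
  have hS0 : ∀ u v, 0 ≤ S u v := fun u v => norm_nonneg _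
  have hG0 : ∀ u v, 0 ≤ G u v := fun u v => norm_nonneg _
  change 1 / (M : ℝ) ^ 2 * ∑ u : ZMod M, ∑ v : ZMod M, F u * F v *
    (S (α u) (α v) * G (β u) (β v)) ≤ _
  have haR : (a : ℝ) = m * q := by rw [hadef]; push_cast; ring
  have hMR : (M : ℝ) = m * q * Q := by rw [hM]; push_cast; rw [haR]
  have haN : (a : ℝ) ≤ 2 * N := by exact_mod_cast ha
  have hQNR : (Q : ℝ) ≤ N := by exact_mod_cast hQN
  have hQ1 : (1 : ℝ) ≤ Q := by exact_mod_cast hQ0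
  have hN1 : (1 : ℝ) ≤ N := by exact_mod_cast hN0
  have hHQ : harmonicSum Q ≤ T :=
    (harmonicSum_mono (Nat.le_mul_of_pos_left Q ha0)).trans hH
  have hHa : harmonicSum a ≤ T :=
    (harmonicSum_mono (Nat.le_mul_of_pos_right a hQ0)).trans hH
  have hQp : (0 : ℝ) < Q := by linarith
  have hmp : (0 : ℝ) < m := by exact_mod_cast hm0
  have hqp : (0 : ℝ) < q := by exact_mod_cast hq0
  have hap : (0 : ℝ) < a := by exact_mod_cast ha0
  have hNp : (0 : ℝ) < N := by linarith
  have hMN : (M : ℝ) ≤ 2 * N * Q := by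
    rw [hMR, ← haR]
    exact mul_le_mul_of_nonneg_right haN hQp.le
  -- class sums
  have hclassQ : ∀ w : ZMod Q, ∑ u ∈ Finset.univ.filter (fun u => β u = w), F u ≤ 4 * N * T := by
    intro w
    refine (sum_freqBound_filter_le N (d := Q) (e := a) (by rw [hM, mul_comm]) w).trans ?_
    have : (a : ℝ) * harmonicSum a ≤ 2 * N * T :=
      mul_le_mul haN hHa (harmonicSum_nonneg _) (by positivity)
    nlinarith
  have hclassa : ∀ w : ZMod a, ∑ u ∈ Finset.univ.filter (fun u => α u = w), F u ^ 2 ≤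
      N * (3 * N * T) := by
    intro w
    have h1 := sum_freqBound_filter_le N (d := a) (e := Q) hM w
    have h2 : (Q : ℝ) * harmonicSum Q ≤ N * T :=
      mul_le_mul hQNR hHQ (harmonicSum_nonneg _) (by positivity)
    calc ∑ u ∈ Finset.univ.filter (fun u => α u = w), F u ^ 2
        ≤ ∑ u ∈ Finset.univ.filter (fun u => α u = w), N * F u := by
          refine Finset.sum_le_sum fun u _ => ?_
          rw [sq]
          exact mul_le_mul_of_nonneg_right (hFN u) (hF0 u)
      _ = N * ∑ u ∈ Finset.univ.filter (fun u => α u = w), F u := by rw [Finset.mul_sum]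
      _ ≤ N * (3 * N * T) := by
          refine mul_le_mul_of_nonneg_left (h1.trans ?_) hNp.le
          nlinarith
  have hFsq : ∑ u, F u ^ 2 ≤ N * (4 * N * Q * T) := by
    calc ∑ u, F u ^ 2 ≤ ∑ u, N * F u := by
          refine Finset.sum_le_sum fun u _ => ?_
          rw [sq]
          exact mul_le_mul_of_nonneg_right (hFN u) (hF0 u)
      _ = N * ∑ u, F u := by rw [Finset.mul_sum]
      _ ≤ N * (4 * N * Q * T) := by
          refine mul_le_mul_of_nonneg_left ((sum_freqBound_le N M).trans ?_) hNp.le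
          have : (M : ℝ) * harmonicSum M ≤ 2 * N * Q * T :=
            mul_le_mul hMN hH (harmonicSum_nonneg _) (by positivity)
          have h3 : (N : ℝ) * 1 ≤ N * (Q * T) :=
            mul_le_mul_of_nonneg_left (by nlinarith) hNp.le
          nlinarith
  -- the diagonal
  have hD5 : ∑ w, S w w ^ 2 ≤ T ^ 4 * (a : ℝ) ^ 2 * q := by
    refine (sum_norm_sq_pairSum_fermatInd_diag_le h hs hc h₁).trans ?_
    rw [haR]
    gcongr
  set r := √(q : ℝ) with hr
  set t := √(Q : ℝ) with ht
  set n := √(N : ℝ) with hn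
  have hr2 : (q : ℝ) = r ^ 2 := (Real.sq_sqrt hqp.le).symm
  have ht2 : (Q : ℝ) = t ^ 2 := (Real.sq_sqrt hQp.le).symm
  have hn2 : (N : ℝ) = n ^ 2 := (Real.sq_sqrt hNp.le).symm
  have hrp : 0 < r := Real.sqrt_pos.2 hqp
  have htp : 0 < t := Real.sqrt_pos.2 hQp
  have hnp : 0 < n := Real.sqrt_pos.2 hNp
  have hX0 : ∑ u, F u ^ 2 * S (α u) (α u) ≤ 4 * N ^ 2 * T ^ 3 * a * r * t := by
    have h1 := Finset.sum_mul_sq_le_sq_mul_sq Finset.univ F (fun u => F u * S (α u) (α u))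
    have h2 : ∑ u, (F u * S (α u) (α u)) ^ 2 ≤ N * (3 * N * T) * (T ^ 4 * (a : ℝ) ^ 2 * q) := by
      have h3 := sum_mul_comp_le α hclassa (h := fun w => S w w ^ 2) (fun w => by positivity)
      simp only [mul_pow]
      exact h3.trans (mul_le_mul_of_nonneg_left hD5 (by positivity))
    have h4 : (∑ u, F u * (F u * S (α u) (α u))) ^ 2 ≤ (4 * N ^ 2 * T ^ 3 * a * r * t) ^ 2 := by
      refine h1.trans ?_
      refine (mul_le_mul hFsq h2 (Finset.sum_nonneg fun u _ => by positivity)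
        (by positivity)).trans ?_
      have : (4 * (N : ℝ) ^ 2 * T ^ 3 * a * r * t) ^ 2 =
        16 * (N ^ 4 * T ^ 6 * a ^ 2 * q * Q) := by
        rw [hr2, ht2]; ring
      rw [this]
      have h5 : 0 ≤ (N : ℝ) ^ 4 * T ^ 6 * a ^ 2 * q * Q := by positivity
      calc (N : ℝ) * (4 * N * Q * T) * (N * (3 * N * T) * (T ^ 4 * (a : ℝ) ^ 2 * q)) =
            12 * (N ^ 4 * T ^ 6 * a ^ 2 * q * Q) := by ring
        _ ≤ _ := by linarith
    have h5 := (sq_le_sq₀ (Finset.sum_nonneg fun u _ => mul_nonneg (hF0 u)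
      (mul_nonneg (hF0 u) (hS0 _ _))) (by positivity)).1 h4
    refine le_trans (le_of_eq ?_) h5
    refine Finset.sum_congr rfl fun u _ => by ring
  have hX1 : ∑ u, F u * F u * (S (α u) (α u) * G (β u) (β u)) ≤
      25 * Q * (4 * N ^ 2 * T ^ 3 * a * r * t) := by
    refine le_trans ?_ (mul_le_mul_of_nonneg_left hX0 (by positivity))
    rw [Finset.mul_sum]
    refine Finset.sum_le_sum fun u _ => ?_
    have h1 : G (β u) (β u) ≤ 25 * Q := hg2 ψ₂ h₂ (β u)
    have h2 : 0 ≤ F u ^ 2 * S (α u) (α u) := mul_nonneg (sq_nonneg _) (hS0 _ _)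
    calc F u * F u * (S (α u) (α u) * G (β u) (β u)) =
          F u ^ 2 * S (α u) (α u) * G (β u) (β u) := by ring
      _ ≤ F u ^ 2 * S (α u) (α u) * (25 * Q) := mul_le_mul_of_nonneg_left h1 h2
      _ = 25 * Q * (F u ^ 2 * S (α u) (α u)) := by ring
  -- the terms off the diagonal
  have hX2 : ∑ u, ∑ v, (if u = v then 0 else F u * F v * S (α u) (α v) ^ 2) ≤
      N * a * Q ^ 2 * (T ^ 7 * m * q ^ 2) * gcdSum R m := by
    have h1 := mul_le_mul_of_nonneg_left (sum_sum_ne_le_gcdSum hR m)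
      (show 0 ≤ (N : ℝ) * a * Q ^ 2 * (T ^ 7 * m * q ^ 2) by positivity)
    refine le_trans ?_ h1
    rw [Finset.mul_sum]
    refine Finset.sum_le_sum fun u _ => ?_
    rw [Finset.mul_sum]
    refine Finset.sum_le_sum fun v _ => ?_
    split_ifs with huv
    · simp
    · have h2 : F u * F v ≤ N * a * Q ^ 2 * (invWeight u.valMinAbs * invWeight v.valMinAbs) := by
        refine freqBound_mul_le ?_ ?_ fun h => huv (ZMod.valMinAbs_inj.1 h)
        · rw [hMR, ← haR]
          calc (N : ℝ) * (a * Q) = (N : ℝ) * a * Q * 1 := by ring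
            _ ≤ (N : ℝ) * a * Q * (2 * Q) :=
              mul_le_mul_of_nonneg_left (by linarith) (by positivity)
            _ = 2 * ((N : ℝ) * a * Q ^ 2) := by ring
        · rw [hMR, ← haR]
          calc ((a : ℝ) * Q) ^ 2 = (a : ℝ) * Q ^ 2 * a := by ring
            _ ≤ (a : ℝ) * Q ^ 2 * (2 * N) := mul_le_mul_of_nonneg_left haN (by positivity)
            _ ≤ (a : ℝ) * Q ^ 2 * (4 * N) :=
              mul_le_mul_of_nonneg_left (by linarith) (by positivity)
            _ = 4 * ((N : ℝ) * a * Q ^ 2) := by ring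
      have h3 : S (α u) (α v) ^ 2 ≤ T ^ 7 * m * q ^ 2 *
          Nat.gcd m (u.valMinAbs ^ 3 - v.valMinAbs ^ 3).natAbs := by
        refine (norm_sq_pairSum_fermatInd_le h hs hc h₁ u.valMinAbs v.valMinAbs).trans ?_
        refine mul_le_mul_of_nonneg_right ?_ (Nat.cast_nonneg _)
        exact mul_le_mul_of_nonneg_right (mul_le_mul_of_nonneg_right
          (pow_le_pow_left₀ (Nat.cast_nonneg _) hd 7) hmp.le) (by positivity)
      calc F u * F v * S (α u) (α v) ^ 2 ≤ _ :=
            mul_le_mul h2 h3 (sq_nonneg _) (mul_nonneg (by positivity)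
              (mul_nonneg (invWeight_nonneg _) (invWeight_nonneg _)))
        _ = _ := by ring
  have hX3 : ∑ u, ∑ v, F u * F v * G (β u) (β v) ^ 2 ≤ (4 * N * T) ^ 2 * (Q : ℝ) ^ 4 := by
    refine (sum_sum_mul_comp_le β hF0 (by positivity) hclassQ (h := fun w z => G w z ^ 2)
      fun w z => sq_nonneg _).trans ?_
    refine mul_le_mul_of_nonneg_left ?_ (by positivity)
    have h1 := sum_norm_sq_pairSum h₂ g
    have h2 : ∑ x, ∑ y, ‖g x y‖ ^ 2 ≤ (Q : ℝ) ^ 2 := by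
      calc ∑ x, ∑ y, ‖g x y‖ ^ 2 ≤ ∑ x : ZMod Q, ∑ y : ZMod Q, (1 : ℝ) :=
            Finset.sum_le_sum fun x _ => Finset.sum_le_sum fun y _ =>
              pow_le_one₀ (norm_nonneg _) (hg1 x y)
        _ = (Q : ℝ) ^ 2 := by simp [ZMod.card, sq]
    calc ∑ w, ∑ z, G w z ^ 2 = (Q : ℝ) ^ 2 * ∑ x, ∑ y, ‖g x y‖ ^ 2 := h1
      _ ≤ (Q : ℝ) ^ 2 * (Q : ℝ) ^ 2 := mul_le_mul_of_nonneg_left h2 (by positivity)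
      _ = _ := by ring
  set l : ℝ := n * Q / (a * r) with hl
  have hlp : 0 < l := by positivity
  have hsplit : ∑ u : ZMod M, ∑ v : ZMod M, F u * F v * (S (α u) (α v) * G (β u) (β v)) ≤
      (∑ u, F u * F u * (S (α u) (α u) * G (β u) (β u))) +
      l / 2 * (∑ u, ∑ v, (if u = v then 0 else F u * F v * S (α u) (α v) ^ 2)) +
      1 / (2 * l) * ∑ u, ∑ v, F u * F v * G (β u) (β v) ^ 2 := by
    have h1 : ∑ u, F u * F u * (S (α u) (α u) * G (β u) (β u)) = ∑ u, ∑ v,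
        if u = v then F u * F v * (S (α u) (α v) * G (β u) (β v)) else 0 := by
      refine Finset.sum_congr rfl fun u _ => ?_
      rw [Finset.sum_ite_eq]
      simp
    rw [h1]
    simp only [Finset.mul_sum, ← Finset.sum_add_distrib]
    refine Finset.sum_le_sum fun u _ => Finset.sum_le_sum fun v _ => ?_
    have h2 : 0 ≤ F u * F v := mul_nonneg (hF0 _) (hF0 _)
    split_ifs with huv
    · have : 0 ≤ 1 / (2 * l) * (F u * F v * G (β u) (β v) ^ 2) := by positivity
      linarith
    · have h3 : S (α u) (α v) * G (β u) (β v) ≤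
          l / 2 * S (α u) (α v) ^ 2 + 1 / (2 * l) * G (β u) (β v) ^ 2 := by
        have h4 : l / 2 * S (α u) (α v) ^ 2 + 1 / (2 * l) * G (β u) (β v) ^ 2 -
          S (α u) (α v) * G (β u) (β v) =
            1 / (2 * l) * (l * S (α u) (α v) - G (β u) (β v)) ^ 2 := by
          field_simp
          ring
        have h5 : 0 ≤ 1 / (2 * l) * (l * S (α u) (α v) - G (β u) (β v)) ^ 2 := by positivity
        linarith
      calc F u * F v * (S (α u) (α v) * G (β u) (β v)) ≤ F u * F v *
            (l / 2 * S (α u) (α v) ^ 2 + 1 / (2 * l) * G (β u) (β v) ^ 2) :=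
            mul_le_mul_of_nonneg_left h3 h2
        _ = _ := by ring
  have hgs : 0 ≤ gcdSum R m := by
    refine Finset.sum_nonneg fun j _ => Finset.sum_nonneg fun i _ => ?_
    split_ifs
    · exact le_rfl
    · exact mul_nonneg (mul_nonneg (invWeight_nonneg _) (invWeight_nonneg _)) (by positivity)
  have hT3 : T ^ 3 ≤ T ^ 7 := pow_le_pow_right₀ hT (by norm_num)
  have hT2 : T ^ 2 ≤ T ^ 7 := pow_le_pow_right₀ hT (by norm_num)
  calc _ ≤ 1 / (M : ℝ) ^ 2 * (25 * Q * (4 * N ^ 2 * T ^ 3 * a * r * t) +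
        l / 2 * (N * a * Q ^ 2 * (T ^ 7 * m * q ^ 2) * gcdSum R m) +
        1 / (2 * l) * ((4 * N * T) ^ 2 * (Q : ℝ) ^ 4)) := by
        refine mul_le_mul_of_nonneg_left (hsplit.trans ?_) (by positivity)
        gcongr
    _ = T ^ 3 * (1 / (m * r)) * (100 * (N ^ 2 / t)) + T ^ 2 * (1 / (m * r)) * (8 * (N * n * Q)) +
        T ^ 7 * (1 / (m * r)) * (N * n * Q * gcdSum R m) / 2 := by
        rw [hl, hMR, haR, hr2, ht2, hn2]
        field_simp
        ring
    _ ≤ T ^ 7 * (1 / (m * r)) * (100 * (N ^ 2 / t)) + T ^ 7 * (1 / (m * r)) * (8 * (N * n * Q)) +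
        T ^ 7 * (1 / (m * r)) * (N * n * Q * gcdSum R m) := by
        have : 0 ≤ T ^ 7 * (1 / (m * r)) * (N * n * Q * gcdSum R m) := by positivity
        have h1 : T ^ 3 * (1 / (m * r)) * (100 * (N ^ 2 / t)) ≤
          T ^ 7 * (1 / (m * r)) * (100 * (N ^ 2 / t)) := by gcongr
        have h2 : T ^ 2 * (1 / (m * r)) * (8 * (N * n * Q)) ≤
          T ^ 7 * (1 / (m * r)) * (8 * (N * n * Q)) := by gcongr
        linarith
    _ = _ := by ring

theorem sum_gcd_div_le {D : ℕ} (hD : D ≠ 0) (X : ℕ) :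
    ∑ m ∈ Finset.Icc 1 X, 1 / (m : ℝ) * Nat.gcd m D ≤ D.divisors.card * harmonicSum X := by
  calc ∑ m ∈ Finset.Icc 1 X, 1 / (m : ℝ) * Nat.gcd m D
      ≤ ∑ m ∈ Finset.Icc 1 X, ∑ g ∈ D.divisors, if g ∣ m then 1 / (m : ℝ) * g else 0 := by
        refine Finset.sum_le_sum fun m _ => ?_
        refine le_trans (le_of_eq ?_) (Finset.single_le_sum
          (f := fun g : ℕ => if g ∣ m then 1 / (m : ℝ) * g else 0) (fun g _ => ?_)
          (Nat.mem_divisors.2 ⟨Nat.gcd_dvd_right m D, hD⟩))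
        · rw [if_pos (Nat.gcd_dvd_left m D)]
        · split_ifs <;> positivity
    _ = ∑ g ∈ D.divisors, ∑ m ∈ Finset.Icc 1 X, if g ∣ m then 1 / (m : ℝ) * g else 0 :=
        Finset.sum_comm
    _ ≤ ∑ g ∈ D.divisors, harmonicSum X := by
        refine Finset.sum_le_sum fun g hg => ?_
        have hg0 : 0 < g := Nat.pos_of_mem_divisors hg
        have hgR : (g : ℝ) ≠ 0 := by exact_mod_cast hg0.ne'
        rw [← Finset.sum_filter]
        have h1 : (Finset.Icc 1 X).filter (fun m => g ∣ m) =
            (Finset.Icc 1 (X / g)).image (fun i => g * i) := by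
          ext m
          simp only [Finset.mem_filter, Finset.mem_Icc, Finset.mem_image]
          constructor
          · rintro ⟨⟨h1, h2⟩, i, rfl⟩
            refine ⟨i, ⟨Nat.pos_of_mul_pos_left h1, ?_⟩, rfl⟩
            rw [Nat.le_div_iff_mul_le hg0, mul_comm]
            exact h2
          · rintro ⟨i, ⟨h1, h2⟩, rfl⟩
            rw [Nat.le_div_iff_mul_le hg0, mul_comm] at h2
            exact ⟨⟨Nat.mul_pos hg0 h1, h2⟩, dvd_mul_right _ _⟩
        rw [h1, Finset.sum_image fun i _ j _ h => Nat.eq_of_mul_eq_mul_left hg0 h]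
        refine le_trans (le_of_eq ?_) (harmonicSum_mono (Nat.div_le_self X g))
        refine Finset.sum_congr rfl fun i _ => ?_
        push_cast
        rw [one_div, one_div, mul_inv, mul_right_comm, inv_mul_cancel₀ hgR, one_mul]
    _ = _ := by rw [Finset.sum_const, nsmul_eq_mul]

theorem sum_invWeight_le (R : ℕ) :
    ∑ j ∈ Finset.Icc (-(R : ℤ)) R, invWeight j ≤ 1 + 2 * harmonicSum R := by
  have h1 : Finset.Icc (-(R : ℤ)) R = {0} ∪ (Finset.Icc 1 R).image (fun i : ℕ => (i : ℤ)) ∪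
      (Finset.Icc 1 R).image (fun i : ℕ => -(i : ℤ)) := by
    ext t
    simp only [Finset.mem_Icc, Finset.mem_union, Finset.mem_singleton, Finset.mem_image]
    constructor
    · rintro ⟨h1, h2⟩
      rcases lt_trichotomy t 0 with h | h | h
      · exact Or.inr ⟨(-t).toNat, by omega, by omega⟩
      · exact Or.inl (Or.inl h)
      · exact Or.inl (Or.inr ⟨t.toNat, by omega, by omega⟩)
    · rintro ((h | ⟨i, hi, rfl⟩) | ⟨i, hi, rfl⟩) <;> omega
  have h2 : ∀ i ∈ Finset.Icc 1 R, invWeight (i : ℤ) = 1 / (i : ℝ) := by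
    intro i hi
    rw [Finset.mem_Icc] at hi
    rw [invWeight_of_ne_zero (by omega)]
    simp
  have h3 : ∀ i ∈ Finset.Icc 1 R, invWeight (-(i : ℤ)) = 1 / (i : ℝ) := by
    intro i hi
    rw [Finset.mem_Icc] at hi
    rw [invWeight_of_ne_zero (by omega)]
    simp
  rw [h1]
  rw [Finset.sum_union, Finset.sum_union, Finset.sum_image, Finset.sum_image,
    Finset.sum_congr rfl h2, Finset.sum_congr rfl h3]
  · refine le_of_eq ?_
    rw [Finset.sum_singleton, harmonicSum]
    simp only [invWeight]
    norm_num
    ring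
  · intro i _ j _ h
    simpa using h
  · intro i _ j _ h
    simpa using h
  · rw [Finset.disjoint_left]
    simp only [Finset.mem_singleton, Finset.mem_image, Finset.mem_Icc]
    rintro t h ⟨i, hi, rfl⟩
    omega
  · rw [Finset.disjoint_left]
    simp only [Finset.mem_union, Finset.mem_singleton, Finset.mem_image, Finset.mem_Icc]
    rintro t (h | ⟨i, hi, rfl⟩) ⟨j, hj, h'⟩ <;> omega

theorem sum_gcdSum_le {R X : ℕ} {T : ℝ} (hT1 : 1 ≤ T)
    (hT : ∀ n : ℕ, n ≠ 0 → n ≤ 2 * R ^ 3 → (n.divisors.card : ℝ) ≤ T)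
    (hX : harmonicSum X ≤ T) (hR : harmonicSum R ≤ T) :
    ∑ m ∈ Finset.Icc 1 X, 1 / (m : ℝ) * gcdSum R m ≤ 9 * T ^ 4 := by
  set I := Finset.Icc (-(R : ℤ)) R with hI
  have key : ∀ j ∈ I, ∀ l ∈ I, ∑ m ∈ Finset.Icc 1 X, 1 / (m : ℝ) * (if j = l then 0 else
      invWeight j * invWeight l * Nat.gcd m (j ^ 3 - l ^ 3).natAbs) ≤
      invWeight j * invWeight l * T ^ 2 := by
    intro j hj l hl
    have hw : 0 ≤ invWeight j * invWeight l := mul_nonneg (invWeight_nonneg _) (invWeight_nonneg _)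
    by_cases hjl : j = l
    · simp only [hjl, if_true, mul_zero, Finset.sum_const_zero]
      have := mul_nonneg (invWeight_nonneg l) (invWeight_nonneg l)
      positivity
    · simp only [if_neg hjl]
      have h0 : j ^ 3 - l ^ 3 ≠ 0 := by
        rw [sub_ne_zero]
        exact fun h => hjl ((Odd.strictMono_pow (R := ℤ) (by decide : Odd 3)).injective h)
      have h1 : (j ^ 3 - l ^ 3).natAbs ≤ 2 * R ^ 3 := by
        rw [hI, Finset.mem_Icc] at hj hl
        have e1 : j ^ 3 ≤ (R : ℤ) ^ 3 :=
          (Odd.strictMono_pow (R := ℤ) (by decide : Odd 3)).monotone hj.2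
        have e2 : l ^ 3 ≤ (R : ℤ) ^ 3 :=
          (Odd.strictMono_pow (R := ℤ) (by decide : Odd 3)).monotone hl.2
        have e3 : (-(R : ℤ)) ^ 3 ≤ j ^ 3 :=
          (Odd.strictMono_pow (R := ℤ) (by decide : Odd 3)).monotone hj.1
        have e4 : (-(R : ℤ)) ^ 3 ≤ l ^ 3 :=
          (Odd.strictMono_pow (R := ℤ) (by decide : Odd 3)).monotone hl.1
        rw [Odd.neg_pow (by decide)] at e3 e4
        zify
        rw [abs_le]
        constructor <;> linarith
      have h2 := sum_gcd_div_le (Int.natAbs_ne_zero.2 h0) X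
      calc _ = invWeight j * invWeight l *
            ∑ m ∈ Finset.Icc 1 X, 1 / (m : ℝ) * Nat.gcd m (j ^ 3 - l ^ 3).natAbs := by
            rw [Finset.mul_sum]
            exact Finset.sum_congr rfl fun m _ => by ring
        _ ≤ invWeight j * invWeight l * (T * T) := by
            refine mul_le_mul_of_nonneg_left (h2.trans ?_) hw
            exact mul_le_mul (hT _ (Int.natAbs_ne_zero.2 h0) h1) hX (harmonicSum_nonneg _)
              (by linarith)
        _ = _ := by ring
  calc ∑ m ∈ Finset.Icc 1 X, 1 / (m : ℝ) * gcdSum R m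
      = ∑ j ∈ I, ∑ l ∈ I, ∑ m ∈ Finset.Icc 1 X, 1 / (m : ℝ) * (if j = l then 0 else
          invWeight j * invWeight l * Nat.gcd m (j ^ 3 - l ^ 3).natAbs) := by
        simp only [gcdSum, Finset.mul_sum]
        rw [Finset.sum_comm]
        refine Finset.sum_congr rfl fun j _ => ?_
        rw [Finset.sum_comm]
    _ ≤ ∑ j ∈ I, ∑ l ∈ I, invWeight j * invWeight l * T ^ 2 :=
        Finset.sum_le_sum fun j hj => Finset.sum_le_sum fun l hl => key j hj l hl
    _ = (∑ j ∈ I, invWeight j) ^ 2 * T ^ 2 := by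
        rw [sq (∑ j ∈ I, invWeight j), Finset.sum_mul_sum, Finset.sum_mul]
        exact Finset.sum_congr rfl fun j _ => by rw [Finset.sum_mul]
    _ ≤ (3 * T) ^ 2 * T ^ 2 := by
        refine mul_le_mul_of_nonneg_right (pow_le_pow_left₀
          (Finset.sum_nonneg fun j _ => invWeight_nonneg j) ?_ 2) (by positivity)
        refine (sum_invWeight_le R).trans ?_
        linarith
    _ = 9 * T ^ 4 := by ring

/-- A natural number is squarefull if each of its prime factors occurs with exponent at least
two. -/
def Squarefull (n : ℕ) : Prop := ∀ p : ℕ, p.Prime → p ∣ n → p ^ 2 ∣ n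

theorem exists_squarefree_mul_squarefull (n : ℕ) : n ≠ 0 →
    ∃ m q, m * q = n ∧ m.Coprime q ∧ Squarefree m ∧ Squarefull q := by
  induction n using Nat.recOnPosPrimePosCoprime with
  | zero => intro h; exact absurd rfl h
  | one => 
    refine fun _ => ⟨1, 1, rfl, Nat.coprime_one_left 1, squarefree_one, fun p hp h => ?_⟩
    exact absurd (Nat.dvd_one.1 h) hp.one_lt.ne'
  | prime_pow p j hp hj =>
    intro _
    rcases Nat.lt_or_ge j 2 with h | h
    · have : j = 1 := by omega
      subst this
      refine ⟨p, 1, by simp, Nat.coprime_one_right p, hp.squarefree, fun r hr h => ?_⟩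
      exact absurd (Nat.dvd_one.1 h) hr.one_lt.ne'
    · refine ⟨1, p ^ j, by simp, Nat.coprime_one_left _, squarefree_one, fun r hr h' => ?_⟩
      rw [(Nat.prime_dvd_prime_iff_eq hr hp).1 (hr.dvd_of_dvd_pow h')]
      exact pow_dvd_pow p h
  | coprime a b ha hb hab iha ihb =>
    intro _
    obtain ⟨m, q, rfl, h1, h2, h3⟩ := iha (by omega)
    obtain ⟨m', q', rfl, h1', h2', h3'⟩ := ihb (by omega)
    have c1 := hab.coprime_mul_right.coprime_mul_right_right
    have c2 := hab.coprime_mul_right.coprime_mul_left_right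
    have c3 := hab.coprime_mul_left.coprime_mul_right_right
    refine ⟨m * m', q * q', by ring, ?_, (Nat.squarefree_mul c1).2 ⟨h2, h2'⟩, ?_⟩
    · exact Nat.Coprime.mul_left (Nat.Coprime.mul_right h1 c2)
        (Nat.Coprime.mul_right c3.symm h1')
    · intro p hp h
      rcases hp.dvd_mul.1 h with h | h
      · exact (h3 p hp h).mul_right _
      · exact (h3' p hp h).mul_left _

theorem Squarefull.exists_eq {q : ℕ} (hq : Squarefull q) (hq0 : q ≠ 0) :
    ∃ s r, q = s ^ 2 * r ∧ r ∣ s := by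
  obtain ⟨r, s, h, hr⟩ := Nat.sq_mul_squarefree q
  refine ⟨s, r, h.symm, ?_⟩
  have hr0 : r ≠ 0 := by rintro rfl; simp at h; exact hq0 h.symm
  have hs0 : s ≠ 0 := by rintro rfl; simp at h; exact hq0 h.symm
  rw [← Nat.prod_primeFactors_of_squarefree hr]
  refine Finset.prod_primes_dvd s (fun p hp => (Nat.prime_of_mem_primeFactors hp).prime) ?_
  intro p hp
  have hp' := Nat.prime_of_mem_primeFactors hp
  have hpr := Nat.dvd_of_mem_primeFactors hp
  by_contra hps
  have h1 : p ^ 2 ∣ s ^ 2 * r := h ▸ hq p hp' (h ▸ hpr.mul_left _)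
  have h2 : (p ^ 2).Coprime (s ^ 2) :=
    Nat.Coprime.pow _ _ ((Nat.Prime.coprime_iff_not_dvd hp').2 hps)
  have h3 : p ^ 2 ∣ r := h2.dvd_of_dvd_mul_left h1
  rw [sq] at h3
  exact hp'.one_lt.ne' (Nat.isUnit_iff.1 (hr p h3))

open Classical in
theorem sum_squarefull_le {X : ℕ} {T : ℝ}
    (hT : ∀ n : ℕ, n ≠ 0 → n ≤ X → (n.divisors.card : ℝ) ≤ T) (hX : harmonicSum X ≤ T) :
    ∑ q ∈ (Finset.Icc 1 X).filter Squarefull, 1 / √(q : ℝ) ≤ T ^ 2 := by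
  have hT0 : 0 ≤ T := (harmonicSum_nonneg X).trans hX
  set U := (Finset.Icc 1 X).sigma (fun s => s.divisors) with hU
  calc ∑ q ∈ (Finset.Icc 1 X).filter Squarefull, 1 / √(q : ℝ)
      ≤ ∑ q ∈ U.image (fun z => (z.1 ^ 2 * z.2 : ℕ)), 1 / √((q : ℕ) : ℝ) := by
        refine Finset.sum_le_sum_of_subset_of_nonneg (fun q hq => ?_) fun _ _ _ => by positivity
        rw [Finset.mem_filter, Finset.mem_Icc] at hq
        obtain ⟨s, r, h, hrs⟩ := hq.2.exists_eq (by omega)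
        have hs0 : s ≠ 0 := by rintro rfl; simp at h; omega
        have hr0 : 0 < r := Nat.pos_of_dvd_of_pos hrs (by omega)
        rw [Finset.mem_image]
        refine ⟨⟨s, r⟩, ?_, h.symm⟩
        simp only [hU, Finset.mem_sigma, Finset.mem_Icc, Nat.mem_divisors]
        refine ⟨⟨by omega, ?_⟩, hrs, hs0⟩
        calc s ≤ s ^ 2 * r := by nlinarith [Nat.pos_of_ne_zero hs0]
          _ ≤ X := h ▸ hq.1.2
    _ ≤ ∑ z ∈ U, 1 / √((z.1 ^ 2 * z.2 : ℕ) : ℝ) :=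
        Finset.sum_image_le_of_nonneg (f := fun q : ℕ => 1 / √(q : ℝ))
          fun _ _ => by positivity
    _ ≤ ∑ z ∈ U, 1 / (z.1 : ℝ) := by
        refine Finset.sum_le_sum fun z hz => ?_
        simp only [hU, Finset.mem_sigma, Finset.mem_Icc] at hz
        have h1 : (0 : ℝ) < z.1 := by exact_mod_cast hz.1.1
        have h2 : 1 ≤ z.2 := Nat.pos_of_mem_divisors hz.2
        have h2' : (1 : ℝ) ≤ z.2 := by exact_mod_cast h2
        refine one_div_le_one_div_of_le h1 (Real.le_sqrt_of_sq_le ?_)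
        push_cast
        nlinarith [sq_nonneg (z.1 : ℝ)]
    _ = ∑ s ∈ Finset.Icc 1 X, (s.divisors.card : ℝ) * (1 / (s : ℝ)) := by
        rw [hU, Finset.sum_sigma]
        exact Finset.sum_congr rfl fun s _ => by
          dsimp only
          rw [Finset.sum_const, nsmul_eq_mul]
    _ ≤ ∑ s ∈ Finset.Icc 1 X, T * (1 / (s : ℝ)) := by
        refine Finset.sum_le_sum fun s hs => ?_
        rw [Finset.mem_Icc] at hs
        exact mul_le_mul_of_nonneg_right (hT s (by omega) hs.2) (by positivity)
    _ = T * harmonicSum X := by rw [harmonicSum, Finset.mul_sum]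
    _ ≤ T ^ 2 := by rw [sq]; exact mul_le_mul_of_nonneg_left hX hT0

theorem exists_dvd_pow_mul_coprime {n c L : ℕ} (hn : n ≠ 0) (hL : n < 2 ^ L) :
    ∃ b a, n = b * a ∧ b ∣ c ^ L ∧ a.Coprime c := by
  have hg : 0 < n.gcd (c ^ L) := Nat.gcd_pos_of_pos_left _ (Nat.pos_of_ne_zero hn)
  obtain ⟨a, ha⟩ := Nat.gcd_dvd_left n (c ^ L)
  refine ⟨n.gcd (c ^ L), a, ha, Nat.gcd_dvd_right _ _, ?_⟩
  refine Nat.coprime_of_dvd fun p hp hpa hpc => ?_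
  have h1 : n.factorization p < L := by
    have h2 : p ^ n.factorization p ≤ n := Nat.ordProj_le p hn
    have h3 : 2 ^ n.factorization p ≤ p ^ n.factorization p := Nat.pow_le_pow_left hp.two_le _
    exact (Nat.pow_lt_pow_iff_right (by norm_num : 1 < 2)).1 (by omega)
  have h2 : p ^ n.factorization p ∣ n.gcd (c ^ L) :=
    Nat.dvd_gcd (Nat.ordProj_dvd n p)
      ((pow_dvd_pow p h1.le).trans (pow_dvd_pow_of_dvd hpc L))
  have h3 : p ^ (n.factorization p + 1) ∣ n := by
    rw [pow_succ]
    conv_rhs => rw [ha]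
    exact mul_dvd_mul h2 hpa
  exact Nat.pow_succ_factorization_not_dvd hn hp h3

/-- A factorisation of each positive integer up to `X` into a divisor of `c ^ L`, a squarefree part
and a squarefull part, the last two being coprime to each other and to `c`. -/
structure SplitUpTo (X c L : ℕ) (b m q : ℕ → ℕ) : Prop where
  eq_mul : ∀ a ∈ Finset.Icc 1 X, a = b a * (m a * q a)
  dvd : ∀ a ∈ Finset.Icc 1 X, b a ∣ c ^ L
  coprime : ∀ a ∈ Finset.Icc 1 X, (m a * q a).Coprime c
  coprime' : ∀ a ∈ Finset.Icc 1 X, (m a).Coprime (q a)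
  squarefree : ∀ a ∈ Finset.Icc 1 X, Squarefree (m a)
  squarefull : ∀ a ∈ Finset.Icc 1 X, Squarefull (q a)

theorem exists_splitUpTo {X c L : ℕ} (hL : X < 2 ^ L) :
    ∃ b m q, SplitUpTo X c L b m q := by
  have h : ∀ a : ℕ, ∃ b m q, a ∈ Finset.Icc 1 X → a = b * (m * q) ∧ b ∣ c ^ L ∧
      (m * q).Coprime c ∧ m.Coprime q ∧ Squarefree m ∧ Squarefull q := by
    intro a
    by_cases ha : a ∈ Finset.Icc 1 X
    · rw [Finset.mem_Icc] at ha
      obtain ⟨b, a0, h1, h2, h3⟩ := exists_dvd_pow_mul_coprime (n := a) (c := c) (L := L)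
        (by omega) (by omega)
      have h4 : a0 ≠ 0 := by rintro rfl; omega
      obtain ⟨m, q, rfl, h5, h6, h7⟩ := exists_squarefree_mul_squarefull a0 h4
      exact ⟨b, m, q, fun _ => ⟨h1, h2, h3, h5, h6, h7⟩⟩
    · exact ⟨0, 0, 0, fun h => absurd h ha⟩
  choose b m q h using h
  exact ⟨b, m, q, fun a ha => (h a ha).1, fun a ha => (h a ha).2.1, fun a ha => (h a ha).2.2.1,
    fun a ha => (h a ha).2.2.2.1, fun a ha => (h a ha).2.2.2.2.1, fun a ha => (h a ha).2.2.2.2.2⟩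

namespace SplitUpTo

theorem m_ne_zero {X c L : ℕ} {b m q : ℕ → ℕ} (S : SplitUpTo X c L b m q) {a : ℕ}
    (ha : a ∈ Finset.Icc 1 X) : m a ≠ 0 := by
  intro h
  have := S.eq_mul a ha
  rw [h, zero_mul, mul_zero] at this
  rw [Finset.mem_Icc] at ha
  omega

theorem q_ne_zero {X c L : ℕ} {b m q : ℕ → ℕ} (S : SplitUpTo X c L b m q) {a : ℕ}
    (ha : a ∈ Finset.Icc 1 X) : q a ≠ 0 := by
  intro h
  have := S.eq_mul a ha
  rw [h, mul_zero, mul_zero] at this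
  rw [Finset.mem_Icc] at ha
  omega

theorem mul_le {X c L : ℕ} {b m q : ℕ → ℕ} (S : SplitUpTo X c L b m q) {a : ℕ}
    (ha : a ∈ Finset.Icc 1 X) : m a * q a ≤ X := by
  have h1 : m a * q a ∣ a := Dvd.intro_left _ (S.eq_mul a ha).symm
  rw [Finset.mem_Icc] at ha
  exact (Nat.le_of_dvd (by omega) h1).trans ha.2

theorem m_mem {X c L : ℕ} {b m q : ℕ → ℕ} (S : SplitUpTo X c L b m q) {a : ℕ}
    (ha : a ∈ Finset.Icc 1 X) : m a ∈ Finset.Icc 1 X := by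
  rw [Finset.mem_Icc]
  exact ⟨Nat.pos_of_ne_zero (S.m_ne_zero ha),
    (Nat.le_mul_of_pos_right _ (Nat.pos_of_ne_zero (S.q_ne_zero ha))).trans (S.mul_le ha)⟩

theorem q_mem {X c L : ℕ} {b m q : ℕ → ℕ} (S : SplitUpTo X c L b m q) {a : ℕ}
    (ha : a ∈ Finset.Icc 1 X) : q a ∈ Finset.Icc 1 X := by
  rw [Finset.mem_Icc]
  exact ⟨Nat.pos_of_ne_zero (S.q_ne_zero ha),
    (Nat.le_mul_of_pos_left _ (Nat.pos_of_ne_zero (S.m_ne_zero ha))).trans (S.mul_le ha)⟩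

end SplitUpTo

open Classical in
theorem SplitUpTo.sum_le {X c L : ℕ} {b m q : ℕ → ℕ} (S : SplitUpTo X c L b m q) (hc : c ≠ 0)
    {h : ℕ → ℕ → ℝ} (hh : ∀ i j, 0 ≤ h i j) :
    ∑ a ∈ Finset.Icc 1 X, h (m a) (q a) ≤ (c ^ L).divisors.card *
      ∑ i ∈ Finset.Icc 1 X, ∑ j ∈ (Finset.Icc 1 X).filter Squarefull, h i j := by
  set V := (c ^ L).divisors ×ˢ (Finset.Icc 1 X ×ˢ (Finset.Icc 1 X).filter Squarefull) with hV
  have hinj : Set.InjOn (fun a => (b a, (m a, q a))) (Finset.Icc 1 X : Finset ℕ) := by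
    intro a ha a' ha' haa
    simp only [Prod.mk.injEq] at haa
    rw [S.eq_mul a ha, S.eq_mul a' ha', haa.1, haa.2.1, haa.2.2]
  have hmem : ∀ a ∈ Finset.Icc 1 X, (b a, (m a, q a)) ∈ V := by
    intro a ha
    simp only [hV, Finset.mem_product, Nat.mem_divisors, Finset.mem_filter]
    exact ⟨⟨S.dvd a ha, pow_ne_zero _ hc⟩, S.m_mem ha, S.q_mem ha, S.squarefull a ha⟩
  calc ∑ a ∈ Finset.Icc 1 X, h (m a) (q a)
      = ∑ z ∈ (Finset.Icc 1 X).image (fun a => (b a, (m a, q a))), h z.2.1 z.2.2 :=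
        (Finset.sum_image (f := fun z : ℕ × ℕ × ℕ => h z.2.1 z.2.2) hinj).symm
    _ ≤ ∑ z ∈ V, h z.2.1 z.2.2 :=
        Finset.sum_le_sum_of_subset_of_nonneg (Finset.image_subset_iff.2 hmem) fun z _ _ => hh _ _
    _ = _ := by
        rw [hV, Finset.sum_product]
        simp only [Finset.sum_const, nsmul_eq_mul, Finset.sum_product]

/-- The discriminant whose values are squares at the solutions. -/
def cubicDisc (k : ℤ) (a x y : ℕ) : ℤ :=
  12 * a * ((x : ℤ) ^ 3 + (y : ℤ) ^ 3) + (12 * a * k - 3 * (a : ℤ) ^ 4)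

theorem cubicChar_natCast (p : ℕ) [Fact p.Prime] (k : ℤ) (a x y : ℕ) :
    cubicChar p (12 * a) (12 * a * k - 3 * (a : ℤ) ^ 4) (x : ZMod p) (y : ZMod p) =
      ((jacobiSym (cubicDisc k a x y) p : ℤ) : ℂ) := by
  rw [← jacobiSym.legendreSym.to_jacobiSym, legendreSym, cubicChar, cubicDisc]
  push_cast
  rfl

theorem norm_sum_fermatInd_jacobiSym_le {m q a N p p' : ℕ} {k : ℤ} (hp : p.Prime) (hp' : p'.Prime)
    (h3 : 3 < p) (h3' : 3 < p') (hpp : p ≠ p') (hpa : ¬ p ∣ a) (hpa' : ¬ p' ∣ a)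
    (hma : m * q ∣ a)
    (h : m.Coprime q) (hs : Squarefree m) (hc : IsCoprime ((m * q : ℕ) : ℤ) (6 * k))
    (hm : m ≠ 0) (hq : q ≠ 0) (ha : m * q ≤ 2 * N) (hQN : p * p' ≤ N)
    {T : ℝ} (hT : 1 ≤ T) (hd : ((m * q).divisors.card : ℝ) ≤ T)
    (hH : harmonicSum (2 * N ^ 2) ≤ T) :
    ‖∑ x ∈ Finset.Icc 1 N, ∑ y ∈ Finset.Icc 1 N, fermatInd (m * q) k (x : ZMod (m * q)) y *
      (((jacobiSym (cubicDisc k a x y) p : ℤ) : ℂ) *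
       ((jacobiSym (cubicDisc k a x y) p' : ℤ) : ℂ))‖ ≤
      T ^ 7 * (1 / (m * √q)) * (100 * (N ^ 2 / √((p * p' : ℕ) : ℝ)) +
        8 * (N * √N * (p * p' : ℕ)) + N * √N * (p * p' : ℕ) * gcdSum (N ^ 2) m) := by
  have : Fact p.Prime := ⟨hp⟩
  have : Fact p'.Prime := ⟨hp'⟩
  have : NeZero m := ⟨hm⟩
  have : NeZero q := ⟨hq⟩
  have hQ : p.Coprime p' := (Nat.coprime_primes hp hp').2 hpp
  set A : ℤ := 12 * a with hA
  set B : ℤ := 12 * a * k - 3 * (a : ℤ) ^ 4 with hB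
  have hA0 : ∀ r : ℕ, r.Prime → 3 < r → ¬ r ∣ a → (A : ZMod r) ≠ 0 := by
    intro r hr h3r hra h0
    rw [ZMod.intCast_zmod_eq_zero_iff_dvd, hA] at h0
    have h1 : r ∣ 12 * a := by exact_mod_cast h0
    rcases hr.dvd_mul.1 h1 with h2 | h2
    · have h4 : r ∣ 2 ^ 2 * 3 := by norm_num; exact h2
      rcases hr.dvd_mul.1 h4 with h5 | h5
      · have := Nat.le_of_dvd (by norm_num) (hr.dvd_of_dvd_pow h5)
        omega
      · have := Nat.le_of_dvd (by norm_num) h5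
        omega
    · exact hra h2
  set e := ZMod.chineseRemainder hQ with he
  set g : ZMod (p * p') → ZMod (p * p') → ℂ := fun x y =>
    cubicChar p A B (e x).1 (e y).1 * cubicChar p' A B (e x).2 (e y).2 with hg
  have hcop : (m * q).Coprime (p * p') := by
    refine Nat.Coprime.mul_right ?_ ?_
    · exact ((Nat.Prime.coprime_iff_not_dvd hp).2 fun h => hpa (h.trans hma)).symm
    · exact ((Nat.Prime.coprime_iff_not_dvd hp').2 fun h => hpa' (h.trans hma)).symm
  have hR : m * q * (p * p') ≤ 2 * N ^ 2 := by
    calc m * q * (p * p') ≤ 2 * N * N := Nat.mul_le_mul ha hQN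
      _ = 2 * N ^ 2 := by ring
  have key := norm_sum_fermatInd_mul_le (Q := p * p') (N := N) (R := N ^ 2) h hs hc hcop ha hQN
    hR hT hd ((harmonicSum_mono hR).trans hH) g ?_ ?_
  · refine le_trans (le_of_eq ?_) key
    congr 1
    refine Finset.sum_congr rfl fun x _ => Finset.sum_congr rfl fun y _ => ?_
    congr 1
    rw [hg]
    simp only [map_natCast, Prod.fst_natCast, Prod.snd_natCast]
    rw [hA, hB, cubicChar_natCast, cubicChar_natCast]
  · intro x y
    rw [hg]
    dsimp only
    rw [norm_mul]
    exact mul_le_one₀ (norm_cubicChar_le _ _ _ _ _) (norm_nonneg _) (norm_cubicChar_le _ _ _ _ _)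
  · intro ψ hψ u
    obtain ⟨ψ₁, ψ₂, h1, h2, hm⟩ := exists_primitive_split hQ hψ
    rw [hg, pairSum_mul hQ hm, norm_mul]
    calc _ ≤ (5 * p : ℝ) * (5 * p') :=
          mul_le_mul (norm_pairSum_cubicChar_diag_le h3 (hA0 p hp h3 hpa) _ _)
            (norm_pairSum_cubicChar_diag_le h3' (hA0 p' hp' h3' hpa') _ _) (norm_nonneg _)
            (by positivity)
      _ = _ := by push_cast; ring

theorem gcdSum_nonneg (R m : ℕ) : 0 ≤ gcdSum R m := by
  refine Finset.sum_nonneg fun j _ => Finset.sum_nonneg fun i _ => ?_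
  split_ifs
  · exact le_rfl
  · exact mul_nonneg (mul_nonneg (invWeight_nonneg _) (invWeight_nonneg _)) (by positivity)

theorem sum_norm_sum_fermatInd_jacobiSym_le {N L p p' : ℕ} {k : ℤ} (hk : k ≠ 0)
    {b m q : ℕ → ℕ} (S : SplitUpTo (2 * N) (6 * k.natAbs) L b m q) (hp : p.Prime)
    (hp' : p'.Prime) (h3 : 3 < p) (h3' : 3 < p') (hpp : p ≠ p') (hQN : p * p' ≤ N)
    {T : ℝ} (hT : 1 ≤ T)
    (hd : ∀ n : ℕ, n ≠ 0 → n ≤ 2 * (N ^ 2) ^ 3 → (n.divisors.card : ℝ) ≤ T)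
    (hdc : (((6 * k.natAbs) ^ L).divisors.card : ℝ) ≤ T)
    (hH : harmonicSum (2 * N ^ 2) ≤ T) :
    ∑ a ∈ (Finset.Icc 1 (2 * N)).filter (fun a => ¬ p ∣ a ∧ ¬ p' ∣ a),
      ‖∑ x ∈ Finset.Icc 1 N, ∑ y ∈ Finset.Icc 1 N,
        fermatInd (m a * q a) k (x : ZMod (m a * q a)) y *
        (((jacobiSym (cubicDisc k a x y) p : ℤ) : ℂ) *
         ((jacobiSym (cubicDisc k a x y) p' : ℤ) : ℂ))‖ ≤
      100 * T ^ 14 * (N ^ 2 / √((p * p' : ℕ) : ℝ) + N * √N * (p * p' : ℕ)) := by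
  classical
  have hQ0 : 0 < p * p' := Nat.mul_pos hp.pos hp'.pos
  have hN1 : 1 ≤ N := hQ0.trans_le hQN
  have hNN : N ≤ N ^ 2 := by nlinarith
  have hN6 : 2 * N ≤ 2 * (N ^ 2) ^ 3 := by
    have : N ^ 1 ≤ N ^ 6 := Nat.pow_le_pow_right hN1 (by norm_num)
    have e : (N ^ 2) ^ 3 = N ^ 6 := by ring
    rw [e]
    rw [pow_one] at this
    omega
  set c1 : ℝ := (N : ℝ) ^ 2 / √((p * p' : ℕ) : ℝ) with hc1
  set c2 : ℝ := (N : ℝ) * √N * (p * p' : ℕ) with hc2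
  have hc10 : 0 ≤ c1 := by positivity
  have hc20 : 0 ≤ c2 := by positivity
  set h : ℕ → ℕ → ℝ := fun i j =>
    T ^ 7 * (1 / (i * √j)) * (100 * c1 + 8 * c2 + c2 * gcdSum (N ^ 2) i) with hh
  have hg := gcdSum_nonneg (N ^ 2)
  have hh0 : ∀ i j, 0 ≤ h i j := fun i j => by
    have := hg i
    simp only [hh]
    positivity
  have hX : harmonicSum (2 * N) ≤ T := (harmonicSum_mono (by omega)).trans hH
  have hsq := sum_squarefull_le (X := 2 * N) (T := T) (fun n h0 h1 => hd n h0 (h1.trans hN6)) hX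
  have hgc := sum_gcdSum_le (R := N ^ 2) (X := 2 * N) hT hd hX
    ((harmonicSum_mono (by omega)).trans hH)
  calc _ ≤ ∑ a ∈ (Finset.Icc 1 (2 * N)).filter (fun a => ¬ p ∣ a ∧ ¬ p' ∣ a), h (m a) (q a) := by
        refine Finset.sum_le_sum fun a ha => ?_
        rw [Finset.mem_filter] at ha
        obtain ⟨ha, hpa, hpa'⟩ := ha
        refine norm_sum_fermatInd_jacobiSym_le hp hp' h3 h3' hpp hpa hpa'
          (Dvd.intro_left _ (S.eq_mul a ha).symm) (S.coprime' a ha) (S.squarefree a ha) ?_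
          (S.m_ne_zero ha) (S.q_ne_zero ha) (S.mul_le ha) hQN hT
          (hd _ (Nat.mul_ne_zero (S.m_ne_zero ha) (S.q_ne_zero ha)) ((S.mul_le ha).trans hN6)) hH
        rw [Int.isCoprime_iff_gcd_eq_one, Int.gcd_def, Int.natAbs_mul]
        exact S.coprime a ha
    _ ≤ ∑ a ∈ Finset.Icc 1 (2 * N), h (m a) (q a) :=
        Finset.sum_le_sum_of_subset_of_nonneg (Finset.filter_subset _ _) fun a _ _ => hh0 _ _
    _ ≤ ((6 * k.natAbs) ^ L).divisors.card * ∑ i ∈ Finset.Icc 1 (2 * N),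
          ∑ j ∈ (Finset.Icc 1 (2 * N)).filter Squarefull, h i j :=
        S.sum_le (by have := Int.natAbs_ne_zero.2 hk; omega) hh0
    _ = ((6 * k.natAbs) ^ L).divisors.card * (T ^ 7 *
          (∑ j ∈ (Finset.Icc 1 (2 * N)).filter Squarefull, 1 / √(j : ℝ)) *
          ((100 * c1 + 8 * c2) * harmonicSum (2 * N) +
            c2 * ∑ i ∈ Finset.Icc 1 (2 * N), 1 / (i : ℝ) * gcdSum (N ^ 2) i)) := by
        congr 1
        rw [harmonicSum, Finset.mul_sum (s := Finset.Icc 1 (2 * N)),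
          Finset.mul_sum (s := Finset.Icc 1 (2 * N)), ← Finset.sum_add_distrib, Finset.mul_sum]
        refine Finset.sum_congr rfl fun i _ => ?_
        rw [Finset.mul_sum, Finset.sum_mul]
        refine Finset.sum_congr rfl fun j _ => ?_
        simp only [hh, one_div, mul_inv]
        ring
    _ ≤ T * (T ^ 7 * T ^ 2 * ((100 * c1 + 8 * c2) * T + c2 * (9 * T ^ 4))) := by
        have h1 : 0 ≤ harmonicSum (2 * N) := harmonicSum_nonneg _
        have h2 : 0 ≤ ∑ i ∈ Finset.Icc 1 (2 * N), 1 / (i : ℝ) * gcdSum (N ^ 2) i :=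
          Finset.sum_nonneg fun i _ => mul_nonneg (by positivity) (hg i)
        have h4 : 0 ≤ ∑ j ∈ (Finset.Icc 1 (2 * N)).filter Squarefull, 1 / √(j : ℝ) :=
          Finset.sum_nonneg fun i _ => by positivity
        gcongr
    _ ≤ T * (T ^ 7 * T ^ 2 * ((100 * c1 + 8 * c2) * T ^ 4 + c2 * (9 * T ^ 4))) := by
        have : T ≤ T ^ 4 := le_self_pow₀ hT (by norm_num)
        gcongr
    _ = T ^ 14 * (100 * c1 + 17 * c2) := by ring
    _ ≤ T ^ 14 * (100 * c1 + 100 * c2) := by gcongr; norm_num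
    _ = _ := by ring

theorem SplitUpTo.card_filter_dvd_le {X c L : ℕ} {b m q : ℕ → ℕ} (S : SplitUpTo X c L b m q)
    (hc : c ≠ 0) {n : ℕ} (hn : n ≠ 0) :
    ((Finset.Icc 1 X).filter (fun a => m a * q a ∣ n)).card ≤
      (c ^ L).divisors.card * n.divisors.card := by
  rw [← Finset.card_product]
  refine Finset.card_le_card_of_injOn (fun a => (b a, m a * q a)) ?_ ?_
  · intro a ha
    rw [Finset.mem_coe, Finset.mem_filter] at ha
    simp only [Finset.mem_coe, Finset.mem_product, Nat.mem_divisors]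
    exact ⟨⟨S.dvd a ha.1, pow_ne_zero _ hc⟩, ha.2, hn⟩
  · intro a ha a' ha' h
    rw [Finset.mem_coe, Finset.mem_filter] at ha ha'
    simp only [Prod.mk.injEq] at h
    rw [S.eq_mul a ha.1, S.eq_mul a' ha'.1, h.1, h.2]

/-- The indicator that `m` divides `x ^ 3 + y ^ 3 + k`. -/
noncomputable def dvdInd (m : ℕ) (k : ℤ) (x y : ℕ) : ℝ :=
  if (m : ℤ) ∣ (x : ℤ) ^ 3 + (y : ℤ) ^ 3 + k then 1 else 0

theorem dvdInd_nonneg (m : ℕ) (k : ℤ) (x y : ℕ) : 0 ≤ dvdInd m k x y := by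
  rw [dvdInd]
  split_ifs <;> norm_num

theorem ofReal_dvdInd (m : ℕ) (k : ℤ) (x y : ℕ) :
    (dvdInd m k x y : ℂ) = fermatInd m k (x : ZMod m) y := by
  have h : ((x : ZMod m) ^ 3 + (y : ZMod m) ^ 3 + (k : ZMod m) = 0) ↔
      (m : ℤ) ∣ (x : ℤ) ^ 3 + (y : ℤ) ^ 3 + k := by
    rw [← ZMod.intCast_zmod_eq_zero_iff_dvd]
    push_cast
    rfl
  rw [dvdInd, fermatInd]
  by_cases h1 : (m : ℤ) ∣ (x : ℤ) ^ 3 + (y : ℤ) ^ 3 + k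
  · rw [if_pos h1, if_pos (h.2 h1)]
    simp
  · rw [if_neg h1, if_neg (fun h2 => h1 (h.1 h2))]
    simp

theorem SplitUpTo.sum_dvdInd_le {N c L : ℕ} {k : ℤ} {b m q : ℕ → ℕ}
    (S : SplitUpTo (2 * N) c L b m q) (hc : c ≠ 0) {T : ℝ} (hT : 1 ≤ T)
    (hd : ∀ n : ℕ, n ≠ 0 → n ≤ 2 * N ^ 3 + k.natAbs → (n.divisors.card : ℝ) ≤ T)
    (hdc : ((c ^ L).divisors.card : ℝ) ≤ T) :
    ∑ a ∈ Finset.Icc 1 (2 * N), ∑ x ∈ Finset.Icc 1 N, ∑ y ∈ Finset.Icc 1 N,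
      dvdInd (m a * q a) k x y ≤ 3 * N ^ 2 * T ^ 2 := by
  classical
  have key : ∀ x ∈ Finset.Icc 1 N, ∀ y ∈ Finset.Icc 1 N,
      ∑ a ∈ Finset.Icc 1 (2 * N), dvdInd (m a * q a) k x y ≤
        T ^ 2 + 2 * N * (if (x : ℤ) ^ 3 + (y : ℤ) ^ 3 + k = 0 then 1 else 0) := by
    intro x hx y hy
    rw [Finset.mem_Icc] at hx hy
    by_cases h0 : (x : ℤ) ^ 3 + (y : ℤ) ^ 3 + k = 0
    · rw [if_pos h0]
      have : ∑ a ∈ Finset.Icc 1 (2 * N), dvdInd (m a * q a) k x y ≤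
          ∑ a ∈ Finset.Icc 1 (2 * N), (1 : ℝ) := by
        refine Finset.sum_le_sum fun a _ => ?_
        rw [dvdInd]
        split_ifs <;> norm_num
      simp only [Finset.sum_const, Nat.card_Icc, nsmul_eq_mul, mul_one, Nat.add_sub_cancel] at this
      push_cast at this
      nlinarith [sq_nonneg T]
    · rw [if_neg h0, mul_zero, add_zero]
      set n := ((x : ℤ) ^ 3 + (y : ℤ) ^ 3 + k).natAbs with hn
      have hn0 : n ≠ 0 := Int.natAbs_ne_zero.2 h0
      have hnle : n ≤ 2 * N ^ 3 + k.natAbs := by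
        have h1 : n ≤ ((x : ℤ) ^ 3 + (y : ℤ) ^ 3).natAbs + k.natAbs := Int.natAbs_add_le _ _
        have h2 : ((x : ℤ) ^ 3 + (y : ℤ) ^ 3).natAbs = x ^ 3 + y ^ 3 := by
          rw [show (x : ℤ) ^ 3 + (y : ℤ) ^ 3 = ((x ^ 3 + y ^ 3 : ℕ) : ℤ) by push_cast; rfl]
          exact Int.natAbs_natCast _
        have h3 : x ^ 3 ≤ N ^ 3 := Nat.pow_le_pow_left hx.2 3
        have h4 : y ^ 3 ≤ N ^ 3 := Nat.pow_le_pow_left hy.2 3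
        omega
      have h1 : ∑ a ∈ Finset.Icc 1 (2 * N), dvdInd (m a * q a) k x y =
          ((Finset.Icc 1 (2 * N)).filter (fun a => m a * q a ∣ n)).card := by
        rw [Finset.card_filter]
        push_cast
        refine Finset.sum_congr rfl fun a _ => ?_
        rw [dvdInd]
        refine if_congr ?_ rfl rfl
        rw [hn, ← Int.natCast_dvd]
      have h2 : ((((Finset.Icc 1 (2 * N)).filter (fun a => m a * q a ∣ n)).card : ℕ) : ℝ) ≤
          ((c ^ L).divisors.card : ℝ) * n.divisors.card := by
        exact_mod_cast S.card_filter_dvd_le hc hn0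
      rw [h1]
      refine h2.trans ?_
      rw [sq]
      exact mul_le_mul hdc (hd n hn0 hnle) (by positivity) (by linarith)
  have hzero : ∀ x ∈ Finset.Icc 1 N, ∑ y ∈ Finset.Icc 1 N,
      (if (x : ℤ) ^ 3 + (y : ℤ) ^ 3 + k = 0 then (1 : ℝ) else 0) ≤ 1 := by
    intro x _
    rw [Finset.sum_boole]
    have : ((Finset.Icc 1 N).filter (fun y : ℕ => (x : ℤ) ^ 3 + (y : ℤ) ^ 3 + k = 0)).card ≤ 1 := by
      rw [Finset.card_le_one]
      intro y hy y' hy'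
      rw [Finset.mem_filter] at hy hy'
      have : (y : ℤ) ^ 3 = (y' : ℤ) ^ 3 := by linarith [hy.2, hy'.2]
      have h2 : y ^ 3 = y' ^ 3 := by exact_mod_cast this
      exact Nat.pow_left_injective (n := 3) (by norm_num) h2
    exact_mod_cast this
  have hT2 : 1 ≤ T ^ 2 := one_le_pow₀ hT
  calc ∑ a ∈ Finset.Icc 1 (2 * N), ∑ x ∈ Finset.Icc 1 N, ∑ y ∈ Finset.Icc 1 N,
        dvdInd (m a * q a) k x y
      = ∑ x ∈ Finset.Icc 1 N, ∑ y ∈ Finset.Icc 1 N, ∑ a ∈ Finset.Icc 1 (2 * N),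
          dvdInd (m a * q a) k x y := by
        rw [Finset.sum_comm]
        exact Finset.sum_congr rfl fun x _ => Finset.sum_comm
    _ ≤ ∑ x ∈ Finset.Icc 1 N, ∑ y ∈ Finset.Icc 1 N,
          (T ^ 2 + 2 * N * (if (x : ℤ) ^ 3 + (y : ℤ) ^ 3 + k = 0 then (1 : ℝ) else 0)) :=
        Finset.sum_le_sum fun x hx => Finset.sum_le_sum fun y hy => key x hx y hy
    _ = ∑ x ∈ Finset.Icc 1 N, (N * T ^ 2 + 2 * N * ∑ y ∈ Finset.Icc 1 N,
          (if (x : ℤ) ^ 3 + (y : ℤ) ^ 3 + k = 0 then (1 : ℝ) else 0)) := by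
        refine Finset.sum_congr rfl fun x _ => ?_
        rw [Finset.sum_add_distrib, ← Finset.mul_sum]
        simp
    _ ≤ ∑ x ∈ Finset.Icc 1 N, ((N : ℝ) * T ^ 2 + 2 * N * 1) := by
        refine Finset.sum_le_sum fun x hx => ?_
        have := hzero x hx
        gcongr
    _ = N ^ 2 * T ^ 2 + 2 * N ^ 2 * 1 := by
        simp only [Finset.sum_const, Nat.card_Icc, nsmul_eq_mul, Nat.add_sub_cancel]
        ring
    _ ≤ (N : ℝ) ^ 2 * T ^ 2 + 2 * N ^ 2 * T ^ 2 := by gcongr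
    _ = _ := by ring

/-- The equation obtained from `n₁ ^ 3 + n₂ ^ 3 = x ^ 3 + y ^ 3 + k` by putting `a = n₁ + n₂` and
`s = n₁ - n₂`, with `s` nonzero. -/
def IsTripleSol (N : ℕ) (k : ℤ) (a x y : ℕ) : Prop :=
  ∃ s : ℤ, s ≠ 0 ∧ s.natAbs ≤ N ∧
    4 * ((x : ℤ) ^ 3 + (y : ℤ) ^ 3 + k) = a * ((a : ℤ) ^ 2 + 3 * s ^ 2)

theorem card_filter_dvd_le_card_divisors (P : Finset ℕ) {n : ℕ} (hn : n ≠ 0) :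
    (P.filter (fun p => p ∣ n)).card ≤ n.divisors.card := by
  refine Finset.card_le_card fun p hp => ?_
  rw [Finset.mem_filter] at hp
  exact Nat.mem_divisors.2 ⟨hp.2, hn⟩

theorem half_card_le_sum_jacobiSym {P : Finset ℕ} (hP : ∀ p ∈ P, p.Prime ∧ 3 < p) {a x y : ℕ}
    {k s : ℤ} (ha : a ≠ 0) (hs : s ≠ 0)
    (h : 4 * ((x : ℤ) ^ 3 + (y : ℤ) ^ 3 + k) = a * ((a : ℤ) ^ 2 + 3 * s ^ 2))
    {T : ℝ} (hTa : (a.divisors.card : ℝ) ≤ T) (hTs : (s.natAbs.divisors.card : ℝ) ≤ T)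
    (hTP : 4 * T ≤ P.card) :
    (P.card : ℝ) / 2 ≤
      ∑ p ∈ P.filter (fun p => ¬ p ∣ a), ((jacobiSym (cubicDisc k a x y) p : ℤ) : ℝ) := by
  have hdisc : cubicDisc k a x y = (3 * a * s) ^ 2 := by
    rw [cubicDisc]
    linear_combination 3 * (a : ℤ) * h
  have hJ : ∀ p ∈ P.filter (fun p => ¬ p ∣ a),
      (if p ∣ s.natAbs then (0 : ℝ) else 1) ≤ ((jacobiSym (cubicDisc k a x y) p : ℤ) : ℝ) := by
    intro p hp
    rw [Finset.mem_filter] at hp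
    obtain ⟨hpr, h3⟩ := hP p hp.1
    split_ifs with hps
    · rw [hdisc, jacobiSym.pow_left]
      push_cast
      positivity
    · have hco : Int.gcd (3 * a * s) p = 1 := by
        rw [Int.gcd_def, Int.natAbs_mul, Int.natAbs_mul, Int.natAbs_natCast, Int.natAbs_natCast]
        refine Nat.Coprime.mul_left (Nat.Coprime.mul_left ?_ ?_) ?_
        · refine ((Nat.coprime_primes Nat.prime_three hpr).2 (by omega))
        · exact ((Nat.Prime.coprime_iff_not_dvd hpr).2 hp.2).symm
        · exact ((Nat.Prime.coprime_iff_not_dvd hpr).2 hps).symm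
      rw [hdisc, jacobiSym.pow_left, jacobiSym.sq_one hco]
      norm_num
  refine le_trans ?_ (Finset.sum_le_sum hJ)
  have h1 : ∑ p ∈ P.filter (fun p => ¬ p ∣ a), (if p ∣ s.natAbs then (0 : ℝ) else 1) =
      ((P.filter (fun p => ¬ p ∣ a)).filter (fun p => ¬ p ∣ s.natAbs)).card := by
    rw [Finset.card_filter]
    push_cast
    refine Finset.sum_congr rfl fun p _ => ?_
    by_cases hps : p ∣ s.natAbs <;> simp [hps]
  have e1 : (P.filter (fun p => p ∣ a)).card + (P.filter (fun p => ¬ p ∣ a)).card = P.card :=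
    Finset.card_filter_add_card_filter_not _
  have e2 : ((P.filter (fun p => ¬ p ∣ a)).filter (fun p => p ∣ s.natAbs)).card +
      ((P.filter (fun p => ¬ p ∣ a)).filter (fun p => ¬ p ∣ s.natAbs)).card =
      (P.filter (fun p => ¬ p ∣ a)).card := Finset.card_filter_add_card_filter_not _
  have e3 : ((P.filter (fun p => p ∣ a)).card : ℝ) ≤ T :=
    (Nat.cast_le.2 (card_filter_dvd_le_card_divisors P ha)).trans hTa
  have e4 : (((P.filter (fun p => ¬ p ∣ a)).filter (fun p => p ∣ s.natAbs)).card : ℝ) ≤ T :=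
    (Nat.cast_le.2 (card_filter_dvd_le_card_divisors _ (Int.natAbs_ne_zero.2 hs))).trans hTs
  have e1' : ((P.filter (fun p => p ∣ a)).card : ℝ) + (P.filter (fun p => ¬ p ∣ a)).card =
      P.card := by exact_mod_cast e1
  have e2' : (((P.filter (fun p => ¬ p ∣ a)).filter (fun p => p ∣ s.natAbs)).card : ℝ) +
      ((P.filter (fun p => ¬ p ∣ a)).filter (fun p => ¬ p ∣ s.natAbs)).card =
      (P.filter (fun p => ¬ p ∣ a)).card := by exact_mod_cast e2
  rw [h1]
  linarith

theorem sum_mul_sum_sq_le {ι : Type*} (s : Finset ι) (P : Finset ℕ) (w : ι → ℝ) (J : ι → ℕ → ℝ)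
    (hw : ∀ i, 0 ≤ w i) (hJ : ∀ i p, |J i p| ≤ 1) :
    ∑ i ∈ s, w i * (∑ p ∈ P, J i p) ^ 2 ≤
      P.card * ∑ i ∈ s, w i +
      ∑ p ∈ P, ∑ p' ∈ P.erase p, |∑ i ∈ s, w i * (J i p * J i p')| := by
  have h1 : ∑ i ∈ s, w i * (∑ p ∈ P, J i p) ^ 2 =
      ∑ p ∈ P, ∑ p' ∈ P, ∑ i ∈ s, w i * (J i p * J i p') := by
    have : ∀ i ∈ s, w i * (∑ p ∈ P, J i p) ^ 2 =
        ∑ p ∈ P, ∑ p' ∈ P, w i * (J i p * J i p') := by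
      intro i _
      rw [sq, Finset.sum_mul_sum, Finset.mul_sum]
      exact Finset.sum_congr rfl fun p _ => Finset.mul_sum _ _ _
    rw [Finset.sum_congr rfl this, Finset.sum_comm]
    exact Finset.sum_congr rfl fun p _ => Finset.sum_comm
  rw [h1, ← nsmul_eq_mul, ← Finset.sum_const, ← Finset.sum_add_distrib]
  refine Finset.sum_le_sum fun p hp => ?_
  rw [← Finset.add_sum_erase P _ hp]
  refine add_le_add (Finset.sum_le_sum fun i _ => ?_)
    (Finset.sum_le_sum fun p' _ => le_abs_self _)
  have h2 : J i p * J i p ≤ 1 := by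
    rw [← sq, ← sq_abs]
    exact pow_le_one₀ (abs_nonneg _) (hJ i p)
  exact mul_le_of_le_one_right (hw i) h2

theorem abs_jacobiSym_le_one (c : ℤ) (n : ℕ) : |((jacobiSym c n : ℤ) : ℝ)| ≤ 1 := by
  rcases jacobiSym.trichotomy c n with h | h | h <;> rw [h] <;> norm_num

theorem abs_sum_dvdInd_mul (s : Finset (ℕ × ℕ)) (n : ℕ) (k : ℤ) (J J' : ℕ × ℕ → ℤ) :
    |∑ i ∈ s, dvdInd n k i.1 i.2 * ((J i : ℝ) * (J' i : ℝ))| =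
      ‖∑ i ∈ s, fermatInd n k (i.1 : ZMod n) i.2 * ((J i : ℂ) * (J' i : ℂ))‖ := by
  rw [← Real.norm_eq_abs, ← Complex.norm_real]
  congr 1
  push_cast
  refine Finset.sum_congr rfl fun i _ => ?_
  rw [ofReal_dvdInd]

theorem SplitUpTo.dvd_of_isTripleSol {N X L : ℕ} {k : ℤ} {b m q : ℕ → ℕ}
    (S : SplitUpTo X (6 * k.natAbs) L b m q) {a x y : ℕ} (ha : a ∈ Finset.Icc 1 X)
    (h : IsTripleSol N k a x y) :
    ((m a * q a : ℕ) : ℤ) ∣ (x : ℤ) ^ 3 + (y : ℤ) ^ 3 + k := by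
  obtain ⟨s, -, -, h⟩ := h
  have h1 : ((m a * q a : ℕ) : ℤ) ∣ (a : ℤ) :=
    Int.natCast_dvd_natCast.2 (Dvd.intro_left _ (S.eq_mul a ha).symm)
  have h2 : ((m a * q a : ℕ) : ℤ) ∣ 4 * ((x : ℤ) ^ 3 + (y : ℤ) ^ 3 + k) := by
    rw [h]
    exact Dvd.dvd.mul_right h1 _
  refine IsCoprime.dvd_of_dvd_mul_left ?_ h2
  have h3 : (m a * q a).Coprime 2 :=
    (S.coprime a ha).coprime_dvd_right ⟨3 * k.natAbs, by ring⟩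
  have h4 : (m a * q a).Coprime 4 := Nat.Coprime.pow_right 2 h3
  exact_mod_cast Nat.isCoprime_iff_coprime.2 h4

theorem sum_inv_sqrt_le (P : ℕ) : ∑ p ∈ Finset.Icc 1 P, 1 / √(p : ℝ) ≤ 2 * √(P : ℝ) := by
  induction P with
  | zero => simp
  | succ n ih =>
    rw [Finset.sum_Icc_succ_top (by omega)]
    have h1 : 0 ≤ √(n : ℝ) := Real.sqrt_nonneg _
    have h2 : 0 < √((n + 1 : ℕ) : ℝ) := Real.sqrt_pos.2 (by positivity)
    have h3 : √(n : ℝ) ^ 2 = n := Real.sq_sqrt (by positivity)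
    have h4 : √((n + 1 : ℕ) : ℝ) ^ 2 = n + 1 := by
      rw [Real.sq_sqrt (by positivity)]
      push_cast
      ring
    have h5 : 1 / √((n + 1 : ℕ) : ℝ) ≤ 2 * √((n + 1 : ℕ) : ℝ) - 2 * √(n : ℝ) := by
      rw [div_le_iff₀ h2]
      nlinarith [sq_nonneg (√((n + 1 : ℕ) : ℝ) - √(n : ℝ))]
    linarith

theorem sum_pair_le {Q : Finset ℕ} {P : ℕ} (hQ : ∀ p ∈ Q, 1 ≤ p ∧ p ≤ P) {A B : ℝ} (hA : 0 ≤ A)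
    (hB : 0 ≤ B) :
    ∑ p ∈ Q, ∑ p' ∈ Q.erase p, (A / √((p * p' : ℕ) : ℝ) + B * (p * p' : ℕ)) ≤
      4 * P * A + B * P ^ 2 * Q.card ^ 2 := by
  have h1 : ∑ p ∈ Q, 1 / √(p : ℝ) ≤ 2 * √(P : ℝ) := by
    refine le_trans (Finset.sum_le_sum_of_subset_of_nonneg (fun p hp => ?_) fun p _ _ => ?_)
      (sum_inv_sqrt_le P)
    · exact Finset.mem_Icc.2 (hQ p hp)
    · positivity
  have h0 : 0 ≤ ∑ p ∈ Q, 1 / √(p : ℝ) := Finset.sum_nonneg fun p _ => by positivity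
  calc ∑ p ∈ Q, ∑ p' ∈ Q.erase p, (A / √((p * p' : ℕ) : ℝ) + B * (p * p' : ℕ))
      ≤ ∑ p ∈ Q, ∑ p' ∈ Q, (A / √((p * p' : ℕ) : ℝ) + B * (p * p' : ℕ)) :=
        Finset.sum_le_sum fun p _ => Finset.sum_le_sum_of_subset_of_nonneg
          (Finset.erase_subset _ _) fun _ _ _ => by positivity
    _ ≤ ∑ p ∈ Q, ∑ p' ∈ Q, (A * (1 / √(p : ℝ) * (1 / √(p' : ℝ))) + B * P ^ 2) := by
        refine Finset.sum_le_sum fun p hp => Finset.sum_le_sum fun p' hp' => ?_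
        refine add_le_add (le_of_eq ?_) ?_
        · push_cast
          rw [Real.sqrt_mul (by positivity)]
          ring
        · have : ((p * p' : ℕ) : ℝ) ≤ (P : ℝ) ^ 2 := by
            rw [sq]
            exact_mod_cast Nat.mul_le_mul (hQ p hp).2 (hQ p' hp').2
          gcongr
    _ = A * (∑ p ∈ Q, 1 / √(p : ℝ)) ^ 2 + B * P ^ 2 * Q.card ^ 2 := by
        simp only [Finset.sum_add_distrib, Finset.sum_const, nsmul_eq_mul, ← Finset.mul_sum]
        rw [← Finset.sum_mul, ← sq]
        ring
    _ ≤ A * (2 * √(P : ℝ)) ^ 2 + B * P ^ 2 * Q.card ^ 2 := by gcongr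
    _ = _ := by
        rw [mul_pow, Real.sq_sqrt (by positivity)]
        ring

open Classical in
/-- The number of triples `(a, x, y)` satisfying `IsTripleSol`. -/
noncomputable def tripleCount (N : ℕ) (k : ℤ) : ℕ :=
  ∑ a ∈ Finset.Icc 1 (2 * N),
    ((Finset.Icc 1 N ×ˢ Finset.Icc 1 N).filter
      (fun i : ℕ × ℕ => IsTripleSol N k a i.1 i.2)).card

theorem sq_card_mul_tripleCount_le {N P L : ℕ} {k : ℤ} (hk : k ≠ 0)
    {b m q : ℕ → ℕ} (S : SplitUpTo (2 * N) (6 * k.natAbs) L b m q) {Q : Finset ℕ}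
    (hQ : ∀ p ∈ Q, p.Prime ∧ 3 < p ∧ p ≤ P) (hPN : P * P ≤ N)
    {T : ℝ} (hT : 1 ≤ T)
    (hd : ∀ n : ℕ, n ≠ 0 → n ≤ 2 * (N ^ 2) ^ 3 + k.natAbs → (n.divisors.card : ℝ) ≤ T)
    (hdc : (((6 * k.natAbs) ^ L).divisors.card : ℝ) ≤ T)
    (hH : harmonicSum (2 * N ^ 2) ≤ T) (hTQ : 4 * T ≤ Q.card) :
    (Q.card : ℝ) ^ 2 / 4 * tripleCount N k ≤ Q.card * (3 * N ^ 2 * T ^ 2) +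
      100 * T ^ 14 * (4 * P * N ^ 2 + N * √N * P ^ 2 * Q.card ^ 2) := by
  classical
  have hN3 : N ≤ N ^ 3 := Nat.le_self_pow (by norm_num) N
  have hN36 : N ^ 3 ≤ (N ^ 2) ^ 3 := by
    rw [← pow_mul]
    rcases Nat.eq_zero_or_pos N with rfl | h
    · simp
    · exact Nat.pow_le_pow_right h (by norm_num)
  set c : ℕ → ℕ → ℕ × ℕ → ℤ := fun a p i => jacobiSym (cubicDisc k a i.1 i.2) p with hc
  set B : Finset (ℕ × ℕ) := Finset.Icc 1 N ×ˢ Finset.Icc 1 N with hB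
  have hQ0 : (0 : ℝ) ≤ Q.card := by positivity
  have hpoint : ∀ a ∈ Finset.Icc 1 (2 * N),
      (Q.card : ℝ) ^ 2 / 4 * (B.filter (fun i : ℕ × ℕ => IsTripleSol N k a i.1 i.2)).card ≤
        Q.card * ∑ i ∈ B, dvdInd (m a * q a) k i.1 i.2 +
        ∑ p ∈ Q.filter (fun p => ¬ p ∣ a), ∑ p' ∈ (Q.filter (fun p => ¬ p ∣ a)).erase p,
          ‖∑ i ∈ B, fermatInd (m a * q a) k (i.1 : ZMod (m a * q a)) i.2 *
            ((c a p i : ℂ) * (c a p' i : ℂ))‖ := by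
    intro a ha
    have ha' := Finset.mem_Icc.1 ha
    have h1 : (Q.card : ℝ) ^ 2 / 4 *
        (B.filter (fun i : ℕ × ℕ => IsTripleSol N k a i.1 i.2)).card ≤
        ∑ i ∈ B, dvdInd (m a * q a) k i.1 i.2 *
          (∑ p ∈ Q.filter (fun p => ¬ p ∣ a), (c a p i : ℝ)) ^ 2 := by
      rw [mul_comm, ← nsmul_eq_mul, ← Finset.sum_const]
      refine le_trans ?_ (Finset.sum_le_sum_of_subset_of_nonneg (Finset.filter_subset
        (fun i : ℕ × ℕ => IsTripleSol N k a i.1 i.2) B) fun i _ _ =>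
        mul_nonneg (dvdInd_nonneg _ _ _ _) (sq_nonneg _))
      refine Finset.sum_le_sum fun i hi => ?_
      rw [Finset.mem_filter] at hi
      have hdvd := S.dvd_of_isTripleSol ha hi.2
      obtain ⟨s, hs0, hsN, hs⟩ := hi.2
      rw [dvdInd, if_pos hdvd, one_mul]
      have h2 := half_card_le_sum_jacobiSym (P := Q) (fun p hp => ⟨(hQ p hp).1, (hQ p hp).2.1⟩)
        (by omega) hs0 hs (hd a (by omega) (by omega))
        (hd s.natAbs (Int.natAbs_ne_zero.2 hs0) (by omega)) hTQ
      calc (Q.card : ℝ) ^ 2 / 4 = ((Q.card : ℝ) / 2) ^ 2 := by ring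
        _ ≤ _ := pow_le_pow_left₀ (by positivity) h2 2
    refine h1.trans ((sum_mul_sum_sq_le B _ (fun i => dvdInd (m a * q a) k i.1 i.2)
      (fun i p => (c a p i : ℝ)) (fun i => dvdInd_nonneg _ _ _ _)
      fun i p => abs_jacobiSym_le_one _ _).trans ?_)
    have h3 : 0 ≤ ∑ i ∈ B, dvdInd (m a * q a) k i.1 i.2 :=
      Finset.sum_nonneg fun i _ => dvdInd_nonneg _ _ _ _
    have h4 : ((Q.filter (fun p => ¬ p ∣ a)).card : ℝ) ≤ Q.card := by
      exact_mod_cast Finset.card_le_card (Finset.filter_subset _ _)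
    refine add_le_add (mul_le_mul_of_nonneg_right h4 h3) (le_of_eq ?_)
    exact Finset.sum_congr rfl fun p _ => Finset.sum_congr rfl fun p' _ =>
      abs_sum_dvdInd_mul _ _ _ _ _
  have hswap : ∀ F : ℕ → ℕ → ℕ → ℝ,
      ∑ a ∈ Finset.Icc 1 (2 * N), ∑ p ∈ Q.filter (fun p => ¬ p ∣ a),
        ∑ p' ∈ (Q.filter (fun p => ¬ p ∣ a)).erase p, F a p p' =
      ∑ p ∈ Q, ∑ p' ∈ Q.erase p,
        ∑ a ∈ (Finset.Icc 1 (2 * N)).filter (fun a => ¬ p ∣ a ∧ ¬ p' ∣ a), F a p p' := by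
    intro F
    have e1 : ∀ a, ∑ p ∈ Q.filter (fun p => ¬ p ∣ a),
        ∑ p' ∈ (Q.filter (fun p => ¬ p ∣ a)).erase p, F a p p' =
        ∑ p ∈ Q, ∑ p' ∈ Q.erase p, if ¬ p ∣ a ∧ ¬ p' ∣ a then F a p p' else 0 := by
      intro a
      rw [Finset.sum_filter]
      refine Finset.sum_congr rfl fun p _ => ?_
      by_cases h : p ∣ a
      · simp [h]
      · rw [if_pos h, ← Finset.filter_erase, Finset.sum_filter]
        simp [h]
    simp only [e1]
    rw [Finset.sum_comm]
    refine Finset.sum_congr rfl fun p _ => ?_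
    rw [Finset.sum_comm]
    exact Finset.sum_congr rfl fun p' _ => (Finset.sum_filter _ _).symm
  calc (Q.card : ℝ) ^ 2 / 4 * tripleCount N k
      = ∑ a ∈ Finset.Icc 1 (2 * N), (Q.card : ℝ) ^ 2 / 4 *
          (B.filter (fun i : ℕ × ℕ => IsTripleSol N k a i.1 i.2)).card := by
        rw [tripleCount]
        push_cast
        rw [Finset.mul_sum]
    _ ≤ ∑ a ∈ Finset.Icc 1 (2 * N), (Q.card * ∑ i ∈ B, dvdInd (m a * q a) k i.1 i.2 +
        ∑ p ∈ Q.filter (fun p => ¬ p ∣ a), ∑ p' ∈ (Q.filter (fun p => ¬ p ∣ a)).erase p,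
          ‖∑ i ∈ B, fermatInd (m a * q a) k (i.1 : ZMod (m a * q a)) i.2 *
            ((c a p i : ℂ) * (c a p' i : ℂ))‖) := Finset.sum_le_sum hpoint
    _ = Q.card * ∑ a ∈ Finset.Icc 1 (2 * N), ∑ i ∈ B, dvdInd (m a * q a) k i.1 i.2 +
        ∑ p ∈ Q, ∑ p' ∈ Q.erase p,
        ∑ a ∈ (Finset.Icc 1 (2 * N)).filter (fun a => ¬ p ∣ a ∧ ¬ p' ∣ a),
          ‖∑ i ∈ B, fermatInd (m a * q a) k (i.1 : ZMod (m a * q a)) i.2 *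
            ((c a p i : ℂ) * (c a p' i : ℂ))‖ := by
        rw [Finset.sum_add_distrib, hswap, Finset.mul_sum]
    _ ≤ Q.card * (3 * N ^ 2 * T ^ 2) + ∑ p ∈ Q, ∑ p' ∈ Q.erase p,
          100 * T ^ 14 * (N ^ 2 / √((p * p' : ℕ) : ℝ) + N * √N * (p * p' : ℕ)) := by
        refine add_le_add (mul_le_mul_of_nonneg_left ?_ hQ0)
          (Finset.sum_le_sum fun p hp => Finset.sum_le_sum fun p' hp' => ?_)
        · have := S.sum_dvdInd_le (k := k) (by have := Int.natAbs_ne_zero.2 hk; omega) hT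
            (fun n h0 h1 => hd n h0 (by omega)) hdc
          refine le_trans (le_of_eq ?_) this
          exact Finset.sum_congr rfl fun a _ => Finset.sum_product _ _ _
        · obtain ⟨h1, h2⟩ := Finset.mem_erase.1 hp'
          have := sum_norm_sum_fermatInd_jacobiSym_le hk S (hQ p hp).1 (hQ p' h2).1 (hQ p hp).2.1
            (hQ p' h2).2.1 h1.symm
            ((Nat.mul_le_mul (hQ p hp).2.2 (hQ p' h2).2.2).trans hPN) hT
            (fun n h0 h1 => hd n h0 (by omega)) hdc hH
          refine le_trans (le_of_eq ?_) this
          refine Finset.sum_congr rfl fun a _ => ?_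
          rw [hB, Finset.sum_product]
    _ = Q.card * (3 * N ^ 2 * T ^ 2) + 100 * T ^ 14 * ∑ p ∈ Q, ∑ p' ∈ Q.erase p,
          ((N : ℝ) ^ 2 / √((p * p' : ℕ) : ℝ) + N * √N * (p * p' : ℕ)) := by
        simp only [Finset.mul_sum]
    _ ≤ _ := by
        have := sum_pair_le (Q := Q) (P := P) (fun p hp => ⟨(hQ p hp).1.one_le, (hQ p hp).2.2⟩)
          (A := (N : ℝ) ^ 2) (B := N * √N) (by positivity) (by positivity)
        gcongr

theorem eq_or_eq_swap_of_add_eq {a b c d : ℕ} (h0 : 0 < a + b) (h1 : a + b = c + d)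
    (h3 : (a : ℤ) ^ 3 + (b : ℤ) ^ 3 = (c : ℤ) ^ 3 + (d : ℤ) ^ 3) :
    (a = c ∧ b = d) ∨ (a = d ∧ b = c) := by
  have h1' : (a : ℤ) + b = c + d := by exact_mod_cast h1
  have h0' : (a : ℤ) + b ≠ 0 := by
    have : (0 : ℤ) < a + b := by exact_mod_cast h0
    exact this.ne'
  have hd : (d : ℤ) = a + b - c := by linarith
  have h2 : ((a : ℤ) + b) * (((a : ℤ) - c) * ((a : ℤ) - d)) = 0 := by
    rw [hd] at h3 ⊢
    have : 3 * (((a : ℤ) + b) * (((a : ℤ) - c) * ((a : ℤ) - (a + b - c)))) = 0 := by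
      linear_combination h3
    linarith
  rcases mul_eq_zero.1 ((mul_eq_zero.1 h2).resolve_left h0') with h | h
  · left
    have : a = c := by exact_mod_cast sub_eq_zero.1 h
    omega
  · right
    have : a = d := by exact_mod_cast sub_eq_zero.1 h
    omega

/-- The solutions of `n₁ ^ 3 + n₂ ^ 3 - n₃ ^ 3 - n₄ ^ 3 = k` in the box `[1, N] ^ 4`. -/
def cubeSols (k : ℤ) (N : ℕ) : Finset ((ℕ × ℕ) × ℕ × ℕ) :=
  ((Finset.Icc 1 N ×ˢ Finset.Icc 1 N) ×ˢ (Finset.Icc 1 N ×ˢ Finset.Icc 1 N)).filter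
    (fun q : (ℕ × ℕ) × ℕ × ℕ =>
      (q.1.1 : ℤ) ^ 3 + (q.1.2 : ℤ) ^ 3 - (q.2.1 : ℤ) ^ 3 - (q.2.2 : ℤ) ^ 3 = k)

theorem mem_cubeSols {k : ℤ} {N : ℕ} {q : (ℕ × ℕ) × ℕ × ℕ} :
    q ∈ cubeSols k N ↔ ((1 ≤ q.1.1 ∧ q.1.1 ≤ N) ∧ (1 ≤ q.1.2 ∧ q.1.2 ≤ N)) ∧
      ((1 ≤ q.2.1 ∧ q.2.1 ≤ N) ∧ (1 ≤ q.2.2 ∧ q.2.2 ≤ N)) ∧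
      (q.1.1 : ℤ) ^ 3 + (q.1.2 : ℤ) ^ 3 - (q.2.1 : ℤ) ^ 3 - (q.2.2 : ℤ) ^ 3 = k := by
  rw [cubeSols, Finset.mem_filter]
  simp only [Finset.mem_product, Finset.mem_Icc, and_assoc]

theorem card_filter_ne_cubeSols_le (k : ℤ) (N : ℕ) :
    ((cubeSols k N).filter (fun z => z.1.1 ≠ z.1.2)).card ≤ 2 * tripleCount N k := by
  classical
  rw [Finset.card_eq_sum_card_fiberwise (f := fun z => z.1.1 + z.1.2)
    (t := Finset.Icc 1 (2 * N)), tripleCount, Finset.mul_sum]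
  · refine Finset.sum_le_sum fun a _ => ?_
    refine (Finset.card_le_mul_card_image (f := Prod.snd) _ 2 ?_).trans
      (Nat.mul_le_mul_left 2 (Finset.card_le_card ?_))
    · intro i hi
      obtain ⟨z, hz, rfl⟩ := Finset.mem_image.1 hi
      refine (Finset.card_le_card (t := {z, (z.1.swap, z.2)}) fun w hw => ?_).trans
        Finset.card_le_two
      simp only [Finset.mem_filter] at hz hw
      obtain ⟨⟨⟨hw1, -⟩, hw2⟩, hw3⟩ := hw
      obtain ⟨⟨hz1, -⟩, hz2⟩ := hz
      rw [mem_cubeSols] at hw1 hz1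
      rw [Finset.mem_insert, Finset.mem_singleton]
      obtain ⟨⟨w1, w2⟩, w3⟩ := w
      obtain ⟨⟨z1, z2⟩, z3⟩ := z
      dsimp only at *
      subst hw3
      rcases eq_or_eq_swap_of_add_eq (a := w1) (b := w2) (c := z1) (d := z2) (by omega)
        (by omega) (by linarith [hw1.2.2, hz1.2.2]) with h | h
      · left
        rw [h.1, h.2]
      · right
        rw [h.1, h.2]
        rfl
    · intro i hi
      obtain ⟨z, hz, rfl⟩ := Finset.mem_image.1 hi
      rw [Finset.mem_filter, Finset.mem_filter] at hz
      obtain ⟨⟨hz1, hne⟩, hz2⟩ := hz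
      rw [mem_cubeSols] at hz1
      obtain ⟨h1, h2, h3⟩ := hz1
      rw [Finset.mem_filter]
      refine ⟨by simp only [Finset.mem_product, Finset.mem_Icc]; exact h2,
        (z.1.1 : ℤ) - z.1.2, ?_, by omega, ?_⟩
      · rw [sub_ne_zero]
        exact_mod_cast hne
      · rw [← hz2]
        push_cast
        linear_combination 4 * h3.symm
  · intro z hz
    rw [Finset.mem_coe, Finset.mem_filter, mem_cubeSols] at hz
    rw [Finset.mem_coe, Finset.mem_Icc]
    dsimp only
    omega

theorem card_filter_eq_cubeSols_le {k : ℤ} {N : ℕ} {T : ℝ} (hT : 1 ≤ T)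
    (hd : ∀ n : ℕ, n ≠ 0 → n ≤ 2 * N ^ 3 + k.natAbs → (n.divisors.card : ℝ) ≤ T) :
    (((cubeSols k N).filter (fun z => ¬ z.1.1 ≠ z.1.2)).card : ℝ) ≤ 2 * N * T := by
  classical
  rw [Finset.card_eq_sum_card_fiberwise (f := fun z => z.1.1) (t := Finset.Icc 1 N)]
  · push_cast
    have key : ∀ n ∈ Finset.Icc 1 N, ((((cubeSols k N).filter
        (fun z => ¬ z.1.1 ≠ z.1.2)).filter (fun z => z.1.1 = n)).card : ℝ) ≤ 2 * T := by
      intro n hn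
      rw [Finset.mem_Icc] at hn
      have h1 : (((cubeSols k N).filter
          (fun z => ¬ z.1.1 ≠ z.1.2)).filter (fun z => z.1.1 = n)).card ≤
          2 * (2 * (n : ℤ) ^ 3 - k).natAbs.divisors.card := by
        refine (Finset.card_le_mul_card_image (f := fun z => z.2.1 + z.2.2) _ 2 ?_).trans
          (Nat.mul_le_mul_left 2 (Finset.card_le_card ?_))
        · intro i hi
          obtain ⟨z, hz, rfl⟩ := Finset.mem_image.1 hi
          refine (Finset.card_le_card (t := {z, (z.1, z.2.swap)}) fun w hw => ?_).trans
            Finset.card_le_two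
          simp only [Finset.mem_filter] at hz hw
          obtain ⟨⟨⟨hw1, hwe⟩, hw2⟩, hw3⟩ := hw
          obtain ⟨⟨hz1, hze⟩, hz2⟩ := hz
          rw [mem_cubeSols] at hw1 hz1
          rw [Finset.mem_insert, Finset.mem_singleton]
          obtain ⟨⟨w1, w2⟩, w3, w4⟩ := w
          obtain ⟨⟨z1, z2⟩, z3, z4⟩ := z
          dsimp only at *
          have e1 : w2 = n := by omega
          have e2 : z2 = n := by omega
          subst e1 hw2 hz2
          subst e2
          rcases eq_or_eq_swap_of_add_eq (a := w3) (b := w4) (c := z3) (d := z4) (by omega)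
            (by omega) (by linarith [hw1.2.2, hz1.2.2]) with h | h
          · left
            rw [h.1, h.2]
          · right
            rw [h.1, h.2]
            rfl
        · intro i hi
          obtain ⟨z, hz, rfl⟩ := Finset.mem_image.1 hi
          rw [Finset.mem_filter, Finset.mem_filter] at hz
          obtain ⟨⟨hz1, hne⟩, hz2⟩ := hz
          rw [mem_cubeSols] at hz1
          obtain ⟨h1, h2, h3⟩ := hz1
          have e1 : z.1.2 = n := by omega
          rw [hz2, e1] at h3
          have e2 : 2 * (n : ℤ) ^ 3 - k = ((z.2.1 ^ 3 + z.2.2 ^ 3 : ℕ) : ℤ) := by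
            push_cast
            linarith
          rw [e2, Int.natAbs_natCast, Nat.mem_divisors]
          refine ⟨Odd.nat_add_dvd_pow_add_pow _ _ (by decide), ?_⟩
          have : 0 < z.2.1 ^ 3 := Nat.pow_pos (by omega)
          omega
      have h2 : ((2 * (n : ℤ) ^ 3 - k).natAbs.divisors.card : ℝ) ≤ T := by
        by_cases h0 : (2 * (n : ℤ) ^ 3 - k).natAbs = 0
        · rw [h0]
          simp only [Nat.divisors_zero, Finset.card_empty, Nat.cast_zero]
          linarith
        · refine hd _ h0 ?_
          have h3 : n ^ 3 ≤ N ^ 3 := Nat.pow_le_pow_left hn.2 3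
          have h4 := Int.natAbs_sub_le (2 * (n : ℤ) ^ 3) k
          have h5 : (2 * (n : ℤ) ^ 3).natAbs = 2 * n ^ 3 := by
            rw [show 2 * (n : ℤ) ^ 3 = ((2 * n ^ 3 : ℕ) : ℤ) by push_cast; rfl]
            exact Int.natAbs_natCast _
          omega
      have h1' : ((((cubeSols k N).filter
          (fun z => ¬ z.1.1 ≠ z.1.2)).filter (fun z => z.1.1 = n)).card : ℝ) ≤
          2 * ((2 * (n : ℤ) ^ 3 - k).natAbs.divisors.card : ℝ) := by exact_mod_cast h1
      linarith
    refine (Finset.sum_le_sum key).trans (le_of_eq ?_)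
    simp only [Finset.sum_const, Nat.card_Icc, nsmul_eq_mul, Nat.add_sub_cancel]
    ring
  · intro z hz
    rw [Finset.mem_coe, Finset.mem_filter, mem_cubeSols] at hz
    rw [Finset.mem_coe, Finset.mem_Icc]
    dsimp only
    omega

theorem card_cubeSols_le {k : ℤ} {N : ℕ} {T : ℝ} (hT : 1 ≤ T)
    (hd : ∀ n : ℕ, n ≠ 0 → n ≤ 2 * N ^ 3 + k.natAbs → (n.divisors.card : ℝ) ≤ T) :
    ((cubeSols k N).card : ℝ) ≤ 2 * tripleCount N k + 2 * N * T := by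
  have h1 : ((cubeSols k N).filter (fun z => z.1.1 ≠ z.1.2)).card +
      ((cubeSols k N).filter (fun z => ¬ z.1.1 ≠ z.1.2)).card = (cubeSols k N).card :=
    Finset.card_filter_add_card_filter_not _
  have h2 := card_filter_ne_cubeSols_le k N
  have h3 := card_filter_eq_cubeSols_le (k := k) (N := N) hT hd
  have h2' : (((cubeSols k N).filter (fun z => z.1.1 ≠ z.1.2)).card : ℝ) ≤ 2 * tripleCount N k := by
    exact_mod_cast h2
  rw [← h1]
  push_cast
  linarith

theorem exists_card_divisors_le_of_le {δ : ℝ} (hδ : 0 < δ) (A B : ℕ) :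
    ∃ C : ℝ, 1 ≤ C ∧ ∀ N : ℕ, 0 < N → ∀ n : ℕ, n ≠ 0 → n ≤ A * N ^ B →
      (n.divisors.card : ℝ) ≤ C * (N : ℝ) ^ δ := by
  have hB : (0 : ℝ) < B + 1 := by positivity
  obtain ⟨C, hC, h⟩ := exists_card_divisors_le_rpow (δ := δ / (B + 1)) (by positivity)
  refine ⟨C * ((A + 1 : ℕ) : ℝ) ^ (δ / (B + 1)), ?_, fun N hN n hn hnle => ?_⟩
  · refine one_le_mul_of_one_le_of_one_le hC (Real.one_le_rpow ?_ (by positivity))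
    push_cast
    linarith [(Nat.cast_nonneg A : (0 : ℝ) ≤ A)]
  · have h1 : n ≤ (A + 1) * N ^ (B + 1) := hnle.trans
      (Nat.mul_le_mul (by omega) (Nat.pow_le_pow_right hN (by omega)))
    have h2 : (n : ℝ) ≤ ((A + 1 : ℕ) : ℝ) * (N : ℝ) ^ (B + 1) := by exact_mod_cast h1
    calc (n.divisors.card : ℝ) ≤ C * (n : ℝ) ^ (δ / (B + 1)) := h n hn
      _ ≤ C * (((A + 1 : ℕ) : ℝ) * (N : ℝ) ^ (B + 1)) ^ (δ / (B + 1)) := by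
          have := Real.rpow_le_rpow (Nat.cast_nonneg n) h2 (z := δ / (B + 1)) (by positivity)
          gcongr
      _ = C * ((A + 1 : ℕ) : ℝ) ^ (δ / (B + 1)) * (N : ℝ) ^ δ := by
          rw [Real.mul_rpow (by positivity) (by positivity), ← Real.rpow_natCast (N : ℝ),
            ← Real.rpow_mul (by positivity), ← mul_assoc]
          congr 2
          push_cast
          field_simp

theorem harmonicSum_le_one_add_log (n : ℕ) : harmonicSum n ≤ 1 + Real.log n := by
  have h := harmonic_le_one_add_log n
  rw [harmonic_eq_sum_Icc] at h
  push_cast at h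
  simpa [harmonicSum, one_div] using h

theorem exists_log_le {δ : ℝ} (hδ : 0 < δ) (A B : ℕ) :
    ∃ C : ℝ, 1 ≤ C ∧ ∀ N : ℕ, 0 < N →
      1 + Real.log ((A * N ^ B : ℕ) : ℝ) ≤ C * (N : ℝ) ^ δ := by
  have hB : (0 : ℝ) < B + 1 := by positivity
  have hA : (0 : ℝ) ≤ ((A + 1 : ℕ) : ℝ) ^ (δ / (B + 1)) / (δ / (B + 1)) := by positivity
  refine ⟨1 + ((A + 1 : ℕ) : ℝ) ^ (δ / (B + 1)) / (δ / (B + 1)), by linarith, fun N hN => ?_⟩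
  have hN1 : (1 : ℝ) ≤ N := by exact_mod_cast hN
  have h0 : (1 : ℝ) ≤ (N : ℝ) ^ δ := Real.one_le_rpow hN1 hδ.le
  have h1 : A * N ^ B ≤ (A + 1) * N ^ (B + 1) :=
    Nat.mul_le_mul (by omega) (Nat.pow_le_pow_right hN (by omega))
  have h2 : ((A * N ^ B : ℕ) : ℝ) ≤ ((A + 1 : ℕ) : ℝ) * (N : ℝ) ^ (B + 1) := by exact_mod_cast h1
  have h3 : Real.log ((A * N ^ B : ℕ) : ℝ) ≤
      ((A + 1 : ℕ) : ℝ) ^ (δ / (B + 1)) / (δ / (B + 1)) * (N : ℝ) ^ δ := by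
    calc Real.log ((A * N ^ B : ℕ) : ℝ)
        ≤ ((A * N ^ B : ℕ) : ℝ) ^ (δ / (B + 1)) / (δ / (B + 1)) :=
          Real.log_le_rpow_div (Nat.cast_nonneg _) (by positivity)
      _ ≤ (((A + 1 : ℕ) : ℝ) * (N : ℝ) ^ (B + 1)) ^ (δ / (B + 1)) / (δ / (B + 1)) := by
          have := Real.rpow_le_rpow (Nat.cast_nonneg _) h2 (z := δ / (B + 1)) (by positivity)
          gcongr
      _ = ((A + 1 : ℕ) : ℝ) ^ (δ / (B + 1)) * (N : ℝ) ^ δ / (δ / (B + 1)) := by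
          rw [Real.mul_rpow (by positivity) (by positivity), ← Real.rpow_natCast (N : ℝ),
            ← Real.rpow_mul (by positivity)]
          congr 3
          push_cast
          field_simp
      _ = _ := by ring
  linarith

theorem exists_primes_card_ge {P : ℕ} {T : ℝ} (hT : 1 ≤ T) (hlog : Real.log (P + 1) ≤ T)
    (hP : 100 * T ^ 2 ≤ P) :
    ∃ Q : Finset ℕ, (∀ p ∈ Q, p.Prime ∧ 3 < p ∧ p ≤ P) ∧ (P : ℝ) ≤ 2 * T * Q.card ∧
      4 * T ≤ Q.card := by
  have hT0 : 0 < T := by linarith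
  have hP1 : (100 : ℝ) ≤ P := by nlinarith
  have hPpos : (0 : ℝ) < P := by linarith
  set Q : Finset ℕ := (Finset.range (P + 1)).filter (fun p => p.Prime ∧ 3 < p) with hQ
  have h1 : Nat.primeCounting P ≤ Q.card + 2 := by
    rw [Nat.primeCounting, Nat.primeCounting', Nat.count_eq_card_filter_range]
    refine (Finset.card_le_card (t := Q ∪ {2, 3}) fun p hp => ?_).trans
      ((Finset.card_union_le _ _).trans (Nat.add_le_add_left Finset.card_le_two _))
    rw [Finset.mem_filter] at hp
    rw [Finset.mem_union, hQ, Finset.mem_filter, Finset.mem_insert, Finset.mem_singleton]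
    have := hp.2.two_le
    by_cases h : 3 < p
    · exact Or.inl ⟨hp.1, hp.2, h⟩
    · right
      omega
  have h1' : (Nat.primeCounting P : ℝ) ≤ Q.card + 2 := by exact_mod_cast h1
  have h2 := Chebyshev.pi_ge P
  have hl0 : 0 < Real.log P := Real.log_pos (by linarith)
  have hl1 : Real.log P ≤ T := (Real.log_le_log hPpos (by linarith)).trans hlog
  rw [div_le_iff₀ hl0] at h2
  have h3 : (Nat.primeCounting P : ℝ) * Real.log P ≤ (Q.card + 2) * T := by gcongr
  have h4 : (0.69 : ℝ) ≤ Real.log 2 := by linarith [Real.log_two_gt_d9]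
  have h5 : (P : ℝ) * 0.69 ≤ P * Real.log 2 := by gcongr
  have h6 : T ≤ T ^ 2 := le_self_pow₀ hT (by norm_num)
  have h7 : (P : ℝ) ≤ 2 * T * Q.card := by linarith
  refine ⟨Q, fun p hp => ?_, h7, ?_⟩
  · rw [hQ, Finset.mem_filter, Finset.mem_range] at hp
    exact ⟨hp.2.1, hp.2.2, by omega⟩
  · have h8 : T * (4 * T) ≤ T * Q.card := by nlinarith
    exact le_of_mul_le_mul_left h8 hT0

theorem card_cubeSols_le_of_bounds {N L : ℕ} {k : ℤ} (hN : 0 < N) (hk : k ≠ 0)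
    (hL : 2 * N < 2 ^ L) {T : ℝ} (hT : 1 ≤ T)
    (hd : ∀ n : ℕ, n ≠ 0 → n ≤ 2 * (N ^ 2) ^ 3 + k.natAbs → (n.divisors.card : ℝ) ≤ T)
    (hdc : (((6 * k.natAbs) ^ L).divisors.card : ℝ) ≤ T)
    (hH : harmonicSum (2 * N ^ 2) ≤ T) (hlog : Real.log (N + 1) ≤ T) :
    ((cubeSols k N).card : ℝ) ≤ 101 ^ 13 * T ^ 26 * (N : ℝ) ^ (11 / 6 : ℝ) := by
  have hN1 : (1 : ℝ) ≤ N := by exact_mod_cast hN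
  have hT0 : 0 < T := by linarith
  set M : ℝ := (N : ℝ) ^ (1 / 6 : ℝ) with hM
  have hM1 : 1 ≤ M := Real.one_le_rpow hN1 (by norm_num)
  have hM0 : 0 < M := by linarith
  have hM6 : M ^ 6 = N := by
    rw [hM, ← Real.rpow_natCast, ← Real.rpow_mul (by positivity)]
    norm_num
  have hM11 : (N : ℝ) ^ (11 / 6 : ℝ) = M ^ 11 := by
    rw [hM, ← Real.rpow_natCast, ← Real.rpow_mul (by positivity)]
    norm_num
  have hM3 : √(N : ℝ) = M ^ 3 := by
    rw [← hM6, show M ^ 6 = (M ^ 3) ^ 2 by ring]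
    exact Real.sqrt_sq (by positivity)
  rw [hM11]
  set P : ℕ := ⌊M⌋₊ with hPdef
  have hPM : (P : ℝ) ≤ M := Nat.floor_le hM0.le
  have hMP : M < P + 1 := Nat.lt_floor_add_one M
  have hPN : P * P ≤ N := by
    have : (P : ℝ) * P ≤ N := by
      calc (P : ℝ) * P ≤ M * M := by gcongr
        _ = M ^ 2 := by ring
        _ ≤ M ^ 6 := pow_le_pow_right₀ hM1 (by norm_num)
        _ = N := hM6
    exact_mod_cast this
  have hP0 : (0 : ℝ) ≤ P := Nat.cast_nonneg P
  have hPN' : (P : ℝ) ≤ N := by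
    calc (P : ℝ) ≤ M := hPM
      _ = M ^ 1 := by ring
      _ ≤ M ^ 6 := pow_le_pow_right₀ hM1 (by norm_num)
      _ = N := hM6
  rcases lt_or_ge (P : ℝ) (100 * T ^ 2) with hsmall | hlarge
  · have hcard : (cubeSols k N).card ≤ N ^ 4 := by
      refine (Finset.card_filter_le _ _).trans (le_of_eq ?_)
      simp only [Finset.card_product, Nat.card_Icc, Nat.add_sub_cancel]
      ring
    have hT2 : 1 ≤ T ^ 2 := one_le_pow₀ hT
    have hMT : M ≤ 101 * T ^ 2 := by linarith
    calc ((cubeSols k N).card : ℝ) ≤ (N : ℝ) ^ 4 := by exact_mod_cast hcard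
      _ = M ^ 13 * M ^ 11 := by
          rw [← hM6]
          ring
      _ ≤ (101 * T ^ 2) ^ 13 * M ^ 11 := by gcongr
      _ = 101 ^ 13 * T ^ 26 * M ^ 11 := by ring
  · obtain ⟨Q, hQ, hPQ, hTQ⟩ := exists_primes_card_ge hT
      ((Real.log_le_log (by positivity) (by linarith)).trans hlog) hlarge
    obtain ⟨b, m, q, S⟩ := exists_splitUpTo (X := 2 * N) (c := 6 * k.natAbs) hL
    have h1 := sq_card_mul_tripleCount_le hk S hQ hPN hT hd hdc hH hTQ
    have hN3 : N ^ 3 ≤ (N ^ 2) ^ 3 := by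
      rw [← pow_mul]
      exact Nat.pow_le_pow_right hN (by norm_num)
    have h2 := card_cubeSols_le (k := k) (N := N) hT (fun n h0 hn => hd n h0 (by omega))
    set w : ℝ := (Q.card : ℝ) with hw
    set t : ℝ := (tripleCount N k : ℝ) with ht
    have hw0 : 0 < w := by linarith
    have hMw : M ≤ 4 * T * w := by
      have : 1 ≤ T ^ 2 := one_le_pow₀ hT
      linarith
    have h3 : t * w ^ 2 ≤ 52096 * (T ^ 16 * M ^ 11) * w ^ 2 := by
      rw [hM3, ← hM6] at h1
      have e1 : w * (3 * (M ^ 6) ^ 2 * T ^ 2) ≤ 12 * (T ^ 16 * M ^ 11) * w ^ 2 := by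
        calc w * (3 * (M ^ 6) ^ 2 * T ^ 2) = M * (3 * w * M ^ 11 * T ^ 2) := by ring
          _ ≤ 4 * T * w * (3 * w * M ^ 11 * T ^ 2) := by gcongr
          _ = 12 * (T ^ 3 * M ^ 11) * w ^ 2 := by ring
          _ ≤ 12 * (T ^ 16 * M ^ 11) * w ^ 2 := by
              have : T ^ 3 ≤ T ^ 16 := pow_le_pow_right₀ hT (by norm_num)
              gcongr
      have e2 : 4 * (P : ℝ) * (M ^ 6) ^ 2 ≤ 64 * (T ^ 2 * M ^ 11) * w ^ 2 := by
        calc 4 * (P : ℝ) * (M ^ 6) ^ 2 ≤ 4 * M * (M ^ 6) ^ 2 := by gcongr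
          _ = 4 * M ^ 11 * M ^ 2 := by ring
          _ ≤ 4 * M ^ 11 * (4 * T * w) ^ 2 := by gcongr
          _ = _ := by ring
      have e3 : M ^ 6 * M ^ 3 * (P : ℝ) ^ 2 * w ^ 2 ≤ (T ^ 2 * M ^ 11) * w ^ 2 := by
        calc M ^ 6 * M ^ 3 * (P : ℝ) ^ 2 * w ^ 2 ≤ M ^ 6 * M ^ 3 * M ^ 2 * w ^ 2 := by gcongr
          _ = 1 * M ^ 11 * w ^ 2 := by ring
          _ ≤ (T ^ 2 * M ^ 11) * w ^ 2 := by
              have : 1 ≤ T ^ 2 := one_le_pow₀ hT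
              gcongr
      have e4 : 100 * T ^ 14 * (4 * (P : ℝ) * (M ^ 6) ^ 2 + M ^ 6 * M ^ 3 * (P : ℝ) ^ 2 * w ^ 2) ≤
          6500 * (T ^ 16 * M ^ 11) * w ^ 2 := by
        calc 100 * T ^ 14 *
              (4 * (P : ℝ) * (M ^ 6) ^ 2 + M ^ 6 * M ^ 3 * (P : ℝ) ^ 2 * w ^ 2)
            ≤ 100 * T ^ 14 * (64 * (T ^ 2 * M ^ 11) * w ^ 2 + (T ^ 2 * M ^ 11) * w ^ 2) := by
              gcongr
          _ = _ := by ring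
      have e5 : 0 ≤ (T ^ 16 * M ^ 11) * w ^ 2 := by positivity
      linarith
    have h4 : t ≤ 52096 * (T ^ 16 * M ^ 11) := le_of_mul_le_mul_right h3 (by positivity)
    have h5 : 2 * (N : ℝ) * T ≤ 2 * (T ^ 16 * M ^ 11) := by
      have g1 : T ≤ T ^ 16 := le_self_pow₀ hT (by norm_num)
      have g2 : (N : ℝ) ≤ M ^ 11 := by
        rw [← hM6]
        exact pow_le_pow_right₀ hM1 (by norm_num)
      calc 2 * (N : ℝ) * T ≤ 2 * M ^ 11 * T ^ 16 := by gcongr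
        _ = _ := by ring
    have h6 : T ^ 16 * M ^ 11 ≤ T ^ 26 * M ^ 11 := by
      have : T ^ 16 ≤ T ^ 26 := pow_le_pow_right₀ hT (by norm_num)
      gcongr
    have h7 : 0 ≤ T ^ 26 * M ^ 11 := by positivity
    calc ((cubeSols k N).card : ℝ) ≤ 2 * t + 2 * N * T := h2
      _ ≤ 104194 * (T ^ 26 * M ^ 11) := by linarith
      _ ≤ 101 ^ 13 * (T ^ 26 * M ^ 11) := by gcongr; norm_num
      _ = _ := by ring

theorem stmt11 (k : ℤ) (hk : k ≠ 0) :
    ∀ ε > (0:ℝ), ∃ C : ℝ, 0 < C ∧ ∀ N : ℕ, 0 < N →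
      ((((Finset.Icc 1 N ×ˢ Finset.Icc 1 N) ×ˢ (Finset.Icc 1 N ×ˢ Finset.Icc 1 N)).filter
        (fun q : (ℕ × ℕ) × ℕ × ℕ =>
          (q.1.1 : ℤ) ^ 3 + (q.1.2 : ℤ) ^ 3 - (q.2.1 : ℤ) ^ 3 - (q.2.2 : ℤ) ^ 3 = k)).card : ℝ) ≤
        C * (N : ℝ) ^ (11 / 6 + ε : ℝ) := by
  intro ε hε
  have hδ : 0 < ε / 26 := by positivity
  set K : ℕ := 6 * k.natAbs with hK
  have hK0 : 0 < K := by
    have := Int.natAbs_ne_zero.2 hk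
    omega
  obtain ⟨C₁, hC₁, h₁⟩ := exists_card_divisors_le_of_le hδ (2 + k.natAbs) 6
  obtain ⟨C₂, hC₂, h₂⟩ := exists_card_divisors_le_of_le hδ (4 ^ K) K
  obtain ⟨C₃, hC₃, h₃⟩ := exists_log_le hδ 2 2
  have hC : 1 ≤ C₁ + C₂ + C₃ := by linarith
  have hC0 : 0 < C₁ + C₂ + C₃ := by linarith
  refine ⟨101 ^ 13 * (C₁ + C₂ + C₃) ^ 26, by positivity, fun N hN => ?_⟩
  have hN1 : (1 : ℝ) ≤ N := by exact_mod_cast hN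
  have hδ1 : (1 : ℝ) ≤ (N : ℝ) ^ (ε / 26) := Real.one_le_rpow hN1 hδ.le
  have hle : ∀ c : ℝ, c ≤ C₁ + C₂ + C₃ →
      c * (N : ℝ) ^ (ε / 26) ≤ (C₁ + C₂ + C₃) * (N : ℝ) ^ (ε / 26) := fun c hc => by gcongr
  set L : ℕ := Nat.log 2 (2 * N) + 1 with hLdef
  have hL : 2 * N < 2 ^ L := Nat.lt_pow_succ_log_self (by norm_num) _
  have hL' : 2 ^ L ≤ 4 * N := by
    have := Nat.pow_log_le_self 2 (x := 2 * N) (by omega)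
    rw [hLdef, pow_succ]
    omega
  have key := card_cubeSols_le_of_bounds (T := (C₁ + C₂ + C₃) * (N : ℝ) ^ (ε / 26)) hN hk hL
    (one_le_mul_of_one_le_of_one_le hC hδ1) ?_ ?_ ?_ ?_
  · refine key.trans (le_of_eq ?_)
    rw [mul_pow, ← Real.rpow_natCast ((N : ℝ) ^ (ε / 26)), ← Real.rpow_mul (by positivity),
      Real.rpow_add (by positivity)]
    have e : ε / 26 * ((26 : ℕ) : ℝ) = ε := by
      push_cast
      ring
    rw [e]
    ring
  · intro n hn0 hn
    refine (h₁ N hN n hn0 (hn.trans ?_)).trans (hle _ (by linarith))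
    have : 1 ≤ N ^ 6 := Nat.one_le_pow _ _ hN
    calc 2 * (N ^ 2) ^ 3 + k.natAbs = 2 * N ^ 6 + k.natAbs * 1 := by ring
      _ ≤ 2 * N ^ 6 + k.natAbs * N ^ 6 := by gcongr
      _ = (2 + k.natAbs) * N ^ 6 := by ring
  · refine (h₂ N hN _ (pow_ne_zero _ hK0.ne') ?_).trans (hle _ (by linarith))
    calc K ^ L ≤ (2 ^ K) ^ L := Nat.pow_le_pow_left (Nat.lt_two_pow_self).le _
      _ = (2 ^ L) ^ K := by rw [← pow_mul, ← pow_mul, mul_comm]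
      _ ≤ (4 * N) ^ K := Nat.pow_le_pow_left hL' _
      _ = 4 ^ K * N ^ K := mul_pow _ _ _
  · exact (harmonicSum_le_one_add_log _).trans ((h₃ N hN).trans (hle _ (by linarith)))
  · refine le_trans ?_ ((h₃ N hN).trans (hle _ (by linarith)))
    have h4 : Real.log ((N : ℝ) + 1) ≤ Real.log ((2 * N ^ 2 : ℕ) : ℝ) := by
      refine Real.log_le_log (by positivity) ?_
      push_cast
      nlinarith
    linarith
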